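/- Theorem (weak convergence, case (a)): Let (α_n) and (β_n) be real sequences with α_n/n → A and β_n/n → B, where −1 < A < 0, −1 < B < 0, −2 < A+B < −1, and suppose there exist numbers r_α, r_β, r_{α+β} ≥ 0 with lim dist(α_n,ℤ)^{1/n} = e^{−r_α}, lim dist(β_n,ℤ)^{1/n} = e^{−r_β}, lim dist(α_n+β_n,ℤ)^{1/n} = e^{−r_{α+β}}. If r_α = r_β = r_{α+β}, then the zeros of P_n^{(α_n,β_n)} accumulate on Γ as n → ∞, and μ is the weak* limit of the normalized zero counting measures. -/

import Mathlib

open Complex Set Filter Topology Bornology Polynomial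

noncomputable section

/-- The branch point `ζ₊`. -/
def zetaP (A B : ℝ) : ℂ :=
  (((B : ℂ) ^ 2 - (A : ℂ) ^ 2) +
      4 * Complex.I * ((Real.sqrt ((A + 1) * (B + 1) * (-A - B - 1)) : ℝ) : ℂ)) /
    ((A : ℂ) + (B : ℂ) + 2) ^ 2

/-- The branch point `ζ₋`. -/
def zetaM (A B : ℝ) : ℂ :=
  (((B : ℂ) ^ 2 - (A : ℂ) ^ 2) -
      4 * Complex.I * ((Real.sqrt ((A + 1) * (B + 1) * (-A - B - 1)) : ℝ) : ℂ)) /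
    ((A : ℂ) + (B : ℂ) + 2) ^ 2

/-- The set `Γ = { z : Re ∫_{ζ₋}^z ((t−ζ₊)(t−ζ₋))^{1/2}/(t²−1) dt = 0 }`. -/
def GammaSet (A B : ℝ) : Set ℂ :=
  {z | ∃ γ g : ℝ → ℂ, ContDiff ℝ 1 γ ∧ γ 0 = zetaM A B ∧ γ 1 = z ∧
    (∀ t ∈ Set.Icc (0 : ℝ) 1, γ t ≠ 1 ∧ γ t ≠ -1) ∧
    ContinuousOn g (Set.Icc 0 1) ∧
    (∀ t ∈ Set.Icc (0 : ℝ) 1, g t ^ 2 = (γ t - zetaP A B) * (γ t - zetaM A B)) ∧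
    (∫ t in (0:ℝ)..1, g t / ((γ t) ^ 2 - 1) * deriv γ t).re = 0}

/-- `γL, γC, γR` are injective regular C¹ parametrizations of the three arcs of `Γ`,
with the orientation of the paper: `Γ_L`, `Γ_C` run from `ζ₊` to `ζ₋`, and `Γ_R` from
`ζ₋` to `ζ₊`; `Γ_L`, `Γ_C`, `Γ_R` cross the real line in `(−∞,−1)`, `(−1,1)`, `(1,∞)`
respectively, and their union is `Γ`. -/
structure ArcParam (A B : ℝ) (γL γC γR : ℝ → ℂ) : Prop where
  smoothL : ContDiff ℝ 1 γL
  smoothC : ContDiff ℝ 1 γC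
  smoothR : ContDiff ℝ 1 γR
  injL : Set.InjOn γL (Set.Icc 0 1)
  injC : Set.InjOn γC (Set.Icc 0 1)
  injR : Set.InjOn γR (Set.Icc 0 1)
  regL : ∀ t ∈ Set.Icc (0:ℝ) 1, deriv γL t ≠ 0
  regC : ∀ t ∈ Set.Icc (0:ℝ) 1, deriv γC t ≠ 0
  regR : ∀ t ∈ Set.Icc (0:ℝ) 1, deriv γR t ≠ 0
  endL0 : γL 0 = zetaP A B
  endL1 : γL 1 = zetaM A B
  endC0 : γC 0 = zetaP A B
  endC1 : γC 1 = zetaM A B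
  endR0 : γR 0 = zetaM A B
  endR1 : γR 1 = zetaP A B
  union : γL '' Set.Icc 0 1 ∪ γC '' Set.Icc 0 1 ∪ γR '' Set.Icc 0 1 = GammaSet A B
  crossL : ∀ t ∈ Set.Icc (0:ℝ) 1, (γL t).im = 0 → (γL t).re < -1
  crossC : ∀ t ∈ Set.Icc (0:ℝ) 1, (γC t).im = 0 → -1 < (γC t).re ∧ (γC t).re < 1
  crossR : ∀ t ∈ Set.Icc (0:ℝ) 1, (γR t).im = 0 → 1 < (γR t).re

/-- `R` is the single-valued analytic branch of `((z−ζ₊)(z−ζ₋))^{1/2}` on `ℂ ∖ Γ_C`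
with `R(z)/z → 1` as `z → ∞`, where `Γ_C` is the image of `γC`. -/
def IsSqrtBranch (A B : ℝ) (γC : ℝ → ℂ) (R : ℂ → ℂ) : Prop :=
  DifferentiableOn ℂ R (γC '' Set.Icc 0 1)ᶜ ∧
  (∀ z ∉ γC '' Set.Icc 0 1, R z ^ 2 = (z - zetaP A B) * (z - zetaM A B)) ∧
  Filter.Tendsto (fun z => R z / z) (Bornology.cobounded ℂ) (nhds 1)

/-- `Rp` is the boundary value `R₊` of `R` on the cut `Γ_C`, taken from the `+` side
(the left-hand side with respect to the orientation of `γC`). -/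
def IsPlusBoundary (A B : ℝ) (γC : ℝ → ℂ) (R : ℂ → ℂ) (Rp : ℝ → ℂ) : Prop :=
  ContinuousOn Rp (Set.Icc 0 1) ∧
  (∀ t ∈ Set.Icc (0:ℝ) 1, Rp t ^ 2 = (γC t - zetaP A B) * (γC t - zetaM A B)) ∧
  ∀ t ∈ Set.Ioo (0:ℝ) 1,
    Filter.Tendsto (fun ε : ℝ => R (γC t + (ε : ℂ) * (Complex.I * deriv γC t)))
      (nhdsWithin 0 (Set.Ioi 0)) (nhds (Rp t))

/-- Generalized binomial coefficient `binom(z, k)` for complex `z` and natural `k`. -/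
def genBinom (z : ℂ) (k : ℕ) : ℂ := (∏ i ∈ Finset.range k, (z - i)) / (Nat.factorial k : ℂ)

/-- The Jacobi polynomial `P_n^{(α,β)}` with (generally complex) parameters `α, β`,
`P_n^{(α,β)}(x) = Σ_{s=0}^n binom(n+α, n−s) binom(n+β, s) ((x−1)/2)^s ((x+1)/2)^{n−s}`. -/
def jacobiPoly (n : ℕ) (α β : ℂ) : Polynomial ℂ :=
  ∑ s ∈ Finset.range (n + 1),
    Polynomial.C (genBinom ((n : ℂ) + α) (n - s) * genBinom ((n : ℂ) + β) s) *
      (Polynomial.C (2⁻¹ : ℂ) * (Polynomial.X - 1)) ^ s *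
      (Polynomial.C (2⁻¹ : ℂ) * (Polynomial.X + 1)) ^ (n - s)

/-- Distance from a real number to the set of integers. -/
def distInt (x : ℝ) : ℝ := |x - (round x : ℝ)|

section

/-- the parameter range of case (a) -/
structure Par (A B : ℝ) : Prop where
  hA : -1 < A
  hA0 : A < 0
  hB : -1 < B
  hB0 : B < 0
  hs : 0 < A + B + 2
  hd : 0 < -A - B - 1

def mm (A B : ℝ) : ℝ := (B^2 - A^2) / (A+B+2)^2
def kk (A B : ℝ) : ℝ := 4 * Real.sqrt ((A + 1) * (B + 1) * (-A - B - 1)) / (A+B+2)^2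
def P0 (A B : ℝ) : ℝ := -(4*(A+1)*(-A-B-1)) / (A+B+2)^2
def P1 (A B : ℝ) : ℝ := 4*(B+1) / (A+B+2)^2
def N0 (A B : ℝ) : ℝ := 4*(B+1)*(-A-B-1) / (A+B+2)^2
def N1 (A B : ℝ) : ℝ := -(4*(A+1)) / (A+B+2)^2
def Qf (A B : ℝ) (z : ℂ) : ℂ := (z - mm A B)^2 + (kk A B : ℂ)^2

def XX (A B : ℝ) (u : ℂ) : ℝ :=
  ‖u - P1 A B‖ ^ (-A) * ‖u - N1 A B‖ ^ (-B) * ‖u‖ ^ (A+B+1)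

def Psi (A B : ℝ) (u : ℂ) : ℂ :=
  -A / (u - P1 A B) + -B / (u - N1 A B) + (A+B+1) / u

def lam (A B : ℝ) (z g : ℂ) : ℂ := ((A+B)*z + A - B - (A+B+2)*g) / (2*(1-z^2))

variable {A B : ℝ}

lemma Par.symm (h : Par A B) : Par B A := ⟨h.hB, h.hB0, h.hA, h.hA0, by linarith [h.hs], by linarith [h.hd]⟩

lemma Par.kk_pos (h : Par A B) : 0 < kk A B := by
  have := h.hA; have := h.hB; have := h.hs; have := h.hd
  unfold kk
  have : 0 < (A + 1) * (B + 1) * (-A - B - 1) := by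
    apply mul_pos (mul_pos _ _) <;> linarith
  positivity

lemma Par.kk_sq (h : Par A B) : kk A B ^2 = 16 * ((A + 1) * (B + 1) * (-A - B - 1)) / (A+B+2)^4 := by
  have := h.hA; have := h.hB; have := h.hs; have := h.hd
  have : 0 < (A + 1) * (B + 1) * (-A - B - 1) := by
    apply mul_pos (mul_pos _ _) <;> linarith
  unfold kk
  rw [div_pow, mul_pow, Real.sq_sqrt this.le]
  ring

lemma Par.P_mul (h : Par A B) : P0 A B * P1 A B = - kk A B ^2 := by
  have := h.hs
  rw [h.kk_sq]; unfold P0 P1; field_simp; ring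

lemma Par.N_mul (h : Par A B) : N0 A B * N1 A B = - kk A B ^2 := by
  have := h.hs
  rw [h.kk_sq]; unfold N0 N1; field_simp; ring

lemma Par.P_add (h : Par A B) : P0 A B + P1 A B = 2 * (1 - mm A B) := by
  have := h.hs
  unfold P0 P1 mm; field_simp; ring

lemma Par.N_add (h : Par A B) : N0 A B + N1 A B = -2 * (1 + mm A B) := by
  have := h.hs
  unfold N0 N1 mm; field_simp; ring

lemma Par.P1_pos (h : Par A B) : 0 < P1 A B := by
  have := h.hs; have := h.hB; unfold P1
  have : 0 < B + 1 := by linarith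
  positivity
lemma Par.P0_neg (h : Par A B) : P0 A B < 0 := by
  have := h.hs; have := h.hA; have := h.hd; unfold P0
  have h1 : 0 < A + 1 := by linarith
  have : 0 < 4 * (A+1) * (-A-B-1) := by positivity
  apply div_neg_of_neg_of_pos <;> [linarith; positivity]
lemma Par.N1_neg (h : Par A B) : N1 A B < 0 := by
  have := h.hs; have := h.hA; have := h.hd; unfold N1
  have h1 : 0 < A + 1 := by linarith
  apply div_neg_of_neg_of_pos <;> [linarith; positivity]
lemma Par.N0_pos (h : Par A B) : 0 < N0 A B := by
  have := h.hs; have := h.hB; have := h.hd; unfold N0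
  have h1 : 0 < B + 1 := by linarith
  positivity
lemma Par.N1_lt_P0 (h : Par A B) : N1 A B < P0 A B := by
  have := h.hs; have := h.hA; have := h.hd; unfold N1 P0
  have h1 : 0 < A + 1 := by linarith
  have h2 : -A-B-1 < 1 := by linarith
  apply div_lt_div_of_pos_right _ (by positivity)
  nlinarith
lemma Par.N0_lt_P1 (h : Par A B) : N0 A B < P1 A B := by
  have := h.hs; have := h.hB; have := h.hd; unfold N0 P1
  have h1 : 0 < B + 1 := by linarith
  apply div_lt_div_of_pos_right _ (by positivity)
  nlinarith

lemma Par.zetaP_eq (h : Par A B) : zetaP A B = mm A B + I * kk A B := by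
  have := h.hs
  have h2 : ((A:ℂ)+B+2) ≠ 0 := by
    have : ((A+B+2 : ℝ) : ℂ) ≠ 0 := by exact_mod_cast this.ne'
    simpa using this
  unfold zetaP mm kk
  push_cast; field_simp
lemma Par.zetaM_eq (h : Par A B) : zetaM A B = mm A B - I * kk A B := by
  have := h.hs
  have h2 : ((A:ℂ)+B+2) ≠ 0 := by
    have : ((A+B+2 : ℝ) : ℂ) ≠ 0 := by exact_mod_cast this.ne'
    simpa using this
  unfold zetaM mm kk
  push_cast; field_simp

lemma Par.Q_eq (h : Par A B) (z : ℂ) : (z - zetaP A B) * (z - zetaM A B) = Qf A B z := by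
  rw [h.zetaP_eq, h.zetaM_eq, Qf]
  linear_combination (- (kk A B:ℂ)^2) * I_sq

/-- sheet equation basics -/
lemma sheet_mul {z g : ℂ} (hg : g^2 = Qf A B z) :
    (z - mm A B + g) * (z - mm A B - g) = - (kk A B : ℂ)^2 := by
  unfold Qf at hg; linear_combination - hg

lemma Par.u_ne (h : Par A B) {z g : ℂ} (hg : g^2 = Qf A B z) : z - mm A B + g ≠ 0 := by
  intro h0
  have := sheet_mul hg
  rw [h0, zero_mul] at this
  have h1 : (kk A B : ℂ) ≠ 0 := by exact_mod_cast h.kk_pos.ne'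
  exact h1 (by simpa using this.symm)

lemma neg_sheet {z g : ℂ} (hg : g^2 = Qf A B z) : (-g)^2 = Qf A B z := by rw [neg_sq, hg]

lemma Par.u'_ne (h : Par A B) {z g : ℂ} (hg : g^2 = Qf A B z) : z - mm A B - g ≠ 0 := by
  have := h.u_ne (neg_sheet hg); rwa [← sub_eq_add_neg] at this

lemma Par.zsub1 (h : Par A B) {z g : ℂ} (hg : g^2 = Qf A B z) :
    (z - 1) * (2 * (z - mm A B + g)) = (z - mm A B + g - P0 A B) * (z - mm A B + g - P1 A B) := by
  have e1 : (P0 A B : ℂ) * P1 A B = - (kk A B:ℂ)^2 := by exact_mod_cast h.P_mul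
  have e2 : (P0 A B : ℂ) + P1 A B = 2 * (1 - mm A B) := by exact_mod_cast h.P_add
  unfold Qf at hg
  linear_combination (-1) * hg - e1 + (z - mm A B + g) * e2
lemma Par.zadd1 (h : Par A B) {z g : ℂ} (hg : g^2 = Qf A B z) :
    (z + 1) * (2 * (z - mm A B + g)) = (z - mm A B + g - N0 A B) * (z - mm A B + g - N1 A B) := by
  have e1 : (N0 A B : ℂ) * N1 A B = - (kk A B:ℂ)^2 := by exact_mod_cast h.N_mul
  have e2 : (N0 A B : ℂ) + N1 A B = -2 * (1 + mm A B) := by exact_mod_cast h.N_add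
  unfold Qf at hg
  linear_combination (-1) * hg - e1 + (z - mm A B + g) * e2

lemma Par.u'_P1 (h : Par A B) {z g : ℂ} (hg : g^2 = Qf A B z) :
    (z - mm A B - g - P1 A B) * (z - mm A B + g) = - P1 A B * (z - mm A B + g - P0 A B) := by
  have e1 : (P0 A B : ℂ) * P1 A B = - (kk A B:ℂ)^2 := by exact_mod_cast h.P_mul
  unfold Qf at hg
  linear_combination -hg - e1
lemma Par.u'_N1 (h : Par A B) {z g : ℂ} (hg : g^2 = Qf A B z) :
    (z - mm A B - g - N1 A B) * (z - mm A B + g) = - N1 A B * (z - mm A B + g - N0 A B) := by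
  have e1 : (N0 A B : ℂ) * N1 A B = - (kk A B:ℂ)^2 := by exact_mod_cast h.N_mul
  unfold Qf at hg
  linear_combination -hg - e1

lemma Par.u_ne_P1 (h : Par A B) {z g : ℂ} (hg : g^2 = Qf A B z) (hz : z ≠ 1) :
    z - mm A B + g - P1 A B ≠ 0 := by
  intro h0
  have := h.zsub1 hg
  rw [h0, mul_zero] at this
  have h1 := h.u_ne hg
  rcases mul_eq_zero.1 this with h2 | h2
  · exact hz (by linear_combination h2)
  · simp at h2; exact h1 h2
lemma Par.u_ne_N1 (h : Par A B) {z g : ℂ} (hg : g^2 = Qf A B z) (hz : z ≠ -1) :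
    z - mm A B + g - N1 A B ≠ 0 := by
  intro h0
  have := h.zadd1 hg
  rw [h0, mul_zero] at this
  have h1 := h.u_ne hg
  rcases mul_eq_zero.1 this with h2 | h2
  · exact hz (by linear_combination h2)
  · simp at h2; exact h1 h2

lemma Par.sg_ne (h : Par A B) : ((A:ℂ)+B+2) ≠ 0 := by
  have : ((A+B+2 : ℝ) : ℂ) ≠ 0 := by exact_mod_cast h.hs.ne'
  simpa using this

lemma Par.sq_key (h : Par A B) (z : ℂ) :
    2*z^2 - 2 + A*(z - mm A B - P1 A B)*(z+1) + B*(z- mm A B - N1 A B)*(z-1)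
      = (A+B+2) * Qf A B z := by
  have hs := h.sg_ne
  have e : (kk A B : ℂ)^2 = 16 * ((A + 1) * (B + 1) * (-A - B - 1)) / (A+B+2)^4 := by
    exact_mod_cast h.kk_sq
  unfold Qf; rw [e]; unfold mm P1 N1
  push_cast
  field_simp
  ring

lemma one_sub_sq_ne {z : ℂ} (hz : z ≠ 1) (hz' : z ≠ -1) : 1 - z^2 ≠ 0 := by
  have : 1 - z^2 = (1-z)*(1+z) := by ring
  rw [this]
  refine (mul_ne_zero (sub_ne_zero.2 (Ne.symm hz)) ?_)
  intro h; exact hz' (by linear_combination h)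

lemma Par.psi_lam' (h : Par A B) {z g : ℂ} (hg : g^2 = Qf A B z) (hz : z ≠ 1)
    (hz' : z ≠ -1) :
    Psi A B (z - mm A B + g) * (z - mm A B + g) = lam A B z g * g := by
  have hu := h.u_ne hg
  have h1 := h.u_ne_P1 hg hz
  have h2 := h.u_ne_N1 hg hz'
  have h3 := one_sub_sq_ne hz hz'
  have hz1 : z - 1 ≠ 0 := sub_ne_zero.2 hz
  have hz2 : z + 1 ≠ 0 := fun h => hz' (by linear_combination h)
  have key := h.sq_key z
  rw [← hg] at key
  have a1 : (P1 A B : ℂ) / (z - mm A B + g - P1 A B) = -(z - mm A B - g - P1 A B) / (2*(z-1)) := by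
    rw [div_eq_div_iff h1 (by simpa using hz1)]
    have := h.zsub1 hg
    have := h.u'_P1 hg
    apply mul_right_cancel₀ hu
    linear_combination (P1 A B : ℂ) * h.zsub1 hg + (z - mm A B + g - P1 A B) * h.u'_P1 hg
  have a2 : (N1 A B : ℂ) / (z - mm A B + g - N1 A B) = -(z - mm A B - g - N1 A B) / (2*(z+1)) := by
    rw [div_eq_div_iff h2 (by simpa using hz2)]
    apply mul_right_cancel₀ hu
    linear_combination (N1 A B : ℂ) * h.zadd1 hg + (z - mm A B + g - N1 A B) * h.u'_N1 hg
  have a3 : Psi A B (z - mm A B + g) * (z - mm A B + g) =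
      1 - A * ((P1 A B : ℂ) / (z - mm A B + g - P1 A B))
       - B * ((N1 A B : ℂ) / (z - mm A B + g - N1 A B)) := by
    unfold Psi
    generalize z - (mm A B:ℂ) + g = u at *
    field_simp
    ring
  rw [a3, a1, a2, lam]
  have e : (1 - z^2) = -(z-1)*(z+1) := by ring
  rw [e]
  field_simp
  linear_combination key

lemma Par.psi_lam (h : Par A B) {z g : ℂ} (hg : g^2 = Qf A B z) (hg0 : g ≠ 0) (hz : z ≠ 1)
    (hz' : z ≠ -1) :
    Psi A B (z - mm A B + g) * ((z - mm A B + g) / g) = lam A B z g := by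
  rw [mul_div_assoc', h.psi_lam' hg hz hz', mul_div_cancel_right₀ _ hg0]

/-- global dominant square root -/
def dg (A B : ℝ) (z : ℂ) : ℂ :=
  if XX A B (z - mm A B - (Qf A B z)^(1/2:ℂ)) ≤ XX A B (z - mm A B + (Qf A B z)^(1/2:ℂ))
  then (Qf A B z)^(1/2:ℂ) else -(Qf A B z)^(1/2:ℂ)

def VV (A B : ℝ) (z : ℂ) : ℝ := XX A B (z - mm A B + dg A B z)
/-- recessive value -/
def vv (A B : ℝ) (z : ℂ) : ℝ := XX A B (z - mm A B - dg A B z)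
/-- the set `Γ` in terms of level sets -/
def Gam (A B : ℝ) : Set ℂ := {z | vv A B z = VV A B z}

lemma csqrt_sq (z : ℂ) : (z^(1/2:ℂ))^2 = z := by
  rw [← Complex.cpow_nat_mul]; simp

lemma dg_sq (A B : ℝ) (z : ℂ) : dg A B z ^2 = Qf A B z := by
  unfold dg; split_ifs
  · exact csqrt_sq _
  · rw [neg_sq]; exact csqrt_sq _

lemma vv_le (A B : ℝ) (z : ℂ) : vv A B z ≤ VV A B z := by
  unfold vv VV dg; split_ifs with h
  · exact h
  · push Not at h
    simpa [sub_eq_add_neg] using h.le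

lemma sq_cases {g g' w : ℂ} (h1 : g^2 = w) (h2 : g'^2 = w) : g = g' ∨ g = -g' := by
  rw [← h2] at h1; exact sq_eq_sq_iff_eq_or_eq_neg.1 h1

lemma VV_eq_max {z g : ℂ} (hg : g^2 = Qf A B z) :
    VV A B z = max (XX A B (z - mm A B + g)) (XX A B (z - mm A B - g)) := by
  have h1 := vv_le A B z
  unfold vv VV at *
  rcases sq_cases hg (dg_sq A B z) with h | h
  · rw [h, max_eq_left h1]
  · rw [h, sub_neg_eq_add, ← sub_eq_add_neg, max_eq_right h1]

lemma vv_eq_min {z g : ℂ} (hg : g^2 = Qf A B z) :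
    vv A B z = min (XX A B (z - mm A B + g)) (XX A B (z - mm A B - g)) := by
  have h1 := vv_le A B z
  unfold vv VV at *
  rcases sq_cases hg (dg_sq A B z) with h | h
  · rw [h, min_eq_right h1]
  · rw [h, sub_neg_eq_add, ← sub_eq_add_neg, min_eq_left h1]

lemma mem_Gam {z g : ℂ} (hg : g^2 = Qf A B z) :
    z ∈ Gam A B ↔ XX A B (z - mm A B + g) = XX A B (z - mm A B - g) := by
  show vv A B z = VV A B z ↔ _
  rw [vv_eq_min hg, VV_eq_max hg]
  constructor
  · intro h
    rcases le_total (XX A B (z - mm A B + g)) (XX A B (z - mm A B - g)) with h1 | h1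
    · rw [min_eq_left h1, max_eq_right h1] at h; exact h
    · rw [min_eq_right h1, max_eq_left h1] at h; exact h.symm
  · intro h; rw [h]; simp

lemma dg_eq {z g : ℂ} (hg : g^2 = Qf A B z)
    (hX : XX A B (z - mm A B - g) < XX A B (z - mm A B + g)) : dg A B z = g := by
  rcases sq_cases (dg_sq A B z) hg with h | h
  · exact h
  · have := vv_le A B z
    unfold vv VV at this
    rw [h, sub_neg_eq_add, ← sub_eq_add_neg] at this
    exact absurd this (not_le.2 hX)

lemma vv_lt_of_notMem {z : ℂ} (hz : z ∉ Gam A B) : vv A B z < VV A B z :=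
  lt_of_le_of_ne (vv_le A B z) hz

lemma XX_nonneg (u : ℂ) : 0 ≤ XX A B u := by unfold XX; positivity

lemma XX_pos {u : ℂ} (h0 : u ≠ 0) (h1 : u - P1 A B ≠ 0) (h2 : u - N1 A B ≠ 0) :
    0 < XX A B u := by
  unfold XX
  have := norm_pos_iff.2 h0; have := norm_pos_iff.2 h1; have := norm_pos_iff.2 h2
  positivity

lemma Par.XX_cont (h : Par A B) {u : ℂ} (h0 : u ≠ 0) : ContinuousAt (XX A B) u := by
  unfold XX
  have a1 := h.hA0; have a2 := h.hB0
  refine ContinuousAt.mul (ContinuousAt.mul ?_ ?_) ?_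
  · exact ContinuousAt.rpow_const (by fun_prop) (Or.inr (by linarith))
  · exact ContinuousAt.rpow_const (by fun_prop) (Or.inr (by linarith))
  · exact ContinuousAt.rpow_const (by fun_prop) (Or.inl (norm_ne_zero_iff.2 h0))

end

section
variable {A B : ℝ}

lemma Qf_diff : Differentiable ℂ (Qf A B) := by unfold Qf; fun_prop

lemma exists_branch {z0 g0 : ℂ} (hg : g0^2 = Qf A B z0) (h0 : g0 ≠ 0) :
    ∃ G : ℂ → ℂ, G z0 = g0 ∧ AnalyticAt ℂ G z0 ∧ ∀ z, G z ^ 2 = Qf A B z := by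
  have hQ : Qf A B z0 ≠ 0 := by rw [← hg]; exact pow_ne_zero 2 h0
  refine ⟨fun z => g0 * (Qf A B z / Qf A B z0)^(1/2:ℂ), ?_, ?_, ?_⟩
  · simp [div_self hQ]
  · refine analyticAt_const.mul (AnalyticAt.cpow ?_ analyticAt_const ?_)
    · exact (Qf_diff.analyticAt z0).div analyticAt_const hQ
    · simp [div_self hQ]
  · intro z
    rw [mul_pow, csqrt_sq, hg]; field_simp

lemma exists_cont_branch (z0 : ℂ) :
    ∃ G : ℂ → ℂ, ContinuousAt G z0 ∧ ∀ z, G z ^ 2 = Qf A B z := by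
  by_cases hQ : Qf A B z0 = 0
  · refine ⟨fun z => (Qf A B z)^(1/2:ℂ), ?_, fun z => csqrt_sq _⟩
    have h1 : ContinuousAt (fun x : ℂ => x^(1/2:ℂ)) (Qf A B z0) :=
      continuousAt_cpow_const_of_re_pos (by simp [hQ]) (by norm_num)
    exact ContinuousAt.comp (g := fun x : ℂ => x^(1/2:ℂ)) h1 Qf_diff.continuous.continuousAt
  · obtain ⟨G, h1, h2, h3⟩ := exists_branch (A := A) (B := B) (z0 := z0) (csqrt_sq _)
      (by intro h; apply hQ; rw [← csqrt_sq (Qf A B z0), h]; simp)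
    exact ⟨G, h2.continuousAt, h3⟩

lemma Par.VV_cont (h : Par A B) : Continuous (VV A B) := by
  rw [continuous_iff_continuousAt]
  intro z
  obtain ⟨G, h1, h2⟩ := exists_cont_branch (A := A) (B := B) z
  have e : VV A B = fun z => max (XX A B (z - mm A B + G z)) (XX A B (z - mm A B - G z)) := by
    ext z; exact VV_eq_max (h2 z)
  rw [e]
  refine ContinuousAt.sup ?_ ?_
  · exact ContinuousAt.comp (g := XX A B) (h.XX_cont (h.u_ne (h2 z))) (by fun_prop)
  · exact ContinuousAt.comp (g := XX A B) (h.XX_cont (h.u'_ne (h2 z))) (by fun_prop)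

lemma Par.vv_cont (h : Par A B) : Continuous (vv A B) := by
  rw [continuous_iff_continuousAt]
  intro z
  obtain ⟨G, h1, h2⟩ := exists_cont_branch (A := A) (B := B) z
  have e : vv A B = fun z => min (XX A B (z - mm A B + G z)) (XX A B (z - mm A B - G z)) := by
    ext z; exact vv_eq_min (h2 z)
  rw [e]
  refine ContinuousAt.inf ?_ ?_
  · exact ContinuousAt.comp (g := XX A B) (h.XX_cont (h.u_ne (h2 z))) (by fun_prop)
  · exact ContinuousAt.comp (g := XX A B) (h.XX_cont (h.u'_ne (h2 z))) (by fun_prop)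

lemma Par.Gam_closed (h : Par A B) : IsClosed (Gam A B) :=
  isClosed_eq h.vv_cont h.VV_cont

lemma Par.XX_P1 (h : Par A B) : XX A B (P1 A B) = 0 := by
  have := h.hA0
  unfold XX; simp [Real.zero_rpow (show -A ≠ 0 by linarith)]
lemma Par.XX_N1 (h : Par A B) : XX A B (N1 A B) = 0 := by
  have := h.hB0
  unfold XX; simp [Real.zero_rpow (show -B ≠ 0 by linarith)]

lemma Par.dg_one (h : Par A B) : dg A B 1 = ((P0 A B - P1 A B)/2 : ℝ) ∧
    (1 : ℂ) - mm A B + dg A B 1 = P0 A B ∧ (1 : ℂ) - mm A B - dg A B 1 = P1 A B := by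
  have e1 : (P0 A B : ℂ) * P1 A B = - (kk A B:ℂ)^2 := by exact_mod_cast h.P_mul
  have e2 : (P0 A B : ℂ) + P1 A B = 2 * (1 - mm A B) := by exact_mod_cast h.P_add
  have e3 : (1 : ℂ) - mm A B + ((P0 A B - P1 A B)/2 : ℝ) = P0 A B := by
    push_cast; linear_combination (-1/2) * e2
  have e4 : (1 : ℂ) - mm A B - ((P0 A B - P1 A B)/2 : ℝ) = P1 A B := by
    push_cast; linear_combination (-1/2) * e2
  have : dg A B 1 = ((P0 A B - P1 A B)/2 : ℝ) := by
    apply dg_eq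
    · unfold Qf; push_cast
      linear_combination (1/4) * ((P0 A B : ℂ) + P1 A B + 2 * (1 - mm A B)) * e2 - e1
    · rw [e3, e4, h.XX_P1]
      have := h.P0_neg; have := h.P1_pos; have := h.N1_lt_P0
      apply XX_pos
      · exact_mod_cast h.P0_neg.ne
      · exact_mod_cast (by linarith : P0 A B - P1 A B < 0).ne
      · exact_mod_cast (by linarith : 0 < P0 A B - N1 A B).ne'
  rw [this]; exact ⟨rfl, e3, e4⟩

lemma Par.dg_neg_one (h : Par A B) : dg A B (-1) = ((N0 A B - N1 A B)/2 : ℝ) ∧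
    (-1 : ℂ) - mm A B + dg A B (-1) = N0 A B ∧ (-1 : ℂ) - mm A B - dg A B (-1) = N1 A B := by
  have e1 : (N0 A B : ℂ) * N1 A B = - (kk A B:ℂ)^2 := by exact_mod_cast h.N_mul
  have e2 : (N0 A B : ℂ) + N1 A B = -2 * (1 + mm A B) := by exact_mod_cast h.N_add
  have e3 : (-1 : ℂ) - mm A B + ((N0 A B - N1 A B)/2 : ℝ) = N0 A B := by
    push_cast; linear_combination (-1/2) * e2
  have e4 : (-1 : ℂ) - mm A B - ((N0 A B - N1 A B)/2 : ℝ) = N1 A B := by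
    push_cast; linear_combination (-1/2) * e2
  have : dg A B (-1) = ((N0 A B - N1 A B)/2 : ℝ) := by
    apply dg_eq
    · unfold Qf; push_cast
      linear_combination (1/4) * ((N0 A B : ℂ) + N1 A B - 2 * (1 + mm A B)) * e2 - e1
    · rw [e3, e4, h.XX_N1]
      have := h.N0_pos; have := h.N1_neg; have := h.N0_lt_P1
      apply XX_pos
      · exact_mod_cast h.N0_pos.ne'
      · exact_mod_cast (by linarith : N0 A B - P1 A B < 0).ne
      · exact_mod_cast (by linarith : 0 < N0 A B - N1 A B).ne'
  rw [this]; exact ⟨rfl, e3, e4⟩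

lemma Par.VV_pos (h : Par A B) (z : ℂ) : 0 < VV A B z := by
  by_cases h1 : z = 1
  · subst h1
    unfold VV; rw [h.dg_one.2.1]
    have := h.P0_neg; have := h.P1_pos; have := h.N1_lt_P0
    apply XX_pos
    · exact_mod_cast h.P0_neg.ne
    · exact_mod_cast (by linarith : P0 A B - P1 A B < 0).ne
    · exact_mod_cast (by linarith : 0 < P0 A B - N1 A B).ne'
  by_cases h2 : z = -1
  · subst h2
    unfold VV; rw [h.dg_neg_one.2.1]
    have := h.N0_pos; have := h.N1_neg; have := h.N0_lt_P1
    apply XX_pos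
    · exact_mod_cast h.N0_pos.ne'
    · exact_mod_cast (by linarith : N0 A B - P1 A B < 0).ne
    · exact_mod_cast (by linarith : 0 < N0 A B - N1 A B).ne'
  have hg := dg_sq A B z
  exact XX_pos (h.u_ne hg) (h.u_ne_P1 hg h1) (h.u_ne_N1 hg h2)

lemma Par.vv_pos (h : Par A B) {z : ℂ} (h1 : z ≠ 1) (h2 : z ≠ -1) : 0 < vv A B z := by
  have hg := neg_sheet (dg_sq A B z)
  have := XX_pos (h.u_ne hg) (h.u_ne_P1 hg h1) (h.u_ne_N1 hg h2)
  unfold vv; rwa [sub_eq_add_neg]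

lemma Par.one_notMem (h : Par A B) : (1:ℂ) ∉ Gam A B := by
  intro h1
  have : vv A B 1 = VV A B 1 := h1
  unfold vv at this
  rw [h.dg_one.2.2, h.XX_P1] at this
  exact (h.VV_pos 1).ne this
lemma Par.neg_one_notMem (h : Par A B) : (-1:ℂ) ∉ Gam A B := by
  intro h1
  have : vv A B (-1) = VV A B (-1) := h1
  unfold vv at this
  rw [h.dg_neg_one.2.2, h.XX_N1] at this
  exact (h.VV_pos (-1)).ne this

lemma dg_ne {z : ℂ} (hz : z ∉ Gam A B) : dg A B z ≠ 0 := by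
  intro h; apply hz
  show vv A B z = VV A B z
  unfold vv VV; rw [h]; simp

lemma mem_Gam_of_Q {z : ℂ} (hz : Qf A B z = 0) : z ∈ Gam A B := by
  by_contra h
  exact dg_ne h (by have := dg_sq A B z; rw [hz] at this; exact pow_eq_zero_iff two_ne_zero |>.1 this)

lemma Par.dg_analytic (h : Par A B) {z : ℂ} (hz : z ∉ Gam A B) : AnalyticAt ℂ (dg A B) z := by
  obtain ⟨G, h1, h2, h3⟩ := exists_branch (dg_sq A B z) (dg_ne hz)
  refine h2.congr ?_
  have hc := h2.continuousAt
  have c1 : ContinuousAt (fun z => XX A B (z - mm A B + G z)) z :=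
    ContinuousAt.comp (g := XX A B) (h.XX_cont (h.u_ne (h3 z))) (by fun_prop)
  have c2 : ContinuousAt (fun z => XX A B (z - mm A B - G z)) z :=
    ContinuousAt.comp (g := XX A B) (h.XX_cont (h.u'_ne (h3 z))) (by fun_prop)
  have hlt : XX A B (z - mm A B - G z) < XX A B (z - mm A B + G z) := by
    rw [h1]; exact vv_lt_of_notMem hz
  filter_upwards [c2.eventually_lt c1 hlt] with w hw
  exact (dg_eq (h3 w) hw).symm

lemma Par.dg_deriv (h : Par A B) {z : ℂ} (hz : z ∉ Gam A B) :
    HasDerivAt (dg A B) ((z - mm A B) / dg A B z) z := by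
  have h1 := (h.dg_analytic hz).differentiableAt.hasDerivAt
  have h2 : HasDerivAt (fun w => dg A B w ^ 2) (2 * (z - mm A B)) z := by
    have : (fun w => dg A B w ^ 2) = Qf A B := by ext w; exact dg_sq A B w
    rw [this]
    unfold Qf
    have := ((hasDerivAt_id z).sub_const (mm A B : ℂ)).pow 2 |>.add_const ((kk A B : ℂ)^2)
    simpa using this
  have h3 := h1.pow 2
  have := h2.unique h3
  have e : deriv (dg A B) z = (z - mm A B) / dg A B z := by
    rw [eq_div_iff (dg_ne hz)]; simp at this; linear_combination -this/2
  rwa [e] at h1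

def LX (A B : ℝ) (u : ℂ) : ℝ :=
  -A * Real.log ‖u - P1 A B‖ + -B * Real.log ‖u - N1 A B‖ + (A+B+1) * Real.log ‖u‖

lemma log_XX {u : ℂ} (h0 : u ≠ 0) (h1 : u - P1 A B ≠ 0) (h2 : u - N1 A B ≠ 0) :
    Real.log (XX A B u) = LX A B u := by
  have a0 := norm_pos_iff.2 h0; have a1 := norm_pos_iff.2 h1; have a2 := norm_pos_iff.2 h2
  unfold XX LX
  rw [Real.log_mul (by positivity) (by positivity), Real.log_mul (by positivity) (by positivity),
    Real.log_rpow a0, Real.log_rpow a1, Real.log_rpow a2]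

lemma hasDerivAt_log_norm {w : ℝ → ℂ} {w' : ℂ} {t : ℝ} (hw : HasDerivAt w w' t) (h0 : w t ≠ 0) :
    HasDerivAt (fun t => Real.log ‖w t‖) (w' / w t).re t := by
  have a0 := norm_pos_iff.2 h0
  have h1 := (hw.norm_sq).log (by positivity)
  have e : (fun t => Real.log ‖w t‖) = fun t => (1/2) * Real.log (‖w t‖^2) := by
    ext t; rw [Real.log_pow]; push_cast; ring
  rw [e]
  refine (h1.const_mul (1/2)).congr_deriv ?_
  rw [Complex.inner, Complex.div_re, Complex.normSq_eq_norm_sq]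
  simp
  field_simp

lemma hasDerivAt_LX {w : ℝ → ℂ} {w' : ℂ} {t : ℝ} (hw : HasDerivAt w w' t) (h0 : w t ≠ 0)
    (h1 : w t - P1 A B ≠ 0) (h2 : w t - N1 A B ≠ 0) :
    HasDerivAt (fun t => LX A B (w t)) (Psi A B (w t) * w').re t := by
  unfold LX
  have b0 := hasDerivAt_log_norm hw h0
  have b1 := hasDerivAt_log_norm (hw.sub_const (P1 A B:ℂ)) h1
  have b2 := hasDerivAt_log_norm (hw.sub_const (N1 A B:ℂ)) h2
  refine (((b1.const_mul (-A)).add (b2.const_mul (-B))).add (b0.const_mul (A+B+1))).congr_deriv ?_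
  unfold Psi
  have e : (-(A:ℂ) / (w t - P1 A B) + -B / (w t - N1 A B) + (A+B+1) / w t) * w'
    = ((-A:ℝ):ℂ) * (w' / (w t - P1 A B)) + ((-B:ℝ):ℂ) * (w' / (w t - N1 A B))
      + ((A+B+1:ℝ):ℂ) * (w'/w t) := by push_cast; ring
  rw [e, add_re, add_re, re_ofReal_mul, re_ofReal_mul, re_ofReal_mul]

/-- logarithmic derivative of the dominant solution -/
def Hh (A B : ℝ) (z : ℂ) : ℂ :=
  Psi A B (z - mm A B + dg A B z) * ((z - mm A B + dg A B z) / dg A B z)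

lemma Par.Hh_eq (h : Par A B) {z : ℂ} (hz : z ∉ Gam A B) (h1 : z ≠ 1) (h2 : z ≠ -1) :
    Hh A B z = lam A B z (dg A B z) := h.psi_lam (dg_sq A B z) (dg_ne hz) h1 h2

lemma Par.ud_ne_P1 (h : Par A B) (z : ℂ) : z - mm A B + dg A B z - P1 A B ≠ 0 := by
  intro h1
  have := (h.VV_pos z).ne'
  unfold VV at this
  rw [sub_eq_zero.1 h1] at this
  exact this h.XX_P1
lemma Par.ud_ne_N1 (h : Par A B) (z : ℂ) : z - mm A B + dg A B z - N1 A B ≠ 0 := by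
  intro h1
  have := (h.VV_pos z).ne'
  unfold VV at this
  rw [sub_eq_zero.1 h1] at this
  exact this h.XX_N1

lemma Par.log_VV (h : Par A B) (z : ℂ) :
    Real.log (VV A B z) = LX A B (z - mm A B + dg A B z) :=
  log_XX (h.u_ne (dg_sq A B z)) (h.ud_ne_P1 z) (h.ud_ne_N1 z)

lemma Par.log_vv (h : Par A B) {z : ℂ} (h1 : z ≠ 1) (h2 : z ≠ -1) :
    Real.log (vv A B z) = LX A B (z - mm A B + -dg A B z) := by
  have hg := neg_sheet (dg_sq A B z)
  unfold vv
  rw [sub_eq_add_neg]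
  exact log_XX (h.u_ne hg) (h.u_ne_P1 hg h1) (h.u_ne_N1 hg h2)

lemma Par.Hh_analytic (h : Par A B) {z : ℂ} (hz : z ∉ Gam A B) : AnalyticAt ℂ (Hh A B) z := by
  have h1 := h.dg_analytic hz
  have hu : AnalyticAt ℂ (fun z => z - mm A B + dg A B z) z :=
    (analyticAt_id.sub analyticAt_const).add h1
  unfold Hh Psi
  refine AnalyticAt.mul (((analyticAt_const.div (hu.sub analyticAt_const) (h.ud_ne_P1 z)).add
    (analyticAt_const.div (hu.sub analyticAt_const) (h.ud_ne_N1 z))).add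
    (analyticAt_const.div hu (h.u_ne (dg_sq A B z)))) (hu.div h1 (dg_ne hz))

lemma Par.hasDerivAt_log_VV (h : Par A B) {γ : ℝ → ℂ} {γ' : ℂ} {t : ℝ} (hγ : HasDerivAt γ γ' t)
    (hz : γ t ∉ Gam A B) :
    HasDerivAt (fun t => Real.log (VV A B (γ t))) (Hh A B (γ t) * γ').re t := by
  have hd := (h.dg_deriv hz).scomp t hγ
  have hw : HasDerivAt (fun t => γ t - mm A B + dg A B (γ t))
      (γ' + γ' * ((γ t - mm A B) / dg A B (γ t))) t := by
    exact (hγ.sub_const (mm A B : ℂ)).add hd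
  simp only [h.log_VV]
  refine (hasDerivAt_LX hw (h.u_ne (dg_sq A B _)) (h.ud_ne_P1 _) (h.ud_ne_N1 _)).congr_deriv ?_
  unfold Hh
  congr 1
  have := dg_ne hz
  field_simp
  ring

lemma Par.hasDerivAt_log_vv (h : Par A B) {γ : ℝ → ℂ} {γ' : ℂ} {t : ℝ} (hγ : HasDerivAt γ γ' t)
    (hz : γ t ∉ Gam A B) (h1 : γ t ≠ 1) (h2 : γ t ≠ -1) :
    HasDerivAt (fun t => Real.log (vv A B (γ t))) (lam A B (γ t) (-dg A B (γ t)) * γ').re t := by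
  have hd := (h.dg_deriv hz).scomp t hγ
  have hw : HasDerivAt (fun t => γ t - mm A B + -dg A B (γ t))
      (γ' + -(γ' * ((γ t - mm A B) / dg A B (γ t)))) t := by
    exact (hγ.sub_const (mm A B : ℂ)).add hd.neg
  have hg := neg_sheet (dg_sq A B (γ t))
  have hev : (fun t => Real.log (vv A B (γ t))) =ᶠ[𝓝 t] fun t => LX A B (γ t - mm A B + -dg A B (γ t)) := by
    filter_upwards [hγ.continuousAt.eventually_ne h1, hγ.continuousAt.eventually_ne h2] with s a1 a2
    exact h.log_vv a1 a2
  refine HasDerivAt.congr_of_eventuallyEq ?_ hev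
  refine (hasDerivAt_LX hw (h.u_ne hg) (h.u_ne_P1 hg h1) (h.u_ne_N1 hg h2)).congr_deriv ?_
  have h0 := dg_ne hz
  rw [← h.psi_lam hg (neg_ne_zero.2 h0) h1 h2]
  congr 1
  field_simp
  ring

open InnerProductSpace in
lemma harmonicAt_LX {w : ℂ → ℂ} {z : ℂ} (hw : AnalyticAt ℂ w z) (h0 : w z ≠ 0)
    (h1 : w z - P1 A B ≠ 0) (h2 : w z - N1 A B ≠ 0) :
    HarmonicAt (fun z => LX A B (w z)) z := by
  have b0 := hw.harmonicAt_log_norm h0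
  have b1 := (hw.sub (analyticAt_const (v := (P1 A B:ℂ)))).harmonicAt_log_norm h1
  have b2 := (hw.sub (analyticAt_const (v := (N1 A B:ℂ)))).harmonicAt_log_norm h2
  exact ((b1.const_smul (c := -A)).add (b2.const_smul (c := -B))).add (b0.const_smul (c := A+B+1))

open InnerProductSpace in
lemma Par.harmonic_log_VV (h : Par A B) {z : ℂ} (hz : z ∉ Gam A B) :
    HarmonicAt (fun z => Real.log (VV A B z)) z := by
  simp only [h.log_VV]
  have h1 := h.dg_analytic hz
  have hu : AnalyticAt ℂ (fun z => z - mm A B + dg A B z) z :=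
    (analyticAt_id.sub analyticAt_const).add h1
  exact harmonicAt_LX hu (h.u_ne (dg_sq A B z)) (h.ud_ne_P1 z) (h.ud_ne_N1 z)

end

section
variable {A B : ℝ}

lemma branch_along {γ g : ℝ → ℂ} {γ' : ℂ} {t : ℝ} (hγ : HasDerivAt γ γ' t)
    (hg : ContinuousAt g t) (hs : ∀ᶠ s in 𝓝 t, g s ^ 2 = Qf A B (γ s)) (h0 : g t ≠ 0) :
    HasDerivAt g (γ' * ((γ t - mm A B) / g t)) t := by
  obtain ⟨G, h1, h2, h3⟩ := exists_branch hs.self_of_nhds h0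
  have hd : HasDerivAt G ((γ t - mm A B) / g t) (γ t) := by
    have h1' := h2.differentiableAt.hasDerivAt
    have h2' : HasDerivAt (fun w => G w ^ 2) (2 * (γ t - mm A B)) (γ t) := by
      have : (fun w => G w ^ 2) = Qf A B := by ext w; exact h3 w
      rw [this]
      unfold Qf
      have := ((hasDerivAt_id (γ t)).sub_const (mm A B : ℂ)).pow 2 |>.add_const ((kk A B : ℂ)^2)
      simpa using this
    have h3' := h1'.pow 2
    have := h2'.unique h3'
    have e : deriv G (γ t) = (γ t - mm A B) / g t := by
      rw [eq_div_iff h0]; simp [h1] at this; linear_combination -this/2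
    rwa [e] at h1'
  have hd2 := hd.scomp t hγ
  refine hd2.congr_of_eventuallyEq ?_
  have hc : ContinuousAt (fun s => g s + G (γ s)) t :=
    hg.add (ContinuousAt.comp (g := G) h2.continuousAt hγ.continuousAt)
  have hne : g t + G (γ t) ≠ 0 := by rw [h1]; simpa [← two_mul] using h0
  filter_upwards [hs, hc.eventually_ne hne] with s a1 a2
  rcases sq_cases a1 (h3 (γ s)) with h | h
  · exact h
  · exact absurd (by rw [h]; ring) a2

lemma Par.lam_sub (z g : ℂ) : lam A B z g - lam A B z (-g) = (A+B+2) * (g / (z^2-1)) := by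
  unfold lam
  rw [← sub_div]
  have : z^2 - 1 = -(1-z^2) := by ring
  rw [this]
  by_cases h : 1 - z^2 = 0
  · simp [h]
  field_simp; ring

/-- the difference function -/
def Th (A B : ℝ) (u : ℂ) : ℝ := LX A B u - LX A B (-(kk A B:ℂ)^2 / u)

lemma Par.u'_eq (h : Par A B) {z g : ℂ} (hg : g^2 = Qf A B z) :
    z - mm A B + -g = -(kk A B:ℂ)^2 / (z - mm A B + g) := by
  rw [eq_div_iff (h.u_ne hg)]; linear_combination sheet_mul hg

/-- conversely from `u` to `z, g`. -/
lemma Par.of_u {u : ℂ} (hu : u ≠ 0) :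
    ((u + (kk A B:ℂ)^2/u)/2)^2 = Qf A B (mm A B + (u - (kk A B:ℂ)^2/u)/2) := by
  unfold Qf; field_simp; ring

lemma Par.Th_deriv (h : Par A B) {w : ℝ → ℂ} {w' : ℂ} {t : ℝ} (hw : HasDerivAt w w' t)
    {z g : ℂ} (hg : g^2 = Qf A B z) (hz : w t = z - mm A B + g) (h1 : z ≠ 1) (h2 : z ≠ -1) :
    HasDerivAt (fun t => Th A B (w t)) ((A+B+2) * (g^2/((z^2-1) * w t)) * w').re t := by
  have hu := h.u_ne hg
  have hw0 : w t ≠ 0 := by rw [hz]; exact hu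
  have hg' := neg_sheet hg
  have hue := h.u'_eq hg
  rw [← hz] at hue
  have hw2 : HasDerivAt (fun t => -(kk A B:ℂ)^2 / w t) ((kk A B:ℂ)^2 / (w t)^2 * w') t := by
    have := (hasDerivAt_const t (-(kk A B:ℂ)^2)).div hw hw0
    refine this.congr_deriv ?_
    ring
  have d1 := hasDerivAt_LX hw hw0 (by rw [hz]; exact h.u_ne_P1 hg h1)
    (by rw [hz]; exact h.u_ne_N1 hg h2)
  have d2 := hasDerivAt_LX (A := A) (B := B) hw2 (by rw [← hue]; exact h.u_ne hg')
    (by rw [← hue]; exact h.u_ne_P1 hg' h1) (by rw [← hue]; exact h.u_ne_N1 hg' h2)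
  refine (d1.sub d2).congr_deriv ?_
  rw [← sub_re]
  congr 1
  have e1 := h.psi_lam' hg h1 h2
  have e2 := h.psi_lam' hg' h1 h2
  rw [hue] at e2
  rw [← hz] at e1
  have e3 := Par.lam_sub (A := A) (B := B) z g
  have hk : (kk A B:ℂ)^2 / (w t)^2 = -(-(kk A B:ℂ)^2 / w t) / w t := by field_simp
  have e4 : Psi A B (w t) = lam A B z g * g / w t := by rw [← e1]; field_simp
  rw [hk, ← mul_assoc, e4]
  have : Psi A B (-↑(kk A B) ^ 2 / w t) * (-(-↑(kk A B) ^ 2 / w t) / w t)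
     = -(Psi A B (-↑(kk A B) ^ 2 / w t) * (-↑(kk A B) ^ 2 / w t)) / w t := by ring
  rw [this, e2]
  have : (A+B+2) * (g^2/((z^2-1) * w t)) = ((A+B+2) * (g / (z^2-1))) * g / w t := by
    field_simp
  rw [this, ← e3]
  ring

lemma Par.Th_cubic (h : Par A B) {u0 : ℂ} (hu0 : u0^2 = -(kk A B:ℂ)^2)
    (h1 : (mm A B : ℂ) + u0 ≠ 1) (h2 : (mm A B : ℂ) + u0 ≠ -1) :
    (fun u => Th A B u - Th A B u0) =O[𝓝 u0] fun u => ‖u - u0‖^3 := by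
  have hk : (kk A B : ℂ) ≠ 0 := by exact_mod_cast h.kk_pos.ne'
  have hne : u0 ≠ 0 := by
    rintro rfl; apply hk; simpa using hu0.symm
  set Z : ℂ → ℂ := fun u => mm A B + (u - (kk A B:ℂ)^2/u)/2 with hZ
  set G : ℂ → ℂ := fun u => (u + (kk A B:ℂ)^2/u)/2 with hG
  have hZ0 : Z u0 = mm A B + u0 := by
    rw [hZ]; simp only; field_simp; linear_combination (-1)*hu0
  have hZc : ContinuousAt Z u0 := by
    rw [hZ]; fun_prop (disch := exact hne)
  set k : ℂ → ℂ := fun u => (A+B+2) * (((u+u0)/(2*u))^2/((Z u^2-1) * u)) with hkdef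
  have hden : Z u0 ^2 - 1 ≠ 0 := by
    rw [hZ0]; intro hh
    apply one_sub_sq_ne h1 h2; linear_combination -hh
  have hkc : ContinuousAt k u0 := by
    rw [hkdef]
    have : 2 * u0 ≠ 0 := by simpa using hne
    have h3 : (Z u0 ^2 - 1) * u0 ≠ 0 := mul_ne_zero hden hne
    fun_prop (disch := assumption)
  have hkb : ∀ᶠ u in 𝓝 u0, ‖k u‖ < ‖k u0‖ + 1 := hkc.norm.eventually_lt_const (by linarith)
  have hall : ∀ᶠ u in 𝓝 u0, ‖k u‖ < ‖k u0‖ + 1 ∧ u ≠ 0 ∧ Z u ≠ 1 ∧ Z u ≠ -1 := by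
    filter_upwards [hkb, eventually_ne_nhds hne, hZc.eventually_ne (by rw [hZ0]; exact h1),
      hZc.eventually_ne (by rw [hZ0]; exact h2)] with u a b c d
    exact ⟨a, b, c, d⟩
  obtain ⟨r, hr, hball⟩ := Metric.eventually_nhds_iff_ball.1 hall
  rw [Asymptotics.isBigO_iff]
  refine ⟨‖k u0‖ + 1, ?_⟩
  filter_upwards [Metric.ball_mem_nhds u0 hr] with u hu
  have hseg : ∀ s ∈ Icc (0:ℝ) 1, u0 + s * (u - u0) ∈ Metric.ball u0 r := by
    intro s hs
    rw [Metric.mem_ball, dist_eq_norm] at *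
    have : u0 + s * (u - u0) - u0 = s * (u-u0) := by ring
    rw [this, norm_mul, Complex.norm_real, Real.norm_eq_abs, abs_of_nonneg hs.1]
    nlinarith [norm_nonneg (u-u0), hs.2]
  have hder : ∀ s ∈ Icc (0:ℝ) 1, ∃ D : ℝ, |D| ≤ (‖k u0‖+1) * ‖u-u0‖^3 ∧
      HasDerivAt (fun s : ℝ => Th A B (u0 + s * (u-u0))) D s := by
    intro s hs
    obtain ⟨b1, b2, b3, b4⟩ := hball _ (hseg s hs)
    set v := u0 + s * (u-u0) with hv
    have hw : HasDerivAt (fun s : ℝ => u0 + s * (u-u0)) (u-u0) s := by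
      have := ((hasDerivAt_id (s:ℂ)).mul_const (u-u0)).const_add u0 |>.comp_ofReal
      simpa using this
    refine ⟨_, ?_, h.Th_deriv hw (g := G v) (z := Z v) (Par.of_u b2) ?_ b3 b4⟩
    · have e : G v = (v - u0) * ((v+u0)/(2*v)) := by
        rw [hG]; simp only; field_simp; linear_combination hu0
      have e2 : (A+B+2) * (G v^2/((Z v^2-1) * (u0 + s * (u-u0)))) * (u-u0) =
          k v * ((s:ℂ)^2 * (u-u0)^3) := by
        rw [e]
        have : v - u0 = s * (u-u0) := by rw [hv]; ring
        rw [this, hkdef]; simp only; rw [← hv]; ring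
      rw [e2]
      refine (Complex.abs_re_le_norm _).trans ?_
      have hn : ‖k v * ((s:ℂ)^2 * (u-u0)^3)‖ = ‖k v‖ * (s^2 * ‖u-u0‖^3) := by
        generalize k v = kv
        rw [norm_mul, norm_mul, norm_pow, norm_pow, Complex.norm_real, Real.norm_eq_abs,
          abs_of_nonneg hs.1]
      rw [hn]
      have : s^2 ≤ 1 := pow_le_one₀ hs.1 hs.2
      gcongr
      calc s^2 * ‖u-u0‖^3 ≤ 1 * ‖u-u0‖^3 := by gcongr
        _ = _ := one_mul _
    · rw [hZ, hG]; simp only; rw [← hv]; ring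
  choose! D hD1 hD2 using hder
  have := norm_image_sub_le_of_norm_deriv_le_segment_01' (f := fun s : ℝ => Th A B (u0 + s * (u-u0)))
    (f' := D) (C := (‖k u0‖+1) * ‖u-u0‖^3) (fun s hs => (hD2 s hs).hasDerivWithinAt)
    (fun s hs => hD1 s ⟨hs.1, hs.2.le⟩)
  simpa using this

lemma Par.Th_along (h : Par A B) {γ g : ℝ → ℂ} {γ' : ℂ} {t : ℝ} (hγ : HasDerivAt γ γ' t)
    (hg : ContinuousAt g t) (hs : ∀ᶠ s in 𝓝 t, g s ^ 2 = Qf A B (γ s))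
    (h1 : γ t ≠ 1) (h2 : γ t ≠ -1) :
    HasDerivAt (fun s => Th A B (γ s - mm A B + g s))
      ((A+B+2) * (g t / (γ t ^2 - 1) * γ')).re t := by
  by_cases h0 : g t = 0
  · have hgt := hs.self_of_nhds
    set u : ℝ → ℂ := fun s => γ s - mm A B + g s with hu
    set u0 := u t with hu0
    have e0 : u0 = γ t - mm A B := by rw [hu0, hu]; simp [h0]
    have hsq : u0^2 = -(kk A B:ℂ)^2 := by
      rw [h0] at hgt; unfold Qf at hgt; rw [e0]; linear_combination -hgt
    have hc : ContinuousAt u t := by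
      have := hγ.continuousAt; rw [hu]; fun_prop
    have key := (h.Th_cubic hsq (by rw [e0]; simpa using h1) (by rw [e0]; simpa using h2)).comp_tendsto hc
    rw [h0]; simp only [zero_div, zero_mul, mul_zero, zero_re]
    rw [hasDerivAt_iff_isLittleO]
    simp only [smul_zero, sub_zero]
    refine key.trans_isLittleO ?_
    have b1 : (fun s => ‖u s - u0‖^2) =O[𝓝 t] fun s => s - t := by
      have b0 : (fun s => ‖u s - u0‖^2) =ᶠ[𝓝 t] fun s => ‖2 * u s‖ * ‖γ s - γ t‖ := by
        filter_upwards [hs] with s hs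
        rw [← norm_pow, ← norm_mul]
        congr 1
        have : γ t = mm A B + u0 := by rw [e0]; ring
        rw [this]
        have := sheet_mul hs
        unfold Qf at hs
        simp only [hu]
        linear_combination hs + hsq
      refine b0.trans_isBigO ?_
      have b2 : (fun s => ‖2 * u s‖) =O[𝓝 t] fun _ => (1:ℝ) :=
        (continuousAt_const.mul hc).norm.tendsto.isBigO_one ℝ
      have b3 := b2.mul hγ.isBigO_sub.norm_left
      simpa using b3
    have b4 : (fun s => ‖u s - u0‖) =o[𝓝 t] fun _ => (1:ℝ) := by
      rw [Asymptotics.isLittleO_one_iff]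
      have : Tendsto (fun s => ‖u s - u0‖) (𝓝 t) (𝓝 ‖u t - u0‖) := (hc.sub continuousAt_const).norm
      simpa [hu0] using this
    have := b1.mul_isLittleO b4
    simpa [pow_succ, Function.comp_def] using this
  · have hd := branch_along hγ hg hs h0
    have hw : HasDerivAt (fun s => γ s - mm A B + g s) (γ' + γ' * ((γ t - mm A B)/g t)) t :=
      (hγ.sub_const _).add hd
    refine (h.Th_deriv hw hs.self_of_nhds rfl h1 h2).congr_deriv ?_
    congr 1
    have hu := h.u_ne hs.self_of_nhds
    have h3 : γ t ^ 2 - 1 ≠ 0 := by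
      intro hh; apply one_sub_sq_ne h1 h2; linear_combination -hh
    field_simp
    ring

lemma Par.LX_cont (h : Par A B) {u : ℂ} (h0 : u ≠ 0) (h1 : u - P1 A B ≠ 0) (h2 : u - N1 A B ≠ 0) :
    ContinuousAt (LX A B) u := by
  have := norm_ne_zero_iff.2 h0; have := norm_ne_zero_iff.2 h1; have := norm_ne_zero_iff.2 h2
  unfold LX
  fun_prop (disch := assumption)

lemma Par.path_int (h : Par A B) {γ g : ℝ → ℂ} (hγ : ContDiff ℝ 1 γ)
    (hne : ∀ t ∈ Icc (0:ℝ) 1, γ t ≠ 1 ∧ γ t ≠ -1) (hg : ContinuousOn g (Icc 0 1))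
    (hs : ∀ t ∈ Icc (0:ℝ) 1, g t ^2 = Qf A B (γ t)) :
    (A+B+2) * (∫ t in (0:ℝ)..1, g t / ((γ t) ^ 2 - 1) * deriv γ t).re =
     Th A B (γ 1 - mm A B + g 1) - Th A B (γ 0 - mm A B + g 0) := by
  have hci : ContinuousOn (fun t => g t / ((γ t) ^ 2 - 1) * deriv γ t) (Icc 0 1) := by
    have c1 := hγ.continuous
    have c2 : Continuous (deriv γ) := hγ.continuous_deriv le_rfl
    refine ContinuousOn.mul (hg.div (by fun_prop) ?_) c2.continuousOn
    intro t ht hh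
    apply one_sub_sq_ne (hne t ht).1 (hne t ht).2; linear_combination -hh
  have hii : IntervalIntegrable (fun t => g t / ((γ t) ^ 2 - 1) * deriv γ t) MeasureTheory.volume 0 1 := by
    apply ContinuousOn.intervalIntegrable; rwa [uIcc_of_le zero_le_one]
  have e1 : (A+B+2) * (∫ t in (0:ℝ)..1, g t / ((γ t) ^ 2 - 1) * deriv γ t).re =
      ∫ t in (0:ℝ)..1, ((A+B+2) * (g t / ((γ t) ^ 2 - 1) * deriv γ t)).re := by
    have := (Complex.reCLM.intervalIntegral_comp_comm hii).symm
    simp only [Complex.reCLM_apply] at this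
    rw [this, ← intervalIntegral.integral_const_mul]
    congr 1; ext t
    rw [show (A:ℂ)+B+2 = ((A+B+2:ℝ):ℂ) by push_cast; ring, re_ofReal_mul]
  rw [e1]
  have hgamd : ∀ t, HasDerivAt γ (deriv γ t) t := fun t =>
    (hγ.differentiable one_ne_zero).differentiableAt.hasDerivAt
  refine intervalIntegral.integral_eq_sub_of_hasDerivAt_of_le zero_le_one (f := fun t => Th A B (γ t - mm A B + g t)) ?_ ?_ ?_
  · intro t ht
    have hu := h.u_ne (hs t ht)
    have hg' := neg_sheet (hs t ht)
    have hue := h.u'_eq (hs t ht)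
    have c1 : ContinuousWithinAt (fun t => γ t - mm A B + g t) (Icc 0 1) t :=
      (hγ.continuous.continuousWithinAt.sub continuousWithinAt_const).add (hg t ht)
    have c2 : ContinuousAt (Th A B) (γ t - mm A B + g t) := by
      unfold Th
      refine (h.LX_cont hu (h.u_ne_P1 (hs t ht) (hne t ht).1) (h.u_ne_N1 (hs t ht) (hne t ht).2)).sub ?_
      refine ContinuousAt.comp (g := LX A B) ?_ (continuousAt_const.div continuousAt_id hu)
      rw [← hue]
      exact h.LX_cont (h.u_ne hg') (h.u_ne_P1 hg' (hne t ht).1) (h.u_ne_N1 hg' (hne t ht).2)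
    exact ContinuousAt.comp_continuousWithinAt (g := Th A B) c2 c1
  · intro t ht
    have hm : Icc (0:ℝ) 1 ∈ 𝓝 t := Icc_mem_nhds ht.1 ht.2
    have ht' := Ioo_subset_Icc_self ht
    refine h.Th_along (hgamd t) (hg.continuousAt hm) ?_ (hne t ht').1 (hne t ht').2
    filter_upwards [hm] with s hs1
    exact hs s hs1
  · apply ContinuousOn.intervalIntegrable; rw [uIcc_of_le zero_le_one]
    exact Complex.continuous_re.comp_continuousOn (continuousOn_const.mul hci)

lemma Par.Th_eq_zero (h : Par A B) {z g : ℂ} (hg : g^2 = Qf A B z) (h1 : z ≠ 1) (h2 : z ≠ -1) :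
    Th A B (z - mm A B + g) = 0 ↔ z ∈ Gam A B := by
  have hg' := neg_sheet hg
  have a1 := XX_pos (h.u_ne hg) (h.u_ne_P1 hg h1) (h.u_ne_N1 hg h2)
  have a2 := XX_pos (h.u_ne hg') (h.u_ne_P1 hg' h1) (h.u_ne_N1 hg' h2)
  rw [mem_Gam hg]
  unfold Th
  rw [← h.u'_eq hg, ← log_XX (h.u_ne hg) (h.u_ne_P1 hg h1) (h.u_ne_N1 hg h2),
    ← log_XX (h.u_ne hg') (h.u_ne_P1 hg' h1) (h.u_ne_N1 hg' h2), sub_eq_zero, sub_eq_add_neg]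
  exact Real.log_injOn_pos.eq_iff a1 a2

lemma Par.Gamma_eq (h : Par A B) : GammaSet A B = Gam A B := by
  have hk := h.kk_pos
  have Q0 : Qf A B (zetaM A B) = 0 := by rw [← h.Q_eq]; simp
  ext z
  constructor
  · rintro ⟨γ, g, hγ, h0, h1, hne, hg, hs, hintg⟩
    simp only [h.Q_eq] at hs
    have key := h.path_int hγ hne hg hs
    have i0 : (0:ℝ) ∈ Icc (0:ℝ) 1 := by simp
    have i1 : (1:ℝ) ∈ Icc (0:ℝ) 1 := by simp
    rw [hintg, mul_zero, (h.Th_eq_zero (hs 0 i0) (hne 0 i0).1 (hne 0 i0).2).2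
      (by rw [h0]; exact mem_Gam_of_Q Q0), sub_zero] at key
    have := (h.Th_eq_zero (hs 1 i1) (hne 1 i1).1 (hne 1 i1).2).1 key.symm
    rwa [h1] at this
  · intro hz
    have hz1 : z ≠ 1 := by rintro rfl; exact h.one_notMem hz
    have hz2 : z ≠ -1 := by rintro rfl; exact h.neg_one_notMem hz
    have hgz := dg_sq A B z
    set u1 := z - mm A B + dg A B z with hu1
    have hu1n : u1 ≠ 0 := h.u_ne hgz
    -- the path in the u-plane
    obtain ⟨s, hsr⟩ : ∃ s : ℝ, ∀ t : ℝ, -kk A B + t * (u1.im + kk A B) = 0 →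
        u1.im = 0 ∧ t = 1 ∧ s = 0 ∨ t * u1.re + s * (t * (1-t)) = P1 A B + N0 A B := by
      by_cases h0 : u1.im = 0
      · refine ⟨0, fun t ht => Or.inl ⟨h0, ?_, rfl⟩⟩
        rw [h0, zero_add] at ht
        have : (t - 1) * kk A B = 0 := by linarith
        rcases mul_eq_zero.1 this with h | h
        · linarith
        · exact absurd h hk.ne'
      · by_cases h1 : u1.im + kk A B = 0
        · refine ⟨0, fun t ht => ?_⟩
          rw [h1] at ht; exfalso; linarith
        · set T := kk A B / (u1.im + kk A B)
          have hT0 : T ≠ 0 := div_ne_zero hk.ne' h1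
          have hT1 : 1 - T ≠ 0 := by
            have : 1 - T = u1.im / (u1.im + kk A B) := by simp only [T]; field_simp; ring
            rw [this]; exact div_ne_zero h0 h1
          refine ⟨(P1 A B + N0 A B - T * u1.re) / (T * (1-T)), fun t ht => Or.inr ?_⟩
          have : t = T := by simp only [T]; rw [eq_div_iff h1]; linarith
          rw [this]; field_simp; ring
    set u : ℝ → ℂ := fun t => -(I * kk A B) + t * (u1 + I * kk A B) + s * (t * (1-t)) with hu
    have uim : ∀ t, (u t).im = -kk A B + t * (u1.im + kk A B) := by
      intro t; rw [hu]
      simp [Complex.add_im, Complex.mul_im]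
    have ure : ∀ t, (u t).re = t * u1.re + s * (t * (1-t)) := by
      intro t; rw [hu]
      simp [Complex.add_re, Complex.mul_re]
    have hN0 := h.N0_pos; have hN1 := h.N1_neg; have hP0 := h.P0_neg; have hP1 := h.P1_pos
    -- bad real points avoided
    have hbad : ∀ c : ℝ, c < P1 A B + N0 A B → u1 ≠ c → ∀ t, u t ≠ c := by
      intro c hc hc1 t ht
      have im0 : (u t).im = 0 := by rw [ht]; simp
      have re0 : (u t).re = c := by rw [ht]; simp
      rw [uim] at im0
      rw [ure] at re0
      rcases hsr t im0 with ⟨a1, a2, a3⟩ | a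
      · apply hc1
        rw [a2, a3] at re0
        apply Complex.ext <;> simp [a1]; linarith
      · linarith
    have hne0 : ∀ t, u t ≠ 0 := by
      have := hbad 0 (by linarith) (by simpa using hu1n)
      simpa using this
    have hZ : ∀ v : ℂ, v ≠ 0 → ((mm A B + (v - (kk A B:ℂ)^2/v)/2 : ℂ) - mm A B + (v + (kk A B:ℂ)^2/v)/2) = v := by
      intro v hv; ring
    have hu1' : (kk A B : ℂ)^2/u1 = -(z - mm A B - dg A B z) := by
      rw [div_eq_iff hu1n]; linear_combination (sheet_mul hgz)
    set γ : ℝ → ℂ := fun t => mm A B + (u t - (kk A B:ℂ)^2/u t)/2 with hγ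
    set g : ℝ → ℂ := fun t => (u t + (kk A B:ℂ)^2/u t)/2 with hg
    have hsq : ∀ t, g t ^ 2 = Qf A B (γ t) := fun t => Par.of_u (hne0 t)
    have hug : ∀ t, γ t - mm A B + g t = u t := fun t => by rw [hγ, hg]; ring
    have cu : ContDiff ℝ 1 u := by
      rw [hu]
      have : ContDiff ℝ 1 (fun t : ℝ => (t:ℂ)) := ofRealCLM.contDiff
      fun_prop
    have cγ : ContDiff ℝ 1 γ := by
      rw [hγ]
      simp only [div_eq_mul_inv]
      exact contDiff_const.add ((cu.sub (contDiff_const.mul (cu.inv hne0))).mul contDiff_const)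
    have hγ0 : γ 0 = zetaM A B := by
      have : (kk A B : ℂ) ≠ 0 := by exact_mod_cast hk.ne'
      rw [hγ, h.zetaM_eq, hu]; simp
      field_simp; linear_combination (kk A B:ℂ)*I_sq
    have hu1e : u 1 = u1 := by rw [hu]; simp
    have hγ1 : γ 1 = z := by
      rw [hγ]; simp only; rw [hu1e, hu1', hu1]; ring
    have hbP : ∀ t, γ t ≠ 1 := by
      intro t ht
      have := h.zsub1 (hsq t)
      rw [hug, ht, sub_self, zero_mul] at this
      rcases mul_eq_zero.1 this.symm with h' | h'
      · refine hbad (P0 A B) (by linarith) ?_ t (sub_eq_zero.1 h')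
        intro hh
        have := h.zsub1 hgz
        rw [← hu1, hh, sub_self, zero_mul] at this
        rcases mul_eq_zero.1 this with h3 | h3
        · exact hz1 (sub_eq_zero.1 h3)
        · rw [← hh] at h3; simp at h3; exact hu1n h3
      · exact hbad (P1 A B) (by linarith) (sub_ne_zero.1 (h.u_ne_P1 hgz hz1)) t (sub_eq_zero.1 h')
    have hbN : ∀ t, γ t ≠ -1 := by
      intro t ht
      have := h.zadd1 (hsq t)
      rw [hug, ht, neg_add_cancel, zero_mul] at this
      rcases mul_eq_zero.1 this.symm with h' | h'
      · refine hbad (N0 A B) (by linarith) ?_ t (sub_eq_zero.1 h')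
        intro hh
        have := h.zadd1 hgz
        rw [← hu1, hh, sub_self, zero_mul] at this
        rcases mul_eq_zero.1 this with h3 | h3
        · exact hz2 (by linear_combination h3)
        · rw [← hh] at h3; simp at h3; exact hu1n h3
      · exact hbad (N1 A B) (by linarith) (sub_ne_zero.1 (h.u_ne_N1 hgz hz2)) t (sub_eq_zero.1 h')
    have hgc : ContinuousOn g (Icc 0 1) := by
      rw [hg]
      have := cu.continuous
      exact ((this.add (continuous_const.div this hne0)).div_const 2).continuousOn
    refine ⟨γ, g, cγ, hγ0, hγ1, fun t _ => ⟨hbP t, hbN t⟩, hgc, fun t _ => by rw [h.Q_eq]; exact hsq t, ?_⟩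
    have key := h.path_int cγ (fun t _ => ⟨hbP t, hbN t⟩) hgc (fun t _ => hsq t)
    rw [(h.Th_eq_zero (hsq 0) (hbP 0) (hbN 0)).2 (by rw [hγ0]; exact mem_Gam_of_Q Q0),
      (h.Th_eq_zero (hsq 1) (hbP 1) (hbN 1)).2 (by rw [hγ1]; exact hz), sub_zero] at key
    exact (mul_eq_zero.1 key).resolve_left h.hs.ne'

end

section
variable {A B : ℝ}

lemma genBinom_succ (z : ℂ) (k : ℕ) : genBinom z (k+1) * (k+1) = genBinom z k * (z - k) := by
  unfold genBinom
  rw [Finset.prod_range_succ, Nat.factorial_succ]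
  have : (Nat.factorial k : ℂ) ≠ 0 := by exact_mod_cast Nat.factorial_ne_zero k
  have : (k:ℂ) + 1 ≠ 0 := by exact_mod_cast Nat.succ_ne_zero k
  push_cast; field_simp

lemma genBinom_eq_choose (z : ℂ) (k : ℕ) : genBinom z k = Ring.choose z k := by
  rw [Ring.choose_eq_smul]
  unfold genBinom
  rw [div_eq_inv_mul, smul_eq_mul]
  congr 1
  rw [← descPochhammer_eval_eq_prod_range, ← aeval_eq_smeval, ← descPochhammer_map (Int.castRingHom ℂ),
    eval_map, aeval_def]
  rfl

lemma genBinom_add (z w : ℂ) (k : ℕ) :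
    genBinom (z+w) k = ∑ ij ∈ Finset.HasAntidiagonal.antidiagonal k, genBinom z ij.1 * genBinom w ij.2 := by
  simp only [genBinom_eq_choose]
  exact Ring.add_choose_eq k (Commute.all z w)

def uP : ℂ[X] := C (2⁻¹ : ℂ) * (X - 1)
def vP : ℂ[X] := C (2⁻¹ : ℂ) * (X + 1)

lemma jacobi_anti (n : ℕ) (α β : ℂ) : jacobiPoly n α β =
    ∑ q ∈ Finset.HasAntidiagonal.antidiagonal n, C (genBinom (n+α) q.2 * genBinom (n+β) q.1) * (uP ^ q.1 * vP ^ q.2) := by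
  rw [Finset.Nat.sum_antidiagonal_eq_sum_range_succ
    (f := fun s t => C (genBinom (n+α) t * genBinom (n+β) s) * (uP ^ s * vP ^ t))]
  unfold jacobiPoly
  refine Finset.sum_congr rfl fun s hs => ?_
  unfold uP vP; ring

/-- action of the hypergeometric operator on a monomial -/
lemma jacobi_term (α β : ℂ) (s t : ℕ) :
    (1 - X^2) * derivative (derivative (uP^s * vP^t)) +
      (C (β - α) - C (α+β+2) * X) * derivative (uP^s * vP^t) +
      C (((s:ℂ)+t) * (s+t+α+β+1)) * (uP^s*vP^t) =
     C (t * (t+β)) * (uP^s * vP^(t-1)) - C (s*(s+α)) * (uP^(s-1)*vP^t) := by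
  have du : derivative uP = C (2⁻¹ : ℂ) := by simp [uP]
  have dv : derivative vP = C (2⁻¹ : ℂ) := by simp [vP]
  have c2 : C (2⁻¹:ℂ) * 2 = 1 := by
    rw [← C_ofNat, ← C_mul]; simp
  have hv : vP = uP + 1 := by
    unfold uP vP; linear_combination c2
  have hx : X = 2 * uP + 1 := by
    unfold uP; linear_combination (1 - X) * c2
  have key : ∀ (w : ℂ[X]) (k : ℕ), derivative w = C (2⁻¹ : ℂ) →
      ∃ a a' : ℂ[X], a = C (k:ℂ) * w^(k-1) ∧ derivative (w^k) = C (2⁻¹:ℂ) * a ∧ derivative a = C (2⁻¹:ℂ) * a' ∧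
        w * a = C (k:ℂ) * w^k ∧ w * a' = (C (k:ℂ) - 1) * a := by
    intro w k hw
    rcases k with _ | _ | k
    · exact ⟨0, 0, by simp, by simp, by simp, by simp, by simp⟩
    · exact ⟨1, 0, by simp, by simp [hw], by simp, by simp, by simp⟩
    · refine ⟨C ((k+2 : ℕ):ℂ) * w^(k+1), C ((k+2 : ℕ):ℂ) * C ((k+1:ℕ):ℂ) * w^k, rfl, ?_, ?_, ?_, ?_⟩
      · rw [derivative_pow, hw]; push_cast; simp only [C_add, C_1, C_ofNat]; simp; ring
      · rw [derivative_mul, derivative_C, derivative_pow, hw]; push_cast; simp; ring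
      · ring
      · push_cast; simp only [C_add, C_1, C_ofNat]; ring
  obtain ⟨a, a', a1, a2, a3, a4, a5⟩ := key uP s du
  obtain ⟨b, b', b1, b2, b3, b4, b5⟩ := key vP t dv
  have e1 : C (t * (t+β)) * (uP^s * vP^(t-1)) = C ((t:ℂ)+β) * uP^s * b := by rw [b1, C_mul]; ring
  have e2 : C (s * (s+α)) * (uP^(s-1) * vP^t) = C ((s:ℂ)+α) * vP^t * a := by rw [a1, C_mul]; ring
  rw [e1, e2]
  simp only [derivative_mul, derivative_add, a2, b2, a3, b3, derivative_C]
  rw [hx]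
  simp only [C_add, C_sub, C_mul, C_1, C_ofNat]
  generalize uP^s = φ at *
  generalize vP^t = ψ at *
  rw [hv] at b4 b5
  generalize C (s:ℂ) = S at *
  generalize C (t:ℂ) = T at *
  generalize C α = al at *
  generalize C β = be at *
  generalize uP = u at *
  have c4 : C (2⁻¹:ℂ)^2 * 4 = 1 := by linear_combination (C (2⁻¹:ℂ) * 2 + 1) * c2
  linear_combination (-u*(u+1)*(a'*ψ+2*a*b+φ*b'))*c4 - ((al+1)+(al+be+2)*u)*(a*ψ+φ*b)*c2
    - (u+1)*ψ*a5 - u*φ*b5 - 2*(u+1)*b*a4 - 2*S*φ*b4 - ψ*(S+al+be+1)*a4 - φ*(T+al+be+1)*b4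

lemma jacobi_ode_poly (n : ℕ) (α β : ℂ) :
    (1 - X^2) * derivative (derivative (jacobiPoly n α β)) +
      (C (β - α) - C (α+β+2) * X) * derivative (jacobiPoly n α β) +
      C ((n:ℂ) * (n+α+β+1)) * jacobiPoly n α β = 0 := by
  have h0 : (1 - X^2) * derivative (derivative (jacobiPoly n α β)) +
      (C (β - α) - C (α+β+2) * X) * derivative (jacobiPoly n α β) +
      C ((n:ℂ) * (n+α+β+1)) * jacobiPoly n α β =
      ∑ q ∈ Finset.HasAntidiagonal.antidiagonal n, C (genBinom (n+α) q.2 * genBinom (n+β) q.1) *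
        (C (q.2 * (q.2+β)) * (uP^q.1 * vP^(q.2-1)) - C (q.1*(q.1+α)) * (uP^(q.1-1)*vP^q.2)) := by
    rw [jacobi_anti]
    simp only [derivative_sum, derivative_C_mul]
    rw [Finset.mul_sum, Finset.mul_sum, Finset.mul_sum, ← Finset.sum_add_distrib,
      ← Finset.sum_add_distrib]
    refine Finset.sum_congr rfl fun q hq => ?_
    have hn : (n:ℂ) = q.1 + q.2 := by
      rw [← Finset.HasAntidiagonal.mem_antidiagonal.1 hq]; push_cast; rfl
    rw [← jacobi_term α β q.1 q.2]
    rw [show ((n:ℂ) * (n+α+β+1)) = ((q.1:ℂ)+q.2)*(q.1+q.2+α+β+1) by rw [hn]]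
    ring
  rw [h0]
  rcases n with _ | n
  · simp
  simp only [mul_sub]
  rw [Finset.sum_sub_distrib, sub_eq_zero]
  rw [Finset.Nat.sum_antidiagonal_succ' (n := n)
    (f := fun q : ℕ × ℕ => C (genBinom ((n+1:ℕ)+α) q.2 * genBinom ((n+1:ℕ)+β) q.1) *
        (C (q.2 * (q.2+β)) * (uP^q.1 * vP^(q.2-1)))),
    Finset.Nat.sum_antidiagonal_succ (n := n)
    (f := fun q : ℕ × ℕ => C (genBinom ((n+1:ℕ)+α) q.2 * genBinom ((n+1:ℕ)+β) q.1) *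
        (C (q.1 * (q.1+α)) * (uP^(q.1-1) * vP^q.2)))]
  simp only [Nat.cast_zero, zero_mul, C_0, mul_zero, zero_add, Nat.add_sub_cancel]
  refine Finset.sum_congr rfl fun q hq => ?_
  rw [← mul_assoc, ← C_mul, ← mul_assoc (C _) (C _), ← C_mul]
  congr 2
  have hn : (n:ℂ) = q.1 + q.2 := by
      rw [← Finset.HasAntidiagonal.mem_antidiagonal.1 hq]; push_cast; rfl
  have e1 := genBinom_succ ((n+1:ℕ)+α) q.2
  have e2 := genBinom_succ ((n+1:ℕ)+β) q.1
  have f1 : ((n+1:ℕ):ℂ) + α - q.2 = q.1 + 1 + α := by push_cast; rw [hn]; ring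
  have f2 : ((n+1:ℕ):ℂ) + β - q.1 = q.2 + 1 + β := by push_cast; rw [hn]; ring
  rw [f1] at e1
  rw [f2] at e2
  push_cast at *
  linear_combination genBinom ((n:ℂ)+1+β) q.1 * (q.2+1+β) * e1 - genBinom ((n:ℂ)+1+α) q.2 * (q.1+1+α) * e2

lemma jacobi_ode (n : ℕ) (α β z : ℂ) :
    (1 - z^2) * (derivative (derivative (jacobiPoly n α β))).eval z +
      (β - α - (α+β+2) * z) * (derivative (jacobiPoly n α β)).eval z +
      ((n:ℂ) * (n+α+β+1)) * (jacobiPoly n α β).eval z = 0 := by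
  have := congrArg (eval z) (jacobi_ode_poly n α β)
  simpa using this

lemma jacobi_one (n : ℕ) (α β : ℂ) : (jacobiPoly n α β).eval 1 = genBinom (n+α) n := by
  unfold jacobiPoly
  rw [eval_finsetSum, Finset.sum_eq_single 0]
  · simp [genBinom]; norm_num
  · intro s hs h0; simp [h0]
  · simp

lemma jacobi_neg_one (n : ℕ) (α β : ℂ) : (jacobiPoly n α β).eval (-1) = (-1)^n * genBinom (n+β) n := by
  unfold jacobiPoly
  rw [eval_finsetSum, Finset.sum_eq_single n]
  · simp [genBinom]; norm_num; ring
  · intro s hs h0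
    have : n - s ≠ 0 := by have := Finset.mem_range.1 hs; omega
    simp [this]
  · simp

lemma jacobi_degree (n : ℕ) (α β : ℂ) : (jacobiPoly n α β).natDegree ≤ n := by
  rw [jacobi_anti]
  refine natDegree_sum_le_of_forall_le _ _ fun q hq => ?_
  have hn := Finset.HasAntidiagonal.mem_antidiagonal.1 hq
  have d1 : uP.natDegree ≤ 1 := by unfold uP; compute_degree
  have d2 : vP.natDegree ≤ 1 := by unfold vP; compute_degree
  refine (natDegree_C_mul_le _ _).trans (natDegree_mul_le.trans ?_)
  have := natDegree_pow_le_of_le q.1 d1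
  have := natDegree_pow_le_of_le q.2 d2
  omega

lemma jacobi_coeff (n : ℕ) (α β : ℂ) : (jacobiPoly n α β).coeff n = (2⁻¹)^n * genBinom (n+(n+α+β)) n := by
  rw [show (n:ℂ)+(n+α+β) = (n+β)+(n+α) by ring, genBinom_add, Finset.mul_sum, jacobi_anti, finsetSum_coeff]
  refine Finset.sum_congr rfl fun q hq => ?_
  have hn := Finset.HasAntidiagonal.mem_antidiagonal.1 hq
  have d1 : uP.natDegree ≤ 1 := by unfold uP; compute_degree
  have d2 : vP.natDegree ≤ 1 := by unfold vP; compute_degree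
  have c1 : uP.coeff 1 = 2⁻¹ := by unfold uP; simp [coeff_one]
  have c2 : vP.coeff 1 = 2⁻¹ := by unfold vP; simp [coeff_one]
  have p1 := coeff_pow_of_natDegree_le (m := q.1) d1
  have p2 := coeff_pow_of_natDegree_le (m := q.2) d2
  rw [mul_one] at p1 p2
  have m1 := natDegree_pow_le_of_le q.1 d1
  have m2 := natDegree_pow_le_of_le q.2 d2
  rw [mul_one] at m1 m2
  rw [coeff_C_mul, ← hn, coeff_mul_add_eq_of_natDegree_le m1 m2, p1, p2, c1, c2, hn, ← hn, pow_add]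
  push_cast
  ring

end

section
variable {A B : ℝ}

lemma tendsto_log_div_nat : Tendsto (fun n : ℕ => Real.log n / n) atTop (𝓝 0) := by
  have := Real.isLittleO_log_id_atTop.tendsto_div_nhds_zero
  exact this.comp tendsto_natCast_atTop_atTop

lemma fact_log {k : ℕ → ℕ} {κ : ℝ} (hκ : 0 < κ) (hk : Tendsto (fun n => (k n : ℝ) / n) atTop (𝓝 κ)) :
    Tendsto (fun n : ℕ => (Real.log ((k n).factorial) - k n * Real.log n) / n) atTop (𝓝 (κ * Real.log κ - κ)) := by
  have hkn : Tendsto k atTop atTop := by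
    have h1 : Tendsto (fun n : ℕ => (k n:ℝ)) atTop atTop := by
      have := hk.pos_mul_atTop hκ tendsto_natCast_atTop_atTop
      refine this.congr' ?_
      filter_upwards [eventually_gt_atTop 0] with n hn
      field_simp
    exact tendsto_natCast_atTop_iff.1 h1
  have hst : Tendsto (fun n : ℕ => Real.log (Stirling.stirlingSeq (k n)) / n) atTop (𝓝 0) := by
    have h1 : Tendsto (fun n => Real.log (Stirling.stirlingSeq (k n))) atTop (𝓝 (Real.log (√Real.pi))) :=
      (Stirling.tendsto_stirlingSeq_sqrt_pi.comp hkn).log (by positivity)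
    exact h1.div_atTop tendsto_natCast_atTop_atTop
  have hl : Tendsto (fun n => Real.log ((k n:ℝ)/n)) atTop (𝓝 (Real.log κ)) := hk.log hκ.ne'
  have hl2 : Tendsto (fun n : ℕ => (1/2*(Real.log 2 + Real.log ((k n:ℝ)/n))) / n) atTop (𝓝 0) :=
    (((hl.const_add _).const_mul _)).div_atTop tendsto_natCast_atTop_atTop
  have := ((hst.add hl2).add (tendsto_log_div_nat.const_mul (1/2))).add (hk.mul (hl.sub_const 1))
  rw [show κ * Real.log κ - κ = 0 + 0 + 1/2*0 + κ * (Real.log κ - 1) by ring]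
  refine this.congr' ?_
  filter_upwards [eventually_gt_atTop 0, hkn.eventually_gt_atTop 0] with n hn hkn
  have hn' : (0:ℝ) < n := by exact_mod_cast hn
  have hk' : (0:ℝ) < k n := by exact_mod_cast hkn
  rw [Stirling.log_stirlingSeq_formula, Real.log_div hk'.ne' hn'.ne', Real.log_mul two_ne_zero hk'.ne',
    Real.log_div hk'.ne' (Real.exp_ne_zero _), Real.log_exp]
  field_simp
  ring

lemma prod_shift {θ : ℝ} (hθ : |θ| ≤ 1/2) (m : ℕ) :
    0 < ∏ i ∈ Finset.range m, ((i:ℝ)+1+θ) ∧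
    |Real.log (∏ i ∈ Finset.range m, ((i:ℝ)+1+θ)) - Real.log m.factorial| ≤ Real.log (2 * (m+1)) := by
  rw [abs_le] at hθ
  have hpos : 0 < ∏ i ∈ Finset.range m, ((i:ℝ)+1+θ) :=
    Finset.prod_pos fun i _ => by have : (0:ℝ) ≤ i := by positivity
                                  linarith
  refine ⟨hpos, ?_⟩
  have hm : (0:ℝ) < m.factorial := by exact_mod_cast m.factorial_pos
  have up : ∏ i ∈ Finset.range m, ((i:ℝ)+1+θ) ≤ (m+1) * m.factorial := by
    clear hm hpos
    induction m with
    | zero => simp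
    | succ m ih =>
      rw [Finset.prod_range_succ, Nat.factorial_succ]
      have h0 : (0:ℝ) < m.factorial := by exact_mod_cast m.factorial_pos
      push_cast
      calc _ ≤ (m+1) * m.factorial * ((m:ℝ)+1+1) := by
            gcongr
            · have : (0:ℝ) ≤ m := by positivity
              linarith
            · linarith
        _ = _ := by ring
  have lo : (m.factorial:ℝ) ≤ 2 * (m+1) * ∏ i ∈ Finset.range m, ((i:ℝ)+1+θ) := by
    have : (m.factorial:ℝ) ≤ 2 * max (1:ℝ) m * ∏ i ∈ Finset.range m, ((i:ℝ)+1+θ) := by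
      clear hm up hpos
      induction m with
      | zero => simp
      | succ m ih =>
        rw [Finset.prod_range_succ, Nat.factorial_succ]
        rcases m with _ | m
        · simp; linarith
        push_cast at *
        have e1 : max (1:ℝ) (m+1) = m+1 := max_eq_right (by linarith [(Nat.cast_nonneg m : (0:ℝ) ≤ m)])
        have e2 : max (1:ℝ) (m+1+1) = m+1+1 := max_eq_right (by linarith [(Nat.cast_nonneg m : (0:ℝ) ≤ m)])
        rw [e1] at ih; rw [e2]
        have h0 : (0:ℝ) ≤ m := by positivity
        have hp : 0 < ∏ i ∈ Finset.range (m+1), ((i:ℝ)+1+θ) :=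
          Finset.prod_pos fun i _ => by have : (0:ℝ) ≤ i := by positivity
                                        linarith
        calc ((m:ℝ)+1+1) * _ ≤ ((m:ℝ)+1+1) * (2 * (m+1) * ∏ i ∈ Finset.range (m+1), ((i:ℝ)+1+θ)) := by
              gcongr
          _ = (2 * (m+1+1) * ∏ i ∈ Finset.range (m+1), ((i:ℝ)+1+θ)) * (m+1) := by ring
          _ ≤ (2 * (m+1+1) * ∏ i ∈ Finset.range (m+1), ((i:ℝ)+1+θ)) * (m+1+1+θ) := by
              refine mul_le_mul_of_nonneg_left (by linarith) (by positivity)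
          _ = _ := by ring
    refine this.trans ?_
    gcongr
    exact max_le (by linarith [(Nat.cast_nonneg m : (0:ℝ) ≤ m)]) (by linarith)
  have h1 := Real.log_le_log hpos up
  have h2 := Real.log_le_log hm lo
  rw [Real.log_mul (by positivity) hm.ne'] at h1
  rw [Real.log_mul (by positivity) hpos.ne'] at h2
  have h3 : Real.log ((m:ℝ)+1) ≤ Real.log (2*(m+1)) := Real.log_le_log (by positivity) (by
    have : (0:ℝ) ≤ m := by positivity
    linarith)
  rw [abs_le]; constructor <;> linarith

lemma genBinom_norm (x : ℝ) (n : ℕ) :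
    ‖genBinom (n + x) n‖ = (∏ i ∈ Finset.range n, |x + i + 1|) / n.factorial := by
  unfold genBinom
  rw [norm_div, norm_prod, Complex.norm_natCast]
  congr 1
  rw [← Finset.prod_range_reflect]
  refine Finset.prod_congr rfl fun i hi => ?_
  have := Finset.mem_range.1 hi
  have e : ((n - 1 - i : ℕ) : ℂ) = n - 1 - i := by
    rw [Nat.cast_sub (by omega), Nat.cast_sub (by omega)]; simp
  rw [e, show (n:ℂ) + x - (n-1-i) = ((x + i + 1 : ℝ):ℂ) by push_cast; ring, Complex.norm_real, Real.norm_eq_abs]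

lemma prod_split {x : ℝ} {k l : ℕ} :
    ∏ i ∈ Finset.range (k+1+l), |x + i + 1| =
      (∏ i ∈ Finset.range k, |(i:ℝ) + 1 + (-(x+(k+1)))|) * |x+(k+1)| *
        ∏ i ∈ Finset.range l, |(i:ℝ)+1+(x+(k+1))| := by
  rw [Finset.prod_range_add, Finset.prod_range_succ]
  congr 2
  · rw [← Finset.prod_range_reflect]
    refine Finset.prod_congr rfl fun i hi => ?_
    have := Finset.mem_range.1 hi
    have e : ((k - 1 - i : ℕ) : ℝ) = k - 1 - i := by
      rw [Nat.cast_sub (by omega), Nat.cast_sub (by omega)]; simp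
    rw [e, ← abs_neg]
    congr 1; ring
  · push_cast; ring_nf
  · ext i
    push_cast; ring_nf

lemma binom_asymp {x : ℕ → ℝ} {X r : ℝ} (hX : -1 < X) (hX0 : X < 0)
    (hx : Tendsto (fun n : ℕ => x n / n) atTop (𝓝 X))
    (hd : Tendsto (fun n : ℕ => distInt (x n) ^ ((n : ℝ)⁻¹)) atTop (𝓝 (Real.exp (-r)))) :
    (∀ᶠ n : ℕ in atTop, 0 < ‖genBinom (n + x n) n‖) ∧
    Tendsto (fun n : ℕ => Real.log ‖genBinom (n + x n) n‖ / n) atTop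
      (𝓝 (-X * Real.log (-X) + (1+X) * Real.log (1+X) - r)) := by
  have hdpos : ∀ᶠ n : ℕ in atTop, 0 < distInt (x n) := by
    filter_upwards [hd.eventually_const_lt (Real.exp_pos _), eventually_gt_atTop 0] with n h1 h2
    rcases (abs_nonneg (x n - round (x n))).eq_or_lt with h | h
    · have h3 : distInt (x n) = 0 := h.symm
      rw [h3, Real.zero_rpow (by positivity)] at h1
      exact absurd h1 (lt_irrefl _)
    · exact h
  have hdl : Tendsto (fun n : ℕ => Real.log (distInt (x n)) / n) atTop (𝓝 (-r)) := by
    have := hd.log (Real.exp_ne_zero _)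
    rw [Real.log_exp] at this
    refine this.congr' ?_
    filter_upwards [hdpos] with n hn
    rw [Real.log_rpow hn]; ring
  have hrt : Tendsto (fun n : ℕ => (-(round (x n)) : ℝ) / n) atTop (𝓝 (-X)) := by
    have h0 : Tendsto (fun n : ℕ => (x n - round (x n)) / n) atTop (𝓝 0) := by
      refine squeeze_zero_norm (a := fun n : ℕ => (1/2:ℝ)/n) (fun n => ?_)
        (tendsto_const_nhds.div_atTop tendsto_natCast_atTop_atTop)
      rw [norm_div, Real.norm_eq_abs, Real.norm_natCast]
      gcongr; exact abs_sub_round _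
    have := h0.sub hx
    rw [zero_sub] at this
    refine this.congr fun n => ?_
    ring
  -- k n + 1 = - round x
  set k : ℕ → ℕ := fun n => (-(round (x n)) - 1).toNat with hk
  have hk1 : ∀ᶠ n : ℕ in atTop, ((k n : ℝ) + 1 = -(round (x n)) ∧ k n + 1 ≤ n) := by
    filter_upwards [hrt.eventually_const_lt (show 0 < -X by linarith),
      hrt.eventually_lt_const (show -X < 1 by linarith), eventually_gt_atTop 0] with n h1 h2 h3
    have hn : (0:ℝ) < n := by exact_mod_cast h3
    have g1 : (0:ℝ) < -(round (x n)) := by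
      by_contra hc
      exact absurd h1 (not_lt.2 (div_nonpos_of_nonpos_of_nonneg (not_lt.1 hc) hn.le))
    have g2 : (-(round (x n)):ℝ) < n := by rwa [div_lt_one hn] at h2
    have g1' : 0 < -(round (x n)) := by exact_mod_cast g1
    have g2' : -(round (x n)) < n := by exact_mod_cast g2
    have g3 : (k n : ℤ) = -(round (x n)) - 1 := Int.toNat_of_nonneg (by omega)
    constructor
    · have : ((k n : ℤ):ℝ) = ((-(round (x n)) - 1 : ℤ) : ℝ) := by rw [g3]
      push_cast at this; linarith
    · omega
  have hkt : Tendsto (fun n : ℕ => (k n : ℝ) / n) atTop (𝓝 (-X)) := by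
    have := hrt.sub (tendsto_const_nhds (x := (1:ℝ)).div_atTop tendsto_natCast_atTop_atTop)
    rw [sub_zero] at this
    refine this.congr' ?_
    filter_upwards [hk1] with n hn
    rw [← hn.1]; ring
  set l : ℕ → ℕ := fun n => n - (k n + 1) with hl
  have hl1 : ∀ᶠ n : ℕ in atTop, (l n : ℝ) = n - (k n + 1) := by
    filter_upwards [hk1] with n hn
    simp only [hl]; rw [Nat.cast_sub hn.2]; push_cast; ring
  have hlt : Tendsto (fun n : ℕ => (l n : ℝ) / n) atTop (𝓝 (1 + X)) := by
    have := (tendsto_const_nhds (x := (1:ℝ))).sub (hkt.add (tendsto_const_nhds (x := (1:ℝ)).div_atTop tendsto_natCast_atTop_atTop))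
    rw [show (1:ℝ) - (-X+0) = 1+X by ring] at this
    refine this.congr' ?_
    filter_upwards [hl1, eventually_gt_atTop 0] with n hn h0
    rw [hn]; field_simp
  have t1 := fact_log (show 0 < -X by linarith) hkt
  have t2 := fact_log (show 0 < 1+X by linarith) hlt
  have t3 := fact_log (k := fun n => n) one_pos (tendsto_const_nhds.congr' (by
    filter_upwards [eventually_gt_atTop 0] with n hn; field_simp))
  have hth : ∀ n, |x n - round (x n)| ≤ 1/2 := fun n => abs_sub_round _
  have key : ∀ᶠ n : ℕ in atTop, 0 < ‖genBinom (n + x n) n‖ ∧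
      Real.log ‖genBinom (n + x n) n‖ = Real.log (∏ i ∈ Finset.range (k n), ((i:ℝ)+1+(-(x n - round (x n)))))
        + Real.log (distInt (x n)) + Real.log (∏ i ∈ Finset.range (l n), ((i:ℝ)+1+(x n - round (x n)))) -
        Real.log n.factorial := by
    filter_upwards [hk1, hdpos] with n hn hd
    have en : n = k n + 1 + l n := by simp only [hl]; omega
    have hf : (0:ℝ) < n.factorial := by exact_mod_cast n.factorial_pos
    have p1 := (prod_shift (θ := -(x n - round (x n))) (by rw [abs_neg]; exact hth n) (k n)).1
    have p2 := (prod_shift (hth n) (l n)).1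
    have e1 : ‖genBinom (n + x n) n‖ = (∏ i ∈ Finset.range (k n), ((i:ℝ)+1+(-(x n - round (x n))))) *
        distInt (x n) * (∏ i ∈ Finset.range (l n), ((i:ℝ)+1+(x n - round (x n)))) / n.factorial := by
      rw [genBinom_norm]
      congr 1
      have hr : Finset.range n = Finset.range (k n + 1 + l n) := congrArg _ en
      rw [hr, prod_split, hn.1, ← sub_eq_add_neg]
      have hth' := abs_le.1 (hth n)
      congr 1
      · congr 1
        refine Finset.prod_congr rfl fun i _ => abs_of_nonneg ?_
        have : (0:ℝ) ≤ i := by positivity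
        linarith
      · refine Finset.prod_congr rfl fun i _ => abs_of_nonneg ?_
        have : (0:ℝ) ≤ i := by positivity
        linarith
    rw [e1]
    refine ⟨by positivity, ?_⟩
    rw [Real.log_div (by positivity) hf.ne', Real.log_mul (by positivity) p2.ne', Real.log_mul p1.ne' hd.ne']
  refine ⟨key.mono fun n h => h.1, ?_⟩
  have herr : ∀ (m : ℕ → ℕ) (θ : ℕ → ℝ), (∀ᶠ n in atTop, m n ≤ n) → (∀ n, |θ n| ≤ 1/2) →
      Tendsto (fun n : ℕ => (Real.log (∏ i ∈ Finset.range (m n), ((i:ℝ)+1+θ n)) - Real.log (m n).factorial) / n)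
        atTop (𝓝 0) := by
    intro m θ hm hθ
    have hlim : Tendsto (fun n : ℕ => Real.log 4 / n + Real.log n / n) atTop (𝓝 0) := by
      have := (tendsto_const_nhds (x := Real.log 4).div_atTop tendsto_natCast_atTop_atTop).add tendsto_log_div_nat
      simpa using this
    refine squeeze_zero_norm' ?_ hlim
    filter_upwards [hm, eventually_gt_atTop 0] with n hn h0
    have hn0 : (1:ℝ) ≤ n := by exact_mod_cast h0
    rw [norm_div, Real.norm_natCast, Real.norm_eq_abs, ← add_div]
    gcongr
    refine (prod_shift (hθ n) (m n)).2.trans ?_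
    rw [← Real.log_mul (by norm_num) (by positivity)]
    refine Real.log_le_log (by positivity) ?_
    have : (m n : ℝ) ≤ n := by exact_mod_cast hn
    linarith
  have u1 := herr k (fun n => -(x n - round (x n))) (hk1.mono fun n h => by omega) (fun n => by rw [abs_neg]; exact hth n)
  have u2 := herr l (fun n => (x n - round (x n))) (Eventually.of_forall fun n => Nat.sub_le _ _) hth
  have := (((((u1.add u2).add t1).add t2).sub t3).add hdl).sub (tendsto_log_div_nat)
  have hval : 0 + 0 + (-X * Real.log (-X) - -X) + ((1 + X) * Real.log (1 + X) - (1 + X)) - (1 * Real.log 1 - 1) + -r - 0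
      = -X * Real.log (-X) + (1+X) * Real.log (1+X) - r := by rw [Real.log_one]; ring
  rw [hval] at this
  refine this.congr' ?_
  · filter_upwards [key, hl1, eventually_gt_atTop 0] with n hn hln h0
    rw [hn.2, hln]
    field_simp
    ring

end

section
variable {A B : ℝ}

/-- two-sided exponential comparison `a n ≈ L^n`. -/
def ExpAsymp (a : ℕ → ℝ) (L : ℝ) : Prop :=
  ∀ ε > 0, ∀ᶠ n : ℕ in atTop, Real.exp (-(ε * n)) * L^n ≤ a n ∧ a n ≤ Real.exp (ε * n) * L^n

lemma expAsymp_of_log {a : ℕ → ℝ} {L : ℝ} (hL : 0 < L) (ha : ∀ᶠ n in atTop, 0 < a n)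
    (h : Tendsto (fun n : ℕ => Real.log (a n) / n) atTop (𝓝 (Real.log L))) : ExpAsymp a L := by
  intro ε hε
  filter_upwards [ha, h.eventually_const_lt (show Real.log L - ε < Real.log L by linarith),
    h.eventually_lt_const (show Real.log L < Real.log L + ε by linarith), eventually_gt_atTop 0] with n h1 h2 h3 h4
  have hn : (0:ℝ) < n := by exact_mod_cast h4
  rw [lt_div_iff₀ hn] at h2
  rw [div_lt_iff₀ hn] at h3
  have e : L^n = Real.exp (Real.log L * n) := by
    rw [mul_comm, Real.exp_nat_mul, Real.exp_log hL]
  rw [e, ← Real.exp_add, ← Real.exp_add]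
  constructor
  · rw [← Real.le_log_iff_exp_le h1]; linarith
  · rw [← Real.log_le_iff_le_exp h1]; linarith

/-- the abstract sequence of polynomials -/
structure JSeq (A B : ℝ) (p : ℕ → ℂ[X]) (α β : ℕ → ℝ) : Prop where
  hα : Tendsto (fun n : ℕ => α n / n) atTop (𝓝 A)
  hβ : Tendsto (fun n : ℕ => β n / n) atTop (𝓝 B)
  ode : ∀ (n : ℕ) (z : ℂ), (1 - z^2) * (derivative (derivative (p n))).eval z +
      (β n - α n - (α n + β n + 2) * z) * (derivative (p n)).eval z +
      ((n:ℂ) * (n+α n + β n+1)) * (p n).eval z = 0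
  deg : ∀ n, (p n).natDegree ≤ n
  real : ∀ (n : ℕ) (x : ℝ), ((p n).eval (x:ℂ)).im = 0
  one : ExpAsymp (fun n => ‖(p n).eval 1‖) (VV A B 1)
  neg_one : ExpAsymp (fun n => ‖(p n).eval (-1)‖) (VV A B (-1))
  lead : ExpAsymp (fun n => ‖(p n).coeff n‖) 2

lemma Par.log_VV_one (h : Par A B) : Real.log (VV A B 1) =
    -A * Real.log (-A) + (1+A) * Real.log (1+A) -
     ((-A-B-1) * Real.log (-A-B-1) + (A+B+2) * Real.log (A+B+2) - Real.log 4) := by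
  have hA := h.hA; have hA0 := h.hA0; have hs := h.hs; have hd := h.hd
  rw [h.log_VV, h.dg_one.2.1]
  unfold LX
  have a1 : ‖(P0 A B : ℂ) - P1 A B‖ = 4 * (-A) / (A+B+2) := by
    rw [← ofReal_sub, Complex.norm_real, Real.norm_eq_abs]
    have : P0 A B - P1 A B = -(4 * (-A) / (A+B+2)) := by unfold P0 P1; field_simp; ring
    rw [this, abs_neg, abs_of_pos]
    apply div_pos _ hs; linarith
  have a2 : ‖(P0 A B : ℂ) - N1 A B‖ = 4 * (1+A) / (A+B+2) := by
    rw [← ofReal_sub, Complex.norm_real, Real.norm_eq_abs]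
    have : P0 A B - N1 A B = (4 * (1+A) / (A+B+2)) := by unfold P0 N1; field_simp; ring
    rw [this, abs_of_pos]
    apply div_pos _ hs; linarith
  have a3 : ‖(P0 A B : ℂ)‖ = 4 * (1+A) * (-A-B-1) / (A+B+2)^2 := by
    rw [Complex.norm_real, Real.norm_eq_abs]
    have : P0 A B = -(4 * (1+A) * (-A-B-1) / (A+B+2)^2) := by unfold P0; ring
    rw [this, abs_neg, abs_of_pos]
    apply div_pos _ (by positivity); apply mul_pos _ hd; linarith
  have b1 : -A ≠ 0 := by linarith
  have b2 : 1+A ≠ 0 := by linarith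
  rw [a1, a2, a3, Real.log_div (by simp at b1 ⊢; exact b1) hs.ne', Real.log_div (by positivity) hs.ne',
    Real.log_div (by positivity) (by positivity), Real.log_mul (by norm_num) b1, Real.log_mul (by norm_num) b2,
    Real.log_mul (by positivity) hd.ne', Real.log_mul (by norm_num) b2, Real.log_pow]
  push_cast; ring

lemma Par.log_VV_neg_one (h : Par A B) : Real.log (VV A B (-1)) =
    -B * Real.log (-B) + (1+B) * Real.log (1+B) -
     ((-A-B-1) * Real.log (-A-B-1) + (A+B+2) * Real.log (A+B+2) - Real.log 4) := by
  have hA := h.hB; have hA0 := h.hB0; have hs := h.hs; have hd := h.hd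
  rw [h.log_VV, h.dg_neg_one.2.1]
  unfold LX
  have a1 : ‖(N0 A B : ℂ) - N1 A B‖ = 4 * (-B) / (A+B+2) := by
    rw [← ofReal_sub, Complex.norm_real, Real.norm_eq_abs]
    have : N0 A B - N1 A B = (4 * (-B) / (A+B+2)) := by unfold N0 N1; field_simp; ring
    rw [this, abs_of_pos]
    apply div_pos _ hs; linarith
  have a2 : ‖(N0 A B : ℂ) - P1 A B‖ = 4 * (1+B) / (A+B+2) := by
    rw [← ofReal_sub, Complex.norm_real, Real.norm_eq_abs]
    have : N0 A B - P1 A B = -(4 * (1+B) / (A+B+2)) := by unfold N0 P1; field_simp; ring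
    rw [this, abs_neg, abs_of_pos]
    apply div_pos _ hs; linarith
  have a3 : ‖(N0 A B : ℂ)‖ = 4 * (1+B) * (-A-B-1) / (A+B+2)^2 := by
    rw [Complex.norm_real, Real.norm_eq_abs]
    have : N0 A B = (4 * (1+B) * (-A-B-1) / (A+B+2)^2) := by unfold N0; ring
    rw [this, abs_of_pos]
    apply div_pos _ (by positivity); apply mul_pos _ hd; linarith
  have b1 : -B ≠ 0 := by linarith
  have b2 : 1+B ≠ 0 := by linarith
  rw [a1, a2, a3, Real.log_div (by positivity) hs.ne', Real.log_div (by simp at b1 ⊢; exact b1) hs.ne',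
    Real.log_div (by positivity) (by positivity), Real.log_mul (by norm_num) b2, Real.log_mul (by norm_num) b1,
    Real.log_mul (by positivity) hd.ne', Real.log_mul (by norm_num) b2, Real.log_pow]
  push_cast; ring

lemma distInt_add_nat (x : ℝ) (n : ℕ) : distInt (x + n) = distInt x := by
  unfold distInt; rw [round_add_natCast]; push_cast; congr 1; ring

/-- normalization constant -/
def lgk (A B r : ℝ) : ℝ :=
  (-A-B-1) * Real.log (-A-B-1) + (A+B+2) * Real.log (A+B+2) - Real.log 4 - r

def pN (A B r : ℝ) (α β : ℕ → ℝ) (n : ℕ) : ℂ[X] :=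
  C ((Real.exp (-(lgk A B r * n)) : ℝ) : ℂ) * jacobiPoly n (α n) (β n)

lemma Par.seq (h : Par A B) {α β : ℕ → ℝ} {r : ℝ}
    (hα : Tendsto (fun n : ℕ => α n / n) atTop (nhds A))
    (hβ : Tendsto (fun n : ℕ => β n / n) atTop (nhds B))
    (hdα : Tendsto (fun n : ℕ => distInt (α n) ^ ((n : ℝ)⁻¹)) atTop (nhds (Real.exp (-r))))
    (hdβ : Tendsto (fun n : ℕ => distInt (β n) ^ ((n : ℝ)⁻¹)) atTop (nhds (Real.exp (-r))))
    (hdαβ : Tendsto (fun n : ℕ => distInt (α n + β n) ^ ((n : ℝ)⁻¹)) atTop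
      (nhds (Real.exp (-r)))) : JSeq A B (pN A B r α β) α β := by
  have hA := h.hA; have hA0 := h.hA0; have hB := h.hB; have hB0 := h.hB0
  have hs := h.hs; have hd := h.hd
  have gen : ∀ (c : ℕ → ℂ) (ℓ L : ℝ), 0 < L → (∀ᶠ n in atTop, 0 < ‖c n‖) →
      Tendsto (fun n : ℕ => Real.log ‖c n‖ / n) atTop (𝓝 ℓ) → ℓ = Real.log L + lgk A B r →
      ExpAsymp (fun n => ‖((Real.exp (-(lgk A B r * n)) : ℝ) : ℂ) * c n‖) L := by
    intro c ℓ L hL h1 h2 h3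
    apply expAsymp_of_log hL
    · filter_upwards [h1] with n hn
      rw [norm_mul, Complex.norm_real, Real.norm_eq_abs, abs_of_pos (Real.exp_pos _)]
      positivity
    · have := h2.sub_const (lgk A B r)
      rw [h3, add_sub_cancel_right] at this
      refine this.congr' ?_
      filter_upwards [h1, eventually_gt_atTop 0] with n hn h0
      rw [norm_mul, Complex.norm_real, Real.norm_eq_abs, abs_of_pos (Real.exp_pos _),
        Real.log_mul (Real.exp_ne_zero _) hn.ne', Real.log_exp]
      field_simp; ring
  refine ⟨hα, hβ, ?_, ?_, ?_, ?_, ?_, ?_⟩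
  · intro n z
    have := jacobi_ode n (α n) (β n) z
    unfold pN
    simp only [derivative_C_mul, eval_mul, eval_C]
    linear_combination ((Real.exp (-(lgk A B r * n)) : ℝ) : ℂ) * this
  · intro n
    exact (natDegree_C_mul_le _ _).trans (jacobi_degree _ _ _)
  · intro n x
    have : ∃ y : ℝ, (pN A B r α β n).eval (x:ℂ) = y := by
      have hb : ∀ (y : ℝ) (k : ℕ), genBinom (n + y) k =
          (((∏ i ∈ Finset.range k, ((n + y) - (i:ℝ))) / (Nat.factorial k : ℝ) : ℝ) : ℂ) := by
        intro y k; unfold genBinom; push_cast; rfl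
      unfold pN jacobiPoly
      simp only [hb]
      refine ⟨Real.exp (-(lgk A B r * n)) * ∑ s ∈ Finset.range (n+1),
        (((∏ i ∈ Finset.range (n-s), ((n + α n) - (i:ℝ))) / (Nat.factorial (n-s) : ℝ)) *
         ((∏ i ∈ Finset.range s, ((n + β n) - (i:ℝ))) / (Nat.factorial s : ℝ))) *
          (2⁻¹ * (x - 1))^s * (2⁻¹ * (x+1))^(n-s), ?_⟩
      simp [eval_finsetSum]
    obtain ⟨y, hy⟩ := this
    rw [hy, ofReal_im]
  · obtain ⟨b1, b2⟩ := binom_asymp hA hA0 hα hdα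
    have := gen (fun n => genBinom (n + α n) n) _ (VV A B 1) (h.VV_pos 1) b1 b2
      (by rw [h.log_VV_one]; unfold lgk; ring)
    simpa only [pN, eval_mul, eval_C, jacobi_one] using this
  · obtain ⟨b1, b2⟩ := binom_asymp hB hB0 hβ hdβ
    have := gen (fun n => (-1)^n * genBinom (n + β n) n) (-B * Real.log (-B) + (1 + B) * Real.log (1 + B) - r) (VV A B (-1)) (h.VV_pos (-1))
      (by simpa using b1) (by simpa using b2)
      (by rw [h.log_VV_neg_one]; unfold lgk; ring)
    simpa only [pN, eval_mul, eval_C, jacobi_neg_one] using this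
  · have hx : Tendsto (fun n : ℕ => (α n + β n + n) / n) atTop (𝓝 (A+B+1)) := by
      refine ((hα.add hβ).add_const 1).congr' ?_
      filter_upwards [eventually_gt_atTop 0] with n hn
      field_simp
    obtain ⟨b1, b2⟩ := binom_asymp (X := A+B+1) (r := r) (by linarith) (by linarith) hx
      (by simpa only [distInt_add_nat] using hdαβ)
    have hc : ∀ n : ℕ, ‖(2⁻¹)^n * genBinom (n + (n + α n + β n)) n‖ = (2⁻¹)^n * ‖genBinom (n + ((α n + β n + n : ℝ):ℂ)) n‖ := by
      intro n
      rw [norm_mul, norm_pow]; congr 2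
      · simp
      · congr 1; push_cast; ring
    have := gen (fun n => (2⁻¹)^n * genBinom (n + (n + α n + β n)) n)
      (-(A+B+1) * Real.log (-(A+B+1)) + (1+(A+B+1)) * Real.log (1+(A+B+1)) - r - Real.log 2) 2 two_pos
      (by filter_upwards [b1] with n hn; rw [hc]; positivity)
      (by
        refine (b2.sub_const (Real.log 2)).congr' ?_
        filter_upwards [b1, eventually_gt_atTop 0] with n hn h0
        rw [hc, Real.log_mul (by positivity) hn.ne', Real.log_pow, Real.log_inv]
        field_simp; ring)
      (by
        unfold lgk
        have : Real.log 4 = 2 * Real.log 2 := by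
          rw [show (4:ℝ) = 2^2 by norm_num, Real.log_pow]; push_cast; ring
        rw [this]; ring_nf)
    simpa only [pN, coeff_C_mul, jacobi_coeff] using this

end

section
variable {A B : ℝ}

lemma mm_symm : mm B A = - mm A B := by unfold mm; rw [show B+A+2 = A+B+2 by ring]; ring
lemma kk_symm : kk B A = kk A B := by
  unfold kk; rw [show B+A+2 = A+B+2 by ring, show (B + 1) * (A + 1) * (-B - A - 1) = (A + 1) * (B + 1) * (-A - B - 1) by ring]
lemma P1_symm : P1 B A = - N1 A B := by unfold P1 N1; rw [show B+A+2 = A+B+2 by ring]; ring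
lemma N1_symm : N1 B A = - P1 A B := by unfold P1 N1; rw [show B+A+2 = A+B+2 by ring]; ring
lemma Qf_symm (z : ℂ) : Qf B A (-z) = Qf A B z := by
  unfold Qf; rw [mm_symm, kk_symm]; push_cast; ring
lemma XX_symm (u : ℂ) : XX B A (-u) = XX A B u := by
  unfold XX; rw [P1_symm (A := A) (B := B), N1_symm (A := A) (B := B)]; push_cast
  rw [show -u - -(N1 A B:ℂ) = -(u - N1 A B) by ring, show -u - -(P1 A B:ℂ) = -(u - P1 A B) by ring,
    norm_neg, norm_neg, norm_neg, show B+A+1 = A+B+1 by ring]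
  ring
lemma VV_symm (z : ℂ) : VV B A (-z) = VV A B z := by
  have h1 := dg_sq A B z
  have h2 : (dg A B z)^2 = Qf B A (-z) := by rw [Qf_symm, h1]
  rw [VV_eq_max h1, VV_eq_max h2, mm_symm]
  push_cast
  rw [show -z - -(mm A B : ℂ) + dg A B z = -(z - mm A B - dg A B z) by ring,
    show -z - -(mm A B : ℂ) - dg A B z = -(z - mm A B + dg A B z) by ring, XX_symm, XX_symm, max_comm]
lemma vv_symm (z : ℂ) : vv B A (-z) = vv A B z := by
  have h1 := dg_sq A B z
  have h2 : (dg A B z)^2 = Qf B A (-z) := by rw [Qf_symm, h1]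
  rw [vv_eq_min h1, vv_eq_min h2, mm_symm]
  push_cast
  rw [show -z - -(mm A B : ℂ) + dg A B z = -(z - mm A B - dg A B z) by ring,
    show -z - -(mm A B : ℂ) - dg A B z = -(z - mm A B + dg A B z) by ring, XX_symm, XX_symm, min_comm]
lemma Gam_symm (z : ℂ) : -z ∈ Gam B A ↔ z ∈ Gam A B := by
  unfold Gam; simp only [mem_ofPred_eq, VV_symm, vv_symm]

/-- real discriminant data -/
def bt (A B x : ℝ) : ℝ := B - A - (A+B)*x
def qr (A B x : ℝ) : ℝ := Real.sqrt ((x - mm A B)^2 + kk A B^2)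
def Wr (A B x : ℝ) : ℝ := (A+B+2) * qr A B x

lemma Par.qr_pos (h : Par A B) (x : ℝ) : 0 < qr A B x := by
  have := h.kk_pos; unfold qr; positivity
lemma qr_sq (x : ℝ) : qr A B x ^2 = (x - mm A B)^2 + kk A B^2 := Real.sq_sqrt (by positivity)
lemma qr_sqC (x : ℝ) : ((-(qr A B x : ℝ)) : ℂ)^2 = Qf A B x := by
  unfold Qf; rw [neg_sq]; exact_mod_cast qr_sq x
lemma Par.Wr_sq (h : Par A B) (x : ℝ) : Wr A B x ^2 = bt A B x ^2 + 4*(-A-B-1)*(1-x^2) := by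
  unfold Wr; rw [mul_pow, qr_sq, h.kk_sq]; unfold mm bt
  have := h.hs
  field_simp; ring
lemma Par.Wr_pos (h : Par A B) (x : ℝ) : 0 < Wr A B x := mul_pos h.hs (h.qr_pos x)
lemma Par.qr_deriv (h : Par A B) (x : ℝ) : HasDerivAt (qr A B) ((x - mm A B)/qr A B x) x := by
  have h1 : HasDerivAt (fun x : ℝ => (x - mm A B)^2 + kk A B^2) (2*(x - mm A B)) x := by
    have := (((hasDerivAt_id x).sub_const (mm A B)).pow 2).add_const (kk A B^2)
    refine this.congr_deriv ?_
    simp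
  have := h1.sqrt (by have := h.kk_pos; positivity)
  refine this.congr_deriv ?_
  rw [show Real.sqrt ((x - mm A B)^2 + kk A B^2) = qr A B x from rfl, mul_div_mul_left _ _ two_ne_zero]
lemma Par.s_nonneg (h : Par A B) {x : ℝ} (h1 : -1 ≤ x) (h2 : x ≤ 1) : 0 ≤ bt A B x + Wr A B x := by
  have := h.Wr_sq x
  have h3 : 0 ≤ (-A-B-1)*(1-x^2) := mul_nonneg h.hd.le (by nlinarith)
  have := sq_le_sq.1 (show bt A B x ^2 ≤ Wr A B x ^2 by nlinarith)
  rw [abs_of_pos (h.Wr_pos x)] at this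
  linarith [neg_abs_le (bt A B x)]
lemma Par.s_pos (h : Par A B) {x : ℝ} (h1 : -1 < x) (h2 : x ≤ 1) : 0 < bt A B x + Wr A B x := by
  rcases h2.eq_or_lt with rfl | h2
  · have := h.Wr_pos 1; have := h.hA0; unfold bt; linarith
  · have := h.Wr_sq x
    have h3 : 0 < (-A-B-1)*(1-x^2) := mul_pos h.hd (by nlinarith)
    have := sq_lt_sq.1 (show bt A B x ^2 < Wr A B x ^2 by nlinarith)
    rw [abs_of_pos (h.Wr_pos x)] at this
    linarith [neg_abs_le (bt A B x)]

lemma Par.Tder (h : Par A B) {x : ℝ} (h1 : -1 < x) (h2 : x < 1) :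
    HasDerivAt (fun x : ℝ => LX A B ((x:ℂ) - mm A B + (-(qr A B x : ℝ):ℂ)))
      (2*(-A-B-1)/(bt A B x + Wr A B x)) x := by
  have hx1 : (x:ℂ) ≠ 1 := by exact_mod_cast h2.ne
  have hx2 : (x:ℂ) ≠ -1 := by exact_mod_cast h1.ne'
  have hγ : HasDerivAt (fun x : ℝ => (x:ℂ)) 1 x := by simpa using (hasDerivAt_id x).ofReal_comp
  have hq : HasDerivAt (fun x : ℝ => (-(qr A B x : ℝ):ℂ)) (-((x - mm A B)/qr A B x : ℝ)) x := by
    exact (h.qr_deriv x).ofReal_comp.neg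
  have hg := qr_sqC (A := A) (B := B) x
  have hg0 : (-(qr A B x : ℝ):ℂ) ≠ 0 := by
    rw [neg_ne_zero]; exact_mod_cast (h.qr_pos x).ne'
  have := hasDerivAt_LX ((hγ.sub_const (mm A B:ℂ)).add hq) (h.u_ne hg) (h.u_ne_P1 hg hx1) (h.u_ne_N1 hg hx2)
  refine this.congr_deriv ?_
  have e1 : (1:ℂ) + -((x - mm A B)/qr A B x : ℝ) = ((x:ℂ) - mm A B + (-(qr A B x : ℝ):ℂ)) / (-(qr A B x : ℝ):ℂ) := by
    rw [eq_div_iff hg0]; push_cast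
    have : (qr A B x : ℂ) ≠ 0 := by exact_mod_cast (h.qr_pos x).ne'
    field_simp; ring
  change (Psi A B ((x:ℂ) - mm A B + (-(qr A B x : ℝ):ℂ)) * ((1:ℂ) + -((x - mm A B)/qr A B x : ℝ))).re = _
  rw [e1, h.psi_lam hg hg0 hx1 hx2]
  unfold lam
  have e2 : ((A+B)*(x:ℂ) + A - B - (A+B+2)*(-(qr A B x : ℝ):ℂ)) / (2*(1-(x:ℂ)^2)) =
     (((Wr A B x - bt A B x) / (2*(1-x^2)) : ℝ) : ℂ) := by
    unfold Wr bt; push_cast; congr 1; ring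
  rw [e2, ofReal_re, div_eq_div_iff (by nlinarith) (h.s_pos h1 h2.le).ne']
  have := h.Wr_sq x
  linear_combination this

lemma Par.Tcont (h : Par A B) {x : ℝ} (h1 : -1 < x) :
    ContinuousAt (fun x : ℝ => LX A B ((x:ℂ) - mm A B + (-(qr A B x : ℝ):ℂ))) x := by
  have hx2 : (x:ℂ) ≠ -1 := by exact_mod_cast h1.ne'
  have hg := qr_sqC (A := A) (B := B) x
  have c : ContinuousAt (fun x : ℝ => ((x:ℂ) - mm A B + (-(qr A B x : ℝ):ℂ))) x := by
    have := (h.qr_deriv x).continuousAt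
    fun_prop
  refine ContinuousAt.comp' (h.LX_cont (h.u_ne hg) ?_ (h.u_ne_N1 hg hx2)) c
  intro h0
  have h3 : x - mm A B - qr A B x - P1 A B = 0 := by
    have := congrArg Complex.re h0
    simpa [sub_eq_add_neg] using this
  have h4 : x - mm A B ≤ qr A B x := by
    unfold qr; apply Real.le_sqrt_of_sq_le; nlinarith [sq_nonneg (kk A B)]
  linarith [h.P1_pos]

lemma Par.T_le (h : Par A B) {x : ℝ} (h1 : -1 < x) (h2 : x < 1) :
    LX A B ((x:ℂ) - mm A B + (-(qr A B x : ℝ):ℂ)) ≤ Real.log (VV A B x) := by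
  have hx1 : (x:ℂ) ≠ 1 := by exact_mod_cast h2.ne
  have hx2 : (x:ℂ) ≠ -1 := by exact_mod_cast h1.ne'
  have hg := qr_sqC (A := A) (B := B) x
  rw [← log_XX (h.u_ne hg) (h.u_ne_P1 hg hx1) (h.u_ne_N1 hg hx2)]
  apply Real.log_le_log (XX_pos (h.u_ne hg) (h.u_ne_P1 hg hx1) (h.u_ne_N1 hg hx2))
  rw [VV_eq_max hg]; exact le_max_left _ _

lemma Par.T_one (h : Par A B) :
    LX A B (((1:ℝ):ℂ) - mm A B + (-(qr A B 1 : ℝ):ℂ)) = Real.log (VV A B 1) := by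
  rw [h.log_VV]
  congr 1
  have hg := qr_sqC (A := A) (B := B) 1
  have h1 := dg_sq A B ((1:ℝ):ℂ)
  rw [ofReal_one] at *
  rcases sq_cases h1 hg with h2 | h2
  · rw [h2]
  · exfalso
    rw [h.dg_one.1, neg_neg] at h2
    have h2 : (P0 A B - P1 A B)/2 = qr A B 1 := by exact_mod_cast h2
    linarith [h.qr_pos 1, h.P0_neg, h.P1_pos]

lemma Par.barrier (h : Par A B) {a' ε : ℝ} (ha : -1 < a') (ha1 : a' < 1) (hε : 0 < ε) :
    ∃ S ℓ ℓ' : ℝ → ℝ, ∃ c C : ℝ, 0 < c ∧ 0 ≤ C ∧ Continuous S ∧ S 1 = Real.log (VV A B 1) ∧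
     (∀ x ∈ Ioo (-1:ℝ) 1, HasDerivAt S (ℓ x) x ∧ HasDerivAt ℓ (ℓ' x) x ∧ |ℓ x| ≤ C ∧ |ℓ' x| ≤ C ∧
       (1-x^2)*ℓ x^2 + bt A B x * ℓ x - (-A-B-1) ≤ -c) ∧
     ∀ x ∈ Ico a' 1, S x ≤ Real.log (VV A B x) + ε := by
  have hd := h.hd
  have cb : Continuous (bt A B) := by unfold bt; fun_prop
  have cq : Continuous (qr A B) := by unfold qr; fun_prop
  have cW : Continuous (Wr A B) := by unfold Wr; fun_prop
  obtain ⟨x0, hx0, hmin⟩ := isCompact_Icc.exists_isMinOn (nonempty_Icc.2 ha1.le) (cb.add cW).continuousOn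
  set s0 := bt A B x0 + Wr A B x0 with hs0
  have s0pos : 0 < s0 := h.s_pos (by linarith [hx0.1]) hx0.2
  set e := ε * s0^2 / (4*(-A-B-1)) with he
  have epos : 0 < e := by positivity
  set d := -A-B-1 with hdd
  set ℓ : ℝ → ℝ := fun x => 2*d/(bt A B x + Wr A B x + e) with hℓ
  set ℓ' : ℝ → ℝ := fun x => -(2*d*(-(A+B) + (A+B+2)*((x - mm A B)/qr A B x)))/(bt A B x + Wr A B x + e)^2 with hℓ'
  have sp : ∀ x ∈ Icc (-1:ℝ) 1, 0 < bt A B x + Wr A B x + e := fun x hx => by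
    linarith [h.s_nonneg hx.1 hx.2]
  have cℓ : ContinuousOn ℓ (Icc (-1) 1) := by
    apply ContinuousOn.div (by fun_prop) (by fun_prop)
    intro x hx; exact (sp x hx).ne'
  have cℓ' : ContinuousOn ℓ' (Icc (-1) 1) := by
    apply ContinuousOn.div
    · have : ∀ x, qr A B x ≠ 0 := fun x => (h.qr_pos x).ne'
      have : Continuous (fun x => (x - mm A B)/qr A B x) := by fun_prop (disch := assumption)
      exact (((this.const_mul (A+B+2)).const_add (-(A+B))).const_mul (2*d)).neg.continuousOn
    · fun_prop
    intro x hx; exact (pow_pos (sp x hx) 2).ne'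
  have cK : ContinuousOn (fun x => d*e*(2*Wr A B x+e)/(bt A B x + Wr A B x + e)^2) (Icc (-1) 1) := by
    apply ContinuousOn.div (by fun_prop) (by fun_prop)
    intro x hx; exact (pow_pos (sp x hx) 2).ne'
  obtain ⟨x1, hx1, hmin1⟩ := isCompact_Icc.exists_isMinOn (nonempty_Icc.2 (by norm_num)) cK
  obtain ⟨C1, hC1⟩ := isCompact_Icc.exists_bound_of_continuousOn cℓ
  obtain ⟨C2, hC2⟩ := isCompact_Icc.exists_bound_of_continuousOn cℓ'
  have hle : (-1:ℝ) ≤ 1 := by norm_num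
  set L := IccExtend hle ((Icc (-1:ℝ) 1).domRestrict ℓ) with hL
  have cL : Continuous L := (continuousOn_iff_continuous_domRestrict.1 cℓ).Icc_extend'
  set S : ℝ → ℝ := fun x => Real.log (VV A B 1) + ∫ t in (1:ℝ)..x, L t with hS
  have dS : ∀ x, HasDerivAt S (L x) x := fun x =>
    (intervalIntegral.integral_hasDerivAt_right (cL.intervalIntegrable _ _)
      (cL.stronglyMeasurableAtFilter _ _) cL.continuousAt).const_add _
  have Leq : ∀ x ∈ Icc (-1:ℝ) 1, L x = ℓ x := fun x hx => by
    rw [hL, IccExtend_of_mem _ _ hx]; rfl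
  refine ⟨S, ℓ, ℓ', d*e*(2*Wr A B x1+e)/(bt A B x1 + Wr A B x1 + e)^2, max C1 C2, ?_, ?_,
    continuous_iff_continuousAt.2 fun x => (dS x).continuousAt, by simp [hS], ?_, ?_⟩
  · have := sp x1 hx1; have := h.Wr_pos x1
    positivity
  · exact (norm_nonneg _).trans ((hC1 0 (by norm_num)).trans (le_max_left _ _))
  · intro x hx
    have hx' := Ioo_subset_Icc_self hx
    refine ⟨by rw [← Leq x hx']; exact dS x, ?_, (hC1 x hx').trans (le_max_left _ _), (hC2 x hx').trans (le_max_right _ _), ?_⟩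
    · have d1 : HasDerivAt (fun x => bt A B x + Wr A B x + e) (-(A+B) + (A+B+2)*((x - mm A B)/qr A B x)) x := by
        have b1 : HasDerivAt (bt A B) (-(A+B)) x := by
          have := ((hasDerivAt_id x).const_mul (A+B)).const_sub (B-A)
          rw [mul_one] at this
          exact this
        exact (b1.add ((h.qr_deriv x).const_mul (A+B+2))).add_const e
      refine ((hasDerivAt_const x (2*d)).div d1 (sp x hx').ne').congr_deriv ?_
      simp [hℓ']
    · have k1 := hmin1 hx'
      simp only [mem_ofPred_eq] at k1
      have := sp x hx'
      have e1 : (1-x^2)*ℓ x^2 + bt A B x * ℓ x - d = -(d*e*(2*Wr A B x+e)/(bt A B x + Wr A B x + e)^2) := by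
        have := h.Wr_sq x
        rw [← hdd] at this
        have k : (1 - x^2) = (Wr A B x^2 - bt A B x^2)/(4*d) := by field_simp; linarith
        rw [k]; simp only [hℓ]
        field_simp; ring
      rw [e1]; linarith
  · intro x hx
    have hx1' : -1 < x := by linarith [hx.1]
    set T := (fun x : ℝ => LX A B ((x:ℂ) - mm A B + (-(qr A B x : ℝ):ℂ))) with hT
    have hmono : MonotoneOn (fun t => S t - T t + (ε/2) * t) (Icc x 1) := by
      have dd : ∀ t ∈ Ioo x 1, HasDerivAt (fun t => S t - T t + (ε/2) * t)
          (ℓ t - 2*d/(bt A B t + Wr A B t) + ε/2) t := by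
        intro t ht
        have h1 := dS t
        rw [Leq t ⟨by linarith [ht.1], ht.2.le⟩] at h1
        have := (h1.sub (h.Tder (by linarith [ht.1]) ht.2)).add ((hasDerivAt_id t).const_mul (ε/2))
        rw [mul_one] at this
        exact this
      apply monotoneOn_of_deriv_nonneg (convex_Icc _ _)
      · intro t ht
        apply ContinuousAt.continuousWithinAt
        exact ((dS t).continuousAt.sub (h.Tcont (by linarith [ht.1]))).add (by fun_prop)
      · rw [interior_Icc]; intro t ht; exact (dd t ht).differentiableAt.differentiableWithinAt
      · rw [interior_Icc]; intro t ht
        rw [(dd t ht).deriv]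
        have m1 := hmin (show t ∈ Icc a' 1 from ⟨by linarith [ht.1, hx.1], ht.2.le⟩)
        simp only [mem_ofPred_eq] at m1
        simp only [hℓ]
        set s := bt A B t + Wr A B t
        have m1 : s0 ≤ s := m1
        have : 0 < s := by linarith
        have : 2*d/s - 2*d/(s+e) ≤ ε/2 := by
          rw [div_sub_div _ _ (by positivity) (by positivity), div_le_div_iff₀ (by positivity) (by positivity)]
          have : e * (4*d) = ε * s0^2 := by rw [he]; field_simp
          have : s0^2 ≤ s^2 := by gcongr
          nlinarith [mul_pos (mul_pos hε epos) (show 0 < s by linarith)]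
        linarith
    have h1 := hmono (left_mem_Icc.2 hx.2.le) (right_mem_Icc.2 hx.2.le) hx.2.le
    simp only at h1
    have h2 : T 1 = S 1 := by simp only [hT]; rw [h.T_one]; simp [hS]
    have h3 := h.T_le hx1' hx.2
    have h4 : T x = LX A B ((x:ℂ) - mm A B + (-(qr A B x : ℝ):ℂ)) := rfl
    nlinarith [hx.2]

end

section
variable {A B : ℝ}

def etaS (A B : ℝ) (α β : ℕ → ℝ) (n : ℕ) : ℝ := |α n / n - A| + |β n / n - B| + 2 / n

lemma eta_nonneg (α β : ℕ → ℝ) (n : ℕ) : 0 ≤ etaS A B α β n := by unfold etaS; positivity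

lemma JSeq.eta_tendsto {p : ℕ → ℂ[X]} {α β : ℕ → ℝ} (S : JSeq A B p α β) :
    Tendsto (etaS A B α β) atTop (𝓝 0) := by
  have h1 := (S.hα.sub_const A).abs
  have h2 := (S.hβ.sub_const B).abs
  have h3 : Tendsto (fun n : ℕ => (2:ℝ)/n) atTop (𝓝 0) := tendsto_const_div_atTop_nhds_zero_nat 2
  have := (h1.add h2).add h3
  rw [sub_self, sub_self, abs_zero, add_zero, add_zero] at this
  exact this

lemma second_deriv_nonpos {w w' : ℝ → ℝ} {w'' x : ℝ} (h1 : ∀ᶠ t in 𝓝 x, HasDerivAt w (w' t) t)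
    (h2 : HasDerivAt w' w'' x) (hm : IsLocalMax w x) : w'' ≤ 0 := by
  by_contra hc
  push Not at hc
  have hx : HasDerivAt w (w' x) x := h1.self_of_nhds
  have hd : deriv w =ᶠ[𝓝 x] w' := by filter_upwards [h1] with t ht using ht.deriv
  have hdd : deriv (deriv w) x = w'' := by rw [hd.deriv_eq, h2.deriv]
  have hmin := isLocalMin_of_deriv_deriv_pos (f := w) (x₀ := x) (by rw [hdd]; exact hc) hm.deriv_eq_zero hx.continuousAt
  have hc2 : w =ᶠ[𝓝 x] fun _ => w x := by
    filter_upwards [hm, hmin] with t a b using le_antisymm a b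
  have : deriv w =ᶠ[𝓝 x] fun _ => 0 := by
    have := hc2.deriv
    simpa using this
  rw [this.deriv_eq] at hdd
  simp at hdd
  linarith

lemma maxprin {y y' y'' φ φ' φ'' b : ℝ → ℝ} {e : ℝ} (he : 0 < e)
    (cy : ContinuousOn y (Icc (-1) 1)) (cφ : ContinuousOn φ (Icc (-1) 1))
    (hy : ∀ x ∈ Ioo (-1:ℝ) 1, HasDerivAt y (y' x) x) (hy' : ∀ x ∈ Ioo (-1:ℝ) 1, HasDerivAt y' (y'' x) x)
    (hφ : ∀ x ∈ Ioo (-1:ℝ) 1, HasDerivAt φ (φ' x) x) (hφ' : ∀ x ∈ Ioo (-1:ℝ) 1, HasDerivAt φ' (φ'' x) x)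
    (ode : ∀ x ∈ Ioo (-1:ℝ) 1, (1-x^2)*y'' x + b x * y' x - e * y x = 0)
    (sup : ∀ x ∈ Ioo (-1:ℝ) 1, (1-x^2)*φ'' x + b x * φ' x - e * φ x ≤ 0)
    (h1 : y 1 ≤ φ 1) (h2 : y (-1) ≤ φ (-1)) : ∀ x ∈ Icc (-1:ℝ) 1, y x ≤ φ x := by
  obtain ⟨x, hx, hmax⟩ := isCompact_Icc.exists_isMaxOn (nonempty_Icc.2 (show (-1:ℝ) ≤ 1 by norm_num)) (cy.sub cφ)
  suffices y x - φ x ≤ 0 by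
    intro t ht
    have := hmax ht
    simp only [mem_ofPred_eq, Pi.sub_apply] at this
    linarith
  rcases hx.1.eq_or_lt with h | h
  · rw [← h]; linarith
  rcases hx.2.eq_or_lt with h' | h'
  · rw [h']; linarith
  have hxo : x ∈ Ioo (-1:ℝ) 1 := ⟨h, h'⟩
  have nb : Ioo (-1:ℝ) 1 ∈ 𝓝 x := Ioo_mem_nhds h h'
  have lm : IsLocalMax (fun t => y t - φ t) x := hmax.isLocalMax (Icc_mem_nhds h h')
  have d1 := (hy x hxo).sub (hφ x hxo)
  have z1 : y' x - φ' x = 0 := lm.hasDerivAt_eq_zero d1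
  have z2 : y'' x - φ'' x ≤ 0 := by
    refine second_deriv_nonpos (w := fun t => y t - φ t) (w' := fun t => y' t - φ' t) ?_ ((hy' x hxo).sub (hφ' x hxo)) lm
    filter_upwards [nb] with t ht using (hy t ht).sub (hφ t ht)
  by_contra hc
  push Not at hc
  have a1 := ode x hxo; have a2 := sup x hxo
  have : (1-x^2) * (y'' x - φ'' x) ≤ 0 := mul_nonpos_of_nonneg_of_nonpos (by nlinarith) z2
  have : b x * (y' x - φ' x) = 0 := by rw [z1, mul_zero]
  nlinarith [mul_pos he hc]

lemma poly_re_deriv (q : ℂ[X]) (x : ℝ) :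
    HasDerivAt (fun x : ℝ => (q.eval (x:ℂ)).re) ((derivative q).eval (x:ℂ)).re x := by
  exact (q.hasDerivAt (x:ℂ)).real_of_complex

lemma real_deriv {q : ℂ[X]} (hq : ∀ x : ℝ, (q.eval (x:ℂ)).im = 0) (x : ℝ) :
    ((derivative q).eval (x:ℂ)).im = 0 := by
  have h1 : HasDerivAt (fun x : ℝ => q.eval (x:ℂ)) ((derivative q).eval (x:ℂ)) x :=
    (q.hasDerivAt (x:ℂ)).comp_ofReal
  have h2 : HasDerivAt (fun x : ℝ => (q.eval (x:ℂ)).im) ((derivative q).eval (x:ℂ)).im x := by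
    have := Complex.imCLM.hasFDerivAt.comp_hasDerivAt x h1
    exact this
  simp only [hq] at h2
  exact h2.unique (hasDerivAt_const x 0)

lemma norm_real_eval {q : ℂ[X]} (hq : ∀ x : ℝ, (q.eval (x:ℂ)).im = 0) (x : ℝ) :
    ‖q.eval (x:ℂ)‖ = |(q.eval (x:ℂ)).re| := by
  have : q.eval (x:ℂ) = (((q.eval (x:ℂ)).re : ℝ) : ℂ) := by
    apply Complex.ext <;> simp [hq]
  rw [this, Complex.norm_real, ofReal_re]; rfl

lemma JSeq.ode_re {p : ℕ → ℂ[X]} {α β : ℕ → ℝ} (S : JSeq A B p α β) (n : ℕ) (x : ℝ) :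
    (1 - x^2) * ((derivative (derivative (p n))).eval (x:ℂ)).re +
      (β n - α n - (α n + β n + 2) * x) * ((derivative (p n)).eval (x:ℂ)).re -
      (-((n:ℝ) * (n+α n + β n+1))) * ((p n).eval (x:ℂ)).re = 0 := by
  have := congrArg Complex.re (S.ode n x)
  have e : ∀ (a : ℝ) (w : ℂ), ((a:ℂ) * w).re = a * w.re := fun a w => by simp
  have e1 : (1 - (x:ℂ)^2) = ((1-x^2 : ℝ):ℂ) := by push_cast; ring
  have e2 : ((β n:ℂ) - α n - (α n + β n + 2) * x) = ((β n - α n - (α n + β n + 2) * x : ℝ):ℂ) := by push_cast; ring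
  have e3 : ((n:ℂ) * (n+α n + β n+1)) = (((n:ℝ) * (n+α n + β n+1) : ℝ):ℂ) := by push_cast; ring
  rw [e1, e2, e3, add_re, add_re, e, e, e, zero_re] at this
  linarith

lemma super_one {ℓ ℓ' C c x η n α β : ℝ} (hn : 1 ≤ n) (hx : x ∈ Ioo (-1:ℝ) 1) (hl : |ℓ| ≤ C) (hl' : |ℓ'| ≤ C)
    (hk : (1-x^2)*ℓ^2 + bt A B x * ℓ - (-A-B-1) ≤ -c)
    (hη : |α / n - A| + |β / n - B| + 2 / n = η) (hc : (3*C+1)*η ≤ c) :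
    (1-x^2)*(n^2*ℓ^2+n*ℓ') + (β - α - (α + β + 2) * x)*(n*ℓ) - (-(n * (n+α + β+1))) ≤ 0 := by
  have hn0 : 0 < n := by linarith
  have hC : 0 ≤ C := (abs_nonneg _).trans hl
  set a := α/n - A with ha
  set b := β/n - B with hb
  have ea : α = n*(A+a) := by rw [ha]; field_simp; ring
  have eb : β = n*(B+b) := by rw [hb]; field_simp; ring
  set m := 1/n with hm
  have em : n*m = 1 := by rw [hm]; field_simp
  have m0 : 0 < m := by positivity
  have hη' : |a| + |b| + 2*m = η := by rw [← hη, hm]; ring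
  have key : (1-x^2)*(n^2*ℓ^2+n*ℓ') + (β - α - (α + β + 2) * x)*(n*ℓ) - (-(n * (n+α + β+1)))
     = n^2 * (((1-x^2)*ℓ^2 + bt A B x * ℓ - (-A-B-1)) + ((b - a - (a+b+2*m)*x)*ℓ + (1-x^2)*ℓ'*m + (a+b+m))) := by
    rw [ea, eb]; unfold bt
    linear_combination (-(1-x^2)*n*ℓ' + 2*x*n*ℓ - n) * em
  rw [key]
  apply mul_nonpos_of_nonneg_of_nonpos (by positivity)
  have hx1 : |x| ≤ 1 := by rw [abs_le]; exact ⟨hx.1.le, hx.2.le⟩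
  have b1 : (b - a - (a+b+2*m)*x)*ℓ ≤ 2*η*C := by
    refine (le_abs_self _).trans ?_
    rw [abs_mul]
    apply mul_le_mul _ hl (abs_nonneg _) (by rw [← hη']; positivity)
    have := abs_sub (b-a) ((a+b+2*m)*x)
    have h2 := abs_sub b a
    have h3 : |(a+b+2*m)*x| ≤ η := by
      rw [abs_mul]
      calc _ ≤ |a+b+2*m| * 1 := by gcongr
        _ ≤ η := by
          rw [mul_one, ← hη']
          refine (abs_add_le _ _).trans ?_
          rw [abs_of_pos (show 0 < 2*m by positivity)]
          linarith [abs_add_le a b]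
    linarith
  have b2 : (1-x^2)*ℓ'*m ≤ C*η := by
    have : (1-x^2)*ℓ' ≤ C := by
      refine (le_abs_self _).trans ?_
      rw [abs_mul, abs_of_nonneg (by nlinarith [hx.1, hx.2])]
      nlinarith [abs_nonneg ℓ', sq_nonneg x]
    have h2 : m ≤ η := by rw [← hη']; linarith [abs_nonneg a, abs_nonneg b]
    nlinarith
  have b3 : a+b+m ≤ η := by rw [← hη']; linarith [le_abs_self a, le_abs_self b]
  nlinarith

lemma exp_log_pow {V : ℝ} (hV : 0 < V) (n : ℕ) : Real.exp (n * Real.log V) = V^n := by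
  rw [Real.exp_nat_mul, Real.exp_log hV]

lemma exp_deriv2 {n : ℝ} {S ℓ ℓ' : ℝ → ℝ} {x : ℝ} (h1 : HasDerivAt S (ℓ x) x) (h2 : HasDerivAt ℓ (ℓ' x) x) :
    HasDerivAt (fun x => Real.exp (n * S x)) (n*ℓ x * Real.exp (n * S x)) x ∧
    HasDerivAt (fun x => n*ℓ x * Real.exp (n * S x)) ((n^2*ℓ x^2+n*ℓ' x) * Real.exp (n * S x)) x := by
  have a := (h1.const_mul n).exp
  refine ⟨a.congr_deriv (by ring), ((h2.const_mul n).mul a).congr_deriv (by ring)⟩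

lemma Par.E5 (h : Par A B) {p : ℕ → ℂ[X]} {α β : ℕ → ℝ} (Sq : JSeq A B p α β)
    {a' b' ε : ℝ} (ha : -1 < a') (hab : a' < 1) (hb : b' < 1) (hb' : -1 < b') (hε : 0 < ε) :
    ∀ᶠ n : ℕ in atTop, ∀ x ∈ Icc a' b', ‖(p n).eval (x:ℂ)‖ ≤ Real.exp (ε * n) * VV A B x ^ n := by
  obtain ⟨S, ℓ, ℓ', c, C, hc, hC, cS, S1, dS, bS⟩ := h.barrier ha hab (show 0 < ε/3 by positivity)
  obtain ⟨T, k, k', c2, C2, hc2, hC2, cT, T1, dT, bT⟩ := h.symm.barrier (a' := -b') (by linarith) (by linarith) (show 0 < ε/3 by positivity)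
  have sy : ∀ z, VV B A z = VV A B (-z) := fun z => (VV_symm z).symm
  rw [sy] at T1
  simp only [sy] at bT
  have ev1 : ∀ᶠ n in atTop, (3*C+1) * etaS A B α β n < c := by
    have := Sq.eta_tendsto.const_mul (3*C+1)
    rw [mul_zero] at this
    exact this.eventually_lt_const hc
  have ev2 : ∀ᶠ n in atTop, (3*C2+1) * etaS A B α β n < c2 := by
    have := Sq.eta_tendsto.const_mul (3*C2+1)
    rw [mul_zero] at this
    exact this.eventually_lt_const hc2
  have ev3 : ∀ᶠ n in atTop, etaS A B α β n < -A-B-1 := Sq.eta_tendsto.eventually_lt_const h.hd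
  have ev4 : ∀ᶠ n : ℕ in atTop, 2 ≤ Real.exp (ε/3 * n) := by
    have : Tendsto (fun n : ℕ => Real.exp (ε/3 * n)) atTop atTop :=
      Real.tendsto_exp_atTop.comp (tendsto_natCast_atTop_atTop.const_mul_atTop (by positivity))
    exact this.eventually_ge_atTop 2
  filter_upwards [ev1, ev2, ev3, ev4, Sq.one (ε/3) (by positivity), Sq.neg_one (ε/3) (by positivity), eventually_ge_atTop 1]
    with n e1 e2 e3 e4 one none hn1
  have hn : (1:ℝ) ≤ n := by exact_mod_cast hn1
  have hn0 : (0:ℝ) < n := by linarith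
  set K := Real.exp (ε/3*n) with hK
  have Kpos : 0 < K := Real.exp_pos _
  set φ : ℝ → ℝ := fun x => K * (Real.exp (n * S x) + Real.exp (n * T (-x))) with hφ
  have dT' : ∀ x ∈ Ioo (-1:ℝ) 1, HasDerivAt (fun x => T (-x)) (-k (-x)) x ∧ HasDerivAt (fun x => -k (-x)) (k' (-x)) x ∧
      |-k (-x)| ≤ C2 ∧ |k' (-x)| ≤ C2 ∧ (1-x^2)*(-k (-x))^2 + bt A B x * (-k (-x)) - (-A-B-1) ≤ -c2 := by
    intro x hx
    obtain ⟨q1, q2, q3, q4, q5⟩ := dT (-x) ⟨by linarith [hx.2], by linarith [hx.1]⟩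
    have nn := hasDerivAt_neg x
    refine ⟨(q1.comp x nn).congr_deriv (by ring), (q2.comp x nn).neg.congr_deriv (by ring), by rwa [abs_neg], q4, ?_⟩
    have : bt B A (-x) = - bt A B x := by unfold bt; ring
    rw [this] at q5
    nlinarith
  have epos : 0 < -((n:ℝ) * (n+α n + β n+1)) := by
    unfold etaS at e3
    have a1 := le_abs_self (α n / n - A); have a2 := le_abs_self (β n / n - B)
    have : α n / n + β n / n + 1/n < -1 := by
      have : (1:ℝ)/n ≤ 2/n := by gcongr; norm_num
      linarith
    have : (α n + β n + 1) < -1 * n := by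
      rw [← add_div, ← add_div, div_lt_iff₀ hn0] at this; exact this
    nlinarith
  have main : ∀ s : ℝ, |s| = 1 → ∀ x ∈ Icc (-1:ℝ) 1, s * ((p n).eval (x:ℂ)).re ≤ φ x := by
    intro s hs
    have hbd : ∀ w : ℂ, s * w.re ≤ ‖w‖ := fun w => by
      refine (le_abs_self _).trans ?_
      rw [abs_mul, hs, one_mul]; exact abs_re_le_norm w
    refine maxprin (y' := fun x => s * ((derivative (p n)).eval (x:ℂ)).re)
      (y'' := fun x => s * ((derivative (derivative (p n))).eval (x:ℂ)).re)
      (φ' := fun x => K * (n*ℓ x * Real.exp (n * S x) + n*(-k (-x)) * Real.exp (n * T (-x))))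
      (φ'' := fun x => K * ((n^2*ℓ x^2+n*ℓ' x) * Real.exp (n * S x) + (n^2*(-k (-x))^2+n*k' (-x)) * Real.exp (n * T (-x))))
      (b := fun x => (β n - α n - (α n + β n + 2) * x)) epos ?_ ?_ ?_ ?_ ?_ ?_ ?_ ?_ ?_ ?_
    · intro x hx
      exact ((poly_re_deriv (p n) x).const_mul s).continuousAt.continuousWithinAt
    · apply Continuous.continuousOn; simp only [hφ]; fun_prop
    · intro x hx; exact (poly_re_deriv _ x).const_mul s
    · intro x hx; exact (poly_re_deriv _ x).const_mul s
    · intro x hx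
      exact ((exp_deriv2 (dS x hx).1 (dS x hx).2.1).1.add (exp_deriv2 (S := fun x => T (-x)) (ℓ := fun x => -k (-x)) (ℓ' := fun x => k' (-x)) (dT' x hx).1 (dT' x hx).2.1).1).const_mul K
    · intro x hx
      exact ((exp_deriv2 (dS x hx).1 (dS x hx).2.1).2.add (exp_deriv2 (S := fun x => T (-x)) (ℓ := fun x => -k (-x)) (ℓ' := fun x => k' (-x)) (dT' x hx).1 (dT' x hx).2.1).2).const_mul K
    · intro x hx
      have := Sq.ode_re n x
      linear_combination s * this
    · intro x hx
      have r1 := super_one hn hx (dS x hx).2.2.1 (dS x hx).2.2.2.1 (dS x hx).2.2.2.2 (η := etaS A B α β n) rfl e1.le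
      have r2 := super_one hn hx (dT' x hx).2.2.1 (dT' x hx).2.2.2.1 (dT' x hx).2.2.2.2 (η := etaS A B α β n) rfl e2.le
      have f1 := mul_nonpos_of_nonneg_of_nonpos (mul_pos Kpos (Real.exp_pos (n * S x))).le r1
      have f2 := mul_nonpos_of_nonneg_of_nonpos (mul_pos Kpos (Real.exp_pos (n * T (-x)))).le r2
      simp only [hφ]
      linarith
    · refine (hbd _).trans ?_
      have := one.2
      simp only [hφ, S1, exp_log_pow (h.VV_pos 1)]
      rw [ofReal_one]
      refine this.trans ?_
      gcongr; linarith [Real.exp_pos (n * T (-1))]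
    · refine (hbd _).trans ?_
      have := none.2
      simp only [hφ, neg_neg, T1, exp_log_pow (h.VV_pos (-1))]
      push_cast
      refine this.trans ?_
      gcongr; linarith [Real.exp_pos (n * S (-1))]
  intro x hx
  have hx1 : -1 < x := by linarith [hx.1]
  have hx2 : x < 1 := by linarith [hx.2]
  rw [norm_real_eval (Sq.real n)]
  have m1 := main 1 (by simp) x ⟨hx1.le, hx2.le⟩
  have m2 := main (-1) (by simp) x ⟨hx1.le, hx2.le⟩
  have : |((p n).eval (x:ℂ)).re| ≤ φ x := abs_le.2 ⟨by linarith, by linarith⟩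
  refine this.trans ?_
  have g1 : Real.exp (n * S x) ≤ K * VV A B x ^n := by
    rw [← exp_log_pow (h.VV_pos x), hK, ← Real.exp_add]
    apply Real.exp_le_exp.2
    have := bS x ⟨hx.1, hx2⟩
    nlinarith
  have g2 : Real.exp (n * T (-x)) ≤ K * VV A B x ^n := by
    rw [← exp_log_pow (h.VV_pos x), hK, ← Real.exp_add]
    apply Real.exp_le_exp.2
    have := bT (-x) ⟨by linarith [hx.2], by linarith⟩
    push_cast at this
    rw [neg_neg] at this
    nlinarith
  have hV := pow_pos (h.VV_pos x) n
  have : Real.exp (ε*n) = K*K*K := by rw [hK, ← Real.exp_add, ← Real.exp_add]; congr 1; ring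
  rw [this]
  calc φ x ≤ K * (K * VV A B x ^n + K * VV A B x ^n) := by simp only [hφ]; gcongr
    _ = K*K*2 * VV A B x ^n := by ring
    _ ≤ _ := by gcongr

end

section
variable {A B : ℝ}

def Dn (p : ℕ → ℂ[X]) (n : ℕ) (z : ℂ) : ℂ := (derivative (p n)).eval z / n
def Pn (p : ℕ → ℂ[X]) (n : ℕ) (z : ℂ) : ℂ := (p n).eval z
def NN (p : ℕ → ℂ[X]) (n : ℕ) (z : ℂ) : ℝ := ‖Pn p n z‖^2 + ‖Dn p n z‖^2
def Fn (A B : ℝ) (p : ℕ → ℂ[X]) (n : ℕ) (z : ℂ) : ℝ := NN p n z / VV A B z ^ (2*n)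

lemma NN_nonneg (p : ℕ → ℂ[X]) (n : ℕ) (z : ℂ) : 0 ≤ NN p n z := by unfold NN; positivity

lemma lam_add (z g : ℂ) : lam A B z g + lam A B z (-g) = ((A+B)*z + A - B)/(1-z^2) := by
  unfold lam
  rw [← add_div, show (A+B)*z + A - B - (A+B+2)*g + ((A+B)*z + A - B - (A+B+2)*(-g)) = 2*((A+B)*z + A - B) by ring,
    mul_div_mul_left _ _ two_ne_zero]

lemma Par.lam_mul (h : Par A B) {z g : ℂ} (hg : g^2 = Qf A B z) (h1 : z ≠ 1) (h2 : z ≠ -1) :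
    lam A B z g * lam A B z (-g) = (A+B+1)/(1-z^2) := by
  have hs := h.sg_ne
  have hz := one_sub_sq_ne h1 h2
  have kC : (kk A B : ℂ)^2 = 16 * ((A + 1) * (B + 1) * (-A - B - 1)) / (A+B+2)^4 := by
    exact_mod_cast h.kk_sq
  have e : ((A:ℂ)+B+2)^2 * g^2 = ((A+B)*z+A-B)^2 - 4*(A+B+1)*(1-z^2) := by
    rw [hg, Qf, kC]; unfold mm; push_cast; field_simp; ring
  unfold lam
  rw [div_mul_div_comm, div_eq_div_iff (by simp [hz]) hz]
  linear_combination -(1-z^2)*e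

lemma Pn_deriv {p : ℕ → ℂ[X]} {n : ℕ} (hn : 1 ≤ n) (z : ℂ) : HasDerivAt (Pn p n) (n * Dn p n z) z := by
  have hn0 : (n:ℂ) ≠ 0 := by exact_mod_cast (by omega : n ≠ 0)
  unfold Dn Pn; rw [mul_div_cancel₀ _ hn0]; exact (p n).hasDerivAt z

/-- normalized ODE with error term -/
lemma JSeq.ode_norm {p : ℕ → ℂ[X]} {α β : ℕ → ℝ} (S : JSeq A B p α β) {n : ℕ} (hn : 1 ≤ n)
    {z : ℂ} (h1 : z ≠ 1) (h2 : z ≠ -1) :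
    ∃ E : ℂ, ‖E‖ ≤ etaS A B α β n * ((1+‖z‖)/‖1-z^2‖) * (‖Pn p n z‖ + ‖Dn p n z‖) ∧
      HasDerivAt (Dn p n) (n * (((A+B)*z + A - B)/(1-z^2) * Dn p n z - (A+B+1)/(1-z^2) * Pn p n z + E)) z := by
  have hz := one_sub_sq_ne h1 h2
  have hn0 : (n:ℂ) ≠ 0 := by exact_mod_cast (by omega : n ≠ 0)
  set a : ℝ := α n / n - A with ha
  set b : ℝ := β n / n - B with hb
  set m : ℝ := 1/n with hm
  have hnr : (n:ℝ) ≠ 0 := by exact_mod_cast (by omega : n ≠ 0)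
  have ea : (α n : ℂ) = n*(A+a) := by
    have : α n = n*(A+a) := by rw [ha]; field_simp; ring
    exact_mod_cast congrArg (fun x : ℝ => (x:ℂ)) this
  have eb : (β n : ℂ) = n*(B+b) := by
    have : β n = n*(B+b) := by rw [hb]; field_simp; ring
    exact_mod_cast congrArg (fun x : ℝ => (x:ℂ)) this
  have em : (n:ℂ)*m = 1 := by rw [hm]; push_cast; field_simp
  have m0 : 0 ≤ m := by positivity
  have hη : etaS A B α β n = |a| + |b| + 2*m := by unfold etaS; rw [hm]; ring
  refine ⟨(((a+b+2*m)*z - (b-a)) * Dn p n z - (a+b+m) * Pn p n z)/(1-z^2), ?_, ?_⟩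
  · rw [norm_div, mul_assoc, mul_comm_div, ← mul_div_assoc]
    rw [mul_div_assoc', div_le_div_iff_of_pos_right (norm_pos_iff.2 hz)]
    have k1 : ‖(a:ℂ)+b+2*m‖ ≤ |a| + |b| + 2*m := by
      have : ((a:ℂ)+b+2*m) = ((a+b+2*m : ℝ) : ℂ) := by push_cast; ring
      rw [this, Complex.norm_real, Real.norm_eq_abs]
      refine (abs_add_le _ _).trans ?_
      rw [abs_of_nonneg (show 0 ≤ 2*m by positivity)]
      linarith [abs_add_le a b]
    have k2 : ‖(b:ℂ)-a‖ ≤ |a| + |b| + 2*m := by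
      have : ((b:ℂ)-a) = ((b-a : ℝ) : ℂ) := by push_cast; ring
      rw [this, Complex.norm_real, Real.norm_eq_abs]
      linarith [abs_sub b a]
    have k3 : ‖(a:ℂ)+b+m‖ ≤ |a| + |b| + 2*m := by
      have : ((a:ℂ)+b+m) = ((a+b+m : ℝ) : ℂ) := by push_cast; ring
      rw [this, Complex.norm_real, Real.norm_eq_abs]
      refine (abs_add_le _ _).trans ?_
      rw [abs_of_nonneg m0]
      linarith [abs_add_le a b]
    rw [hη]
    set η := |a| + |b| + 2*m
    have hη0 : 0 ≤ η := by positivity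
    calc _ ≤ ‖(((a:ℂ)+b+2*m)*z - (b-a)) * Dn p n z‖ + ‖((a:ℂ)+b+m) * Pn p n z‖ := norm_sub_le _ _
      _ ≤ (η * ‖z‖ + η) * ‖Dn p n z‖ + η * ‖Pn p n z‖ := by
        rw [norm_mul, norm_mul]
        gcongr
        refine (norm_sub_le _ _).trans ?_
        rw [norm_mul]; gcongr
      _ ≤ _ := by nlinarith [mul_nonneg (mul_nonneg hη0 (norm_nonneg z)) (norm_nonneg (Pn p n z))]
  · have hd := ((derivative (p n)).hasDerivAt z).div_const (n:ℂ)
    refine hd.congr_deriv ?_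
    have ode := S.ode n z
    rw [ea, eb] at ode
    have : (derivative (p n)).eval z = n * Dn p n z := by unfold Dn; field_simp
    rw [this] at ode
    have e2 : eval z (p n) = Pn p n z := rfl
    rw [e2] at ode
    field_simp
    linear_combination ode - (2*n*z* Dn p n z - n * Pn p n z) * em

lemma gron {f f' : ℝ → ℝ} {K a b : ℝ} (hab : a ≤ b) (hf : ∀ t ∈ Icc a b, HasDerivAt f (f' t) t)
    (hK : ∀ t ∈ Icc a b, f' t ≤ K * f t) : f b ≤ Real.exp (K*(b-a)) * f a := by
  have dd : ∀ t ∈ Icc a b, HasDerivAt (fun t => Real.exp (-(K*t)) * f t)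
      (Real.exp (-(K*t)) * (f' t - K * f t)) t := by
    intro t ht
    have h1 : HasDerivAt (fun t => -(K*t)) (-K) t := by
      have := ((hasDerivAt_id t).const_mul K).neg
      rw [mul_one] at this; exact this
    exact (h1.exp.mul (hf t ht)).congr_deriv (by ring)
  have anti : AntitoneOn (fun t => Real.exp (-(K*t)) * f t) (Icc a b) := by
    apply antitoneOn_of_deriv_nonpos (convex_Icc _ _)
    · intro t ht; exact (dd t ht).continuousAt.continuousWithinAt
    · intro t ht; rw [interior_Icc] at ht
      exact (dd t (Ioo_subset_Icc_self ht)).differentiableAt.differentiableWithinAt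
    · intro t ht; rw [interior_Icc] at ht
      have ht := Ioo_subset_Icc_self ht
      rw [(dd t ht).deriv]
      exact mul_nonpos_of_nonneg_of_nonpos (Real.exp_pos _).le (by linarith [hK t ht])
  have := anti (left_mem_Icc.2 hab) (right_mem_Icc.2 hab) hab
  simp only at this
  have e : f b = Real.exp (K*b) * (Real.exp (-(K*b)) * f b) := by
    rw [← mul_assoc, ← Real.exp_add]; simp
  rw [e]
  calc _ ≤ Real.exp (K*b) * (Real.exp (-(K*a)) * f a) := by gcongr
    _ = _ := by rw [← mul_assoc, ← Real.exp_add]; congr 2; ring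

lemma JSeq.E1 {p : ℕ → ℂ[X]} {α β : ℕ → ℝ} (S : JSeq A B p α β) {z0 : ℂ} {ρ : ℝ}
    (hK : ∀ z ∈ Metric.closedBall z0 ρ, z ≠ 1 ∧ z ≠ -1) :
    ∃ C : ℝ, 0 ≤ C ∧ ∀ᶠ n : ℕ in atTop, ∀ z ∈ Metric.closedBall z0 ρ, ∀ w ∈ Metric.closedBall z0 ρ,
      NN p n z ≤ Real.exp (C * n * ‖z - w‖) * NN p n w := by
  have c1 : ContinuousOn (fun z : ℂ => ((A+B)*z + A - B)/(1-z^2)) (Metric.closedBall z0 ρ) :=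
    ContinuousOn.div (by fun_prop) (by fun_prop) fun z hz => one_sub_sq_ne (hK z hz).1 (hK z hz).2
  have c2 : ContinuousOn (fun z : ℂ => ((A:ℂ)+B+1)/(1-z^2)) (Metric.closedBall z0 ρ) :=
    ContinuousOn.div (by fun_prop) (by fun_prop) fun z hz => one_sub_sq_ne (hK z hz).1 (hK z hz).2
  have c3 : ContinuousOn (fun z : ℂ => (1+‖z‖)/‖1-z^2‖) (Metric.closedBall z0 ρ) :=
    ContinuousOn.div (by fun_prop) (by fun_prop) fun z hz => (norm_pos_iff.2 (one_sub_sq_ne (hK z hz).1 (hK z hz).2)).ne'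
  obtain ⟨M1, h1⟩ := (isCompact_closedBall z0 ρ).exists_bound_of_continuousOn c1
  obtain ⟨M2, h2⟩ := (isCompact_closedBall z0 ρ).exists_bound_of_continuousOn c2
  obtain ⟨M3, h3⟩ := (isCompact_closedBall z0 ρ).exists_bound_of_continuousOn c3
  set M := |M1| + |M2| + |M3| with hM
  have M0 : 0 ≤ M := by positivity
  refine ⟨1+3*M, by positivity, ?_⟩
  filter_upwards [S.eta_tendsto.eventually_lt_const one_pos, eventually_ge_atTop 1] with n hη hn
  intro z hz w hw
  set γ : ℝ → ℂ := fun t => w + t * (z-w) with hγ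
  have dγ : ∀ t, HasDerivAt γ (z-w) t := fun t => by
    have := (((hasDerivAt_id t).ofReal_comp).mul_const (z-w)).const_add w
    rw [ofReal_one, one_mul] at this
    exact this
  have γm : ∀ t ∈ Icc (0:ℝ) 1, γ t ∈ Metric.closedBall z0 ρ := by
    intro t ht
    have := (convex_closedBall z0 ρ) hw hz (show 0 ≤ 1-t by linarith [ht.2]) ht.1 (by ring)
    convert this using 1
    simp only [hγ, real_smul]; push_cast; ring
  choose! E hE hD using fun t (ht : t ∈ Icc (0:ℝ) 1) => S.ode_norm hn (hK _ (γm t ht)).1 (hK _ (γm t ht)).2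
  have n1 : ∀ t ∈ Icc (0:ℝ) 1, HasDerivAt (fun t => NN p n (γ t)) _ t := fun t ht =>
    (((Pn_deriv hn (γ t)).scomp t (dγ t)).norm_sq).add (((hD t ht).scomp t (dγ t)).norm_sq)
  have := gron (K := (1+3*M) * n * ‖z-w‖) zero_le_one n1 ?_
  · simpa [hγ] using this
  intro t ht
  have k1 := h1 _ (γm t ht)
  have k2 := h2 _ (γm t ht)
  have k3 := h3 _ (γm t ht)
  have kE := hE t ht
  rw [Real.norm_of_nonneg (by positivity)] at k3
  simp only [Function.comp, smul_eq_mul]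
  unfold NN
  set P := Pn p n (γ t)
  set D := Dn p n (γ t)
  set X1 := ((A+B)*(γ t) + A - B)/(1-(γ t)^2)
  set X2 := ((A:ℂ)+B+1)/(1-(γ t)^2)
  have i1 : inner ℝ P ((z-w) * (n*D)) ≤ ‖P‖ * (‖z-w‖ * (n * ‖D‖)) := by
    refine (real_inner_le_norm _ _).trans ?_
    rw [norm_mul, norm_mul, Complex.norm_natCast]
  have bE : ‖X1 * D - X2 * P + E t‖ ≤ M * (‖P‖+‖D‖) := by
    calc _ ≤ ‖X1 * D‖ + ‖X2 * P‖ + ‖E t‖ := (norm_add_le _ _).trans (by gcongr; exact norm_sub_le _ _)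
      _ ≤ |M1| * ‖D‖ + |M2| * ‖P‖ + 1 * |M3| * (‖P‖ + ‖D‖) := by
        rw [norm_mul, norm_mul]
        gcongr
        · exact k1.trans (le_abs_self _)
        · exact k2.trans (le_abs_self _)
        · refine kE.trans ?_
          gcongr
          exact k3.trans (le_abs_self _)
      _ ≤ _ := by
        rw [hM]; nlinarith [mul_nonneg (abs_nonneg M1) (norm_nonneg P), mul_nonneg (abs_nonneg M2) (norm_nonneg D)]
  have i2 : inner ℝ D ((z-w) * (n*(X1 * D - X2 * P + E t))) ≤ ‖D‖ * (‖z-w‖ * (n * (M * (‖P‖+‖D‖)))) := by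
    refine (real_inner_le_norm _ _).trans ?_
    rw [norm_mul, norm_mul, Complex.norm_natCast]
    gcongr
  have hs : 0 ≤ ‖z-w‖ * n := by positivity
  have q : 2*(‖P‖*‖D‖) + 2 * M * (‖D‖ * (‖P‖+‖D‖)) ≤ (1+3*M) * (‖P‖^2+‖D‖^2) := by
    nlinarith [sq_nonneg (‖P‖-‖D‖), mul_nonneg M0 (sq_nonneg (‖P‖-‖D‖)), mul_nonneg M0 (sq_nonneg ‖P‖)]
  nlinarith [mul_le_mul_of_nonneg_left q hs]

end

section
variable {A B : ℝ}

/-- diagonalised first order variable attached to the branch `G` -/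
def aF (A B : ℝ) (p : ℕ → ℂ[X]) (n : ℕ) (G : ℂ → ℂ) (z : ℂ) : ℂ :=
  Dn p n z - lam A B z (-G z) * Pn p n z

lemma lam_analytic {G : ℂ → ℂ} {z : ℂ} (hG : AnalyticAt ℂ G z) (h1 : z ≠ 1) (h2 : z ≠ -1) :
    AnalyticAt ℂ (fun z => lam A B z (G z)) z := by
  unfold lam
  have hz := one_sub_sq_ne h1 h2
  refine AnalyticAt.div ?_ (by fun_prop) (by simpa using hz)
  fun_prop

lemma aF_deriv (h : Par A B) {p : ℕ → ℂ[X]} {n : ℕ} (hn : 1 ≤ n) {G : ℂ → ℂ} {z E l' : ℂ}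
    (h1 : z ≠ 1) (h2 : z ≠ -1) (hsq : G z ^ 2 = Qf A B z)
    (hl : HasDerivAt (fun z => lam A B z (-G z)) l' z)
    (hD : HasDerivAt (Dn p n) (n * (((A+B)*z + A - B)/(1-z^2) * Dn p n z - (A+B+1)/(1-z^2) * Pn p n z + E)) z) :
    HasDerivAt (aF A B p n G) (n * lam A B z (G z) * aF A B p n G z + (n * E - l' * Pn p n z)) z := by
  refine (hD.sub (hl.mul (Pn_deriv hn z))).congr_deriv ?_
  rw [← lam_add z (G z), ← h.lam_mul hsq h1 h2]
  unfold aF; ring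

lemma ev_bdd {f : ℂ → ℂ} {z0 : ℂ} (hf : ContinuousAt f z0) : ∃ M : ℝ, 0 ≤ M ∧ ∀ᶠ z in 𝓝 z0, ‖f z‖ ≤ M :=
  ⟨‖f z0‖ + 1, by positivity, (hf.norm.eventually_lt_const (lt_add_one _)).mono fun _ h => h.le⟩

set_option maxHeartbeats 1000000 in
lemma JSeq.abSys (h : Par A B) {p : ℕ → ℂ[X]} {α β : ℕ → ℝ} (S : JSeq A B p α β) {z0 : ℂ} {G : ℂ → ℂ}
    (hG : AnalyticAt ℂ G z0) (hsq : ∀ z, G z ^ 2 = Qf A B z) (h0 : G z0 ≠ 0) (h1 : z0 ≠ 1) (h2 : z0 ≠ -1) :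
    ∃ M : ℝ, 1 ≤ M ∧ ∀ᶠ z in 𝓝 z0, z ≠ 1 ∧ z ≠ -1 ∧ G z ≠ 0 ∧ AnalyticAt ℂ G z ∧
      ∀ n : ℕ, 1 ≤ n → ∃ Ea Eb : ℂ,
        HasDerivAt (aF A B p n G) (n * lam A B z (G z) * aF A B p n G z + Ea) z ∧
        HasDerivAt (aF A B p n (-G)) (n * lam A B z (-G z) * aF A B p n (-G) z + Eb) z ∧
        ‖Ea‖ ≤ M * (1 + n * etaS A B α β n) * (‖aF A B p n G z‖ + ‖aF A B p n (-G) z‖) ∧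
        ‖Eb‖ ≤ M * (1 + n * etaS A B α β n) * (‖aF A B p n G z‖ + ‖aF A B p n (-G) z‖) ∧
        NN p n z ≤ M * (‖aF A B p n G z‖^2 + ‖aF A B p n (-G) z‖^2) ∧
        ‖aF A B p n G z‖^2 + ‖aF A B p n (-G) z‖^2 ≤ M * NN p n z ∧
        aF A B p n G z - aF A B p n (-G) z = (lam A B z (G z) - lam A B z (-G z)) * Pn p n z := by
  have hz0 := one_sub_sq_ne h1 h2
  have aL1 := lam_analytic (A := A) (B := B) hG h1 h2
  have aL2 := lam_analytic (A := A) (B := B) hG.neg h1 h2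
  have d0 : lam A B z0 (G z0) - lam A B z0 (-G z0) ≠ 0 := by
    rw [Par.lam_sub]
    refine mul_ne_zero h.sg_ne (div_ne_zero h0 ?_)
    intro e; apply hz0; linear_combination -e
  obtain ⟨M1, m1, b1⟩ := ev_bdd aL1.continuousAt
  obtain ⟨M2, m2, b2⟩ := ev_bdd aL2.continuousAt
  obtain ⟨M3, m3, b3⟩ := ev_bdd aL1.deriv.continuousAt
  obtain ⟨M4, m4, b4⟩ := ev_bdd aL2.deriv.continuousAt
  obtain ⟨M5, m5, b5⟩ := ev_bdd ((aL1.continuousAt.sub aL2.continuousAt).inv₀ d0)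
  have c6 : ContinuousAt (fun z : ℂ => (((1+‖z‖)/‖1-z^2‖ : ℝ) : ℂ)) z0 := by
    apply continuous_ofReal.continuousAt.comp
    exact ContinuousAt.div (by fun_prop) (by fun_prop) (norm_ne_zero_iff.2 hz0)
  obtain ⟨M6, m6, b6⟩ := ev_bdd c6
  set K := M5 + (1 + M2 * M5) with hK
  have hK0 : 0 ≤ K := by positivity
  set M := 1 + (M6 * K + M3 * M5 + M4 * M5) + 4 * K^2 + 4 * (1+M1+M2)^2 with hM
  refine ⟨M, by rw [hM]; linarith [show 0 ≤ (M6 * K + M3 * M5 + M4 * M5) + 4 * K^2 + 4 * (1+M1+M2)^2 by positivity], ?_⟩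
  filter_upwards [b1, b2, b3, b4, b5, b6, hG.eventually_analyticAt, hG.continuousAt.eventually_ne h0,
    eventually_ne_nhds h1, eventually_ne_nhds h2, (aL1.continuousAt.sub aL2.continuousAt).eventually_ne d0]
    with z b1 b2 b3 b4 b5 b6 aG gne z1 z2 dne
  refine ⟨z1, z2, gne, aG, fun n hn => ?_⟩
  obtain ⟨E, hE, hD⟩ := S.ode_norm hn z1 z2
  have l1 := (lam_analytic (A := A) (B := B) aG z1 z2).differentiableAt.hasDerivAt
  have l2 := (lam_analytic (A := A) (B := B) aG.neg z1 z2).differentiableAt.hasDerivAt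
  have n0 : (0:ℝ) ≤ n := Nat.cast_nonneg _
  have η0 := eta_nonneg (A := A) (B := B) α β n
  set η := etaS A B α β n
  have hab : aF A B p n G z - aF A B p n (-G) z = (lam A B z (G z) - lam A B z (-G z)) * Pn p n z := by
    unfold aF; simp only [Pi.neg_apply, neg_neg]; ring
  have hD2 : Dn p n z = aF A B p n G z + lam A B z (-G z) * Pn p n z := by unfold aF; ring
  have bb : aF A B p n (-G) z = Dn p n z - lam A B z (G z) * Pn p n z := by
    unfold aF; simp only [Pi.neg_apply, neg_neg]
  have ha := aF_deriv h hn z1 z2 (hsq z) l2 hD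
  have hb := aF_deriv h (G := -G) hn z1 z2 (by simpa using hsq z)
    (l' := deriv (fun z => lam A B z (G z)) z) (by simpa using l1) hD
  have aeq : aF A B p n G z = Dn p n z - lam A B z (-G z) * Pn p n z := rfl
  rw [Complex.norm_real, Real.norm_of_nonneg (by positivity)] at b6
  simp only [Pi.neg_apply, Pi.sub_apply, Pi.inv_apply] at b2 b5 dne
  set P := Pn p n z
  set D := Dn p n z
  set a := aF A B p n G z
  set b := aF A B p n (-G) z
  have hP : ‖P‖ ≤ M5 * (‖a‖ + ‖b‖) := by
    have : P = (lam A B z (G z) - lam A B z (-G z))⁻¹ * (a - b) := by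
      rw [hab, inv_mul_cancel_left₀ dne]
    rw [this, norm_mul]
    gcongr
    exact norm_sub_le _ _
  have hDn : ‖D‖ ≤ (1 + M2 * M5) * (‖a‖ + ‖b‖) := by
    rw [hD2]
    calc _ ≤ ‖a‖ + M2 * (M5 * (‖a‖ + ‖b‖)) := by
          refine (norm_add_le _ _).trans ?_
          rw [norm_mul]; gcongr
      _ ≤ _ := by linarith [norm_nonneg b]
  have hPD : ‖P‖ + ‖D‖ ≤ K * (‖a‖ + ‖b‖) := by rw [hK]; linarith
  have s0 : 0 ≤ ‖a‖ + ‖b‖ := by positivity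
  have hEb : ‖E‖ ≤ η * (M6 * (K * (‖a‖ + ‖b‖))) := by
    refine hE.trans ?_
    rw [mul_assoc]; gcongr
  have key : ∀ l : ℂ, ∀ L : ℝ, ‖l‖ ≤ L → L * M5 ≤ M3 * M5 + M4 * M5 →
      ‖n * E - l * P‖ ≤ M * (1 + n * η) * (‖a‖ + ‖b‖) := by
    intro l L hl hL
    have L0 := (norm_nonneg _).trans hl
    calc _ ≤ n * (η * (M6 * (K * (‖a‖ + ‖b‖)))) + L * (M5 * (‖a‖ + ‖b‖)) := by
          refine (norm_sub_le _ _).trans ?_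
          rw [norm_mul, norm_mul, Complex.norm_natCast]
          gcongr
      _ = (M6 * K * (n*η) + L * M5) * (‖a‖ + ‖b‖) := by ring
      _ ≤ _ := by
        gcongr
        have e1 : M6 * K ≤ M := by
          rw [hM]; linarith [show 0 ≤ M3 * M5 + M4 * M5 + 4 * K^2 + 4 * (1+M1+M2)^2 by positivity]
        have e2 : L * M5 ≤ M := by
          rw [hM]; linarith [show 0 ≤ M6 * K + 4 * K^2 + 4 * (1+M1+M2)^2 by positivity]
        have : 0 ≤ n * η := by positivity
        nlinarith
  refine ⟨_, _, ha, hb, ?_, ?_, ?_, ?_, hab⟩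
  · exact key _ M4 b4 (by linarith [mul_nonneg m3 m5])
  · exact key _ M3 b3 (by linarith [mul_nonneg m4 m5])
  · have e : NN p n z = ‖P‖^2 + ‖D‖^2 := rfl
    have k1 : ‖P‖^2 + ‖D‖^2 ≤ (K * (‖a‖ + ‖b‖))^2 := by
      nlinarith [norm_nonneg P, norm_nonneg D, mul_nonneg (norm_nonneg P) (norm_nonneg D)]
    rw [e]
    refine k1.trans ?_
    have e1 : 2 * K^2 ≤ M := by
      rw [hM]; linarith [show 0 ≤ M6 * K + M3 * M5 + M4 * M5 + 2 * K^2 + 4 * (1+M1+M2)^2 by positivity]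
    have : (K * (‖a‖ + ‖b‖))^2 ≤ 2 * K^2 * (‖a‖^2 + ‖b‖^2) := by
      nlinarith [mul_nonneg (sq_nonneg K) (sq_nonneg (‖a‖-‖b‖))]
    refine this.trans ?_
    gcongr
  · have e : NN p n z = ‖P‖^2 + ‖D‖^2 := rfl
    have k1 : ‖a‖ ≤ (1+M1+M2) * (‖P‖ + ‖D‖) := by
      rw [aeq]
      calc _ ≤ ‖D‖ + M2 * ‖P‖ := by
            refine (norm_sub_le _ _).trans ?_
            rw [norm_mul]; gcongr
        _ ≤ _ := by nlinarith [norm_nonneg P, norm_nonneg D, mul_nonneg m1 (norm_nonneg P), mul_nonneg m1 (norm_nonneg D), mul_nonneg m2 (norm_nonneg D)]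
    have k2 : ‖b‖ ≤ (1+M1+M2) * (‖P‖ + ‖D‖) := by
      rw [bb]
      calc _ ≤ ‖D‖ + M1 * ‖P‖ := by
            refine (norm_sub_le _ _).trans ?_
            rw [norm_mul]; gcongr
        _ ≤ _ := by nlinarith [norm_nonneg P, norm_nonneg D, mul_nonneg m2 (norm_nonneg P), mul_nonneg m1 (norm_nonneg D), mul_nonneg m2 (norm_nonneg D)]
    have q1 := pow_le_pow_left₀ (norm_nonneg _) k1 2
    have q2 := pow_le_pow_left₀ (norm_nonneg _) k2 2
    have e1 : 4 * (1+M1+M2)^2 ≤ M := by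
      rw [hM]; linarith [show 0 ≤ M6 * K + M3 * M5 + M4 * M5 + 4 * K^2 by positivity]
    rw [e]
    have q3 : ((1+M1+M2) * (‖P‖ + ‖D‖))^2 ≤ 2 * (1+M1+M2)^2 * (‖P‖^2 + ‖D‖^2) := by
      nlinarith [mul_nonneg (sq_nonneg (1+M1+M2)) (sq_nonneg (‖P‖-‖D‖))]
    calc _ ≤ 4 * (1+M1+M2)^2 * (‖P‖^2 + ‖D‖^2) := by linarith
      _ ≤ _ := by gcongr

lemma Par.Fn_eq (h : Par A B) (p : ℕ → ℂ[X]) (n : ℕ) (z : ℂ) :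
    Fn A B p n z = NN p n z * Real.exp (-(2*n*Real.log (VV A B z))) := by
  unfold Fn
  rw [div_eq_mul_inv, Real.exp_neg, mul_comm (2*(n:ℝ)), Real.exp_mul, Real.exp_log (h.VV_pos z)]
  congr 2
  exact_mod_cast rfl

lemma Par.Fn_nonneg (h : Par A B) (p : ℕ → ℂ[X]) (n : ℕ) (z : ℂ) : 0 ≤ Fn A B p n z := by
  rw [h.Fn_eq]; exact mul_nonneg (NN_nonneg _ _ _) (Real.exp_pos _).le

lemma JSeq.E1' (h : Par A B) {p : ℕ → ℂ[X]} {α β : ℕ → ℝ} (S : JSeq A B p α β) {z0 : ℂ} {ε : ℝ}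
    (hε : 0 < ε) (h1 : z0 ≠ 1) (h2 : z0 ≠ -1) :
    ∃ U ∈ 𝓝 z0, ∀ᶠ n : ℕ in atTop, ∀ z ∈ U, ∀ w ∈ U, Fn A B p n z ≤ Real.exp (ε*n) * Fn A B p n w := by
  obtain ⟨ρ, ρ0, hρ⟩ := Metric.nhds_basis_closedBall.mem_iff.1
    ((eventually_ne_nhds h1).and (eventually_ne_nhds h2))
  obtain ⟨C, C0, hC⟩ := S.E1 (z0 := z0) (ρ := ρ) fun z hz => hρ hz
  have cl : ContinuousAt (fun z => Real.log (VV A B z)) z0 := h.VV_cont.continuousAt.log (h.VV_pos z0).ne'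
  obtain ⟨r, r0, hr⟩ := Metric.continuousAt_iff.1 cl (ε/8) (by positivity)
  set r' := min ρ (min r (ε/(4*(C+1)))) with hr'
  have r'0 : 0 < r' := by rw [hr']; positivity
  refine ⟨Metric.ball z0 r', Metric.ball_mem_nhds _ r'0, ?_⟩
  filter_upwards [hC] with n hn
  intro z hz w hw
  have i1 : r' ≤ ρ := min_le_left _ _
  have i2 : r' ≤ r := (min_le_right _ _).trans (min_le_left _ _)
  have i3 : r' ≤ ε/(4*(C+1)) := (min_le_right _ _).trans (min_le_right _ _)
  have a1 := hn z (Metric.ball_subset_closedBall (Metric.ball_subset_ball i1 hz)) w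
    (Metric.ball_subset_closedBall (Metric.ball_subset_ball i1 hw))
  have a2 := hr (lt_of_lt_of_le hz i2)
  have a3 := hr (lt_of_lt_of_le hw i2)
  rw [Real.dist_eq, abs_lt] at a2 a3
  have d : ‖z - w‖ ≤ 2 * r' := by
    rw [← dist_eq_norm]
    have := dist_triangle_right z w z0
    rw [Metric.mem_ball] at hz hw
    linarith
  have d2 : C * ‖z-w‖ ≤ ε/2 := by
    have : 2 * r' ≤ 2 * (ε/(4*(C+1))) := by linarith
    calc C * ‖z-w‖ ≤ (C+1) * (2 * (ε/(4*(C+1)))) := by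
          gcongr
          · linarith
          · linarith
      _ = ε/2 := by field_simp; ring
  rw [h.Fn_eq, h.Fn_eq]
  have n0 : (0:ℝ) ≤ n := Nat.cast_nonneg _
  calc _ ≤ Real.exp (C * n * ‖z - w‖) * NN p n w * Real.exp (-(2*n*Real.log (VV A B z))) := by gcongr
    _ = (Real.exp (C * n * ‖z - w‖) * Real.exp (-(2*n*Real.log (VV A B z)))) * NN p n w := by ring
    _ ≤ (Real.exp (ε*n) * Real.exp (-(2*n*Real.log (VV A B w)))) * NN p n w := by
      refine mul_le_mul_of_nonneg_right ?_ (NN_nonneg _ _ _)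
      rw [← Real.exp_add, ← Real.exp_add]
      apply Real.exp_le_exp.2
      nlinarith [mul_le_mul_of_nonneg_right d2 n0]
    _ = _ := by ring

end

section
variable {A B : ℝ}

lemma Par.ne_of_Gam (h : Par A B) {z : ℂ} (hz : z ∈ Gam A B) : z ≠ 1 ∧ z ≠ -1 :=
  ⟨fun e => h.one_notMem (e ▸ hz), fun e => h.neg_one_notMem (e ▸ hz)⟩

lemma Par.log_VV_Gam (h : Par A B) {z g : ℂ} (hz : z ∈ Gam A B) (hg : g^2 = Qf A B z) :
    Real.log (VV A B z) = LX A B (z - mm A B + g) := by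
  have hz' := h.ne_of_Gam hz
  rw [VV_eq_max hg, ← (mem_Gam hg).1 hz, max_self]
  exact log_XX (h.u_ne hg) (h.u_ne_P1 hg hz'.1) (h.u_ne_N1 hg hz'.2)

lemma Par.W_deriv (h : Par A B) {γ : ℝ → ℂ} {γ' : ℂ} {t : ℝ} (hγ : HasDerivAt γ γ' t)
    (hΓ : ∀ᶠ s in 𝓝 t, γ s ∈ Gam A B) {G : ℂ → ℂ} (hG : ContinuousAt G (γ t))
    (hsq : ∀ z, G z ^ 2 = Qf A B z) (h0 : G (γ t) ≠ 0) :
    HasDerivAt (fun s => Real.log (VV A B (γ s))) (lam A B (γ t) (G (γ t)) * γ').re t := by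
  have hz := hΓ.self_of_nhds
  have hz' := h.ne_of_Gam hz
  have e : (fun s => Real.log (VV A B (γ s))) =ᶠ[𝓝 t] fun s => LX A B (γ s - mm A B + G (γ s)) := by
    filter_upwards [hΓ] with s hs using h.log_VV_Gam hs (hsq _)
  have hb := branch_along (A := A) (B := B) (g := fun s => G (γ s)) hγ (ContinuousAt.comp (f := γ) (x := t) hG hγ.continuousAt)
    (Eventually.of_forall fun s => hsq _) h0
  have hu : HasDerivAt (fun s => γ s - mm A B + G (γ s)) (γ' + γ' * ((γ t - mm A B)/G (γ t))) t :=
    (hγ.sub_const _).add hb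
  have := hasDerivAt_LX hu (h.u_ne (hsq _)) (h.u_ne_P1 (hsq _) hz'.1) (h.u_ne_N1 (hsq _) hz'.2)
  refine (this.congr_of_eventuallyEq e).congr_deriv ?_
  congr 1
  rw [← h.psi_lam (hsq _) h0 hz'.1 hz'.2]
  field_simp
  ring

lemma inner_mul_self (a l : ℂ) : inner ℝ a (l * a) = l.re * ‖a‖^2 := by
  rw [Complex.inner, ← Complex.normSq_eq_norm_sq, Complex.normSq_apply]
  simp [Complex.mul_re, Complex.mul_im]; ring

set_option maxHeartbeats 1000000 in
lemma JSeq.E2loc (h : Par A B) {p : ℕ → ℂ[X]} {α β : ℕ → ℝ} (S : JSeq A B p α β)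
    {γ : ℝ → ℂ} (hγ : ContDiff ℝ 1 γ) {t0 : ℝ} (hΓ : ∀ᶠ s in 𝓝 t0, γ s ∈ Gam A B)
    (hQ : Qf A B (γ t0) ≠ 0) :
    ∃ δ > 0, ∀ s ∈ Metric.ball t0 δ, ∀ t ∈ Metric.ball t0 δ, s ≤ t → ∀ ε > 0, ∀ᶠ n : ℕ in atTop,
      Fn A B p n (γ t) ≤ Real.exp (ε*n) * Fn A B p n (γ s) ∧
      Fn A B p n (γ s) ≤ Real.exp (ε*n) * Fn A B p n (γ t) := by
  have hz := hΓ.self_of_nhds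
  have hz' := h.ne_of_Gam hz
  have g0 : dg A B (γ t0) ≠ 0 := by
    intro e; apply hQ; rw [← dg_sq, e]; ring
  obtain ⟨G, hG0, hG, hsq⟩ := exists_branch (dg_sq A B (γ t0)) g0
  obtain ⟨M, M1, hM⟩ := S.abSys h hG hsq (by rw [hG0]; exact g0) hz'.1 hz'.2
  have cγ : ContinuousAt γ t0 := hγ.continuous.continuousAt
  have cγ' : ContinuousAt (deriv γ) t0 := (hγ.continuous_deriv le_rfl).continuousAt
  have ev := ((cγ.eventually hM).and (hΓ.eventually_nhds)).and
    (cγ'.norm.eventually_lt_const (lt_add_one _))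
  obtain ⟨δ, δ0, hδ⟩ := Metric.nhds_basis_ball.mem_iff.1 ev
  set L := ‖deriv γ t0‖ + 1 with hL
  have L0 : 0 ≤ L := by positivity
  refine ⟨δ, δ0, fun s hs t ht hst ε hε => ?_⟩
  have sub : ∀ x ∈ Icc s t, x ∈ Metric.ball t0 δ := fun x hx =>
    (convex_ball t0 δ).ordConnected.out hs ht hx
  set Q := 4 * L * M * (t - s) with hQdef
  have Q0 : 0 ≤ Q := by have : 0 ≤ t - s := by linarith
                        positivity
  have lim : Tendsto (fun n : ℕ => (2 * Real.log M + Q) / n + Q * etaS A B α β n) atTop (𝓝 0) := by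
    have := (tendsto_const_div_atTop_nhds_zero_nat (2 * Real.log M + Q)).add (S.eta_tendsto.const_mul Q)
    simpa using this
  filter_upwards [lim.eventually_lt_const hε, eventually_ge_atTop 1] with n hl hn
  have n0 : (0:ℝ) < n := by exact_mod_cast hn
  have η0 := eta_nonneg (A := A) (B := B) α β n
  have hl2 : 2 * Real.log M + Q * (1 + n * etaS A B α β n) ≤ ε * n := by
    have := mul_le_mul_of_nonneg_right hl.le n0.le
    rw [add_mul, div_mul_cancel₀ _ n0.ne'] at this
    nlinarith
  choose! Ea Eb k1 k2 k3 k4 k5 k6 k7 using fun x (hx : x ∈ Icc s t) => (hδ (sub x hx)).1.1.2.2.2.2 n hn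
  set η := etaS A B α β n
  set W : ℝ → ℝ := fun x => Real.log (VV A B (γ x))
  set En : ℝ → ℝ := fun x => Real.exp (-(2*n*W x)) * (‖aF A B p n G (γ x)‖^2 + ‖aF A B p n (-G) (γ x)‖^2)
  have dγ : ∀ x, HasDerivAt γ (deriv γ x) x := fun x =>
    (hγ.differentiable one_ne_zero).differentiableAt.hasDerivAt
  have hx1 : ∀ x ∈ Icc s t, HasDerivAt W (lam A B (γ x) (G (γ x)) * deriv γ x).re x := fun x hx =>
    h.W_deriv (dγ x) (hδ (sub x hx)).1.2 (hδ (sub x hx)).1.1.2.2.2.1.continuousAt hsq (hδ (sub x hx)).1.1.2.2.1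
  have hx2 : ∀ x ∈ Icc s t, HasDerivAt W (lam A B (γ x) (-G (γ x)) * deriv γ x).re x := fun x hx =>
    h.W_deriv (G := -G) (dγ x) (hδ (sub x hx)).1.2 (hδ (sub x hx)).1.1.2.2.2.1.neg.continuousAt
      (fun z => by simpa using hsq z) (by simpa using (hδ (sub x hx)).1.1.2.2.1)
  have dEn : ∀ x ∈ Icc s t, ∃ E', HasDerivAt En E' x ∧ |E'| ≤ 4 * L * M * (1 + n * η) * En x := by
    intro x hx
    have w12 := (hx1 x hx).unique (hx2 x hx)
    have w1 := (((hx1 x hx).const_mul (2*(n:ℝ))).neg).exp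
    have da := ((k1 x hx).scomp x (dγ x)).norm_sq
    have db := ((k2 x hx).scomp x (dγ x)).norm_sq
    refine ⟨_, w1.mul (da.add db), ?_⟩
    have kL : ‖deriv γ x‖ ≤ L := (hδ (sub x hx)).2.le
    have e3 := k3 x hx
    have e4 := k4 x hx
    simp only [Function.comp, smul_eq_mul, En, W, Pi.neg_apply]
    set a := aF A B p n G (γ x)
    set b := aF A B p n (-G) (γ x)
    set l1 := lam A B (γ x) (G (γ x))
    set l2 := lam A B (γ x) (-G (γ x))
    set γ' := deriv γ x
    set X := Real.exp (-(2*n*Real.log (VV A B (γ x))))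
    have X0 : 0 < X := Real.exp_pos _
    have i1 : inner ℝ a (γ' * (n * l1 * a + Ea x)) = n * (l1*γ').re * ‖a‖^2 + inner ℝ a (γ' * Ea x) := by
      rw [mul_add, inner_add_right, show γ' * (n * l1 * a) = (n * (l1 * γ')) * a by ring, inner_mul_self]
      simp
    have i2 : inner ℝ b (γ' * (n * l2 * b + Eb x)) = n * (l1*γ').re * ‖b‖^2 + inner ℝ b (γ' * Eb x) := by
      rw [mul_add, inner_add_right, show γ' * (n * l2 * b) = (n * (l2 * γ')) * b by ring, inner_mul_self, w12]
      simp
    rw [i1, i2]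
    set N := ‖a‖ + ‖b‖
    have N0 : 0 ≤ N := by positivity
    have j1 : |inner ℝ a (γ' * Ea x)| ≤ ‖a‖ * (L * (M * (1+n*η) * N)) := by
      refine (abs_real_inner_le_norm _ _).trans ?_
      rw [norm_mul]; gcongr
    have j2 : |inner ℝ b (γ' * Eb x)| ≤ ‖b‖ * (L * (M * (1+n*η) * N)) := by
      refine (abs_real_inner_le_norm _ _).trans ?_
      rw [norm_mul]; gcongr
    rw [show ∀ w u v : ℝ, X * -(2*n*w) * (‖a‖^2+‖b‖^2) + X * (2 * (n * w * ‖a‖^2 + u) + 2 * (n * w * ‖b‖^2 + v)) = X * (2*(u+v)) by intros; ring]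
    rw [abs_mul, abs_of_pos X0, abs_mul, abs_two]
    have j3 := abs_add_le (inner ℝ a (γ' * Ea x)) (inner ℝ b (γ' * Eb x))
    have NN2 : N^2 ≤ 2*(‖a‖^2+‖b‖^2) := by
      simp only [N]; nlinarith [sq_nonneg (‖a‖-‖b‖)]
    have LM : 0 ≤ L * M * (1+n*η) := by positivity
    calc _ ≤ X * (2 * (‖a‖ * (L * (M * (1+n*η) * N)) + ‖b‖ * (L * (M * (1+n*η) * N)))) := by
          gcongr; linarith
      _ = X * (2 * (L * M * (1+n*η)) * N^2) := by simp only [N]; ring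
      _ ≤ X * (2 * (L * M * (1+n*η)) * (2*(‖a‖^2+‖b‖^2))) := by gcongr
      _ = _ := by ring
  choose! E' hE' bE' using dEn
  have st : t - s ≥ 0 := by linarith
  have g1 := gron hst hE' (fun x hx => (le_abs_self _).trans (bE' x hx))
  have g2 := gron (f := fun x => En (-x)) (f' := fun x => - E' (-x)) (K := 4 * L * M * (1 + n * η))
    (a := -t) (b := -s) (by linarith)
    (fun x hx => by
      have hx' : -x ∈ Icc s t := ⟨by linarith [hx.2], by linarith [hx.1]⟩
      have := (hE' (-x) hx').scomp x (hasDerivAt_neg x)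
      rw [neg_one_smul] at this
      exact this)
    (fun x hx => by
      have hx' : -x ∈ Icc s t := ⟨by linarith [hx.2], by linarith [hx.1]⟩
      exact (neg_le_abs _).trans (bE' _ hx'))
  simp only [neg_neg] at g2
  have rel1 : ∀ x ∈ Icc s t, Fn A B p n (γ x) ≤ M * En x := by
    intro x hx
    rw [h.Fn_eq]
    calc _ ≤ (M * (‖aF A B p n G (γ x)‖^2 + ‖aF A B p n (-G) (γ x)‖^2)) * Real.exp (-(2*n*W x)) := by
          gcongr; exact k5 x hx
      _ = _ := by simp only [En]; ring
  have rel2 : ∀ x ∈ Icc s t, En x ≤ M * Fn A B p n (γ x) := by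
    intro x hx
    rw [h.Fn_eq]
    calc _ ≤ Real.exp (-(2*n*W x)) * (M * NN p n (γ x)) := by
          simp only [En]; gcongr; exact k6 x hx
      _ = _ := by ring
  have hMM : M * (Real.exp (Q * (1+n*η)) * M) ≤ Real.exp (ε * n) := by
    have M0 : 0 < M := by linarith
    nth_rw 1 [← Real.exp_log M0]
    nth_rw 2 [← Real.exp_log M0]
    rw [← Real.exp_add, ← Real.exp_add]
    apply Real.exp_le_exp.2
    linarith
  have eQ : 4 * L * M * (1 + n * η) * (t - s) = Q * (1 + n*η) := by rw [hQdef]; ring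
  have eQ' : 4 * L * M * (1 + n * η) * (-s - -t) = Q * (1 + n*η) := by rw [hQdef]; ring
  rw [eQ] at g1
  rw [eQ'] at g2
  have ls := left_mem_Icc.2 hst
  have lt := right_mem_Icc.2 hst
  have fin : ∀ x ∈ Icc s t, ∀ y ∈ Icc s t, En x ≤ Real.exp (Q * (1+n*η)) * En y →
      Fn A B p n (γ x) ≤ Real.exp (ε * n) * Fn A B p n (γ y) := by
    intro x hx y hy hxy
    calc _ ≤ M * En x := rel1 x hx
      _ ≤ M * (Real.exp (Q * (1+n*η)) * (M * Fn A B p n (γ y))) := by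
        gcongr
        exact hxy.trans (by gcongr; exact rel2 y hy)
      _ = (M * (Real.exp (Q * (1+n*η)) * M)) * Fn A B p n (γ y) := by ring
      _ ≤ _ := by
        gcongr
        exact h.Fn_nonneg _ _ _
  exact ⟨fin t lt s ls g1, fin s ls t lt g2⟩

end

section
variable {A B : ℝ}

def relF (A B : ℝ) (p : ℕ → ℂ[X]) (z w : ℂ) : Prop := ∀ ε > 0, ∀ᶠ n : ℕ in atTop,
  Fn A B p n z ≤ Real.exp (ε*n) * Fn A B p n w ∧ Fn A B p n w ≤ Real.exp (ε*n) * Fn A B p n z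

lemma relF.symm {p : ℕ → ℂ[X]} {z w : ℂ} (hr : relF A B p z w) : relF A B p w z := fun ε hε =>
  (hr ε hε).mono fun _ h => ⟨h.2, h.1⟩

lemma exp_half_trans {ε n x y z : ℝ} (h1 : x ≤ Real.exp (ε/2*n) * y) (h2 : y ≤ Real.exp (ε/2*n) * z) :
    x ≤ Real.exp (ε*n) * z := by
  calc x ≤ Real.exp (ε/2*n) * (Real.exp (ε/2*n) * z) := h1.trans (by gcongr)
    _ = _ := by rw [← mul_assoc, ← Real.exp_add]; congr 2; ring

lemma relF.trans {p : ℕ → ℂ[X]} {x y z : ℂ} (h1 : relF A B p x y) (h2 : relF A B p y z) : relF A B p x z := by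
  intro ε hε
  filter_upwards [h1 (ε/2) (by positivity), h2 (ε/2) (by positivity)] with n a b
  exact ⟨exp_half_trans a.1 b.1, exp_half_trans b.2 a.2⟩

lemma JSeq.relF_Icc (h : Par A B) {p : ℕ → ℂ[X]} {α β : ℕ → ℝ} (S : JSeq A B p α β)
    {γ : ℝ → ℂ} (hγ : ContDiff ℝ 1 γ) (hΓ : ∀ t ∈ Icc (0:ℝ) 1, γ t ∈ Gam A B)
    (hQ : ∀ t ∈ Ioo (0:ℝ) 1, Qf A B (γ t) ≠ 0) {s t : ℝ} (hs : s ∈ Icc (0:ℝ) 1) (ht : t ∈ Icc (0:ℝ) 1) :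
    relF A B p (γ s) (γ t) := by
  have core : ∀ s ∈ Ioo (0:ℝ) 1, ∀ t ∈ Ioo (0:ℝ) 1, relF A B p (γ s) (γ t) := by
    intro s hs t ht
    refine isPreconnected_Ioo.induction₂ (fun s t => relF A B p (γ s) (γ t)) ?_ ?_ ?_ hs ht
    · intro x hx
      have ev : ∀ᶠ s in 𝓝 x, γ s ∈ Gam A B := by
        filter_upwards [Ioo_mem_nhds hx.1 hx.2] with s hs using hΓ s (Ioo_subset_Icc_self hs)
      obtain ⟨δ, δ0, hδ⟩ := S.E2loc h hγ ev (hQ x hx)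
      refine mem_nhdsWithin_of_mem_nhds ?_
      filter_upwards [Metric.ball_mem_nhds x δ0] with y hy
      rcases le_total x y with hxy | hxy
      · intro ε hε
        filter_upwards [hδ x (Metric.mem_ball_self δ0) y hy hxy ε hε] with n hn using ⟨hn.2, hn.1⟩
      · intro ε hε
        filter_upwards [hδ y hy x (Metric.mem_ball_self δ0) hxy ε hε] with n hn using hn
    · intro x y z _ _ _ a b; exact a.trans b
    · intro x y _ _ a; exact a.symm
  have near : ∀ x ∈ Icc (0:ℝ) 1, ∀ ε > 0, ∃ y ∈ Ioo (0:ℝ) 1, ∀ᶠ n : ℕ in atTop,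
      Fn A B p n (γ x) ≤ Real.exp (ε*n) * Fn A B p n (γ y) ∧ Fn A B p n (γ y) ≤ Real.exp (ε*n) * Fn A B p n (γ x) := by
    intro x hx ε hε
    have hz := h.ne_of_Gam (hΓ x hx)
    obtain ⟨U, hU, hn⟩ := S.E1' h hε hz.1 hz.2
    have : γ ⁻¹' U ∈ 𝓝 x := hγ.continuous.continuousAt hU
    have hcl : x ∈ closure (Ioo (0:ℝ) 1) := by rw [closure_Ioo (by norm_num)]; exact hx
    obtain ⟨y, hy1, hy2⟩ := mem_closure_iff_nhds.1 hcl _ this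
    refine ⟨y, hy2, hn.mono fun n hn => ⟨hn _ (mem_of_mem_nhds hU) _ hy1, hn _ hy1 _ (mem_of_mem_nhds hU)⟩⟩
  intro ε hε
  obtain ⟨y, hy, e1⟩ := near s hs (ε/4) (by positivity)
  obtain ⟨z, hz, e2⟩ := near t ht (ε/4) (by positivity)
  filter_upwards [e1, e2, core y hy z hz (ε/2) (by positivity)] with n e1 e2 e3
  have r : ∀ x, Real.exp (ε/4*n) * x = Real.exp (ε/2/2*n) * x := fun x => by ring_nf
  rw [r, r] at e1 e2
  constructor
  · have a1 : Fn A B p n (γ s) ≤ Real.exp (ε/2/2 * n) * Fn A B p n (γ y) := e1.1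
    calc _ ≤ Real.exp (ε/2/2 * n) * (Real.exp (ε/2*n) * (Real.exp (ε/2/2 * n) * Fn A B p n (γ t))) :=
          a1.trans (by gcongr; exact e3.1.trans (by gcongr; exact e2.2))
      _ = _ := by rw [← mul_assoc, ← mul_assoc, ← Real.exp_add, ← Real.exp_add]; congr 2; ring
  · calc _ ≤ Real.exp (ε/2/2 * n) * (Real.exp (ε/2*n) * (Real.exp (ε/2/2 * n) * Fn A B p n (γ s))) :=
          e2.1.trans (by gcongr; exact e3.2.trans (by gcongr; exact e1.2))
      _ = _ := by rw [← mul_assoc, ← mul_assoc, ← Real.exp_add, ← Real.exp_add]; congr 2; ring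

def UBN (A B : ℝ) (p : ℕ → ℂ[X]) (z : ℂ) : Prop := ∀ ε > 0, ∀ᶠ n : ℕ in atTop, Fn A B p n z ≤ Real.exp (ε*n)

lemma relF.ubn {p : ℕ → ℂ[X]} {x y : ℂ} (h1 : relF A B p x y) (h2 : UBN A B p x) : UBN A B p y := by
  intro ε hε
  filter_upwards [h1 (ε/2) (by positivity), h2 (ε/2) (by positivity)] with n a b
  have := exp_half_trans (z := 1) a.2 (by simpa using b)
  simpa using this

lemma JSeq.ubn_real (h : Par A B) {p : ℕ → ℂ[X]} {α β : ℕ → ℝ} (S : JSeq A B p α β) {x0 : ℝ}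
    (h1 : -1 < x0) (h2 : x0 < 1) : UBN A B p x0 := by
  intro ε hε
  have z1 : (x0:ℂ) ≠ 1 := by exact_mod_cast h2.ne
  have z2 : (x0:ℂ) ≠ -1 := by exact_mod_cast h1.ne'
  obtain ⟨U, hU, hn⟩ := S.E1' h (half_pos hε) z1 z2
  have cl : ContinuousAt (fun z => Real.log (VV A B z)) (x0:ℂ) := h.VV_cont.continuousAt.log (h.VV_pos x0).ne'
  obtain ⟨r, r0, hr⟩ := Metric.continuousAt_iff.1 cl (ε/32) (by positivity)
  have hV : {z : ℂ | dist z x0 < r} ∈ 𝓝 (x0:ℂ) := Metric.ball_mem_nhds _ r0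
  have ev : ∀ᶠ x : ℝ in 𝓝 x0, (x:ℂ) ∈ U ∩ {z : ℂ | dist z x0 < r} :=
    continuous_ofReal.continuousAt (inter_mem hU hV)
  obtain ⟨ρ, ρ0, hρ⟩ := Metric.nhds_basis_closedBall.mem_iff.1 ev
  set x1 := min (x0 + ρ) ((x0+1)/2) with hx1
  have x01 : x0 < x1 := by rw [hx1]; exact lt_min (by linarith) (by linarith)
  have x11 : x1 < 1 := (min_le_right _ _).trans_lt (by linarith)
  have sub : ∀ x ∈ Icc x0 x1, (x:ℂ) ∈ U ∧ dist (x:ℂ) x0 < r := by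
    intro x hx
    refine hρ (Metric.mem_closedBall.2 ?_)
    have := min_le_left (x0 + ρ) ((x0+1)/2)
    rw [Real.dist_eq, abs_of_nonneg (by linarith [hx.1])]
    linarith [hx.2]
  set c := 1 + (2/(x1-x0))^2 with hc
  have c0 : 0 < c := by rw [hc]; positivity
  have lim : ∀ᶠ n : ℕ in atTop, Real.log c / n < ε/4 :=
    (tendsto_const_div_atTop_nhds_zero_nat _).eventually_lt_const (by positivity)
  filter_upwards [hn, h.E5 S (a' := x0) (b' := x1) h1 h2 x11 (by linarith) (show 0 < ε/32 by positivity), lim,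
    eventually_ge_atTop 1] with n hn h5 hl hn1
  have n0 : (1:ℝ) ≤ n := by exact_mod_cast hn1
  have lc : c ≤ Real.exp (ε/4*n) := by
    rw [← Real.exp_log c0]
    apply Real.exp_le_exp.2
    rw [div_lt_iff₀ (by linarith)] at hl; exact hl.le
  set T := Real.exp (n * (Real.log (VV A B x0) + ε/16)) with hT
  have bd : ∀ x ∈ Icc x0 x1, ‖(p n).eval (x:ℂ)‖ ≤ T := by
    intro x hx
    refine (h5 x hx).trans ?_
    rw [← exp_log_pow (h.VV_pos _), ← Real.exp_add]
    apply Real.exp_le_exp.2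
    have := hr (sub x hx).2
    rw [Real.dist_eq, abs_lt] at this
    nlinarith
  obtain ⟨ξ, hξ, e⟩ := exists_hasDerivAt_eq_slope (fun x : ℝ => ((p n).eval (x:ℂ)).re) _ x01
    (fun x _ => (poly_re_deriv (p n) x).continuousAt.continuousWithinAt) (fun x _ => poly_re_deriv (p n) x)
  have hξ' := Ioo_subset_Icc_self hξ
  have bD : ‖Dn p n ξ‖ ≤ 2/(x1-x0) * T := by
    unfold Dn
    rw [norm_div, Complex.norm_natCast, norm_real_eval (q := derivative (p n)) (real_deriv (S.real n)), e, abs_div,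
      abs_of_pos (show 0 < x1 - x0 by linarith)]
    have i1 := bd x0 (left_mem_Icc.2 x01.le)
    have i2 := bd x1 (right_mem_Icc.2 x01.le)
    have i3 : |((p n).eval (x1:ℂ)).re - ((p n).eval (x0:ℂ)).re| ≤ 2 * T := by
      refine (abs_sub _ _).trans ?_
      linarith [abs_re_le_norm ((p n).eval (x1:ℂ)), abs_re_le_norm ((p n).eval (x0:ℂ))]
    have x10 : 0 < x1 - x0 := by linarith
    calc _ ≤ |((p n).eval (x1:ℂ)).re - ((p n).eval (x0:ℂ)).re| / (x1 - x0) := div_le_self (by positivity) n0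
      _ ≤ 2 * T / (x1 - x0) := by gcongr
      _ = _ := by ring
  have bN : NN p n ξ ≤ c * T^2 := by
    have i1 := pow_le_pow_left₀ (norm_nonneg _) (bd ξ hξ') 2
    have i2 := pow_le_pow_left₀ (norm_nonneg _) bD 2
    have e : NN p n ξ = ‖(p n).eval (ξ:ℂ)‖^2 + ‖Dn p n ξ‖^2 := rfl
    rw [e, hc]; nlinarith
  have bF : Fn A B p n ξ ≤ Real.exp (ε/2*n) * 1 := by
    rw [h.Fn_eq]
    calc _ ≤ (Real.exp (ε/4*n) * T^2) * Real.exp (-(2*n*Real.log (VV A B ξ))) := by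
          gcongr; exact bN.trans (by gcongr)
      _ ≤ _ := by
        rw [hT, ← Real.exp_nat_mul, ← Real.exp_add, ← Real.exp_add, mul_one]
        apply Real.exp_le_exp.2
        have := hr (sub ξ hξ').2
        rw [Real.dist_eq, abs_lt] at this
        push_cast
        nlinarith
  have := exp_half_trans (hn _ (mem_of_mem_nhds hU) _ (sub ξ hξ').1) bF
  simpa using this

lemma Par.arc_facts (h : Par A B) {γL γC γR : ℝ → ℂ} (hr : ArcParam A B γL γC γR) :
    ((∀ t ∈ Icc (0:ℝ) 1, γL t ∈ Gam A B) ∧ (∀ t ∈ Icc (0:ℝ) 1, γC t ∈ Gam A B) ∧ (∀ t ∈ Icc (0:ℝ) 1, γR t ∈ Gam A B)) ∧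
    (∀ t ∈ Ioo (0:ℝ) 1, Qf A B (γL t) ≠ 0) ∧ (∀ t ∈ Ioo (0:ℝ) 1, Qf A B (γC t) ≠ 0) ∧ (∀ t ∈ Ioo (0:ℝ) 1, Qf A B (γR t) ≠ 0) := by
  have hu := hr.union
  rw [h.Gamma_eq] at hu
  have z0 : (0:ℝ) ∈ Icc (0:ℝ) 1 := by simp
  have z1 : (1:ℝ) ∈ Icc (0:ℝ) 1 := by simp
  have key : ∀ γ : ℝ → ℂ, InjOn γ (Icc 0 1) → (zetaP A B = γ 0 ∧ zetaM A B = γ 1 ∨ zetaP A B = γ 1 ∧ zetaM A B = γ 0) →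
      ∀ t ∈ Ioo (0:ℝ) 1, Qf A B (γ t) ≠ 0 := by
    intro γ hi he t ht e
    have a0 : γ t ≠ γ 0 := fun e => ht.1.ne' (hi (Ioo_subset_Icc_self ht) z0 e)
    have a1 : γ t ≠ γ 1 := fun e => ht.2.ne (hi (Ioo_subset_Icc_self ht) z1 e)
    rw [← h.Q_eq, mul_eq_zero, sub_eq_zero, sub_eq_zero] at e
    rcases he with ⟨e1, e2⟩ | ⟨e1, e2⟩ <;> rw [e1, e2] at e <;> tauto
  refine ⟨⟨?_, ?_, ?_⟩, key _ hr.injL (Or.inl ⟨hr.endL0.symm, hr.endL1.symm⟩),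
    key _ hr.injC (Or.inl ⟨hr.endC0.symm, hr.endC1.symm⟩), key _ hr.injR (Or.inr ⟨hr.endR1.symm, hr.endR0.symm⟩)⟩
  · intro t ht; rw [← hu]; exact Or.inl (Or.inl ⟨t, ht, rfl⟩)
  · intro t ht; rw [← hu]; exact Or.inl (Or.inr ⟨t, ht, rfl⟩)
  · intro t ht; rw [← hu]; exact Or.inr ⟨t, ht, rfl⟩

lemma Par.Gam_compact (h : Par A B) {γL γC γR : ℝ → ℂ} (hr : ArcParam A B γL γC γR) : IsCompact (Gam A B) := by
  rw [← h.Gamma_eq, ← hr.union]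
  exact ((isCompact_Icc.image hr.smoothL.continuous).union (isCompact_Icc.image hr.smoothC.continuous)).union
    (isCompact_Icc.image hr.smoothR.continuous)

lemma JSeq.ubn_Gam (h : Par A B) {p : ℕ → ℂ[X]} {α β : ℕ → ℝ} (S : JSeq A B p α β)
    {γL γC γR : ℝ → ℂ} (hr : ArcParam A B γL γC γR) : ∀ z ∈ Gam A B, UBN A B p z := by
  obtain ⟨⟨gL, gC, gR⟩, qL, qC, qR⟩ := h.arc_facts hr
  have z0 : (0:ℝ) ∈ Icc (0:ℝ) 1 := by simp
  have z1 : (1:ℝ) ∈ Icc (0:ℝ) 1 := by simp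
  have hk := h.kk_pos
  have i0 : (γC 0).im = kk A B := by rw [hr.endC0, h.zetaP_eq]; simp
  have i1 : (γC 1).im = - kk A B := by rw [hr.endC1, h.zetaM_eq]; simp
  have : (0:ℝ) ∈ (fun t => (γC t).im) '' Icc 0 1 :=
    intermediate_value_Icc' zero_le_one (continuous_im.comp hr.smoothC.continuous).continuousOn
      ⟨by show (γC 1).im ≤ 0; rw [i1]; linarith, by show 0 ≤ (γC 0).im; rw [i0]; linarith⟩
  obtain ⟨t0, ht0, e0⟩ := this
  have hc := hr.crossC t0 ht0 e0
  have u0 := S.ubn_real h hc.1 hc.2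
  have ex : (((γC t0).re : ℝ) : ℂ) = γC t0 := by
    apply Complex.ext <;> simp; exact e0.symm
  rw [ex] at u0
  have uC : ∀ t ∈ Icc (0:ℝ) 1, UBN A B p (γC t) := fun t ht => (S.relF_Icc h hr.smoothC gC qC ht0 ht).ubn u0
  have uP : UBN A B p (zetaP A B) := hr.endC0 ▸ uC 0 z0
  have uL : ∀ t ∈ Icc (0:ℝ) 1, UBN A B p (γL t) := fun t ht =>
    (S.relF_Icc h hr.smoothL gL qL z0 ht).ubn (hr.endL0.symm ▸ uP)
  have uR : ∀ t ∈ Icc (0:ℝ) 1, UBN A B p (γR t) := fun t ht =>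
    (S.relF_Icc h hr.smoothR gR qR z1 ht).ubn (hr.endR1.symm ▸ uP)
  intro z hz
  rw [← h.Gamma_eq, ← hr.union] at hz
  rcases hz with (⟨t, ht, rfl⟩ | ⟨t, ht, rfl⟩) | ⟨t, ht, rfl⟩
  · exact uL t ht
  · exact uC t ht
  · exact uR t ht

/-- uniform upper bound on Γ -/
lemma JSeq.ub_Gam (h : Par A B) {p : ℕ → ℂ[X]} {α β : ℕ → ℝ} (S : JSeq A B p α β)
    {γL γC γR : ℝ → ℂ} (hr : ArcParam A B γL γC γR) {ε : ℝ} (hε : 0 < ε) :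
    ∀ᶠ n : ℕ in atTop, ∀ z ∈ Gam A B, ‖(p n).eval z‖ ≤ Real.exp (ε*n) * VV A B z ^ n := by
  have : ∀ᶠ n : ℕ in atTop, ∀ z ∈ Gam A B, Fn A B p n z ≤ Real.exp (ε*n) := by
    refine (h.Gam_compact hr).induction_on (p := fun s => ∀ᶠ n : ℕ in atTop, ∀ z ∈ s, Fn A B p n z ≤ Real.exp (ε*n))
      ?_ ?_ ?_ ?_
    · simp
    · intro s t hst ht; exact ht.mono fun n hn z hz => hn z (hst hz)
    · intro s t hs ht
      filter_upwards [hs, ht] with n a b z hz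
      exact hz.elim (a z) (b z)
    · intro z hz
      have hz' := h.ne_of_Gam hz
      obtain ⟨U, hU, hn⟩ := S.E1' h (half_pos hε) hz'.1 hz'.2
      refine ⟨U, mem_nhdsWithin_of_mem_nhds hU, ?_⟩
      filter_upwards [hn, S.ubn_Gam h hr z hz (ε/2) (half_pos hε)] with n a b w hw
      have := exp_half_trans (z := 1) (a w hw z (mem_of_mem_nhds hU)) (by simpa using b)
      simpa using this
  filter_upwards [this] with n hn z hz
  have a := hn z hz
  rw [Fn, div_le_iff₀ (pow_pos (h.VV_pos z) _)] at a
  have b : ‖(p n).eval z‖^2 ≤ NN p n z := by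
    have : NN p n z = ‖(p n).eval z‖^2 + ‖Dn p n z‖^2 := rfl
    rw [this]; linarith [sq_nonneg ‖Dn p n z‖]
  have n0 : (0:ℝ) ≤ ε * n := by positivity
  have e1 : 1 ≤ Real.exp (ε*n) := Real.one_le_exp n0
  have v0 := pow_pos (h.VV_pos z) n
  apply le_of_sq_le_sq _ (by positivity)
  rw [mul_pow, ← pow_mul, mul_comm n 2]
  refine (b.trans a).trans ?_
  exact mul_le_mul_of_nonneg_right (by nlinarith) (pow_nonneg (h.VV_pos z).le _)

end

section
variable {A B : ℝ}

/-- the uniformised coordinate at infinity -/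
def us (A B : ℝ) (w : ℂ) : ℂ := (1 - mm A B * w) + ((1 - mm A B * w)^2 + (kk A B)^2 * w^2)^(1/2:ℂ)

def Lam (A B : ℝ) (w : ℂ) : ℝ :=
  -A * Real.log ‖us A B w - P1 A B * w‖ + -B * Real.log ‖us A B w - N1 A B * w‖ + (A+B+1) * Real.log ‖us A B w‖

lemma us_zero : us A B 0 = 2 := by unfold us; norm_num

lemma us_analytic : AnalyticAt ℂ (us A B) 0 := by
  unfold us
  refine AnalyticAt.add (by fun_prop) (AnalyticAt.cpow (by fun_prop) (by fun_prop) ?_)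
  simp

lemma Lam_zero : Lam A B 0 = Real.log 2 := by
  unfold Lam; rw [us_zero]; norm_num; ring

lemma Lam_harmonic : InnerProductSpace.HarmonicAt (Lam A B) 0 := by
  have b0 := (us_analytic (A := A) (B := B)).harmonicAt_log_norm (by rw [us_zero]; norm_num)
  have b1 := (show AnalyticAt ℂ (fun w => us A B w - P1 A B * w) 0 from us_analytic.sub (by fun_prop)).harmonicAt_log_norm
    (by rw [us_zero]; norm_num)
  have b2 := (show AnalyticAt ℂ (fun w => us A B w - N1 A B * w) 0 from us_analytic.sub (by fun_prop)).harmonicAt_log_norm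
    (by rw [us_zero]; norm_num)
  exact ((b1.const_smul (c := -A)).add (b2.const_smul (c := -B))).add (b0.const_smul (c := A+B+1))

lemma Par.VV_inf' (h : Par A B) : ∀ᶠ w in 𝓝[≠] (0:ℂ), Real.log (VV A B (w⁻¹)) = Lam A B w - Real.log ‖w‖ ∧
    dg A B w⁻¹ = (((1 - mm A B * w)^2 + (kk A B)^2 * w^2)^(1/2:ℂ)) / w := by
  have cu := (us_analytic (A := A) (B := B)).continuousAt
  have e0 : ∀ᶠ w in 𝓝 (0:ℂ), us A B w ≠ 0 := cu.eventually_ne (by rw [us_zero]; norm_num)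
  have e1 : ∀ᶠ w in 𝓝 (0:ℂ), us A B w - P1 A B * w ≠ 0 :=
    (cu.sub (by fun_prop)).eventually_ne (by simp [us_zero])
  have e2 : ∀ᶠ w in 𝓝 (0:ℂ), us A B w - N1 A B * w ≠ 0 :=
    (cu.sub (by fun_prop)).eventually_ne (by simp [us_zero])
  have d1 := h.hd
  have c1 : Tendsto (fun w : ℂ => (‖-(kk A B)^2 * w / us A B w - P1 A B‖ ^ (-A) * ‖-(kk A B)^2 * w / us A B w - N1 A B‖^(-B) *
     (‖(-(kk A B)^2 / us A B w : ℂ)‖^(A+B+1))) * ‖w‖^(A+B+2)) (𝓝 0) (𝓝 0) := by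
    have : ContinuousAt (fun w : ℂ => (‖-(kk A B)^2 * w / us A B w - P1 A B‖ ^ (-A) * ‖-(kk A B)^2 * w / us A B w - N1 A B‖^(-B) *
      (‖(-(kk A B)^2 / us A B w : ℂ)‖^(A+B+1))) * ‖w‖^(A+B+2)) 0 := by
      have u2 : us A B 0 ≠ 0 := by rw [us_zero]; norm_num
      have k0 : (kk A B : ℂ) ≠ 0 := by exact_mod_cast h.kk_pos.ne'
      refine ContinuousAt.mul (ContinuousAt.mul (ContinuousAt.mul ?_ ?_) ?_) ?_
      · refine ContinuousAt.rpow_const (ContinuousAt.norm (ContinuousAt.sub (ContinuousAt.div (by fun_prop) cu u2) (by fun_prop))) (Or.inr (by linarith [h.hA0]))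
      · refine ContinuousAt.rpow_const (ContinuousAt.norm (ContinuousAt.sub (ContinuousAt.div (by fun_prop) cu u2) (by fun_prop))) (Or.inr (by linarith [h.hB0]))
      · refine ContinuousAt.rpow_const (ContinuousAt.norm (ContinuousAt.div (by fun_prop) cu u2)) (Or.inl ?_)
        rw [norm_ne_zero_iff]; exact div_ne_zero (by simp [k0]) u2
      · exact ContinuousAt.rpow_const (by fun_prop) (Or.inr h.hs.le)
    have := this.tendsto
    simp only [norm_zero, Real.zero_rpow h.hs.ne', mul_zero] at this
    exact this
  have c2 : ContinuousAt (Lam A B) 0 := by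
    unfold Lam
    refine ContinuousAt.add (ContinuousAt.add ?_ ?_) ?_
    · exact continuousAt_const.mul ((cu.sub (by fun_prop)).norm.log (by simp [us_zero]))
    · exact continuousAt_const.mul ((cu.sub (by fun_prop)).norm.log (by simp [us_zero]))
    · exact continuousAt_const.mul (cu.norm.log (by simp [us_zero]))
  have e3 := c1.eventually_lt_const (show (0:ℝ) < 1 by norm_num)
  have e4 : ∀ᶠ w in 𝓝 (0:ℂ), 0 < Lam A B w := c2.tendsto.eventually_const_lt (by rw [Lam_zero]; exact Real.log_pos (by norm_num))
  filter_upwards [nhdsWithin_le_nhds e0, nhdsWithin_le_nhds e1, nhdsWithin_le_nhds e2, nhdsWithin_le_nhds e3,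
    nhdsWithin_le_nhds e4, self_mem_nhdsWithin] with w e0 e1 e2 e3 e4 w0
  have w0 : w ≠ 0 := w0
  set g := (((1 - mm A B * w)^2 + (kk A B)^2 * w^2)^(1/2:ℂ)) / w with hg
  have gsq : g^2 = Qf A B w⁻¹ := by
    rw [hg, div_pow, csqrt_sq]; unfold Qf; field_simp
  have hu : w⁻¹ - mm A B + g = us A B w / w := by rw [hg]; unfold us; field_simp
  have hu2 : w⁻¹ - mm A B - g = -(kk A B)^2 * w / us A B w := by
    have := sheet_mul gsq
    rw [hu] at this
    rw [eq_div_iff e0]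
    have h2 : us A B w / w * w = us A B w := div_mul_cancel₀ _ w0
    generalize us A B w / w = U at this h2
    rw [← h2]
    clear_value g
    linear_combination w * this
  have nw : 0 < ‖w‖ := norm_pos_iff.2 w0
  have n0 := norm_pos_iff.2 e0
  have n1 := norm_pos_iff.2 e1
  have n2 := norm_pos_iff.2 e2
  have x1 : Real.log (XX A B (us A B w / w)) = Lam A B w - Real.log ‖w‖ := by
    have f1 : us A B w / w - P1 A B = (us A B w - P1 A B * w)/w := by rw [sub_div, mul_div_cancel_right₀ _ w0]
    have f2 : us A B w / w - N1 A B = (us A B w - N1 A B * w)/w := by rw [sub_div, mul_div_cancel_right₀ _ w0]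
    rw [log_XX (div_ne_zero e0 w0) (by rw [f1]; exact div_ne_zero e1 w0) (by rw [f2]; exact div_ne_zero e2 w0)]
    unfold LX Lam
    rw [f1, f2, norm_div, norm_div, norm_div, Real.log_div n1.ne' nw.ne', Real.log_div n2.ne' nw.ne', Real.log_div n0.ne' nw.ne']
    ring
  have x1' : XX A B (us A B w / w) = Real.exp (Lam A B w) / ‖w‖ := by
    have : 0 < XX A B (us A B w / w) := by
      have f1 : us A B w / w - P1 A B = (us A B w - P1 A B * w)/w := by rw [sub_div, mul_div_cancel_right₀ _ w0]
      have f2 : us A B w / w - N1 A B = (us A B w - N1 A B * w)/w := by rw [sub_div, mul_div_cancel_right₀ _ w0]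
      exact XX_pos (div_ne_zero e0 w0) (by rw [f1]; exact div_ne_zero e1 w0) (by rw [f2]; exact div_ne_zero e2 w0)
    rw [← Real.exp_log this, x1, Real.exp_sub, Real.exp_log nw]
  have x2 : XX A B (-(kk A B)^2 * w / us A B w) ≤ 1 / ‖w‖ := by
    rw [le_div_iff₀ nw]
    refine le_trans (le_of_eq ?_) e3.le
    unfold XX
    rw [show (-(kk A B)^2 * w / us A B w : ℂ) = (-(kk A B)^2 / us A B w) * w by ring, norm_mul _ w,
      Real.mul_rpow (norm_nonneg _) (norm_nonneg _), show ‖w‖^(A+B+2) = ‖w‖^(A+B+1) * ‖w‖ by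
        rw [show A+B+2 = (A+B+1)+1 by ring, Real.rpow_add nw, Real.rpow_one]]
    generalize ‖w‖^(A+B+1) = q1
    generalize ‖(-(kk A B)^2 / us A B w : ℂ)‖^(A+B+1) = q2
    ring
  have x3 : XX A B (-(kk A B)^2 * w / us A B w) < XX A B (us A B w / w) := by
    rw [x1']
    refine x2.trans_lt ?_
    gcongr
    exact Real.one_lt_exp_iff.2 e4
  refine ⟨by rw [VV_eq_max gsq, hu, hu2, max_eq_left x3.le, x1], dg_eq gsq ?_⟩
  rw [hu, hu2]; exact x3

lemma Par.VV_inf (h : Par A B) : ∀ᶠ w in 𝓝[≠] (0:ℂ), Real.log (VV A B (w⁻¹)) = Lam A B w - Real.log ‖w‖ :=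
  h.VV_inf'.mono fun _ hw => hw.1

lemma Par.loc_exp (h : Par A B) {z0 : ℂ} (hz : z0 ∉ Gam A B) :
    ∃ r > 0, ∃ F : ℂ → ℂ, AnalyticOnNhd ℂ F (Metric.ball z0 r) ∧
      ∀ z ∈ Metric.ball z0 r, z ∉ Gam A B ∧ Real.log (VV A B z) = (F z).re := by
  obtain ⟨r, r0, hr⟩ := Metric.isOpen_iff.1 h.Gam_closed.isOpen_compl z0 hz
  obtain ⟨F, hF, e⟩ := InnerProductSpace.HarmonicOnNhd.exists_analyticOnNhd_ball_re_eq
    (f := fun z => Real.log (VV A B z)) (z := z0) (R := r) (fun z hz => h.harmonic_log_VV (hr hz))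
  exact ⟨r, r0, F, hF, fun z hz => ⟨hr hz, (e hz).symm⟩⟩

/-- reversed polynomial -/
def qn (p : ℕ → ℂ[X]) (n : ℕ) : ℂ[X] := (p n).reflect n

lemma JSeq.qn_eval {p : ℕ → ℂ[X]} {α β : ℕ → ℝ} (S : JSeq A B p α β) (n : ℕ) {w : ℂ} (hw : w ≠ 0) :
    (qn p n).eval w = w^n * (p n).eval w⁻¹ := by
  have hi : Invertible w⁻¹ := invertibleOfNonzero (inv_ne_zero hw)
  have := eval₂_reflect_mul_pow (RingHom.id ℂ) w⁻¹ n (p n) (S.deg n)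
  rw [invOf_eq_inv, inv_inv] at this
  unfold qn
  rw [Polynomial.eval, Polynomial.eval, ← this, mul_left_comm, ← mul_pow, mul_inv_cancel₀ hw, one_pow, mul_one]

lemma qn_zero (p : ℕ → ℂ[X]) (n : ℕ) : (qn p n).eval 0 = (p n).coeff n := by
  unfold qn
  rw [← Polynomial.coeff_zero_eq_eval_zero, coeff_reflect, revAt_le (Nat.zero_le n), Nat.sub_zero]

lemma Par.VV_pow (h : Par A B) (n : ℕ) (z : ℂ) : VV A B z ^ n = Real.exp (n * Real.log (VV A B z)) :=
  (exp_log_pow (h.VV_pos z) n).symm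

/-- global upper bound -/
lemma JSeq.ub (h : Par A B) {p : ℕ → ℂ[X]} {α β : ℕ → ℝ} (S : JSeq A B p α β)
    {γL γC γR : ℝ → ℂ} (hr : ArcParam A B γL γC γR) {ε : ℝ} (hε : 0 < ε) :
    ∀ᶠ n : ℕ in atTop, ∀ z, ‖(p n).eval z‖ ≤ Real.exp (ε*n) * VV A B z ^ n := by
  filter_upwards [S.ub_Gam h hr (half_pos hε), S.lead (ε/2) (half_pos hε), eventually_gt_atTop 0] with n hG hl hn
  have n0 : (0:ℝ) < n := by exact_mod_cast hn
  set T := Real.exp (ε*n) with hT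
  have hTT : Real.exp (ε/2*n) < T := Real.exp_lt_exp.2 (by nlinarith)
  set u : ℂ → ℝ := fun z => ‖(p n).eval z‖ / VV A B z ^ n with hu
  have cu : Continuous u := by
    refine Continuous.div (p n).continuous.norm (h.VV_cont.pow n) (fun z => (pow_pos (h.VV_pos z) n).ne')
  suffices ∀ z, u z ≤ T by
    intro z
    have := this z
    rwa [hu, div_le_iff₀ (pow_pos (h.VV_pos z) n)] at this
  -- at infinity
  have hinf : ∀ᶠ z in cobounded ℂ, u z < T := by
    have cq : Tendsto (fun w => ‖(qn p n).eval w‖ * Real.exp (-(n * Lam A B w))) (𝓝[≠] 0) (𝓝 (‖(p n).coeff n‖ * Real.exp (-(n*Real.log 2)))) := by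
      rw [← qn_zero, ← Lam_zero (A := A) (B := B)]
      refine Tendsto.mono_left (ContinuousAt.tendsto ?_) nhdsWithin_le_nhds
      have cL : ContinuousAt (Lam A B) 0 := Lam_harmonic.1.continuousAt
      exact (qn p n).continuous.norm.continuousAt.mul (continuousAt_const.mul cL).neg.rexp
    have lt : ‖(p n).coeff n‖ * Real.exp (-(n*Real.log 2)) < T := by
      have := hl.2
      rw [← exp_log_pow two_pos] at this
      calc _ ≤ Real.exp (ε / 2 * n) * Real.exp (n * Real.log 2) * Real.exp (-(n*Real.log 2)) := by gcongr
        _ = Real.exp (ε/2*n) := by rw [mul_assoc, ← Real.exp_add]; simp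
        _ < _ := hTT
    have := (cq.eventually_lt_const lt).and h.VV_inf
    have := (tendsto_inv₀_cobounded' (α := ℂ)).eventually this
    filter_upwards [this, eventually_ne_cobounded (0:ℂ)] with z hz z0
    refine lt_of_le_of_lt (le_of_eq ?_) hz.1
    have e2 := hz.2
    rw [inv_inv] at e2
    rw [S.qn_eval n (inv_ne_zero z0), inv_inv, norm_mul, norm_pow]
    simp only [hu]
    rw [h.VV_pow, e2, div_eq_mul_inv, ← Real.exp_neg, mul_comm (‖z⁻¹‖^n), mul_assoc]
    congr 1
    rw [← exp_log_pow (norm_pos_iff.2 (inv_ne_zero z0)), ← Real.exp_add]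
    congr 1; ring
  obtain ⟨R, -, hR⟩ := Filter.hasBasis_cobounded_norm.mem_iff.1 hinf
  intro z1
  by_contra hz1
  push Not at hz1
  obtain ⟨zs, -, hzs⟩ := (isCompact_closedBall (0:ℂ) (max R ‖z1‖)).exists_isMaxOn
    ⟨z1, by simp⟩ cu.continuousOn
  have hmax : ∀ z, u z ≤ u zs := by
    intro z
    by_cases hz : z ∈ Metric.closedBall (0:ℂ) (max R ‖z1‖)
    · exact hzs hz
    · have h1 : u z < T := hR (by
        simp only [Metric.mem_closedBall, dist_zero_right, not_le] at hz
        exact ((le_max_left _ _).trans hz.le))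
      have h2 : u z1 ≤ u zs := hzs (by simp)
      linarith
  have hTs : T < u zs := hz1.trans_le (hmax z1)
  have clo : IsClosed {z | u z = u zs} := isClosed_eq cu continuous_const
  have opn : IsOpen {z | u z = u zs} := by
    rw [isOpen_iff_mem_nhds]
    intro z hz
    have hz : u z = u zs := hz
    have hzG : z ∉ Gam A B := by
      intro hzG
      have h1 := hG z hzG
      rw [← div_le_iff₀ (pow_pos (h.VV_pos z) n)] at h1
      have h1 : u z ≤ _ := h1
      linarith
    obtain ⟨r, r0, F, hF, hFe⟩ := h.loc_exp hzG
    have hnm : ∀ w ∈ Metric.ball z r, ‖(p n).eval w * exp (-(n * F w))‖ = u w := by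
      intro w hw
      rw [norm_mul, Complex.norm_exp]
      simp only [hu]
      rw [h.VV_pow, (hFe w hw).2, div_eq_mul_inv, ← Real.exp_neg]
      simp
    have hb := Metric.ball_mem_nhds z r0
    have hd : ∀ᶠ w in 𝓝 z, DifferentiableAt ℂ (fun w => (p n).eval w * exp (-(n * F w))) w := by
      filter_upwards [hb] with w hw
      exact (p n).differentiable.differentiableAt.mul ((((hF w hw).differentiableAt).const_mul _).neg.cexp)
    have := Complex.norm_eventually_eq_of_isLocalMax hd (by
      filter_upwards [hb] with w hw
      simp only [Function.comp]
      rw [hnm w hw, hnm z (Metric.mem_ball_self r0), hz]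
      exact hmax w)
    filter_upwards [this, hb] with w hw hwb
    rw [hnm w hwb, hnm z (Metric.mem_ball_self r0)] at hw
    exact hw.trans hz
  have huniv := IsClopen.eq_univ ⟨clo, opn⟩ ⟨zs, rfl⟩
  have h1 : u ((max R 0 : ℝ):ℂ) = u zs := by
    have : ((max R 0 : ℝ):ℂ) ∈ {z | u z = u zs} := by rw [huniv]; trivial
    exact this
  have h2 : u ((max R 0 : ℝ):ℂ) < T := hR (by
    show R ≤ ‖((max R 0 : ℝ):ℂ)‖
    rw [Complex.norm_real, Real.norm_eq_abs, abs_of_nonneg (le_max_right _ _)]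
    exact le_max_left _ _)
  linarith

end

section
variable {A B : ℝ}

lemma rot_close {K : ℕ} (hK : 0 < K) {x y : ℂ} (hxy : ‖x‖ = ‖y‖) (hx : x ≠ 0) :
    ∃ k < K, ‖exp (2*Real.pi*I*(k/K)) * x - y‖ ≤ 2*Real.pi*‖y‖/K := by
  have hK' : (0:ℝ) < K := by exact_mod_cast hK
  have pi := Real.pi_pos
  obtain ⟨t, t0, t1, ht⟩ : ∃ t : ℝ, 0 ≤ t ∧ t < 2*Real.pi ∧ y = exp (I*t) * x := by
    have hy : y / x = exp (I * arg (y/x)) := by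
      have := norm_mul_exp_arg_mul_I (y/x)
      rw [norm_div, hxy, div_self (by rw [← hxy]; exact norm_ne_zero_iff.2 hx), ofReal_one, one_mul, mul_comm] at this
      exact this.symm
    have hy' : y = exp (I * arg (y/x)) * x := by rw [← hy]; field_simp
    by_cases ha : 0 ≤ arg (y/x)
    · exact ⟨arg (y/x), ha, by linarith [arg_le_pi (y/x)], hy'⟩
    · refine ⟨arg (y/x) + 2*Real.pi, by linarith [neg_pi_lt_arg (y/x)], by linarith, ?_⟩
      push_cast
      rw [show I * ((arg (y/x):ℂ) + 2*Real.pi) = I * arg (y/x) + 2*Real.pi*I by ring, exp_add, exp_two_pi_mul_I, mul_one]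
      exact hy'
  refine ⟨⌊t*K/(2*Real.pi)⌋₊, ?_, ?_⟩
  · rw [Nat.floor_lt (by positivity), div_lt_iff₀ (by positivity)]
    nlinarith
  · have f1 := Nat.floor_le (show 0 ≤ t*K/(2*Real.pi) by positivity)
    have f2 := Nat.lt_floor_add_one (t*K/(2*Real.pi))
    set k := ⌊t*K/(2*Real.pi)⌋₊
    have e : exp (2*Real.pi*I*(k/K)) * x - y = (exp (I * ((2*Real.pi*k/K - t : ℝ):ℂ)) - 1) * y := by
      rw [ht]
      have : exp (2*Real.pi*I*(k/K)) = exp (I * ((2*Real.pi*k/K - t : ℝ):ℂ)) * exp (I*t) := by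
        rw [← exp_add]; congr 1; push_cast; ring
      rw [this]; ring
    rw [e, norm_mul]
    have := Real.norm_exp_I_mul_ofReal_sub_one_le (x := 2*Real.pi*k/K - t)
    have h2 : ‖2*Real.pi*k/K - t‖ ≤ 2*Real.pi/K := by
      rw [le_div_iff₀ (by positivity)] at f1
      rw [div_lt_iff₀ (by positivity)] at f2
      rw [Real.norm_eq_abs, abs_le]
      constructor
      · rw [neg_le_iff_add_nonneg, show 2*Real.pi*k/K - t + 2*Real.pi/K = ((k+1)*(2*Real.pi) - t*K)/K by field_simp; ring]
        exact div_nonneg (by linarith) hK'.le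
      · rw [← sub_nonneg, show 2*Real.pi/K - (2*Real.pi*k/K - t) = (2*Real.pi + (t*K - k*(2*Real.pi)))/K by field_simp; ring]
        exact div_nonneg (by linarith) hK'.le
    calc _ ≤ 2*Real.pi/K * ‖y‖ := by gcongr; exact this.trans h2
      _ = _ := by ring

lemma rot_ineq {F : ℂ → ℂ} {c w1 : ℂ} {M m η : ℝ} {K : ℕ} (hK : 0 < K)
    (hη : 2*Real.pi*‖w1 - c‖ < K*η) (_hm : 0 ≤ m)
    (hF : DifferentiableOn ℂ F (Metric.closedBall c ‖w1-c‖))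
    (hM : ∀ z ∈ Metric.closedBall c ‖w1-c‖, ‖F z‖ ≤ M) (hm' : ∀ z ∈ Metric.ball w1 η, ‖F z‖ ≤ m) :
    ‖F c‖^K ≤ M^(K-1) * m := by
  have hK' : (0:ℝ) < K := by exact_mod_cast hK
  have hη0 : 0 < η := by
    have : 0 ≤ 2*Real.pi*‖w1 - c‖ := by have := Real.pi_pos; positivity
    by_contra h; push Not at h; nlinarith
  have hM0 : 0 ≤ M := (norm_nonneg _).trans (hM c (by simp))
  by_cases hw : w1 = c
  · have h1 := hM c (by simp)
    have h2 := hm' c (by rw [hw]; simpa using hη0)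
    obtain ⟨k, rfl⟩ : ∃ k, K = k+1 := ⟨K-1, by omega⟩
    rw [pow_succ]; simp only [Nat.add_sub_cancel]; gcongr
  have ρ0 : 0 < ‖w1 - c‖ := norm_pos_iff.2 (sub_ne_zero.2 hw)
  set ρ := ‖w1-c‖ with hρ
  have unit : ∀ k : ℕ, ‖exp (2*Real.pi*I*(k/K))‖ = 1 := by
    intro k
    rw [show 2*Real.pi*I*(k/K) = ((2*Real.pi*(k/K) : ℝ):ℂ)*I by push_cast; ring, norm_exp_ofReal_mul_I]
  have maps : ∀ k : ℕ, ∀ z ∈ Metric.closedBall c ρ, c + exp (2*Real.pi*I*(k/K)) * (z-c) ∈ Metric.closedBall c ρ := by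
    intro k z hz
    rw [mem_closedBall_iff_norm] at hz ⊢
    rw [add_sub_cancel_left, norm_mul, unit, one_mul]; exact hz
  set G : ℂ → ℂ := fun z => ∏ k ∈ Finset.range K, F (c + exp (2*Real.pi*I*(k/K)) * (z-c)) with hG
  have hd : DifferentiableOn ℂ G (Metric.closedBall c ρ) := by
    refine DifferentiableOn.fun_finsetProd (fun k _ => ?_)
    exact hF.comp (by fun_prop) (maps k)
  have key := norm_le_of_forall_mem_frontier_norm_le (f := G) (U := Metric.ball c ρ) Metric.isBounded_ball
    (C := M^(K-1)*m) (by
      apply DifferentiableOn.diffContOnCl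
      rw [closure_ball c ρ0.ne']; exact hd) (by
      intro z hz
      rw [frontier_ball c ρ0.ne', mem_sphere_iff_norm] at hz
      obtain ⟨k, hk, hkk⟩ := rot_close hK (x := z - c) (y := w1 - c) (by rw [hz]) (by
        rw [← norm_pos_iff, hz]; exact ρ0)
      have hzc : z ∈ Metric.closedBall c ρ := by rw [mem_closedBall_iff_norm, hz]
      simp only [hG]
      rw [norm_prod, ← Finset.mul_prod_erase _ _ (Finset.mem_range.2 hk), mul_comm]
      refine mul_le_mul ?_ (hm' _ ?_) (norm_nonneg _) (pow_nonneg hM0 _)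
      · refine (Finset.prod_le_prod (fun j _ => norm_nonneg _) (fun j _ => hM _ (maps j z hzc))).trans (le_of_eq ?_)
        rw [Finset.prod_const, Finset.card_erase_of_mem (Finset.mem_range.2 hk), Finset.card_range]
      · rw [mem_ball_iff_norm, show c + exp (2*Real.pi*I*(k/K)) * (z-c) - w1 = exp (2*Real.pi*I*(k/K)) * (z-c) - (w1 - c) by ring]
        refine hkk.trans_lt ?_
        rw [div_lt_iff₀ hK', mul_comm η]; exact hη)
    (z := c) (subset_closure (Metric.mem_ball_self ρ0))
  simpa [hG] using key

/-- propagation of lower bounds -/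
lemma lb_prop {f : ℕ → ℂ → ℂ} {z0 : ℂ} {r : ℝ} (r0 : 0 < r)
    (hf : ∀ n, DifferentiableOn ℂ (f n) (Metric.ball z0 r))
    (ub : ∀ ε > 0, ∀ᶠ n : ℕ in atTop, ∀ z ∈ Metric.ball z0 r, ‖f n z‖ ≤ Real.exp (ε*n))
    (lb : ∀ ε > 0, ∀ᶠ n : ℕ in atTop, ∃ z ∈ Metric.ball z0 ε, Real.exp (-(ε*n)) ≤ ‖f n z‖)
    {w : ℂ} (hw : w ∈ Metric.ball z0 (r/4)) :
    ∀ ε > 0, ∀ᶠ n : ℕ in atTop, ∃ z ∈ Metric.ball w ε, Real.exp (-(ε*n)) ≤ ‖f n z‖ := by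
  intro ε hε
  have pi := Real.pi_pos
  obtain ⟨K, hK⟩ := exists_nat_gt (2*Real.pi*r/ε)
  have hK0 : (0:ℝ) < K := lt_trans (by positivity) hK
  have hK1 : 0 < K := by exact_mod_cast hK0
  rw [div_lt_iff₀ hε] at hK
  set e := min (r/4) (ε/(2*K)) with he
  have e0 : 0 < e := by positivity
  filter_upwards [ub e e0, lb e e0, eventually_gt_atTop 0] with n hu hl hn
  have n0 : (0:ℝ) < n := by exact_mod_cast hn
  obtain ⟨c, hc, hlc⟩ := hl
  by_contra hcon
  push Not at hcon
  have hcr : dist c z0 < r/4 := lt_of_lt_of_le hc (min_le_left _ _)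
  have hwr : dist w z0 < r/4 := hw
  have hwc : ‖w - c‖ < r/2 := by
    rw [← dist_eq_norm]
    have := dist_triangle_right w c z0
    linarith
  have sub : Metric.closedBall c ‖w-c‖ ⊆ Metric.ball z0 r := by
    intro z hz
    rw [Metric.mem_closedBall] at hz
    rw [Metric.mem_ball]
    have := dist_triangle z c z0
    linarith
  have := rot_ineq hK1 (F := f n) (c := c) (w1 := w) (M := Real.exp (e*n)) (m := Real.exp (-(ε*n))) (η := ε)
    (by nlinarith) (Real.exp_pos _).le ((hf n).mono sub) (fun z hz => hu z (sub hz)) (fun z hz => (hcon z hz).le)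
  have h2 : Real.exp (-(e*n))^K ≤ Real.exp (e*n)^(K-1) * Real.exp (-(ε*n)) :=
    (pow_le_pow_left₀ (Real.exp_pos _).le hlc K).trans this
  rw [← Real.exp_nat_mul, ← Real.exp_nat_mul, ← Real.exp_add, Real.exp_le_exp, Nat.cast_sub hK1] at h2
  have h3 : e * (2*K) ≤ ε := by
    rw [← le_div_iff₀ (by positivity)]; exact min_le_right _ _
  push_cast at h2
  have : 0 < e * n := by positivity
  nlinarith

/-- lower bound at `z` (in the weak, nearby, sense) -/
def LB (A B : ℝ) (p : ℕ → ℂ[X]) (z : ℂ) : Prop :=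
  ∀ ε > 0, ∀ᶠ n : ℕ in atTop, ∃ w ∈ Metric.ball z ε, Real.exp (-(ε*n)) * VV A B w ^ n ≤ ‖(p n).eval w‖

lemma LB_closed (p : ℕ → ℂ[X]) : IsClosed {z | LB A B p z} := by
  rw [← isSeqClosed_iff_isClosed]
  intro x z hx hz ε hε
  obtain ⟨k, hk⟩ := (hz.eventually (Metric.ball_mem_nhds z (half_pos hε))).exists
  filter_upwards [hx k (ε/2) (half_pos hε)] with n hn
  obtain ⟨w, hw, h1⟩ := hn
  refine ⟨w, ?_, le_trans ?_ h1⟩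
  · rw [Metric.mem_ball] at *
    linarith [dist_triangle w (x k) z]
  · by_cases hV : 0 ≤ VV A B w ^ n
    · gcongr; linarith
    · exact absurd (pow_nonneg (by unfold VV; exact XX_nonneg _) n) hV

lemma JSeq.LB_open (h : Par A B) {p : ℕ → ℂ[X]} {α β : ℕ → ℝ} (S : JSeq A B p α β)
    {γL γC γR : ℝ → ℂ} (hr : ArcParam A B γL γC γR) {z0 : ℂ} (hz : z0 ∉ Gam A B) (hl : LB A B p z0) :
    ∀ᶠ w in 𝓝 z0, LB A B p w := by
  obtain ⟨r, r0, F, hF, hFe⟩ := h.loc_exp hz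
  have hnm : ∀ n : ℕ, ∀ w ∈ Metric.ball z0 r, ‖(p n).eval w * exp (-(n * F w))‖ = ‖(p n).eval w‖ * Real.exp (-(n * Real.log (VV A B w))) := by
    intro n w hw
    rw [norm_mul, Complex.norm_exp, (hFe w hw).2]
    simp
  have conv : ∀ (n : ℕ) (ε : ℝ), ∀ w ∈ Metric.ball z0 r,
      (Real.exp (-(ε*n)) * VV A B w ^ n ≤ ‖(p n).eval w‖ ↔ Real.exp (-(ε*n)) ≤ ‖(p n).eval w * exp (-(n * F w))‖) := by
    intro n ε w hw
    rw [hnm n w hw, h.VV_pow, Real.exp_neg (n * _), ← div_eq_mul_inv, le_div_iff₀ (Real.exp_pos _)]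
  filter_upwards [Metric.ball_mem_nhds z0 (show 0 < r/4 by positivity)] with w hw
  have := lb_prop (f := fun n w => (p n).eval w * exp (-(n * F w))) r0 (fun n => by
      intro z hz
      exact ((p n).differentiable.differentiableAt.mul ((((hF z hz).differentiableAt).const_mul _).neg.cexp)).differentiableWithinAt)
    (fun ε hε => by
      filter_upwards [S.ub h hr hε] with n hn z hz
      rw [hnm n z hz, Real.exp_neg, ← div_eq_mul_inv, div_le_iff₀ (Real.exp_pos _), ← h.VV_pow]
      exact hn z)
    (fun ε hε => by
      filter_upwards [hl (min ε r) (lt_min hε r0)] with n hn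
      obtain ⟨z, hz, hh⟩ := hn
      have hz1 := Metric.ball_subset_ball (min_le_left ε r) hz
      have hz2 := Metric.ball_subset_ball (min_le_right ε r) hz
      refine ⟨z, hz1, ?_⟩
      rw [conv n _ z hz2] at hh
      refine le_trans ?_ hh
      have := min_le_left ε r
      gcongr) hw
  intro ε hε
  filter_upwards [this (min ε (r/4)) (by positivity)] with n hn
  obtain ⟨z, hz, hh⟩ := hn
  have hz1 := Metric.ball_subset_ball (min_le_left ε (r/4)) hz
  have hz2 := Metric.ball_subset_ball (min_le_right ε (r/4)) hz
  have hz3 : z ∈ Metric.ball z0 r := by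
    rw [Metric.mem_ball] at *; linarith [dist_triangle z w z0]
  refine ⟨z, hz1, ?_⟩
  rw [conv n _ z hz3]
  refine le_trans ?_ hh
  have := min_le_left ε (r/4)
  gcongr

lemma JSeq.LB_one {p : ℕ → ℂ[X]} {α β : ℕ → ℝ} (S : JSeq A B p α β) :
    LB A B p 1 ∧ LB A B p (-1) := by
  constructor
  · intro ε hε
    filter_upwards [S.one ε hε] with n hn
    exact ⟨1, Metric.mem_ball_self hε, hn.1⟩
  · intro ε hε
    filter_upwards [S.neg_one ε hε] with n hn
    exact ⟨-1, Metric.mem_ball_self hε, hn.1⟩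

set_option maxHeartbeats 1000000 in
lemma JSeq.LB_inf (h : Par A B) {p : ℕ → ℂ[X]} {α β : ℕ → ℝ} (S : JSeq A B p α β)
    {γL γC γR : ℝ → ℂ} (hr : ArcParam A B γL γC γR) : ∃ R : ℝ, ∀ z : ℂ, R ≤ ‖z‖ → LB A B p z := by
  have h1 : ∀ᶠ w in 𝓝 (0:ℂ), InnerProductSpace.HarmonicAt (Lam A B) w := by
    have := InnerProductSpace.isOpen_setOfPred_harmonicAt (Lam A B)
    exact this.mem_nhds Lam_harmonic
  have h2 : ∀ᶠ w in 𝓝 (0:ℂ), w ≠ 0 → Real.log (VV A B (w⁻¹)) = Lam A B w - Real.log ‖w‖ :=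
    eventually_nhdsWithin_iff.1 h.VV_inf
  obtain ⟨r, r0, hrr⟩ := Metric.eventually_nhds_iff_ball.1 (h1.and h2)
  obtain ⟨F, hF, hFe⟩ := InnerProductSpace.HarmonicOnNhd.exists_analyticOnNhd_ball_re_eq
    (f := Lam A B) (z := 0) (R := r) (fun z hz => (hrr z hz).1)
  have hnm : ∀ n : ℕ, ∀ w ∈ Metric.ball (0:ℂ) r, ‖(qn p n).eval w * exp (-(n * F w))‖ = ‖(qn p n).eval w‖ * Real.exp (-(n * Lam A B w)) := by
    intro n w hw
    rw [norm_mul, Complex.norm_exp, ← hFe hw]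
    simp
  have hnm' : ∀ n : ℕ, ∀ w ∈ Metric.ball (0:ℂ) r, w ≠ 0 → ‖(qn p n).eval w * exp (-(n * F w))‖ = ‖(p n).eval w⁻¹‖ * Real.exp (-(n * Real.log (VV A B w⁻¹))) := by
    intro n w hw w0
    rw [hnm n w hw, (hrr w hw).2 w0, S.qn_eval n w0, norm_mul, norm_pow, ← exp_log_pow (norm_pos_iff.2 w0),
      mul_comm (Real.exp _), mul_assoc, ← Real.exp_add]
    congr 2; ring
  refine ⟨8/r, fun z hz => ?_⟩
  have z0 : 0 < ‖z‖ := lt_of_lt_of_le (by positivity) hz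
  have zne : z ≠ 0 := norm_pos_iff.1 z0
  have hw : z⁻¹ ∈ Metric.ball (0:ℂ) (r/4) := by
    rw [mem_ball_zero_iff, norm_inv, inv_lt_comm₀ z0 (by positivity)]
    refine lt_of_lt_of_le ?_ hz
    rw [inv_div]; gcongr; norm_num
  have key := lb_prop (f := fun n w => (qn p n).eval w * exp (-(n * F w))) r0 (fun n => by
      intro z hz
      exact ((qn p n).differentiable.differentiableAt.mul ((((hF z hz).differentiableAt).const_mul _).neg.cexp)).differentiableWithinAt)
    (fun ε hε => by
      filter_upwards [S.ub h hr hε, S.lead ε hε] with n hn hl z hz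
      by_cases z0 : z = 0
      · subst z0
        rw [hnm n 0 hz, qn_zero, Lam_zero, Real.exp_neg, ← div_eq_mul_inv, div_le_iff₀ (Real.exp_pos _), exp_log_pow two_pos]
        exact hl.2
      · rw [hnm' n z hz z0, Real.exp_neg, ← div_eq_mul_inv, div_le_iff₀ (Real.exp_pos _), ← h.VV_pow]
        exact hn _)
    (fun ε hε => by
      filter_upwards [S.lead ε hε] with n hl
      refine ⟨0, Metric.mem_ball_self hε, ?_⟩
      show _ ≤ ‖(qn p n).eval 0 * exp (-(n * F 0))‖
      rw [hnm n 0 (Metric.mem_ball_self r0), qn_zero, Lam_zero, Real.exp_neg (n * _), ← div_eq_mul_inv, le_div_iff₀ (Real.exp_pos _), exp_log_pow two_pos]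
      exact hl.1) hw
  intro ε hε
  have hcont : ∀ᶠ w in 𝓝 z⁻¹, w ≠ 0 ∧ w⁻¹ ∈ Metric.ball z ε ∧ w ∈ Metric.ball (0:ℂ) r := by
    have c1 : ContinuousAt (fun w : ℂ => w⁻¹) z⁻¹ := continuousAt_inv₀ (inv_ne_zero zne)
    refine (eventually_ne_nhds (inv_ne_zero zne)).and ((c1.eventually ?_).and ?_)
    · show Metric.ball z ε ∈ 𝓝 (z⁻¹⁻¹)
      rw [inv_inv]; exact Metric.ball_mem_nhds z hε
    · exact Metric.isOpen_ball.mem_nhds (Metric.ball_subset_ball (by linarith) hw)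
  obtain ⟨η, η0, hη⟩ := Metric.eventually_nhds_iff_ball.1 hcont
  filter_upwards [key (min ε η) (by positivity)] with n hn
  obtain ⟨w, hw, hh⟩ := hn
  obtain ⟨w0, w1, w2⟩ := hη w (Metric.ball_subset_ball (min_le_right ε η) hw)
  refine ⟨w⁻¹, w1, ?_⟩
  rw [hnm' n w w2 w0, Real.exp_neg (n * _), ← div_eq_mul_inv, le_div_iff₀ (Real.exp_pos _), ← h.VV_pow] at hh
  refine le_trans ?_ hh
  have := min_le_left ε η
  have := h.VV_pos w⁻¹
  gcongr

lemma JSeq.lb (h : Par A B) {p : ℕ → ℂ[X]} {α β : ℕ → ℝ} (S : JSeq A B p α β)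
    {γL γC γR : ℝ → ℂ} (hr : ArcParam A B γL γC γR) {z0 : ℂ} (hz0 : z0 ∉ Gam A B) : LB A B p z0 := by
  by_contra hz0l
  set U := {z | z ∉ Gam A B ∧ ¬ LB A B p z} with hU
  have oU : IsOpen U := (h.Gam_closed.isOpen_compl).inter (LB_closed p).isOpen_compl
  have clU : closure U ⊆ U ∪ Gam A B := by
    intro z hz
    by_cases hzG : z ∈ Gam A B
    · exact Or.inr hzG
    · refine Or.inl ⟨hzG, fun hl => ?_⟩
      have := mem_closure_iff_nhds.1 hz _ (S.LB_open h hr hzG hl)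
      obtain ⟨w, hw, hw2⟩ := this
      exact hw2.2 hw
  obtain ⟨R, hR⟩ := S.LB_inf h hr
  have bU : IsBounded U := by
    refine (Metric.isBounded_ball (x := (0:ℂ)) (r := R)).subset (fun z hz => ?_)
    rw [mem_ball_zero_iff]
    by_contra h1
    exact hz.2 (hR z (not_lt.1 h1))
  obtain ⟨zm, hzm, hmin⟩ := (bU.isCompact_closure).exists_isMinOn ⟨z0, subset_closure ⟨hz0, hz0l⟩⟩
    (f := fun z => vv A B z / VV A B z) (h.vv_cont.div h.VV_cont (fun z => (h.VV_pos z).ne')).continuousOn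
  have lt1 : vv A B zm / VV A B zm < 1 := by
    refine lt_of_le_of_lt (hmin (subset_closure ⟨hz0, hz0l⟩)) ?_
    rw [div_lt_one (h.VV_pos z0)]; exact vv_lt_of_notMem hz0
  have hzU : zm ∈ U := by
    refine (clU hzm).resolve_right (fun hG => ?_)
    have : vv A B zm = VV A B zm := hG
    rw [this, div_self (h.VV_pos zm).ne'] at lt1
    exact lt_irrefl _ lt1
  have ne1 : ∀ z ∈ U, z ≠ 1 ∧ z ≠ -1 := by
    intro z hz
    refine ⟨fun e => hz.2 (e ▸ (S.LB_one).1), fun e => hz.2 (e ▸ (S.LB_one).2)⟩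
  set D := lam A B zm (-dg A B zm) - Hh A B zm with hD
  have hγ : HasDerivAt (fun t : ℝ => zm + t * (starRingEnd ℂ) D) ((starRingEnd ℂ) D) 0 := by
    have := ((hasDerivAt_id (0:ℝ)).ofReal_comp.mul_const ((starRingEnd ℂ) D)).const_add zm
    rw [ofReal_one, one_mul] at this; exact this
  have g0 : zm + ((0:ℝ):ℂ) * (starRingEnd ℂ) D = zm := by simp
  have d1 := h.hasDerivAt_log_vv hγ (by rw [g0]; exact hzU.1) (by rw [g0]; exact (ne1 _ hzU).1) (by rw [g0]; exact (ne1 _ hzU).2)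
  have d2 := h.hasDerivAt_log_VV hγ (by rw [g0]; exact hzU.1)
  have d3 := d1.sub d2
  have hloc : IsLocalMin ((fun t : ℝ => Real.log (vv A B (zm + t * (starRingEnd ℂ) D))) - fun t : ℝ => Real.log (VV A B (zm + t * (starRingEnd ℂ) D))) 0 := by
    have : ∀ᶠ t : ℝ in 𝓝 0, zm + t * (starRingEnd ℂ) D ∈ U := by
      refine hγ.continuousAt.eventually (oU.mem_nhds ?_)
      show zm + ((0:ℝ):ℂ) * (starRingEnd ℂ) D ∈ U
      rw [g0]; exact hzU
    filter_upwards [this] with t ht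
    have hh := hmin (subset_closure ht)
    simp only [Pi.sub_apply]
    rw [show ((0:ℝ):ℂ) = 0 from ofReal_zero, zero_mul, add_zero]
    have v1 := h.vv_pos (ne1 _ hzU).1 (ne1 _ hzU).2
    have v2 := h.vv_pos (ne1 _ ht).1 (ne1 _ ht).2
    rw [← Real.log_div v1.ne' (h.VV_pos _).ne', ← Real.log_div v2.ne' (h.VV_pos _).ne']
    exact Real.log_le_log (div_pos v1 (h.VV_pos _)) hh
  have := hloc.hasDerivAt_eq_zero d3
  rw [g0, ← sub_re, ← sub_mul, ← hD, mul_conj, ofReal_re, normSq_eq_zero] at this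
  rw [hD, h.Hh_eq hzU.1 (ne1 _ hzU).1 (ne1 _ hzU).2, ← neg_sub, Par.lam_sub, neg_eq_zero, mul_eq_zero, div_eq_zero_iff] at this
  have hs : ((A:ℂ)+B+2) ≠ 0 := by exact_mod_cast h.hs.ne'
  rcases this with h1 | h1 | h1
  · exact hs h1
  · exact dg_ne hzU.1 h1
  · have : (zm-1)*(zm+1) = 0 := by linear_combination h1
    rcases mul_eq_zero.1 this with h2 | h2
    · exact (ne1 _ hzU).1 (sub_eq_zero.1 h2)
    · exact (ne1 _ hzU).2 (eq_neg_of_add_eq_zero_left h2)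

end

section
variable {A B : ℝ}

lemma ev_exp_ge {c : ℝ} (hc : 0 < c) (K : ℝ) : ∀ᶠ n : ℕ in atTop, K ≤ Real.exp (c * n) := by
  have : Tendsto (fun n : ℕ => Real.exp (c * n)) atTop atTop :=
    Real.tendsto_exp_atTop.comp (tendsto_natCast_atTop_atTop.const_mul_atTop hc)
  exact this.eventually_ge_atTop K

lemma JSeq.Fn_ub (h : Par A B) {p : ℕ → ℂ[X]} {α β : ℕ → ℝ} (S : JSeq A B p α β)
    {γL γC γR : ℝ → ℂ} (hr : ArcParam A B γL γC γR) (z0 : ℂ) {ε : ℝ} (hε : 0 < ε) :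
    ∃ U ∈ 𝓝 z0, ∀ᶠ n : ℕ in atTop, ∀ z ∈ U, Fn A B p n z ≤ Real.exp (ε*n) := by
  have cl : ContinuousAt (fun z => Real.log (VV A B z)) z0 := h.VV_cont.continuousAt.log (h.VV_pos z0).ne'
  obtain ⟨r, r0, hrr⟩ := Metric.continuousAt_iff.1 cl (ε/16) (by positivity)
  refine ⟨Metric.ball z0 (r/3), Metric.ball_mem_nhds _ (by positivity), ?_⟩
  filter_upwards [S.ub h hr (show 0 < ε/8 by positivity), eventually_ge_atTop 1,
    ev_exp_ge (show 0 < ε/2 by positivity) (1 + (3/r)^2)] with n hn n1 hK z hz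
  have n0 : (1:ℝ) ≤ n := by exact_mod_cast n1
  set L := Real.log (VV A B z) with hL
  have hs : ∀ w ∈ Metric.closedBall z (r/3), ‖(p n).eval w‖ ≤ Real.exp (ε/4*n) * Real.exp (n*L) := by
    intro w hw
    have h1 := hrr (show dist z z0 < r by rw [Metric.mem_ball] at hz; linarith)
    have h2 := hrr (show dist w z0 < r by
      rw [Metric.mem_ball] at hz; rw [Metric.mem_closedBall] at hw; linarith [dist_triangle w z z0])
    rw [Real.dist_eq, abs_lt] at h1 h2
    refine (hn w).trans ?_
    rw [h.VV_pow, ← Real.exp_add, ← Real.exp_add, Real.exp_le_exp]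
    nlinarith
  have hP : ‖Pn p n z‖ ≤ Real.exp (ε/4*n) * Real.exp (n*L) := hs z (Metric.mem_closedBall_self (by positivity))
  have hD : ‖Dn p n z‖ ≤ (3/r) * (Real.exp (ε/4*n) * Real.exp (n*L)) := by
    have := Complex.norm_deriv_le_of_forall_mem_sphere_norm_le (f := fun w => (p n).eval w) (c := z) (R := r/3) (by positivity)
      (p n).differentiable.diffContOnCl (fun w hw => hs w (Metric.sphere_subset_closedBall hw))
    rw [Polynomial.deriv] at this
    unfold Dn
    rw [norm_div, Complex.norm_natCast]
    refine (div_le_self (norm_nonneg _) n0).trans (this.trans (le_of_eq ?_))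
    field_simp
  rw [h.Fn_eq, Real.exp_neg, ← div_eq_mul_inv, div_le_iff₀ (Real.exp_pos _)]
  have e1 : (Real.exp (ε/4*n) * Real.exp (n*L))^2 = Real.exp (ε/2*n) * Real.exp (2*n*L) := by
    rw [← Real.exp_add, ← Real.exp_add, ← Real.exp_nat_mul]; congr 1; push_cast; ring
  have e2 : Real.exp (ε*n) = Real.exp (ε/2*n) * Real.exp (ε/2*n) := by
    rw [← Real.exp_add]; congr 1; ring
  unfold NN
  calc _ ≤ (Real.exp (ε/4*n) * Real.exp (n*L))^2 + ((3/r) * (Real.exp (ε/4*n) * Real.exp (n*L)))^2 := by gcongr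
    _ = (1 + (3/r)^2) * (Real.exp (ε/2*n) * Real.exp (2*n*L)) := by rw [← e1]; ring
    _ ≤ Real.exp (ε/2*n) * (Real.exp (ε/2*n) * Real.exp (2*n*L)) := by gcongr
    _ = _ := by rw [e2]; ring

lemma JSeq.Fn_lb (h : Par A B) {p : ℕ → ℂ[X]} {α β : ℕ → ℝ} (S : JSeq A B p α β)
    {γL γC γR : ℝ → ℂ} (hr : ArcParam A B γL γC γR) {z0 : ℂ} (hz : z0 ∉ Gam A B) (h1 : z0 ≠ 1) (h2 : z0 ≠ -1)
    {ε : ℝ} (hε : 0 < ε) :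
    ∃ U ∈ 𝓝 z0, ∀ᶠ n : ℕ in atTop, ∀ z ∈ U, Real.exp (-(ε*n)) ≤ Fn A B p n z := by
  obtain ⟨U, hU, hE⟩ := S.E1' h (half_pos hε) h1 h2
  obtain ⟨r, r0, hrU⟩ := Metric.mem_nhds_iff.1 hU
  refine ⟨U, hU, ?_⟩
  filter_upwards [hE, S.lb h hr hz (min r (ε/4)) (by positivity)] with n hn hl z hz
  obtain ⟨w, hw, hwl⟩ := hl
  have hwU := hrU (Metric.ball_subset_ball (min_le_left _ _) hw)
  have h3 := hn w hwU z hz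
  have h4 : Real.exp (-(ε/2*n)) ≤ Fn A B p n w := by
    unfold Fn
    rw [le_div_iff₀ (pow_pos (h.VV_pos w) _)]
    have h5 : Real.exp (-(ε/4*n)) * VV A B w ^ n ≤ ‖(p n).eval w‖ := by
      refine le_trans ?_ hwl
      have := h.VV_pos w
      have := min_le_right r (ε/4)
      gcongr
    have h6 := pow_le_pow_left₀ (mul_nonneg (Real.exp_pos _).le (pow_nonneg (h.VV_pos w).le _)) h5 2
    calc _ = (Real.exp (-(ε/4*n)) * VV A B w ^ n)^2 := by
            rw [mul_pow, ← pow_mul, mul_comm n 2, ← Real.exp_nat_mul]; congr 2; push_cast; ring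
      _ ≤ _ := h6
      _ ≤ _ := by unfold NN Pn; nlinarith [sq_nonneg ‖Dn p n w‖]
  have e : Real.exp (-(ε*n)) = Real.exp (-(ε/2*n)) * Real.exp (-(ε/2*n)) := by rw [← Real.exp_add]; congr 1; ring
  have e' : Real.exp (ε/2*n) * Real.exp (-(ε/2*n)) = 1 := by rw [← Real.exp_add]; simp
  rw [e]
  calc _ ≤ (Real.exp (ε/2*n) * Fn A B p n z) * Real.exp (-(ε/2*n)) := by gcongr; exact h4.trans h3
    _ = (Real.exp (ε/2*n) * Real.exp (-(ε/2*n))) * Fn A B p n z := by ring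
    _ = _ := by rw [e', one_mul]

set_option maxHeartbeats 2000000 in
lemma JSeq.cone (h : Par A B) {p : ℕ → ℂ[X]} {α β : ℕ → ℝ} (S : JSeq A B p α β)
    {γL γC γR : ℝ → ℂ} (hr : ArcParam A B γL γC γR) {z0 : ℂ} (hz : z0 ∉ Gam A B) (h1 : z0 ≠ 1) (h2 : z0 ≠ -1)
    {δ : ℝ} (hδ : 0 < δ) (hδ1 : δ ≤ 1) :
    ∃ U ∈ 𝓝 z0, ∀ᶠ n : ℕ in atTop, ∀ z ∈ U,
      ‖aF A B p n (-dg A B) z‖ ≤ 2*δ * ‖aF A B p n (dg A B) z‖ := by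
  have aG := h.dg_analytic hz
  obtain ⟨M, M1, hM⟩ := S.abSys h aG (dg_sq A B) (dg_ne hz) h1 h2
  have M0 : 0 < M := by linarith
  set D := lam A B z0 (dg A B z0) - lam A B z0 (-dg A B z0) with hD
  have D0 : D ≠ 0 := by
    rw [hD, Par.lam_sub]
    refine mul_ne_zero h.sg_ne (div_ne_zero (dg_ne hz) ?_)
    intro e; apply one_sub_sq_ne h1 h2; linear_combination -e
  set v := -(starRingEnd ℂ) D with hv
  set s0 := normSq D / 2 with hs0
  have s0pos : 0 < s0 := by have := normSq_pos.2 D0; positivity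
  have cs : ContinuousAt (fun z => ((lam A B z (-dg A B z) - lam A B z (dg A B z)) * v).re) z0 :=
    continuous_re.continuousAt.comp (((lam_analytic (A := A) (B := B) aG.neg h1 h2).continuousAt.sub
      (lam_analytic (A := A) (B := B) aG h1 h2).continuousAt).mul continuousAt_const)
  have hs : ∀ᶠ z in 𝓝 z0, s0 < ((lam A B z (-dg A B z) - lam A B z (dg A B z)) * v).re := by
    refine cs.tendsto.eventually_const_lt ?_
    rw [← neg_sub, ← hD, hv, neg_mul_neg, mul_conj, ofReal_re]
    have := normSq_pos.2 D0
    rw [hs0]; linarith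
  have hGam : ∀ᶠ z in 𝓝 z0, z ∉ Gam A B := h.Gam_closed.isOpen_compl.mem_nhds hz
  obtain ⟨ρ, ρ0, hρ⟩ := Metric.eventually_nhds_iff_ball.1 ((hM.and hs).and hGam)
  have v0 : 0 < ‖v‖ := by rw [hv, norm_neg, norm_conj]; exact norm_pos_iff.2 D0
  set T := ρ/(4*‖v‖) with hT
  have T0 : 0 < T := by positivity
  have hTv : T * ‖v‖ = ρ/4 := by rw [hT]; field_simp
  set ε := s0*T/4 with hε
  have ε0 : 0 < ε := by positivity
  obtain ⟨U1, hU1, hl⟩ := S.Fn_lb h hr hz h1 h2 ε0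
  obtain ⟨U2, hU2, hu⟩ := S.Fn_ub h hr (z0 + T * v) ε0
  have hU2' : ∀ᶠ z in 𝓝 z0, z + T * v ∈ U2 := by
    have : ContinuousAt (fun z : ℂ => z + T*v) z0 := by fun_prop
    exact this.eventually hU2
  refine ⟨U1 ∩ ({z | z + T * v ∈ U2} ∩ Metric.ball z0 (ρ/4)),
    inter_mem hU1 (inter_mem hU2' (Metric.ball_mem_nhds _ (by positivity))), ?_⟩
  have lim : Tendsto (fun n : ℕ => 8*‖v‖*M * ((1:ℝ)/n + etaS A B α β n)) atTop (𝓝 0) := by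
    have := ((tendsto_const_div_atTop_nhds_zero_nat (1:ℝ)).add S.eta_tendsto).const_mul (8*‖v‖*M)
    simpa using this
  filter_upwards [hl, hu, eventually_ge_atTop 1, lim.eventually_lt_const (show 0 < s0*δ^2 by positivity),
    ev_exp_ge ε0 (4*M^2/δ^2)] with n hl hu n1 hlim hK z hzz
  obtain ⟨zU1, zU2, zb⟩ := hzz
  have n0 : (0:ℝ) < n := by exact_mod_cast n1
  by_contra hcon
  push Not at hcon
  set γ : ℝ → ℂ := fun t => z + t * v with hγ
  have dγ : ∀ t, HasDerivAt γ v t := fun t => by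
    have := (((hasDerivAt_id t).ofReal_comp).mul_const v).const_add z
    rw [ofReal_one, one_mul] at this
    exact this
  have inb : ∀ t ∈ Icc 0 T, γ t ∈ Metric.ball z0 ρ := by
    intro t ht
    rw [mem_ball_iff_norm] at zb ⊢
    have : ‖(t:ℂ) * v‖ ≤ ρ/4 := by
      rw [norm_mul, Complex.norm_real, Real.norm_eq_abs, abs_of_nonneg ht.1, ← hTv]; gcongr; exact ht.2
    calc ‖γ t - z0‖ = ‖(z - z0) + t*v‖ := by simp only [hγ]; congr 1; ring
      _ ≤ ‖z - z0‖ + ‖(t:ℂ)*v‖ := norm_add_le _ _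
      _ < ρ := by linarith
  set a : ℝ → ℂ := fun t => aF A B p n (dg A B) (γ t) with ha
  set b : ℝ → ℂ := fun t => aF A B p n (-dg A B) (γ t) with hb
  set w : ℝ → ℝ := fun t => Real.exp (-(2*n*Real.log (VV A B (γ t)))) with hw
  have key : ∀ t, ∃ f' : ℝ, t ∈ Icc 0 T → HasDerivAt (fun t => w t * (δ^2*‖a t‖^2 - ‖b t‖^2)) f' t ∧
      f' ≤ (n*s0) * (w t * (δ^2*‖a t‖^2 - ‖b t‖^2)) := by
    intro t
    by_cases ht : t ∈ Icc 0 T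
    swap
    · exact ⟨0, fun h => absurd h ht⟩
    obtain ⟨⟨⟨g1, g2, g0, -, hsys⟩, hst⟩, hG⟩ := hρ _ (inb t ht)
    obtain ⟨Ea, Eb, ea, eb, na, nb, -⟩ := hsys n n1
    have ea' : HasDerivAt a ((n * lam A B (γ t) (dg A B (γ t)) * a t + Ea) * v) t := by
      have := ea.scomp t (dγ t); rw [smul_eq_mul, mul_comm] at this; exact this
    have eb' : HasDerivAt b ((n * lam A B (γ t) (-dg A B (γ t)) * b t + Eb) * v) t := by
      have := eb.scomp t (dγ t); rw [smul_eq_mul, mul_comm] at this; exact this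
    have ew : HasDerivAt w (w t * (-(2*n*(Hh A B (γ t) * v).re))) t :=
      ((h.hasDerivAt_log_VV (dγ t) hG).const_mul (2*(n:ℝ))).neg.exp
    have d := ew.mul ((ea'.norm_sq.const_mul (δ^2)).sub eb'.norm_sq)
    refine ⟨_, fun _ => ⟨d, ?_⟩⟩
    simp only [Pi.sub_apply]
    rw [h.Hh_eq hG g1 g2]
    set l1 := lam A B (γ t) (dg A B (γ t))
    set l2 := lam A B (γ t) (-dg A B (γ t))
    have wt : 0 < w t := Real.exp_pos _
    have i1 : inner ℝ (a t) ((n * l1 * a t + Ea) * v) = n * (l1*v).re * ‖a t‖^2 + inner ℝ (a t) (Ea*v) := by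
      rw [show (n * l1 * a t + Ea) * v = (n * (l1*v)) * a t + Ea * v by ring, inner_add_right, inner_mul_self]
      congr 2
      rw [← ofReal_natCast, re_ofReal_mul]
    have i2 : inner ℝ (b t) ((n * l2 * b t + Eb) * v) = n * (l2*v).re * ‖b t‖^2 + inner ℝ (b t) (Eb*v) := by
      rw [show (n * l2 * b t + Eb) * v = (n * (l2*v)) * b t + Eb * v by ring, inner_add_right, inner_mul_self]
      congr 2
      rw [← ofReal_natCast, re_ofReal_mul]
    rw [i1, i2]
    have c1 := real_inner_le_norm (a t) (Ea*v)
    have c2 := (abs_le.1 (abs_real_inner_le_norm (b t) (Eb*v))).1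
    rw [norm_mul] at c1 c2
    have hst : s0 < (l2*v).re - (l1*v).re := by rw [← sub_re, ← sub_mul]; exact hst
    generalize inner ℝ (a t) (Ea*v) = ia at c1 ⊢
    generalize inner ℝ (b t) (Eb*v) = ib at c2 ⊢
    generalize (l1*v).re = x1 at hst ⊢
    generalize (l2*v).re = x2 at hst ⊢
    have na : ‖Ea‖ ≤ M * (1 + n * etaS A B α β n) * (‖a t‖ + ‖b t‖) := na
    have nb : ‖Eb‖ ≤ M * (1 + n * etaS A B α β n) * (‖a t‖ + ‖b t‖) := nb
    have pa := norm_nonneg (a t)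
    have pb := norm_nonneg (b t)
    generalize ‖a t‖ = x at *
    generalize ‖b t‖ = y at *
    have hE : 8*‖v‖*(M*(1+n*etaS A B α β n)) ≤ n * (s0*δ^2) := by
      have := mul_le_mul_of_nonneg_left hlim.le n0.le
      refine le_trans (le_of_eq ?_) this
      field_simp
    generalize M*(1+n*etaS A B α β n) = Q at *
    have k1 : δ^2 * ia ≤ x * (Q*(x+y)*‖v‖) := by
      have : ia ≤ x * (Q*(x+y)*‖v‖) := c1.trans (by gcongr)
      have h3 : (0:ℝ) ≤ x * (Q*(x+y)*‖v‖) := by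
        have : 0 ≤ Q*(x+y) := (norm_nonneg _).trans na
        positivity
      have h4 : δ^2 ≤ 1 := by nlinarith
      nlinarith [sq_nonneg δ]
    have k2 : -ib ≤ y * (Q*(x+y)*‖v‖) := by
      have : y * (‖Eb‖*‖v‖) ≤ y * (Q*(x+y)*‖v‖) := by gcongr
      linarith
    have k3 : 2*δ^2*ia - 2*ib ≤ n*(s0*δ^2)*(x^2+y^2) := by
      have : (x+y)^2 ≤ 2*(x^2+y^2) := by nlinarith [sq_nonneg (x-y)]
      by_cases hQ : 0 ≤ Q
      · calc 2*δ^2*ia - 2*ib ≤ 2*Q*‖v‖*(x+y)^2 := by nlinarith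
          _ ≤ 2*Q*‖v‖*(2*(x^2+y^2)) := by gcongr
          _ ≤ (8*‖v‖*Q)*(x^2+y^2) := by nlinarith [mul_nonneg (mul_nonneg hQ v0.le) (show 0 ≤ x^2+y^2 by positivity)]
          _ ≤ _ := by gcongr
      · have : Q*‖v‖*(x+y)^2 ≤ 0 := mul_nonpos_of_nonpos_of_nonneg (mul_nonpos_of_nonpos_of_nonneg (not_le.1 hQ).le v0.le) (sq_nonneg _)
        have : 0 ≤ n*(s0*δ^2)*(x^2+y^2) := by positivity
        nlinarith
    have hδ2 : δ^2 ≤ 1 := by nlinarith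
    have final : -(2*n*x1)*(δ^2*x^2 - y^2) + (δ^2*(2*(n*x1*x^2+ia)) - 2*(n*x2*y^2+ib)) ≤ n*s0*(δ^2*x^2-y^2) := by
      have e1 : n*s0*y^2 ≤ n*(x2-x1)*y^2 := by gcongr
      have e2 : n*s0*(δ^2)*y^2 ≤ n*s0*1*y^2 := by gcongr
      nlinarith
    nlinarith [mul_le_mul_of_nonneg_left final wt.le]
  choose f' hf' using key
  have gr := gron T0.le (fun t ht => (hf' t ht).1) (fun t ht => (hf' t ht).2)
  simp only [sub_zero] at gr
  have γ0 : γ 0 = z := by simp [hγ]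
  have wF : ∀ t, Fn A B p n (γ t) = NN p n (γ t) * w t := fun t => h.Fn_eq p n (γ t)
  have hz1 : ‖b 0‖ > 2*δ*‖a 0‖ := by simp only [ha, hb, γ0]; exact hcon
  obtain ⟨⟨⟨-, -, -, -, s1⟩, -⟩, -⟩ := hρ _ (inb 0 ⟨le_rfl, T0.le⟩)
  obtain ⟨⟨⟨-, -, -, -, s2⟩, -⟩, -⟩ := hρ _ (inb T ⟨T0.le, le_rfl⟩)
  obtain ⟨-, -, -, -, -, -, n1', -, -⟩ := s1 n n1
  obtain ⟨-, -, -, -, -, -, -, n2', -⟩ := s2 n n1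
  have n1' : NN p n (γ 0) ≤ M * (‖a 0‖^2 + ‖b 0‖^2) := n1'
  have n2' : ‖a T‖^2 + ‖b T‖^2 ≤ M * NN p n (γ T) := n2'
  have lo : Real.exp (-(ε*n)) ≤ NN p n (γ 0) * w 0 := by rw [← wF, γ0]; exact hl z zU1
  have hi : NN p n (γ T) * w T ≤ Real.exp (ε*n) := by rw [← wF]; exact hu _ zU2
  have w0 : 0 < w 0 := Real.exp_pos _
  have wT : 0 < w T := Real.exp_pos _
  have q1 : δ^2*(‖a 0‖^2+‖b 0‖^2) ≤ 4*(‖b 0‖^2 - δ^2*‖a 0‖^2) := by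
    have := pow_le_pow_left₀ (by positivity) hz1.le 2
    have h5 : δ^2 ≤ 1 := by nlinarith
    nlinarith [sq_nonneg ‖b 0‖]
  have q2 : δ^2 * Real.exp (-(ε*n)) ≤ 4*M*(w 0 * (‖b 0‖^2 - δ^2*‖a 0‖^2)) := by
    calc δ^2 * Real.exp (-(ε*n)) ≤ δ^2 * ((M * (‖a 0‖^2 + ‖b 0‖^2)) * w 0) := by gcongr; exact lo.trans (by gcongr)
      _ = M * w 0 * (δ^2 * (‖a 0‖^2 + ‖b 0‖^2)) := by ring
      _ ≤ M * w 0 * (4*(‖b 0‖^2 - δ^2*‖a 0‖^2)) := by gcongr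
      _ = _ := by ring
  have q3 : w T * (‖b T‖^2 - δ^2*‖a T‖^2) ≤ M * Real.exp (ε*n) := by
    calc _ ≤ w T * (M * NN p n (γ T)) := by
          gcongr; nlinarith [sq_nonneg (δ * ‖a T‖), sq_nonneg ‖a T‖]
      _ = M * (NN p n (γ T) * w T) := by ring
      _ ≤ _ := by gcongr
  have q4 : Real.exp (n*s0*T) * (δ^2 * Real.exp (-(ε*n))) ≤ 4*M*(M*Real.exp (ε*n)) := by
    calc _ ≤ Real.exp (n*s0*T) * (4*M*(w 0 * (‖b 0‖^2 - δ^2*‖a 0‖^2))) := by gcongr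
      _ = 4*M*(Real.exp (n*s0*T) * (w 0 * (‖b 0‖^2 - δ^2*‖a 0‖^2))) := by ring
      _ ≤ 4*M*(w T * (‖b T‖^2 - δ^2*‖a T‖^2)) :=
          mul_le_mul_of_nonneg_left (by
            have q : w T * (‖b T‖^2 - δ^2*‖a T‖^2) = -(w T * (δ^2*‖a T‖^2 - ‖b T‖^2)) := by ring
            have q' : Real.exp (n*s0*T) * (w 0 * (‖b 0‖^2 - δ^2*‖a 0‖^2)) = -(Real.exp (n*s0*T) * (w 0 * (δ^2*‖a 0‖^2 - ‖b 0‖^2))) := by ring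
            rw [q, q']; linarith) (by positivity)
      _ ≤ _ := by gcongr
  have e4 : Real.exp (n*s0*T) * Real.exp (-(ε*n)) = Real.exp (ε*n) * Real.exp (ε*n) * Real.exp (ε*n) := by
    rw [← Real.exp_add, ← Real.exp_add, ← Real.exp_add]; congr 1; rw [hε]; ring
  have X1 : 1 < Real.exp (ε*n) := Real.one_lt_exp_iff.2 (by positivity)
  rw [div_le_iff₀ (by positivity)] at hK
  set X := Real.exp (ε*n) with hX
  have q5 : δ^2 * X * X * X ≤ 4*M^2*X := by
    calc _ = Real.exp (n*s0*T) * (δ^2 * Real.exp (-(ε*n))) := by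
            rw [show Real.exp (n*s0*T) * (δ^2 * Real.exp (-(ε*n))) = δ^2 * (Real.exp (n*s0*T) * Real.exp (-(ε*n))) by ring, e4]; ring
      _ ≤ _ := q4
      _ = _ := by ring
  have h9 : 4*M^2*X ≤ X*δ^2*X := mul_le_mul_of_nonneg_right hK (by positivity)
  have h10 : 0 < δ^2*X*X*(X-1) := by have := sub_pos.2 X1; positivity
  linarith [show δ^2*X*X*(X-1) = δ^2*X*X*X - X*δ^2*X by ring]

/-- main local asymptotics off `Γ` -/
lemma JSeq.locAsymp (h : Par A B) {p : ℕ → ℂ[X]} {α β : ℕ → ℝ} (S : JSeq A B p α β)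
    {γL γC γR : ℝ → ℂ} (hr : ArcParam A B γL γC γR) {z0 : ℂ} (hz : z0 ∉ Gam A B) (h1 : z0 ≠ 1) (h2 : z0 ≠ -1)
    {δ : ℝ} (hδ : 0 < δ) :
    ∃ U ∈ 𝓝 z0, ∀ᶠ n : ℕ in atTop, ∀ z ∈ U, (p n).eval z ≠ 0 ∧ ‖Dn p n z / Pn p n z - Hh A B z‖ ≤ δ := by
  have aG := h.dg_analytic hz
  obtain ⟨M, M1, hM⟩ := S.abSys h aG (dg_sq A B) (dg_ne hz) h1 h2
  have M0 : 0 < M := by linarith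
  obtain ⟨C, C0, hC⟩ := ev_bdd ((lam_analytic (A := A) (B := B) aG h1 h2).continuousAt.sub
    (lam_analytic (A := A) (B := B) aG.neg h1 h2).continuousAt)
  set d := min (1/4) (δ/(4*(C+1))) with hd
  have d0 : 0 < d := by positivity
  have d4 : d ≤ 1/4 := min_le_left _ _
  have hdC : d * (4*(C+1)) ≤ δ := by rw [← le_div_iff₀ (by positivity)]; exact min_le_right _ _
  obtain ⟨U1, hU1, hcone⟩ := S.cone h hr hz h1 h2 d0 (by linarith)
  obtain ⟨U2, hU2, hlb⟩ := S.Fn_lb h hr hz h1 h2 one_pos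
  have hGam : ∀ᶠ z in 𝓝 z0, z ∉ Gam A B := h.Gam_closed.isOpen_compl.mem_nhds hz
  refine ⟨U1 ∩ (U2 ∩ {z | _}), inter_mem hU1 (inter_mem hU2 ((hM.and hC).and hGam)), ?_⟩
  filter_upwards [hcone, hlb, eventually_ge_atTop 1] with n hcone hlb n1 z hzz
  obtain ⟨z1, z2, ⟨⟨g1, g2, g0, -, hsys⟩, hCz⟩, hG⟩ := hzz
  obtain ⟨-, -, -, -, -, -, nn, -, hab⟩ := hsys n n1
  have hb := hcone z z1
  have hl := hlb z z2
  have hbD : aF A B p n (-dg A B) z = Dn p n z - Hh A B z * Pn p n z := by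
    unfold aF; simp only [Pi.neg_apply, neg_neg]; rw [h.Hh_eq hG g1 g2]
  have hC' : ‖lam A B z (dg A B z) - lam A B z (-dg A B z)‖ ≤ C := hCz
  set a := aF A B p n (dg A B) z
  set b := aF A B p n (-dg A B) z
  have hNN : 0 < NN p n z := by
    have : 0 < Fn A B p n z := (Real.exp_pos _).trans_le hl
    unfold Fn at this
    exact (div_pos_iff_of_pos_right (pow_pos (h.VV_pos z) _)).1 this
  have a0 : 0 < ‖a‖ := by
    by_contra hcon
    have e : ‖a‖ = 0 := le_antisymm (not_lt.1 hcon) (norm_nonneg _)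
    rw [e, mul_zero] at hb
    have : ‖b‖ = 0 := le_antisymm hb (norm_nonneg _)
    rw [e, this] at nn
    simp at nn; linarith
  have hba : ‖a‖ ≤ 2 * (C * ‖Pn p n z‖) := by
    have h3 : ‖a - b‖ ≤ C * ‖Pn p n z‖ := by rw [hab, norm_mul]; gcongr
    have h4 := norm_sub_norm_le a b
    nlinarith
  have P0 : 0 < ‖Pn p n z‖ := by
    by_contra hcon
    have e : ‖Pn p n z‖ = 0 := le_antisymm (not_lt.1 hcon) (norm_nonneg _)
    rw [e] at hba; linarith
  have P0' : Pn p n z ≠ 0 := norm_pos_iff.1 P0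
  refine ⟨P0', ?_⟩
  rw [show Dn p n z / Pn p n z - Hh A B z = b / Pn p n z by rw [hbD]; field_simp, norm_div, div_le_iff₀ P0]
  calc ‖b‖ ≤ 2*d*‖a‖ := hb
    _ ≤ 2*d*(2 * (C * ‖Pn p n z‖)) := by gcongr
    _ = (d*(4*C)) * ‖Pn p n z‖ := by ring
    _ ≤ δ * ‖Pn p n z‖ := by gcongr; nlinarith

end

section
variable {A B : ℝ}

lemma cone_alg {a η X Y : ℝ} (ha : 0 < a) (h1 : η ≤ a^2/8) (h2 : η ≤ a/8) (hX : 0 ≤ X) (hY : 0 ≤ Y) :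
    (a/2)^2*(2*(X*Y)) - 2*(a*Y^2) + 2*(η*(X+Y)*Y) ≤ a*((a/2)^2*X^2 - Y^2) := by
  have e1 : 0 ≤ a*(a/2*X-3/4*Y)^2 := by positivity
  have e2 : 0 ≤ (a^2/8-η)*(X*Y) := mul_nonneg (by linarith) (by positivity)
  have e3 : 0 ≤ (a/8-η)*Y^2 := mul_nonneg (by linarith) (by positivity)
  nlinarith [mul_nonneg ha.le (sq_nonneg Y)]

lemma normsq_deriv {x : ℝ → ℂ} {x' : ℂ} {t : ℝ} (h : HasDerivAt x x' t) :
    HasDerivAt (fun t => ‖x t‖^2) (2 * inner ℝ (x t) x') t := h.norm_sq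

set_option maxHeartbeats 1000000 in
lemma JSeq.nearpt (h : Par A B) {p : ℕ → ℂ[X]} {α β : ℕ → ℝ} (S : JSeq A B p α β)
    {γL γC γR : ℝ → ℂ} (hr : ArcParam A B γL γC γR) {c : ℂ} (hc : c = 1 ∨ c = -1) {a : ℝ} (ha : 0 < a)
    (hk : -c * (((A+B)*c + A - B)/(1+c*c)) = a) (hcG : c ∉ Gam A B)
    (hp : ∀ᶠ n : ℕ in atTop, (p n).eval c ≠ 0) :
    ∃ U ∈ 𝓝 c, ∀ᶠ n : ℕ in atTop, ∀ z ∈ U, (p n).eval z ≠ 0 := by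
  have hc2 : c*c = 1 := by rcases hc with rfl | rfl <;> norm_num
  have nc : ‖c‖ = 1 := by rcases hc with rfl | rfl <;> simp
  have hden : (1 + c*c : ℂ) ≠ 0 := by rw [hc2]; norm_num
  set η := min (a^2/8) (a/8) with hη
  have η0 : 0 < η := by positivity
  have c1 : ContinuousAt (fun z : ℂ => -c * (((A+B)*z + A - B)/(1+c*z))) c :=
    continuousAt_const.mul (ContinuousAt.div (by fun_prop) (by fun_prop) hden)
  have c2 : ContinuousAt (fun z : ℂ => c*(z-c)*((A+B+1)/(1+c*z))) c :=
    ContinuousAt.mul (by fun_prop) (ContinuousAt.div (by fun_prop) (by fun_prop) hden)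
  have c3 : ContinuousAt (fun z : ℂ => (1+‖z‖)/‖1+c*z‖) c :=
    ContinuousAt.div (by fun_prop) (by fun_prop) (norm_ne_zero_iff.2 hden)
  obtain ⟨H, H0, hH⟩ := ev_bdd (h.Hh_analytic hcG).continuousAt
  have e1 : ∀ᶠ z in 𝓝 c, ‖-c * (((A+B)*z + A - B)/(1+c*z)) - a‖ < η/4 := by
    have : ContinuousAt (fun z : ℂ => ‖-c * (((A+B)*z + A - B)/(1+c*z)) - a‖) c := (c1.sub continuousAt_const).norm
    have := this.tendsto
    rw [hk, sub_self, norm_zero] at this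
    exact this.eventually_lt_const (by positivity)
  have e2 : ∀ᶠ z in 𝓝 c, ‖c*(z-c)*((A+B+1)/(1+c*z))‖ < η/4 := by
    have := c2.norm.tendsto
    simp only [sub_self, mul_zero, zero_mul, norm_zero] at this
    exact this.eventually_lt_const (by positivity)
  have e3 : ∀ᶠ z in 𝓝 c, (1+‖z‖)/‖1+c*z‖ < 3 := by
    have := c3.tendsto
    rw [hc2, nc] at this
    exact this.eventually_lt_const (by norm_num)
  have e4 : ∀ᶠ z in 𝓝 c, z ∉ Gam A B := h.Gam_closed.isOpen_compl.mem_nhds hcG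
  have e5 : ∀ᶠ z in 𝓝 c, z ≠ -c := eventually_ne_nhds (by
    intro e; have : c = 0 := by linear_combination e/2
    rw [this] at nc; simp at nc)
  obtain ⟨ρ0, ρ00, hρ0⟩ := Metric.eventually_nhds_iff.1 (((((e1.and e2).and e3).and e4).and e5).and hH)
  set ρ := min (min (ρ0/2) 1) (a/(8*(H+1))) with hρ
  have ρpos : 0 < ρ := by positivity
  have ρlt : ρ < ρ0 := lt_of_le_of_lt ((min_le_left _ _).trans (min_le_left _ _)) (by linarith)
  have ρ1 : ρ ≤ 1 := (min_le_left _ _).trans (min_le_right _ _)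
  have ρH : ρ * (8*(H+1)) ≤ a := by rw [← le_div_iff₀ (by positivity)]; exact min_le_right _ _
  have ne1 : ∀ z, dist z c < ρ0 → z ≠ c → z ≠ 1 ∧ z ≠ -1 := by
    intro z hz hzc
    have := (hρ0 hz).1.2
    rcases hc with rfl | rfl
    · exact ⟨hzc, this⟩
    · exact ⟨by simpa using this, hzc⟩
  -- uniform asymptotics on the circle
  have circ : ∀ᶠ n : ℕ in atTop, ∀ z ∈ Metric.sphere c ρ, (p n).eval z ≠ 0 ∧ ‖Dn p n z / Pn p n z - Hh A B z‖ ≤ 1 := by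
    refine (isCompact_sphere c ρ).induction_on (p := fun s => ∀ᶠ n : ℕ in atTop, ∀ z ∈ s, (p n).eval z ≠ 0 ∧ ‖Dn p n z / Pn p n z - Hh A B z‖ ≤ 1) (by simp)
      (fun s t hst ht => ht.mono fun n hn z hz => hn z (hst hz))
      (fun s t hs ht => (hs.and ht).mono fun n hn z hz => hz.elim (hn.1 z) (hn.2 z)) ?_
    intro z hz
    have hz' : dist z c = ρ := hz
    have zc : z ≠ c := by rw [← dist_pos, hz']; exact ρpos
    obtain ⟨z1, z2⟩ := ne1 z (by rw [hz']; exact ρlt) zc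
    obtain ⟨U, hU, hU'⟩ := S.locAsymp h hr (hρ0 (by rw [hz']; exact ρlt)).1.1.2 z1 z2 one_pos
    exact ⟨U, mem_nhdsWithin_of_mem_nhds hU, hU'⟩
  have hs1 : ∀ᶠ n : ℕ in atTop, etaS A B α β n < η/12 := S.eta_tendsto.eventually_lt_const (by positivity)
  have hs2 : ∀ᶠ n : ℕ in atTop, (1:ℝ)/n < η/4 := (tendsto_const_div_atTop_nhds_zero_nat 1).eventually_lt_const (by positivity)
  refine ⟨Metric.ball c ρ, Metric.ball_mem_nhds _ ρpos, ?_⟩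
  filter_upwards [circ, hs1, hs2, hp, eventually_ge_atTop 1] with n circ hs1 hs2 hp n1 z hz h0
  have hn0 : (0:ℝ) < n := by exact_mod_cast (by omega : 0 < n)
  have zc : z ≠ c := by rintro rfl; exact hp h0
  set w := z - c with hw
  have w0 : 0 < ‖w‖ := norm_pos_iff.2 (sub_ne_zero.2 zc)
  have wρ : ‖w‖ < ρ := by rw [hw, ← dist_eq]; exact hz
  set T := Real.log (ρ/‖w‖) with hT
  have T0 : 0 ≤ T := Real.log_nonneg (by rw [le_div_iff₀ w0]; linarith)
  have eT : Real.exp T * ‖w‖ = ρ := by rw [hT, Real.exp_log (by positivity)]; field_simp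
  set γ : ℝ → ℂ := fun t => c + (Real.exp t : ℝ) * w with hγ
  have γd : ∀ t, HasDerivAt γ (γ t - c) t := by
    intro t
    have := (((Real.hasDerivAt_exp t).ofReal_comp).mul_const w).const_add c
    refine this.congr_deriv ?_
    simp only [hγ]; ring
  have nγ : ∀ t, ‖γ t - c‖ = Real.exp t * ‖w‖ := by
    intro t; simp only [hγ, add_sub_cancel_left, norm_mul, norm_real, Real.norm_eq_abs, Real.abs_exp]
  have dγ : ∀ t ∈ Icc 0 T, 0 < ‖γ t - c‖ ∧ ‖γ t - c‖ ≤ ρ := by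
    intro t ht; rw [nγ]
    refine ⟨by positivity, ?_⟩
    rw [← eT]; gcongr; exact ht.2
  set x : ℝ → ℂ := fun t => Pn p n (γ t) with hx
  set y : ℝ → ℂ := fun t => (γ t - c) * Dn p n (γ t) with hy
  have key : ∀ t ∈ Icc 0 T, HasDerivAt x (n * y t) t ∧ ∃ e : ℂ, ‖e‖ ≤ η * (‖x t‖ + ‖y t‖) ∧
      HasDerivAt y (n * (a * y t + e)) t := by
    intro t ht
    obtain ⟨d1, d2⟩ := dγ t ht
    have dd : dist (γ t) c < ρ0 := by rw [dist_eq]; linarith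
    have γc : γ t ≠ c := sub_ne_zero.1 (norm_pos_iff.1 d1)
    obtain ⟨z1, z2⟩ := ne1 _ dd γc
    obtain ⟨⟨⟨⟨⟨b1, b2⟩, b3⟩, -⟩, -⟩, -⟩ := hρ0 dd
    obtain ⟨E, hE, hD⟩ := S.ode_norm n1 z1 z2
    have hX := (Pn_deriv (p := p) n1 (γ t)).comp t (γd t)
    have hDt := hD.comp t (γd t)
    refine ⟨hX.congr_deriv (by simp only [hy]; ring), ?_⟩
    have hY := ((γd t).sub_const c).mul hDt
    set Z := γ t with hZ
    have f1 : (1 - Z^2) = -c*(Z-c)*(1+c*Z) := by linear_combination (Z^2 - 1 - c*Z)*hc2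
    have f0 : (1+c*Z) ≠ 0 := by
      intro e; apply one_sub_sq_ne z1 z2; rw [f1, e, mul_zero]
    have f2 : Z - c ≠ 0 := sub_ne_zero.2 γc
    have c0 : c ≠ 0 := by rintro rfl; simp at nc
    have nc0 : (n:ℂ) ≠ 0 := by exact_mod_cast hn0.ne'
    refine ⟨(-c * (((A+B)*Z + A - B)/(1+c*Z)) - a) * y t + c*(Z-c)*((A+B+1)/(1+c*Z)) * x t + (Z-c)^2*E + y t/n, ?_, ?_⟩
    · have g1 : ‖(Z-c)^2*E‖ ≤ η/4 * (‖x t‖ + ‖y t‖) := by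
        rw [norm_mul, norm_pow]
        have nf : ‖1 - Z^2‖ = ‖Z-c‖*‖1+c*Z‖ := by rw [f1, norm_mul, norm_mul, norm_neg, nc, one_mul]
        have f0' : 0 < ‖1+c*Z‖ := norm_pos_iff.2 f0
        have η1 := eta_nonneg (A := A) (B := B) α β n
        calc ‖Z-c‖^2*‖E‖ ≤ ‖Z-c‖^2*(etaS A B α β n * ((1+‖Z‖)/‖1-Z^2‖) * (‖Pn p n Z‖ + ‖Dn p n Z‖)) := by gcongr
          _ = etaS A B α β n * ((1+‖Z‖)/‖1+c*Z‖) * (‖Z-c‖*‖x t‖ + ‖y t‖) := by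
              rw [nf]; simp only [hx, hy, norm_mul, ← hZ]; field_simp
          _ ≤ η/12 * 3 * (1*‖x t‖ + ‖y t‖) := by gcongr; linarith
          _ = _ := by ring
      have g2 : ‖y t/n‖ ≤ η/4 * ‖y t‖ := by
        rw [norm_div, Complex.norm_natCast, div_eq_mul_one_div, mul_comm]; gcongr
      calc _ ≤ ‖(-c * (((A+B)*Z + A - B)/(1+c*Z)) - a) * y t‖ + ‖c*(Z-c)*((A+B+1)/(1+c*Z)) * x t‖ + ‖(Z-c)^2*E‖ + ‖y t/n‖ := norm_add₄_le
        _ ≤ η/4*‖y t‖ + η/4*‖x t‖ + η/4*(‖x t‖+‖y t‖) + η/4*‖y t‖ := by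
            rw [norm_mul _ (y t), norm_mul _ (x t)]; gcongr
        _ ≤ _ := by nlinarith [norm_nonneg (x t), norm_nonneg (y t)]
    · refine hY.congr_deriv ?_
      have k0 : (Z-c)/(1-Z^2) = -c/(1+c*Z) := by
        rw [div_eq_div_iff (one_sub_sq_ne z1 z2) f0, f1]
        linear_combination (-(Z-c)*(1+c*Z))*hc2
      have k1 : (n:ℂ)*(((Z-c)*Dn p n Z)/n) = (Z-c)*Dn p n Z := mul_div_cancel₀ _ nc0
      simp only [hx, hy, ← hZ, Function.comp]
      linear_combination (n*((A+B)*Z + A - B)*(Z-c)*Dn p n Z - n*(A+B+1)*(Z-c)*Pn p n Z)*k0 - k1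
  have fd : ∀ t ∈ Icc 0 T, HasDerivAt (fun t => (a/2)^2*‖x t‖^2 - ‖y t‖^2)
      (deriv (fun t => (a/2)^2*‖x t‖^2 - ‖y t‖^2) t) t := by
    intro t ht
    obtain ⟨hX, e, -, hY⟩ := key t ht
    exact (((normsq_deriv hX).const_mul _).sub (normsq_deriv hY)).differentiableAt.hasDerivAt
  have G := gron (K := n*a) T0 fd ?_
  · have s0 : x 0 = 0 := by simp only [hx, hγ, Real.exp_zero, ofReal_one, one_mul, hw, add_sub_cancel]; exact h0
    simp only [s0, norm_zero] at G
    have G2 : (a/2)^2*‖x T‖^2 ≤ ‖y T‖^2 := by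
      have : 0 ≤ Real.exp (n*a*(T-0)) * ‖y 0‖^2 := by positivity
      linarith
    have G3 : a/2*‖x T‖ ≤ ‖y T‖ := by
      apply le_of_sq_le_sq _ (norm_nonneg _); rw [mul_pow]; exact G2
    have onc : γ T ∈ Metric.sphere c ρ := by rw [mem_sphere_iff_norm, nγ, eT]
    obtain ⟨q1, q2⟩ := circ _ onc
    have q1' : 0 < ‖x T‖ := norm_pos_iff.2 q1
    have hHb := (hρ0 (show dist (γ T) c < ρ0 by rw [dist_eq, nγ, eT]; exact ρlt)).2
    have q3 : ‖Dn p n (γ T) / Pn p n (γ T)‖ ≤ H+1 := by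
      calc _ = ‖(Dn p n (γ T) / Pn p n (γ T) - Hh A B (γ T)) + Hh A B (γ T)‖ := by rw [sub_add_cancel]
        _ ≤ _ := (norm_add_le _ _).trans (by linarith)
    rw [norm_div, div_le_iff₀ q1'] at q3
    have q4 : ‖y T‖ ≤ ρ*((H+1)*‖x T‖) := by
      simp only [hy]; rw [norm_mul, nγ, eT]; gcongr
    nlinarith
  · intro t ht
    obtain ⟨hX, e, he, hY⟩ := key t ht
    have dd : HasDerivAt (fun t => (a/2)^2*‖x t‖^2 - ‖y t‖^2) _ t :=
      (((normsq_deriv hX).const_mul ((a/2)^2)).sub (normsq_deriv hY))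
    rw [dd.deriv]
    have i1 : inner ℝ (x t) (n * y t) ≤ n*(‖x t‖*‖y t‖) := by
      refine (real_inner_le_norm _ _).trans ?_
      rw [norm_mul, Complex.norm_natCast]; apply le_of_eq; ring
    have i2 : inner ℝ (y t) (n * (a * y t + e)) ≥ n*(a*‖y t‖^2 - η*(‖x t‖+‖y t‖)*‖y t‖) := by
      have r1 : (n * (a * y t + e) : ℂ) = ((n:ℝ)*a:ℝ) • y t + (n:ℝ) • e := by
        simp only [real_smul]; push_cast; ring
      rw [r1, inner_add_right, inner_smul_right, inner_smul_right, real_inner_self_eq_norm_sq]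
      have := (abs_le.1 (abs_real_inner_le_norm (y t) e)).1
      have h3 : ‖y t‖*‖e‖ ≤ ‖y t‖*(η * (‖x t‖ + ‖y t‖)) := by gcongr
      have h4 : -(‖y t‖*(η * (‖x t‖ + ‖y t‖))) ≤ inner ℝ (y t) e := by linarith
      nlinarith [mul_le_mul_of_nonneg_left h4 hn0.le]
    have := cone_alg (η := η) ha (min_le_left _ _) (min_le_right _ _) (norm_nonneg (x t)) (norm_nonneg (y t))
    have := mul_le_mul_of_nonneg_left this hn0.le
    have := mul_le_mul_of_nonneg_left i1 (show 0 ≤ (a/2)^2 by positivity)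
    linarith

lemma ExpAsymp.ev_ne {a : ℕ → ℂ} {L : ℝ} (hL : 0 < L) (h : ExpAsymp (fun n => ‖a n‖) L) :
    ∀ᶠ n in atTop, a n ≠ 0 := by
  filter_upwards [h 1 one_pos] with n hn e
  have : 0 < Real.exp (-(1*n)) * L^n := by positivity
  have h1 := hn.1
  simp only [e, norm_zero] at h1
  linarith

/-- local zero-freeness off `Γ` -/
lemma JSeq.zerofree (h : Par A B) {p : ℕ → ℂ[X]} {α β : ℕ → ℝ} (S : JSeq A B p α β)
    {γL γC γR : ℝ → ℂ} (hr : ArcParam A B γL γC γR) {z0 : ℂ} (hz : z0 ∉ Gam A B) :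
    ∃ U ∈ 𝓝 z0, ∀ᶠ n : ℕ in atTop, ∀ z ∈ U, (p n).eval z ≠ 0 := by
  by_cases h1 : z0 = 1
  · subst h1
    refine S.nearpt h hr (Or.inl rfl) (a := -A) (by linarith [h.hA0]) ?_ hz (ExpAsymp.ev_ne (h.VV_pos 1) S.one)
    push_cast; ring
  by_cases h2 : z0 = -1
  · subst h2
    refine S.nearpt h hr (Or.inr rfl) (a := -B) (by linarith [h.hB0]) ?_ hz (ExpAsymp.ev_ne (h.VV_pos (-1)) S.neg_one)
    push_cast; ring
  obtain ⟨U, hU, h3⟩ := S.locAsymp h hr hz h1 h2 one_pos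
  exact ⟨U, hU, h3.mono fun n hn z hz => (hn z hz).1⟩

lemma JSeq.accum (h : Par A B) {p : ℕ → ℂ[X]} {α β : ℕ → ℝ} (S : JSeq A B p α β)
    {γL γC γR : ℝ → ℂ} (hr : ArcParam A B γL γC γR) {K : Set ℂ} (hK : IsCompact K) (hKG : K ∩ Gam A B = ∅) :
    ∀ᶠ n : ℕ in atTop, ∀ z ∈ K, (p n).eval z ≠ 0 := by
  refine hK.induction_on (p := fun s => ∀ᶠ n : ℕ in atTop, ∀ z ∈ s, (p n).eval z ≠ 0) (by simp)
      (fun s t hst ht => ht.mono fun n hn z hz => hn z (hst hz))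
      (fun s t hs ht => (hs.and ht).mono fun n hn z hz => hz.elim (hn.1 z) (hn.2 z)) ?_
  intro z hz
  obtain ⟨U, hU, hU'⟩ := S.zerofree h hr (z0 := z) (fun hG => by
    have : z ∈ K ∩ Gam A B := ⟨hz, hG⟩
    rw [hKG] at this; exact this)
  exact ⟨U, mem_nhdsWithin_of_mem_nhds hU, hU'⟩

end

section
variable {A B : ℝ}
open MeasureTheory

def dbar (f : ℂ → ℂ) (z : ℂ) : ℂ := (fderiv ℝ f z 1 + I * fderiv ℝ f z I) / 2

lemma fderiv_split (L : ℂ →L[ℝ] ℂ) (w : ℂ) : L w = w.re * L 1 + w.im * L I := by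
  conv_lhs => rw [← re_add_im w]
  have e1 : (w.re : ℂ) = w.re • (1:ℂ) := by simp
  have e2 : (w.im : ℂ) * I = w.im • I := by simp
  rw [map_add, e1, e2, map_smul, map_smul]; simp

lemma polar_symm_eq (r θ : ℝ) : Complex.polarCoord.symm (r, θ) = r * exp (θ * I) := by
  rw [Complex.polarCoord_symm_apply, exp_mul_I, ← ofReal_cos, ← ofReal_sin]

lemma dbar_polar (f : ℂ → ℂ) {r θ : ℝ} (hr : r ≠ 0) :
    r • (dbar f (r * exp (θ * I)) / (r * exp (θ * I))) =
      (1/2) * fderiv ℝ f (r * exp (θ * I)) (exp (θ*I)) + (I/2) * fderiv ℝ f (r * exp (θ * I)) (I * exp (θ*I)) := by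
  have hr' : (r:ℂ) ≠ 0 := by exact_mod_cast hr
  have he := exp_ne_zero (θ * I)
  rw [fderiv_split _ (exp (θ*I)), fderiv_split _ (I * exp (θ*I))]
  unfold dbar
  generalize fderiv ℝ f (r * exp (θ * I)) 1 = a
  generalize fderiv ℝ f (r * exp (θ * I)) I = b
  have hc : (exp (θ*I)).re = Real.cos θ := exp_ofReal_mul_I_re θ
  have hs : (exp (θ*I)).im = Real.sin θ := exp_ofReal_mul_I_im θ
  simp only [mul_re, mul_im, I_re, I_im, hc, hs, real_smul]
  have e : exp (θ*I) = Real.cos θ + Real.sin θ * I := by rw [exp_mul_I, ← ofReal_cos, ← ofReal_sin]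
  rw [mul_div_assoc', mul_div_mul_left _ _ hr', div_eq_iff he, e]
  have cs : (Real.cos θ:ℂ)^2 + (Real.sin θ:ℂ)^2 = 1 := by exact_mod_cast Real.cos_sq_add_sin_sq θ
  push_cast at cs ⊢
  generalize (Complex.cos θ) = c at *
  generalize (Complex.sin θ) = s at *
  simp only [zero_mul, one_mul, zero_sub, zero_add]
  linear_combination (-(a + I*b)/2) * cs + (s^2*a/2 - c*s*b/2) * I_sq

/-- Cauchy–Pompeiu formula for compactly supported functions -/
lemma pompeiu0 {f : ℂ → ℂ} (hf : ContDiff ℝ 1 f) (hc : HasCompactSupport f) :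
    ∫ z, dbar f z / z = - (Real.pi * f 0) := by
  rw [← Complex.integral_comp_polarCoord_symm]
  obtain ⟨R0, hR0⟩ := hc.isCompact.isBounded.subset_closedBall 0
  set R := max R0 0 + 1 with hR
  have Rp : 0 < R := by rw [hR]; positivity
  have hz0 : ∀ z : ℂ, R ≤ ‖z‖ → z ∉ tsupport f := by
    intro z hz hz'
    have := hR0 hz'
    rw [mem_closedBall_zero_iff] at this
    have := le_max_left R0 0; linarith
  have vz : ∀ z : ℂ, R ≤ ‖z‖ → f z = 0 := fun z hz => image_eq_zero_of_notMem_tsupport (hz0 z hz)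
  have dz : ∀ z : ℂ, R ≤ ‖z‖ → fderiv ℝ f z = 0 := fun z hz =>
    image_eq_zero_of_notMem_tsupport (fun h => hz0 z hz (tsupport_fderiv_subset ℝ h))
  have cD := hf.continuous_fderiv one_ne_zero
  set D1 : ℝ × ℝ → ℂ := fun q => (1/2) * fderiv ℝ f (q.1 * exp (q.2 * I)) (exp (q.2*I)) with hD1
  set D2 : ℝ × ℝ → ℂ := fun q => (I/2) * fderiv ℝ f (q.1 * exp (q.2 * I)) (I * exp (q.2*I)) with hD2
  have c1 : Continuous D1 := by
    refine continuous_const.mul (Continuous.clm_apply (cD.comp (by fun_prop)) (by fun_prop))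
  have c2 : Continuous D2 := by
    refine continuous_const.mul (Continuous.clm_apply (cD.comp (by fun_prop)) (by fun_prop))
  have nn : ∀ q : ℝ × ℝ, ‖(q.1 * exp (q.2 * I) : ℂ)‖ = |q.1| := by
    intro q; rw [norm_mul, norm_exp_ofReal_mul_I, mul_one, norm_real, Real.norm_eq_abs]
  have ion : ∀ D : ℝ × ℝ → ℂ, Continuous D → (∀ q : ℝ × ℝ, R ≤ q.1 → D q = 0) →
      IntegrableOn D (Ioi (0:ℝ) ×ˢ Ioo (-Real.pi) Real.pi) (volume.prod volume) := by
    intro D cD hD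
    have : IntegrableOn D (Icc 0 R ×ˢ Icc (-Real.pi) Real.pi) (volume.prod volume) :=
      cD.continuousOn.integrableOn_compact (isCompact_Icc.prod isCompact_Icc)
    refine this.of_forall_sdiff_eq_zero (measurableSet_Ioi.prod measurableSet_Ioo) ?_
    rintro ⟨r, θ⟩ ⟨⟨h1, h2⟩, h3⟩
    apply hD
    by_contra h4
    push Not at h4
    exact h3 ⟨⟨le_of_lt h1, h4.le⟩, ⟨h2.1.le, h2.2.le⟩⟩
  have i1 := ion D1 c1 (fun q hq => by
    simp only [hD1]; rw [dz _ (by rw [nn]; exact hq.trans (le_abs_self _))]; simp)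
  have i2 := ion D2 c2 (fun q hq => by
    simp only [hD2]; rw [dz _ (by rw [nn]; exact hq.trans (le_abs_self _))]; simp)
  have e0 : ∫ q in polarCoord.target, q.1 • (dbar f (Complex.polarCoord.symm q) / Complex.polarCoord.symm q) =
      ∫ q in Ioi (0:ℝ) ×ˢ Ioo (-Real.pi) Real.pi, (D1 q + D2 q) := by
    rw [polarCoord_target]
    refine setIntegral_congr_fun (measurableSet_Ioi.prod measurableSet_Ioo) ?_
    rintro ⟨r, θ⟩ ⟨h1, h2⟩
    simp only [polar_symm_eq]
    exact dbar_polar f (ne_of_gt h1)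
  rw [e0, Measure.volume_eq_prod, integral_add i1 i2]
  have hd : Differentiable ℝ f := hf.differentiable one_ne_zero
  have I2 : ∫ q in Ioi (0:ℝ) ×ˢ Ioo (-Real.pi) Real.pi, D2 q ∂(volume.prod volume) = 0 := by
    rw [setIntegral_prod _ i2]
    refine setIntegral_eq_zero_of_forall_eq_zero ?_
    intro r hr
    have hr0 : (r:ℂ) ≠ 0 := by exact_mod_cast (ne_of_gt hr)
    have hder : ∀ θ : ℝ, HasDerivAt (fun θ : ℝ => (I/2)*((r:ℂ)⁻¹ * f (r * exp (θ * I)))) (D2 (r, θ)) θ := by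
      intro θ
      have h1 : HasDerivAt (fun θ : ℝ => (r:ℂ) * exp (θ * I)) (r * (I * exp (θ*I))) θ := by
        have := (((hasDerivAt_id θ).ofReal_comp.mul_const I).cexp).const_mul (r:ℂ)
        refine this.congr_deriv ?_
        simp only [id]; push_cast; ring
      have h2 := (((hd _).hasFDerivAt.comp_hasDerivAt θ h1).const_mul (r:ℂ)⁻¹).const_mul (I/2)
      refine h2.congr_deriv ?_
      simp only [hD2]
      rw [show (r:ℂ) * (I * exp (θ*I)) = r • (I * exp (θ*I)) from (real_smul).symm, map_smul, real_smul]
      field_simp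
    rw [← integral_Ioc_eq_integral_Ioo, ← intervalIntegral.integral_of_le (by linarith [Real.pi_pos]),
      intervalIntegral.integral_eq_sub_of_hasDerivAt (fun θ _ => hder θ)
        ((c2.comp (by fun_prop : Continuous fun θ : ℝ => ((r, θ) : ℝ × ℝ))).intervalIntegrable _ _)]
    have : exp (((-Real.pi : ℝ):ℂ) * I) = exp ((Real.pi:ℂ)*I) := by
      push_cast; rw [neg_mul, exp_neg, exp_pi_mul_I]; norm_num
    rw [this, sub_self]
  have I1 : ∫ q in Ioi (0:ℝ) ×ˢ Ioo (-Real.pi) Real.pi, D1 q ∂(volume.prod volume) = -(Real.pi * f 0) := by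
    rw [← Measure.prod_restrict, integral_prod_symm _ (by rw [Measure.prod_restrict]; exact i1)]
    have inner : ∀ θ : ℝ, ∫ r in Ioi (0:ℝ), D1 (r, θ) = -(f 0/2) := by
      intro θ
      have hder : ∀ r : ℝ, HasDerivAt (fun r : ℝ => (1/2) * f (r * exp (θ * I))) (D1 (r, θ)) r := by
        intro r
        have h1 : HasDerivAt (fun r : ℝ => (r:ℂ) * exp (θ * I)) (exp (θ*I)) r := by
          have := ((hasDerivAt_id r).ofReal_comp.mul_const (exp (θ*I)))
          refine this.congr_deriv ?_
          simp
        exact ((hd _).hasFDerivAt.comp_hasDerivAt r h1).const_mul (1/2)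
      have cc : Continuous fun r : ℝ => D1 (r, θ) := c1.comp (by fun_prop)
      have z1 : ∀ r : ℝ, R ≤ r → D1 (r, θ) = 0 := by
        intro r hr
        simp only [hD1]; rw [dz _ (by rw [nn (r, θ)]; exact hr.trans (le_abs_self _))]; simp
      have iI : IntegrableOn (fun r : ℝ => D1 (r, θ)) (Ioi 0) := by
        have : IntegrableOn (fun r : ℝ => D1 (r, θ)) (Icc 0 R) := cc.continuousOn.integrableOn_compact isCompact_Icc
        refine this.of_forall_sdiff_eq_zero measurableSet_Ioi ?_
        rintro r ⟨h1, h3⟩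
        apply z1
        by_contra h4
        push Not at h4
        exact h3 ⟨le_of_lt h1, h4.le⟩
      rw [integral_Ioi_of_hasDerivAt_of_tendsto (m := 0) (hder 0).continuousAt.continuousWithinAt (fun r _ => hder r) iI ?_]
      · simp; ring
      · refine tendsto_const_nhds.congr' ?_
        filter_upwards [eventually_ge_atTop R] with r hr
        rw [vz _ (by rw [nn (r, θ)]; exact hr.trans (le_abs_self _)), mul_zero]
    simp only [inner]
    rw [setIntegral_const]
    simp [Real.pi_pos.le]
    ring
  rw [I1, I2, add_zero]

lemma dbar_comp_add (f : ℂ → ℂ) (t z : ℂ) : dbar (fun z => f (z + t)) z = dbar f (z + t) := by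
  unfold dbar; rw [fderiv_comp_add_right]

lemma pompeiu {f : ℂ → ℂ} (hf : ContDiff ℝ 1 f) (hc : HasCompactSupport f) (t : ℂ) :
    ∫ z, dbar f z / (z - t) = - (Real.pi * f t) := by
  have h1 := pompeiu0 (f := fun z => f (z + t)) (hf.comp (contDiff_id.add contDiff_const))
    (hc.comp_homeomorph (Homeomorph.addRight t))
  simp only [dbar_comp_add, zero_add] at h1
  rw [← h1, ← integral_add_right_eq_self (fun z => dbar f z / (z - t)) t]
  simp

end

section
variable {A B : ℝ}
open MeasureTheory

lemma curve_null {γ : ℝ → ℂ} (hγ : ContDiff ℝ 1 γ) (s : Set ℝ) : volume (γ '' s) = 0 := by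
  have hd : ∀ z ∈ (univ : Set ℂ), HasFDerivWithinAt (fun z : ℂ => γ z.re)
      ((fderiv ℝ γ z.re).comp reCLM) univ z := fun z _ =>
    (((hγ.differentiable one_ne_zero) z.re).hasFDerivAt.comp z reCLM.hasFDerivAt).hasFDerivWithinAt
  have := addHaar_image_eq_zero_of_det_fderivWithin_eq_zero (μ := (volume : Measure ℂ)) hd ?_
  · refine measure_mono_null ?_ this
    rintro _ ⟨t, -, rfl⟩
    exact ⟨t, trivial, by simp⟩
  · intro z _
    by_contra h
    have hu : IsUnit (LinearMap.det (((fderiv ℝ γ z.re).comp reCLM : ℂ →L[ℝ] ℂ) : ℂ →ₗ[ℝ] ℂ)) := isUnit_iff_ne_zero.2 h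
    have hk := LinearMap.bot_lt_ker_of_det_eq_zero (f := (((fderiv ℝ γ z.re).comp reCLM : ℂ →L[ℝ] ℂ) : ℂ →ₗ[ℝ] ℂ))
    have inj : Function.Injective (((fderiv ℝ γ z.re).comp reCLM : ℂ →L[ℝ] ℂ) : ℂ →ₗ[ℝ] ℂ) :=
      (LinearMap.equivOfDetNeZero _ h).injective
    have : (I:ℂ) = 0 := inj (by simp)
    exact I_ne_zero this

lemma Par.Gam_null (h : Par A B) {γL γC γR : ℝ → ℂ} (hr : ArcParam A B γL γC γR) : volume (Gam A B) = 0 := by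
  rw [← h.Gamma_eq, ← hr.union]
  exact measure_union_null (measure_union_null (curve_null hr.smoothL _) (curve_null hr.smoothC _)) (curve_null hr.smoothR _)

lemma Par.Hh_locbdd (h : Par A B) (z0 : ℂ) : ∃ M : ℝ, 0 ≤ M ∧ ∀ᶠ z in 𝓝 z0, z ∉ Gam A B → ‖Hh A B z‖ ≤ M := by
  by_cases hz : z0 ∈ Gam A B
  · have h1 : z0 ≠ 1 := by rintro rfl; exact h.one_notMem hz
    have h2 : z0 ≠ -1 := by rintro rfl; exact h.neg_one_notMem hz
    have hz0 := one_sub_sq_ne h1 h2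
    have hQ : Continuous (Qf A B) := by unfold Qf; fun_prop
    obtain ⟨M1, m1, b1⟩ := ev_bdd (hQ.continuousAt (x := z0))
    have c1 : ContinuousAt (fun z : ℂ => ((A+B)*z + A - B)/(2*(1-z^2))) z0 :=
      ContinuousAt.div (by fun_prop) (by fun_prop) (mul_ne_zero two_ne_zero hz0)
    have c2 : ContinuousAt (fun z : ℂ => ((A+B+2:ℂ))/(2*(1-z^2))) z0 :=
      ContinuousAt.div (by fun_prop) (by fun_prop) (mul_ne_zero two_ne_zero hz0)
    obtain ⟨M2, m2, b2⟩ := ev_bdd c1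
    obtain ⟨M3, m3, b3⟩ := ev_bdd c2
    refine ⟨M2 + M3*(1+M1), by positivity, ?_⟩
    filter_upwards [b1, b2, b3, eventually_ne_nhds h1, eventually_ne_nhds h2] with z b1 b2 b3 z1 z2 zG
    rw [h.Hh_eq zG z1 z2]
    have e : lam A B z (dg A B z) = ((A+B)*z + A - B)/(2*(1-z^2)) - (A+B+2:ℂ)/(2*(1-z^2)) * dg A B z := by
      unfold lam; ring
    have hd : ‖dg A B z‖ ≤ 1 + M1 := by
      have := congrArg norm (dg_sq A B z)
      rw [norm_pow] at this
      nlinarith [norm_nonneg (dg A B z), sq_nonneg (‖dg A B z‖ - 1)]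
    rw [e]
    refine (norm_sub_le _ _).trans ?_
    rw [norm_mul]
    gcongr
  · obtain ⟨M, m, b⟩ := ev_bdd (h.Hh_analytic hz).continuousAt
    exact ⟨M, m, b.mono fun z hz _ => hz⟩

lemma Par.Hh_bdd (h : Par A B) {K : Set ℂ} (hK : IsCompact K) : ∃ M : ℝ, 0 ≤ M ∧ ∀ z ∈ K, z ∉ Gam A B → ‖Hh A B z‖ ≤ M := by
  refine hK.induction_on (p := fun s => ∃ M : ℝ, 0 ≤ M ∧ ∀ z ∈ s, z ∉ Gam A B → ‖Hh A B z‖ ≤ M) ⟨0, le_rfl, by simp⟩ ?_ ?_ ?_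
  · rintro s t hst ⟨M, m, hM⟩; exact ⟨M, m, fun z hz => hM z (hst hz)⟩
  · rintro s t ⟨M, m, hM⟩ ⟨M', m', hM'⟩
    refine ⟨max M M', le_max_of_le_left m, fun z hz hG => ?_⟩
    rcases hz with hz | hz
    · exact (hM z hz hG).trans (le_max_left _ _)
    · exact (hM' z hz hG).trans (le_max_right _ _)
  · intro z0 _
    obtain ⟨M, m, hM⟩ := h.Hh_locbdd z0
    exact ⟨_, mem_nhdsWithin_of_mem_nhds hM, M, m, fun z hz => hz⟩

lemma Par.Hh_aesm (h : Par A B) {γL γC γR : ℝ → ℂ} (hr : ArcParam A B γL γC γR) : AEStronglyMeasurable (Hh A B) volume := by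
  have : ContinuousOn (Hh A B) (Gam A B)ᶜ := fun z hz => (h.Hh_analytic hz).continuousAt.continuousWithinAt
  have h1 := this.aestronglyMeasurable (μ := volume) h.Gam_closed.isOpen_compl.measurableSet
  have h2 : (volume.restrict (Gam A B)ᶜ : Measure ℂ) = volume := by
    apply Measure.restrict_eq_self_of_ae_mem
    rw [ae_iff]; simpa using h.Gam_null hr
  rwa [h2] at h1

lemma inv_locInt : LocallyIntegrable (fun z : ℂ => z⁻¹) volume := by
  refine locallyIntegrable_of_norm_le_rpow (C := 1) (α := 1) (by simp) (by simp) ?_ measurable_inv.aestronglyMeasurable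
  refine Eventually.of_forall fun z => ?_
  rw [norm_inv, Real.rpow_neg_one, one_mul]

lemma inv_small {ε : ℝ} (hε : 0 < ε) : ∃ δ > 0, ∀ s : Set ℂ, MeasurableSet s → volume s ≤ ENNReal.ofReal δ →
    ∀ t : ℂ, ∫⁻ z in s, ‖(1/(z-t) : ℂ)‖ₑ ≤ ENNReal.ofReal ε := by
  have h1 : IntegrableOn (fun z : ℂ => z⁻¹) (Metric.closedBall 0 1) := inv_locInt.integrableOn_isCompact (isCompact_closedBall _ _)
  set g : ℂ → ENNReal := (Metric.closedBall (0:ℂ) 1).indicator (fun z => ‖z⁻¹‖ₑ) with hg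
  have mg : Measurable g := (measurable_inv.enorm).indicator Metric.isClosed_closedBall.measurableSet
  have hfin : ∫⁻ z, g z ≠ ⊤ := by
    rw [hg, lintegral_indicator Metric.isClosed_closedBall.measurableSet]
    exact h1.2.ne
  obtain ⟨δ, δ0, hδ⟩ := exists_pos_setLIntegral_lt_of_measure_lt hfin (ε := ENNReal.ofReal (ε/2)) (by simpa using hε)
  obtain ⟨δ', δ'0, hδ'⟩ : ∃ δ' : ℝ, 0 < δ' ∧ ENNReal.ofReal δ' < δ := by
    obtain ⟨q, q0, hq⟩ := ENNReal.lt_iff_exists_nnreal_btwn.1 δ0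
    refine ⟨q, by simpa using q0, by simpa using hq⟩
  refine ⟨min δ' (ε/2), by positivity, fun s hs hsv t => ?_⟩
  have le1 : ∀ z : ℂ, ‖(1/(z-t):ℂ)‖ₑ ≤ g (z - t) + 1 := by
    intro z
    rw [hg, one_div]
    by_cases hz : z - t ∈ Metric.closedBall (0:ℂ) 1
    · rw [indicator_of_mem hz]; exact le_self_add
    · rw [indicator_of_notMem hz, zero_add]
      rw [mem_closedBall_zero_iff] at hz
      push Not at hz
      rw [← ofReal_norm, norm_inv, ENNReal.ofReal_le_one]
      exact inv_le_one_of_one_le₀ hz.le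
  calc ∫⁻ z in s, ‖(1/(z-t):ℂ)‖ₑ ≤ ∫⁻ z in s, (g (z-t) + 1) := lintegral_mono fun z => le1 z
    _ = (∫⁻ z in s, g (z-t)) + volume s := by
        rw [lintegral_add_right _ measurable_const]; simp
    _ ≤ ENNReal.ofReal (ε/2) + ENNReal.ofReal (ε/2) := by
        gcongr
        · have e : ∫⁻ z in s, g (z-t) = ∫⁻ z in ((fun z => z + t) ⁻¹' s), g z := by
            rw [← lintegral_indicator hs, ← lintegral_indicator (measurable_add_const t hs),
              ← lintegral_add_right_eq_self _ t]
            congr 1; ext z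
            simp only [indicator, mem_preimage]; simp
            rfl
          rw [e]
          refine (hδ _ ?_).le
          rw [measure_preimage_add_right]
          exact lt_of_le_of_lt (hsv.trans (ENNReal.ofReal_le_ofReal (min_le_left _ _))) hδ'
        · exact hsv.trans (ENNReal.ofReal_le_ofReal (min_le_right _ _))
    _ = ENNReal.ofReal ε := by rw [← ENNReal.ofReal_add (by positivity) (by positivity)]; ring_nf

def hs (p : ℕ → ℂ[X]) (n : ℕ) (z : ℂ) : ℂ := ((p n).roots.map (fun t => 1/(z-t))).sum / n

lemma msum_enorm (m : Multiset ℂ) (s : Set ℂ) {e : ENNReal} (he : ∀ t : ℂ, ∫⁻ z in s, ‖(1/(z-t) : ℂ)‖ₑ ≤ e) :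
    ∫⁻ z in s, ‖(m.map (fun t => 1/(z-t))).sum‖ₑ ≤ m.card * e := by
  induction m using Multiset.induction_on with
  | empty => simp
  | cons a m ih =>
    simp only [Multiset.map_cons, Multiset.sum_cons, Multiset.card_cons]
    calc _ ≤ ∫⁻ z in s, (‖(1/(z-a):ℂ)‖ₑ + ‖(m.map (fun t => 1/(z-t))).sum‖ₑ) := lintegral_mono fun z => enorm_add_le _ _
      _ = _ := lintegral_add_left (by fun_prop) _
      _ ≤ e + m.card * e := add_le_add (he a) ih
      _ = _ := by push_cast; ring

lemma msum_meas (m : Multiset ℂ) : Measurable (fun z : ℂ => (m.map (fun t => 1/(z-t))).sum) := by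
  induction m using Multiset.induction_on with
  | empty => simp
  | cons a m ih =>
    simp only [Multiset.map_cons, Multiset.sum_cons]
    exact Measurable.add (by fun_prop) ih

lemma hs_meas (p : ℕ → ℂ[X]) (n : ℕ) : Measurable (hs p n) := (msum_meas _).div_const _

lemma JSeq.hs_tendsto (h : Par A B) {p : ℕ → ℂ[X]} {α β : ℕ → ℝ} (S : JSeq A B p α β)
    {γL γC γR : ℝ → ℂ} (hr : ArcParam A B γL γC γR) {z0 : ℂ} (hz : z0 ∉ Gam A B) (h1 : z0 ≠ 1) (h2 : z0 ≠ -1) :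
    Tendsto (fun n => hs p n z0) atTop (𝓝 (Hh A B z0)) := by
  rw [Metric.tendsto_nhds]
  intro ε hε
  obtain ⟨U, hU, hU'⟩ := S.locAsymp h hr hz h1 h2 (half_pos hε)
  filter_upwards [hU', eventually_ge_atTop 1] with n hn n1
  obtain ⟨q1, q2⟩ := hn z0 (mem_of_mem_nhds hU)
  have : hs p n z0 = Dn p n z0 / Pn p n z0 := by
    unfold hs Dn Pn
    rw [← (IsAlgClosed.splits (p n)).eval_derivative_div_eval_of_ne_zero q1, div_right_comm]
  rw [dist_eq, this]; linarith

lemma JSeq.hs_small {p : ℕ → ℂ[X]} {α β : ℕ → ℝ} (S : JSeq A B p α β) (n : ℕ) (s : Set ℂ) {e : ENNReal}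
    (he : ∀ t : ℂ, ∫⁻ z in s, ‖(1/(z-t) : ℂ)‖ₑ ≤ e) : ∫⁻ z in s, ‖hs p n z‖ₑ ≤ e := by
  by_cases hn : n = 0
  · subst hn; unfold hs; simp
  have h1 := msum_enorm (p n).roots s he
  have hc : ((p n).roots.card : ENNReal) ≤ n := by
    exact_mod_cast ((p n).card_roots').trans (S.deg n)
  have hn0 : (n:ENNReal) ≠ 0 := by exact_mod_cast hn
  unfold hs
  simp only [div_eq_mul_inv, enorm_mul]
  rw [lintegral_mul_const _ (by have := msum_meas (p n).roots; simp only [div_eq_mul_inv] at this; exact this.enorm)]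
  have e2 : ‖((n:ℂ))⁻¹‖ₑ = (n:ENNReal)⁻¹ := by
    rw [enorm_inv (by exact_mod_cast hn)]; simp [enorm_eq_nnnorm]
  rw [e2]
  simp only [div_eq_mul_inv] at h1
  calc _ ≤ ((p n).roots.card * e) * (n:ENNReal)⁻¹ := by gcongr
    _ ≤ (n * e) * (n:ENNReal)⁻¹ := by gcongr
    _ = e := by
      rw [mul_comm (n:ENNReal) e, mul_assoc, ENNReal.mul_inv_cancel hn0 (ENNReal.natCast_ne_top n), mul_one]

end

section
variable {A B : ℝ}
open MeasureTheory

lemma dbar_cont {f : ℂ → ℂ} (hf : ContDiff ℝ 1 f) : Continuous (dbar f) := by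
  have h1 := hf.continuous_fderiv one_ne_zero
  unfold dbar
  fun_prop

lemma dbar_zero {f : ℂ → ℂ} {z : ℂ} (hz : z ∉ tsupport f) : dbar f z = 0 := by
  have h1 : fderiv ℝ f z = 0 := by
    by_contra hc
    exact hz (support_fderiv_subset ℝ hc)
  simp [dbar, h1]

lemma dbar_supp {f : ℂ → ℂ} (hc : HasCompactSupport f) : HasCompactSupport (dbar f) :=
  hc.mono' fun z hz => by
    by_contra hn; exact hz (dbar_zero hn)

lemma cc_inv_int {φ : ℂ → ℂ} (hφ : Continuous φ) (hc : HasCompactSupport φ) (t : ℂ) :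
    Integrable (fun z => φ z * (1/(z-t))) := by
  have h1 : Integrable (fun z => φ (z+t) • z⁻¹) :=
    inv_locInt.integrable_smul_left_of_hasCompactSupport (by fun_prop)
      (hc.comp_homeomorph (Homeomorph.addRight t))
  have h2 := h1.comp_sub_right t
  refine h2.congr (Eventually.of_forall fun z => ?_)
  simp

lemma msum_pompeiu {f : ℂ → ℂ} (hf : ContDiff ℝ 1 f) (hc : HasCompactSupport f) (m : Multiset ℂ) :
    Integrable (fun z => dbar f z * (m.map (fun t => 1/(z-t))).sum) ∧
    ∫ z, dbar f z * (m.map (fun t => 1/(z-t))).sum = -(Real.pi * (m.map f).sum) := by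
  induction m using Multiset.induction_on with
  | empty => simp
  | cons a m ih =>
    simp only [Multiset.map_cons, Multiset.sum_cons, mul_add]
    have ha := cc_inv_int (dbar_cont hf) (dbar_supp hc) a
    refine ⟨ha.add ih.1, ?_⟩
    rw [integral_add ha ih.1, ih.2]
    have := pompeiu hf hc a
    simp only [mul_one_div]
    rw [this]; ring

/-- the limit functional -/
def Lf (A B : ℝ) (f : ℂ → ℂ) : ℂ := -(1/Real.pi) * ∫ z, dbar f z * Hh A B z

lemma hs_pompeiu {f : ℂ → ℂ} (hf : ContDiff ℝ 1 f) (hc : HasCompactSupport f) (p : ℕ → ℂ[X]) (n : ℕ) :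
    Integrable (fun z => dbar f z * hs p n z) ∧
    ((p n).roots.map f).sum / n = -(1/Real.pi) * ∫ z, dbar f z * hs p n z := by
  obtain ⟨h1, h2⟩ := msum_pompeiu hf hc (p n).roots
  have e : (fun z => dbar f z * hs p n z) = fun z => (dbar f z * ((p n).roots.map (fun t => 1/(z-t))).sum) / n := by
    ext z; unfold hs; ring
  rw [e]
  refine ⟨h1.div_const _, ?_⟩
  rw [integral_div, h2]
  have : (Real.pi:ℂ) ≠ 0 := by exact_mod_cast Real.pi_ne_zero
  field_simp

lemma Par.Hh_int (h : Par A B) {γL γC γR : ℝ → ℂ} (hr : ArcParam A B γL γC γR) {K : Set ℂ} (hK : IsCompact K) :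
    IntegrableOn (Hh A B) K := by
  obtain ⟨M, m, hM⟩ := h.Hh_bdd hK
  have : IsFiniteMeasure (volume.restrict K : Measure ℂ) := ⟨by simpa using hK.measure_lt_top⟩
  refine Integrable.of_bound (h.Hh_aesm hr).restrict M ?_
  have h1 : ∀ᵐ z ∂(volume.restrict K : Measure ℂ), z ∉ Gam A B := by
    apply ae_restrict_of_ae
    rw [ae_iff]; simpa using h.Gam_null hr
  filter_upwards [h1, ae_restrict_mem hK.measurableSet] with z hz hk using hM z hk hz

lemma Par.Lf_int (h : Par A B) {γL γC γR : ℝ → ℂ} (hr : ArcParam A B γL γC γR) {φ : ℂ → ℂ}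
    (hφ : Continuous φ) (hc : HasCompactSupport φ) : Integrable (fun z => φ z * Hh A B z) := by
  have hl : LocallyIntegrable (Hh A B) volume := by
    rw [locallyIntegrable_iff]
    exact fun K hK => h.Hh_int hr hK
  exact hl.integrable_smul_left_of_hasCompactSupport hφ hc

lemma JSeq.limC1 (h : Par A B) {p : ℕ → ℂ[X]} {α β : ℕ → ℝ} (S : JSeq A B p α β)
    {γL γC γR : ℝ → ℂ} (hr : ArcParam A B γL γC γR) {f : ℂ → ℂ} (hf : ContDiff ℝ 1 f) (hc : HasCompactSupport f) :
    Tendsto (fun n => ((p n).roots.map f).sum / n) atTop (𝓝 (Lf A B f)) := by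
  have e : (fun n => ((p n).roots.map f).sum / n) = fun n => -(1/Real.pi) * ∫ z, dbar f z * hs p n z := by
    ext n; exact (hs_pompeiu hf hc p n).2
  rw [e]
  refine Tendsto.const_mul _ ?_
  set K := tsupport f with hKdef
  have hK : IsCompact K := hc
  have : IsFiniteMeasure (volume.restrict K : Measure ℂ) := ⟨by simpa using hK.measure_lt_top⟩
  have hae : ∀ᵐ z ∂(volume : Measure ℂ), z ∉ Gam A B := by
    rw [ae_iff]; simpa using h.Gam_null hr
  have hpt : ∀ (c : ℂ), ∀ᵐ z ∂(volume : Measure ℂ), z ≠ c := fun c => by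
    rw [ae_iff]; simp
  have hL1 : Tendsto (fun n => eLpNorm (hs p n - Hh A B) 1 (volume.restrict K)) atTop (𝓝 0) := by
    refine tendsto_Lp_finite_of_tendsto_ae le_rfl ENNReal.one_ne_top (fun n => (hs_meas p n).aestronglyMeasurable)
      (memLp_one_iff_integrable.2 (h.Hh_int hr hK)) ?_ ?_
    · intro ε hε
      obtain ⟨δ, δ0, hδ⟩ := inv_small hε
      refine ⟨δ, δ0, fun n s hs' hsv => ?_⟩
      rw [eLpNorm_one_eq_lintegral_enorm]
      have e1 : (fun z => ‖s.indicator (hs p n) z‖ₑ) = s.indicator (fun z => ‖hs p n z‖ₑ) := by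
        ext z; exact enorm_indicator_eq_indicator_enorm _ _
      rw [e1, lintegral_indicator hs', Measure.restrict_restrict hs']
      refine S.hs_small n _ (hδ _ (hs'.inter hK.measurableSet) ?_)
      rwa [Measure.restrict_apply hs'] at hsv
    · apply ae_restrict_of_ae
      filter_upwards [hae, hpt 1, hpt (-1)] with z h0 h1 h2 using S.hs_tendsto h hr h0 h1 h2
  obtain ⟨C, hC⟩ : ∃ C, ∀ z, ‖dbar f z‖ ≤ C := (dbar_cont hf).bounded_above_of_compact_support (dbar_supp hc)
  have hC0 : 0 ≤ C := (norm_nonneg _).trans (hC 0)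
  refine tendsto_integral_of_L1 _ (h.Lf_int hr (dbar_cont hf) (dbar_supp hc)).1 (Eventually.of_forall fun n => (hs_pompeiu hf hc p n).1) ?_
  have hb : ∀ n, ∫⁻ z, ‖dbar f z * hs p n z - dbar f z * Hh A B z‖ₑ ≤ ENNReal.ofReal C * eLpNorm (hs p n - Hh A B) 1 (volume.restrict K) := by
    intro n
    rw [eLpNorm_one_eq_lintegral_enorm, ← lintegral_const_mul' _ _ ENNReal.ofReal_ne_top, ← lintegral_indicator hK.measurableSet]
    refine lintegral_mono fun z => ?_
    by_cases hz : z ∈ K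
    · rw [indicator_of_mem hz, ← mul_sub, enorm_mul]
      gcongr
      · rw [← ofReal_norm]; exact ENNReal.ofReal_le_ofReal (hC z)
      · rfl
    · rw [indicator_of_notMem hz, dbar_zero hz]; simp
  refine tendsto_of_tendsto_of_tendsto_of_le_of_le tendsto_const_nhds ?_ (fun _ => zero_le) hb
  have := ENNReal.Tendsto.const_mul hL1 (Or.inr (ENNReal.ofReal_ne_top (r := C)))
  simpa using this

end

section
variable {A B : ℝ}
open MeasureTheory

lemma int_half {φ : ℝ → ℂ} (hφ : ContDiff ℝ 1 φ) (hc : HasCompactSupport φ) (a b : ℂ) :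
    ∫ u : ℝ, (if 0 < u then a else b) * deriv φ u = (b - a) * φ 0 := by
  have hi : Integrable (deriv φ) := (hφ.continuous_deriv le_rfl).integrable_of_hasCompactSupport hc.deriv
  have h1 : ∫ u in Ioi (0:ℝ), (if 0 < u then a else b) * deriv φ u = a * (-φ 0) := by
    rw [← hc.integral_Ioi_deriv_eq hφ, ← integral_const_mul]
    refine setIntegral_congr_fun measurableSet_Ioi fun u hu => ?_
    simp only [mem_Ioi] at hu; simp [hu]
  have h2 : ∫ u in Iic (0:ℝ), (if 0 < u then a else b) * deriv φ u = b * φ 0 := by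
    rw [← hc.integral_Iic_deriv_eq hφ, ← integral_const_mul]
    refine setIntegral_congr_fun measurableSet_Iic fun u hu => ?_
    simp only [mem_Iic] at hu; simp [not_lt.2 hu]
  have e1 : IntegrableOn (fun u => (if 0 < u then a else b) * deriv φ u) (Ioi (0:ℝ)) :=
    IntegrableOn.congr_fun (hi.const_mul a).integrableOn (fun u hu => by simp only [mem_Ioi] at hu; simp [hu]) measurableSet_Ioi
  have e2 : IntegrableOn (fun u => (if 0 < u then a else b) * deriv φ u) (Iic (0:ℝ)) :=
    IntegrableOn.congr_fun (hi.const_mul b).integrableOn (fun u hu => by simp only [mem_Iic] at hu; simp [not_lt.2 hu]) measurableSet_Iic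
  rw [← setIntegral_univ, ← Iic_union_Ioi (a := (0:ℝ)), setIntegral_union (Iic_disjoint_Ioi le_rfl) measurableSet_Ioi e2 e1, h1, h2]
  ring

lemma slice_supp {F : ℂ → ℂ} (hc : HasCompactSupport F) {φ : ℝ → ℂ} (hφ : Continuous φ) (hp : ∀ R : ℝ, Bornology.IsBounded {x | ‖φ x‖ ≤ R}) :
    HasCompactSupport (fun x => F (φ x)) := by
  obtain ⟨R, hR⟩ := hc.isCompact.isBounded.exists_norm_le
  refine HasCompactSupport.intro (K := {x | ‖φ x‖ ≤ R}) ?_ ?_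
  · exact Metric.isCompact_of_isClosed_isBounded (isClosed_le (by fun_prop) continuous_const) (hp R)
  · intro x hx
    by_contra hn
    exact hx (hR _ (subset_tsupport _ hn))

lemma stripe {F : ℂ → ℂ} (hF : ContDiff ℝ 1 F) (hc : HasCompactSupport F) (a b : ℂ) :
    ∫ z : ℂ, (if 0 < z.re then a else b) * dbar F z = (b-a)/2 * ∫ v : ℝ, F (v * I) := by
  set k : ℝ → ℂ := fun u => if 0 < u then a else b with hk
  have mk : Measurable k := Measurable.ite measurableSet_Ioi measurable_const measurable_const
  have bk : ∀ u, ‖k u‖ ≤ max ‖a‖ ‖b‖ := by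
    intro u; simp only [hk]; split_ifs <;> simp
  have cF := hF.continuous_fderiv one_ne_zero
  have hFd := hF.differentiable one_ne_zero
  have hcs : ∀ w : ℂ, HasCompactSupport (fun z => fderiv ℝ F z w) := fun w =>
    (hc.fderiv ℝ).comp_left (g := fun L : ℂ →L[ℝ] ℂ => L w) (by simp)
  -- integrability
  have hintg : ∀ w : ℂ, Integrable (fun z : ℂ => k z.re * fderiv ℝ F z w) := by
    intro w
    have i1 : Integrable (fun z => fderiv ℝ F z w) :=
      Continuous.integrable_of_hasCompactSupport (by fun_prop) (hcs w)
    refine i1.bdd_mul (c := max ‖a‖ ‖b‖) ?_ ?_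
    · exact (mk.comp measurable_re).aestronglyMeasurable
    · exact Eventually.of_forall fun z => bk _
  have hmp := Complex.volume_preserving_equiv_real_prod.symm
  have eqv : ∀ q : ℝ × ℝ, (measurableEquivRealProd.symm q : ℂ) = q.1 + q.2 * I := fun q => by
    apply Complex.ext <;> simp
  have hintg2 : ∀ w : ℂ, Integrable (fun q : ℝ × ℝ => k q.1 * fderiv ℝ F (q.1 + q.2 * I) w) (volume.prod volume) := by
    intro w
    have := (hmp.integrable_comp_emb (MeasurableEquiv.measurableEmbedding _)).2 (hintg w)
    rw [← Measure.volume_eq_prod]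
    refine this.congr (Eventually.of_forall fun q => ?_)
    simp [eqv]
  have hfub : ∀ w : ℂ, ∫ z : ℂ, k z.re * fderiv ℝ F z w = ∫ q : ℝ × ℝ, k q.1 * fderiv ℝ F (q.1 + q.2 * I) w ∂(volume.prod volume) := by
    intro w
    rw [← Measure.volume_eq_prod, ← hmp.integral_comp (MeasurableEquiv.measurableEmbedding _)]
    congr 1; ext q; simp [eqv]
  have hu : ∫ z : ℂ, k z.re * fderiv ℝ F z 1 = (b - a) * ∫ v : ℝ, F (v*I) := by
    rw [hfub, integral_prod_symm _ (hintg2 1), ← integral_const_mul]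
    congr 1; ext v
    have hφ : ContDiff ℝ 1 (fun u : ℝ => F (u + v * I)) := hF.comp (ofRealCLM.contDiff.add contDiff_const)
    have hd : ∀ u : ℝ, deriv (fun u : ℝ => F (u + v * I)) u = fderiv ℝ F (u + v*I) 1 := by
      intro u
      have h1 : HasDerivAt (fun u : ℝ => (u:ℂ) + v * I) 1 u := (ofRealCLM.hasDerivAt.add_const _)
      exact ((hFd _).hasFDerivAt.comp_hasDerivAt u h1).deriv
    have hcc : HasCompactSupport (fun u : ℝ => F (u + v * I)) := by
      refine slice_supp hc (φ := fun u : ℝ => (u:ℂ) + v * I) (by fun_prop) fun R => ?_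
      refine (Metric.isBounded_closedBall (x := (0:ℝ)) (r := R)).subset fun u hu => ?_
      rw [mem_closedBall_zero_iff, Real.norm_eq_abs]
      have := abs_re_le_norm ((u:ℂ) + v*I)
      simp at this; exact this.trans hu
    have := int_half hφ hcc a b
    simp only [hd] at this
    rw [ofReal_zero, zero_add] at this
    exact this
  have hv : ∫ z : ℂ, k z.re * fderiv ℝ F z I = 0 := by
    rw [hfub, integral_prod _ (hintg2 I)]
    refine integral_eq_zero_of_ae (Eventually.of_forall fun u => ?_)
    simp only [Pi.zero_apply]
    rw [integral_const_mul]
    have hφ : ContDiff ℝ 1 (fun v : ℝ => F (u + v * I)) := hF.comp (contDiff_const.add (ofRealCLM.contDiff.mul contDiff_const))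
    have hd : ∀ v : ℝ, deriv (fun v : ℝ => F (u + v * I)) v = fderiv ℝ F (u + v*I) I := by
      intro v
      have h1 : HasDerivAt (fun v : ℝ => (u:ℂ) + v * I) I v := by
        have := ((ofRealCLM.hasDerivAt (x := v)).mul_const I).const_add (u:ℂ)
        simpa using this
      exact ((hFd _).hasFDerivAt.comp_hasDerivAt v h1).deriv
    have hcc : HasCompactSupport (fun v : ℝ => F (u + v * I)) := by
      refine slice_supp hc (φ := fun v : ℝ => (u:ℂ) + v * I) (by fun_prop) fun R => ?_
      refine (Metric.isBounded_closedBall (x := (0:ℝ)) (r := R)).subset fun v hv => ?_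
      rw [mem_closedBall_zero_iff, Real.norm_eq_abs]
      have := abs_im_le_norm ((u:ℂ) + v*I)
      simp at this; exact this.trans hv
    have := int_half hφ hcc 1 1
    simp only [hd] at this
    simp at this
    rw [this, mul_zero]
  have e : (fun z : ℂ => k z.re * dbar F z) = fun z => (1/2) * (k z.re * fderiv ℝ F z 1) + (I/2) * (k z.re * fderiv ℝ F z I) := by
    ext z; unfold dbar; ring
  change ∫ z : ℂ, k z.re * dbar F z = _
  rw [e, integral_add ((hintg 1).const_mul _) ((hintg I).const_mul _), integral_const_mul, integral_const_mul, hu, hv]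
  ring

lemma dbar_int_zero {F : ℂ → ℂ} (hF : ContDiff ℝ 1 F) (hc : HasCompactSupport F) : ∫ z : ℂ, dbar F z = 0 := by
  have := stripe hF hc 1 1
  simpa using this

/-- product of a test function with a function holomorphic near its support -/
lemma mul_test {f E : ℂ → ℂ} (hf : ContDiff ℝ 1 f) (hE : ∀ z ∈ tsupport f, AnalyticAt ℂ E z) :
    ContDiff ℝ 1 (fun z => f z * E z) ∧ ∀ z, dbar (fun z => f z * E z) z = dbar f z * E z := by
  have out : ∀ z ∉ tsupport f, (fun z => f z * E z) =ᶠ[𝓝 z] fun _ => 0 := by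
    intro z hz
    filter_upwards [(isClosed_tsupport f).isOpen_compl.mem_nhds hz] with w hw
    rw [image_eq_zero_of_notMem_tsupport hw, zero_mul]
  constructor
  · rw [contDiff_iff_contDiffAt]
    intro z
    by_cases hz : z ∈ tsupport f
    · exact hf.contDiffAt.mul (((hE z hz).restrictScalars (𝕜 := ℝ)).contDiffAt)
    · exact contDiffAt_const.congr_of_eventuallyEq (out z hz)
  · intro z
    by_cases hz : z ∈ tsupport f
    · have h1 := (hf.differentiable one_ne_zero z).hasFDerivAt
      have h2 := (hE z hz).differentiableAt.hasDerivAt.hasFDerivAt.restrictScalars ℝ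
      have h3 := h1.mul' h2
      unfold dbar
      have h4 : fderiv ℝ (fun z => f z * E z) z = _ := h3.fderiv
      rw [h4]
      simp
      linear_combination (f z * deriv E z / 2) * I_mul_I
    · rw [dbar_zero hz, zero_mul]
      unfold dbar
      rw [(out z hz).fderiv_eq]; simp

lemma dbar_mul_zero {f E : ℂ → ℂ} (hf : ContDiff ℝ 1 f) (hc : HasCompactSupport f) (hE : ∀ z ∈ tsupport f, AnalyticAt ℂ E z) :
    ∫ z, dbar f z * E z = 0 := by
  obtain ⟨h1, h2⟩ := mul_test hf hE
  rw [← dbar_int_zero h1 hc.mul_right]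
  congr 1; ext z; exact (h2 z).symm

end

section
variable {A B : ℝ}
open MeasureTheory

lemma det_mulC (d : ℂ) : (((ContinuousLinearMap.toSpanSingleton ℂ d : ℂ →L[ℂ] ℂ)).restrictScalars ℝ : ℂ →L[ℝ] ℂ).det = ‖d‖^2 := by
  have : ((ContinuousLinearMap.toSpanSingleton ℂ d : ℂ →L[ℂ] ℂ)).det = d := by
    simp [ContinuousLinearMap.det]
  simp only [ContinuousLinearMap.det] at this ⊢
  have e : (((ContinuousLinearMap.toSpanSingleton ℂ d : ℂ →L[ℂ] ℂ).restrictScalars ℝ : ℂ →L[ℝ] ℂ) : ℂ →ₗ[ℝ] ℂ) =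
    ((ContinuousLinearMap.toSpanSingleton ℂ d : ℂ →L[ℂ] ℂ) : ℂ →ₗ[ℂ] ℂ).restrictScalars ℝ := rfl
  rw [e, LinearMap.det_restrictScalars, this, Algebra.norm_complex_eq]
  exact Complex.normSq_eq_norm_sq d

lemma chart_int (e : OpenPartialHomeomorph ℂ ℂ) {d : ℂ → ℂ} (he : ∀ z ∈ e.source, HasDerivAt e (d z) z)
    (hd : ∀ z ∈ e.source, d z ≠ 0) {f : ℂ → ℂ} (hf : ContDiff ℝ 1 f) (hc : HasCompactSupport f)
    (hs : tsupport f ⊆ e.source) (a b : ℂ) :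
    ∃ F : ℂ → ℂ, (∀ z ∈ e.source, F (e z) = f z) ∧ (∀ w, w ∉ e '' tsupport f → F w = 0) ∧ Continuous F ∧
      ∫ z, dbar f z * ((if 0 < (e z).re then a else b) * d z) = (b-a)/2 * ∫ v : ℝ, F (v * I) := by
  classical
  set F : ℂ → ℂ := fun w => if w ∈ e.target then f (e.symm w) else 0 with hF
  have h1 : ∀ z ∈ e.source, F (e z) = f z := fun z hz => by
    simp only [hF]; rw [if_pos (e.map_source hz), e.left_inv hz]
  have h2 : ∀ w, w ∉ e '' tsupport f → F w = 0 := fun w hw => by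
    simp only [hF]
    split_ifs with ht
    · by_contra hn
      exact hw ⟨e.symm w, subset_tsupport _ hn, e.right_inv ht⟩
    · rfl
  have hK : IsCompact (e '' tsupport f) := hc.isCompact.image_of_continuousOn (e.continuousOn.mono hs)
  have hKt : e '' tsupport f ⊆ e.target := by rintro _ ⟨z, hz, rfl⟩; exact e.map_source (hs hz)
  have hFc : HasCompactSupport F := HasCompactSupport.intro hK fun w hw => h2 w hw
  have hdo : DifferentiableOn ℂ e e.source := fun z hz => (he z hz).differentiableAt.differentiableWithinAt
  have hFs : ContDiff ℝ 1 F := by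
    rw [contDiff_iff_contDiffAt]
    intro w
    by_cases hw : w ∈ e '' tsupport f
    · have ht := hKt hw
      have hz := e.map_target ht
      have cs : ContDiffAt ℂ 1 e.symm w := e.contDiffAt_symm_deriv (hd _ hz) ht (he _ hz)
        ((hdo.analyticAt (e.open_source.mem_nhds hz)).contDiffAt)
      have : F =ᶠ[𝓝 w] fun w => f (e.symm w) := by
        filter_upwards [e.open_target.mem_nhds ht] with w' hw'
        simp only [hF]; rw [if_pos hw']
      exact (ContDiffAt.comp w hf.contDiffAt (cs.restrict_scalars ℝ)).congr_of_eventuallyEq this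
    · have : F =ᶠ[𝓝 w] fun _ => 0 := by
        filter_upwards [hK.isClosed.isOpen_compl.mem_nhds hw] with w' hw' using h2 _ hw'
      exact contDiffAt_const.congr_of_eventuallyEq this
  refine ⟨F, h1, h2, hFs.continuous, ?_⟩
  have hdb : ∀ z ∈ e.source, dbar f z = dbar F (e z) * (starRingEnd ℂ) (d z) := by
    intro z hz
    have ev : f =ᶠ[𝓝 z] fun z => F (e z) := by
      filter_upwards [e.open_source.mem_nhds hz] with w hw using (h1 w hw).symm
    have q1 := (he z hz).hasFDerivAt.restrictScalars ℝ
    have q2 := ((hFs.differentiable one_ne_zero (e z)).hasFDerivAt).comp z q1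
    have q3 : fderiv ℝ f z = _ := ev.fderiv_eq.trans q2.fderiv
    unfold dbar
    rw [q3]
    simp only [ContinuousLinearMap.comp_apply, ContinuousLinearMap.coe_restrictScalars', ContinuousLinearMap.toSpanSingleton_apply, smul_eq_mul, one_mul]
    rw [fderiv_split _ (d z), fderiv_split _ (I * d z)]
    generalize fderiv ℝ F (e z) 1 = x
    generalize fderiv ℝ F (e z) I = y
    have e1 : (starRingEnd ℂ) (d z) = (d z).re - (d z).im * I := by
      apply Complex.ext <;> simp
    rw [e1]
    simp only [mul_re, mul_im, I_re, I_im]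
    push_cast
    linear_combination ((y * (d z).im)/2) * I_mul_I
  have key := integral_target_eq_integral_abs_det_fderiv_smul (μ := (volume : Measure ℂ)) (f := e)
    (f' := fun z => (ContinuousLinearMap.toSpanSingleton ℂ (d z) : ℂ →L[ℂ] ℂ).restrictScalars ℝ)
    (fun z hz => (he z hz).hasFDerivAt.restrictScalars ℝ) (fun w : ℂ => (if 0 < w.re then a else b) * dbar F w)
  have L : ∫ w in e.target, (if 0 < w.re then a else b) * dbar F w = (b-a)/2 * ∫ v : ℝ, F (v * I) := by
    rw [← stripe hFs hFc]
    refine setIntegral_eq_integral_of_forall_compl_eq_zero fun w hw => ?_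
    rw [dbar_zero, mul_zero]
    intro hw'
    have : tsupport F ⊆ e '' tsupport f := closure_minimal (fun w hw => by by_contra hn; exact hw (h2 w hn)) hK.isClosed
    exact hw (hKt (this hw'))
  rw [← L, key, ← setIntegral_eq_integral_of_forall_compl_eq_zero (s := e.source)]
  · refine setIntegral_congr_fun e.open_source.measurableSet fun z hz => ?_
    rw [det_mulC, hdb z hz, abs_of_nonneg (by positivity), real_smul]
    push_cast
    rw [← Complex.conj_mul']
    ring
  · intro z hz
    rw [dbar_zero (fun h => hz (hs h)), zero_mul]

/-- local chart straightening `Γ` at a regular point -/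
lemma Par.chart (h : Par A B) {z0 g0 : ℂ} (hz : z0 ∈ Gam A B) (hg : g0^2 = Qf A B z0) (h0 : g0 ≠ 0) :
    ∃ (e : OpenPartialHomeomorph ℂ ℂ) (G : ℂ → ℂ), z0 ∈ e.source ∧ e z0 = 0 ∧ G z0 = g0 ∧ (∀ z, G z ^2 = Qf A B z) ∧
      (∀ z ∈ e.source, AnalyticAt ℂ G z ∧ G z ≠ 0 ∧ z ≠ 1 ∧ z ≠ -1 ∧ HasDerivAt e (G z / (z^2-1)) z ∧
        ((e z).re = 0 ↔ z ∈ Gam A B) ∧ (0 < (e z).re → dg A B z = G z) ∧ ((e z).re < 0 → dg A B z = - G z)) := by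
  obtain ⟨G, hG0, hG, hsq⟩ := exists_branch hg h0
  have hz' := h.ne_of_Gam hz
  have ev : ∀ᶠ z in 𝓝 z0, AnalyticAt ℂ G z ∧ G z ≠ 0 ∧ z ≠ 1 ∧ z ≠ -1 := by
    filter_upwards [hG.eventually_analyticAt, hG.continuousAt.eventually_ne (by rw [hG0]; exact h0),
      isOpen_ne.mem_nhds hz'.1, isOpen_ne.mem_nhds hz'.2] with z a b c d using ⟨a, b, c, d⟩
  obtain ⟨ρ, ρ0, hρ⟩ := Metric.eventually_nhds_iff_ball.1 ev
  have hne : ∀ z ∈ Metric.ball z0 ρ, z^2 - 1 ≠ 0 := by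
    intro z hz
    obtain ⟨-, -, a, b⟩ := hρ z hz
    have := one_sub_sq_ne a b
    intro h; apply this; linear_combination -h
  have hex : DifferentiableOn ℂ (fun z => G z / (z^2-1)) (Metric.ball z0 ρ) := by
    intro z hz
    exact ((hρ z hz).1.differentiableAt.div (by fun_prop) (hne z hz)).differentiableWithinAt
  obtain ⟨Φ, hΦ0, hΦ⟩ := hex.isExactOn_ball.with_val_at z0 0
  have hmem : z0 ∈ Metric.ball z0 ρ := Metric.mem_ball_self ρ0
  have hΦd : DifferentiableOn ℂ Φ (Metric.ball z0 ρ) := fun z hz => (hΦ z hz).differentiableAt.differentiableWithinAt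
  have han : AnalyticAt ℂ Φ z0 := hΦd.analyticAt (Metric.ball_mem_nhds _ ρ0)
  have hstr : HasStrictDerivAt Φ (G z0 / (z0^2-1)) z0 := by
    have := han.contDiffAt.hasStrictDerivAt (n := 1) one_ne_zero
    rwa [(hΦ z0 hmem).deriv] at this
  have hd0 : G z0 / (z0^2-1) ≠ 0 := div_ne_zero (by rw [hG0]; exact h0) (hne _ hmem)
  have hT0 : Th A B (z0 - mm A B + G z0) = 0 := (h.Th_eq_zero (hsq _) hz'.1 hz'.2).2 hz
  have hTh : ∀ z ∈ Metric.ball z0 ρ, Th A B (z - mm A B + G z) = (A+B+2) * (Φ z).re := by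
    intro z hzb
    set γ : ℝ → ℂ := fun s => z0 + s * (z - z0) with hγ
    have hγd : ∀ s, HasDerivAt γ (z - z0) s := fun s => by
      have := ((ofRealCLM.hasDerivAt (x := s)).mul_const (z - z0)).const_add z0
      rw [ofRealCLM_apply, ofReal_one, one_mul] at this
      exact this
    have hγm : ∀ s ∈ Icc (0:ℝ) 1, γ s ∈ Metric.ball z0 ρ := by
      intro s hs
      rw [mem_ball_iff_norm] at hzb ⊢
      simp only [hγ, add_sub_cancel_left, norm_mul, norm_real, Real.norm_eq_abs]
      have : |s| ≤ 1 := by rw [abs_of_nonneg hs.1]; exact hs.2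
      nlinarith [norm_nonneg (z - z0)]
    have hder : ∀ s ∈ Icc (0:ℝ) 1, HasDerivAt (fun s => Th A B (γ s - mm A B + G (γ s)) - (A+B+2) * (Φ (γ s)).re) 0 s := by
      intro s hs
      obtain ⟨a1, a2, a3, a4⟩ := hρ _ (hγm s hs)
      have t1 := h.Th_along (g := fun s => G (γ s)) (hγd s) (ContinuousAt.comp (f := γ) (x := s) a1.continuousAt (hγd s).continuousAt)
        (Eventually.of_forall fun s => hsq _) a3 a4
      have t2 : HasDerivAt (fun s => (Φ (γ s)).re) (G (γ s) / (γ s^2-1) * (z - z0)).re s := by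
        have t3 := (hΦ _ (hγm s hs)).comp_of_eq s (hγd s) rfl
        exact reCLM.hasFDerivAt.comp_hasDerivAt s t3
      refine (t1.sub (t2.const_mul (A+B+2))).congr_deriv ?_
      have : ((A:ℂ)+B+2) = ((A+B+2 : ℝ) : ℂ) := by push_cast; ring
      rw [this, re_ofReal_mul, sub_self]
    have hconst := constant_of_has_deriv_right_zero (a := 0) (b := 1) (fun s hs => (hder s hs).continuousAt.continuousWithinAt)
      (fun s hs => (hder s (Ico_subset_Icc_self hs)).hasDerivWithinAt) 1 (by simp)
    have g0 : γ 0 = z0 := by simp [hγ]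
    have g1 : γ 1 = z := by simp [hγ]
    simp only [g0, g1, hT0, hΦ0] at hconst
    simp at hconst; linarith
  have hpos : ∀ z ∈ Metric.ball z0 ρ, 0 < (Φ z).re → XX A B (z - mm A B - G z) < XX A B (z - mm A B + G z) := by
    intro z hzb hp
    obtain ⟨-, -, h1, h2⟩ := hρ z hzb
    have t := hTh z hzb
    have hg := hsq z
    have hg' := neg_sheet hg
    have a1 := XX_pos (h.u_ne hg) (h.u_ne_P1 hg h1) (h.u_ne_N1 hg h2)
    have a2 := XX_pos (h.u_ne hg') (h.u_ne_P1 hg' h1) (h.u_ne_N1 hg' h2)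
    unfold Th at t
    rw [← h.u'_eq hg, ← log_XX (h.u_ne hg) (h.u_ne_P1 hg h1) (h.u_ne_N1 hg h2),
      ← log_XX (h.u_ne hg') (h.u_ne_P1 hg' h1) (h.u_ne_N1 hg' h2)] at t
    rw [sub_eq_add_neg _ (G z), ← Real.log_lt_log_iff a2 a1]
    nlinarith [h.hs]
  have hneg : ∀ z ∈ Metric.ball z0 ρ, (Φ z).re < 0 → XX A B (z - mm A B + G z) < XX A B (z - mm A B - G z) := by
    intro z hzb hp
    obtain ⟨-, -, h1, h2⟩ := hρ z hzb
    have t := hTh z hzb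
    have hg := hsq z
    have hg' := neg_sheet hg
    have a1 := XX_pos (h.u_ne hg) (h.u_ne_P1 hg h1) (h.u_ne_N1 hg h2)
    have a2 := XX_pos (h.u_ne hg') (h.u_ne_P1 hg' h1) (h.u_ne_N1 hg' h2)
    unfold Th at t
    rw [← h.u'_eq hg, ← log_XX (h.u_ne hg) (h.u_ne_P1 hg h1) (h.u_ne_N1 hg h2),
      ← log_XX (h.u_ne hg') (h.u_ne_P1 hg' h1) (h.u_ne_N1 hg' h2)] at t
    rw [sub_eq_add_neg _ (G z), ← Real.log_lt_log_iff a1 a2]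
    nlinarith [h.hs]
  set e0 := (hstr.hasStrictFDerivAt_equiv hd0).toOpenPartialHomeomorph Φ with he0
  have hs0 : z0 ∈ e0.source := (hstr.hasStrictFDerivAt_equiv hd0).mem_toOpenPartialHomeomorph_source
  have hce : (e0 : ℂ → ℂ) = Φ := rfl
  refine ⟨e0.restrOpen (Metric.ball z0 ρ) Metric.isOpen_ball, G, ⟨hs0, hmem⟩, hΦ0, hG0, hsq, ?_⟩
  intro z hz
  have hzb : z ∈ Metric.ball z0 ρ := hz.2
  obtain ⟨a1, a2, a3, a4⟩ := hρ z hzb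
  have hce' : (e0.restrOpen (Metric.ball z0 ρ) Metric.isOpen_ball : ℂ → ℂ) = Φ := rfl
  rw [hce']
  refine ⟨a1, a2, a3, a4, hΦ z hzb, ?_, fun hp => dg_eq (hsq z) (hpos z hzb hp), fun hp => dg_eq (neg_sheet (hsq z)) ?_⟩
  · rw [← h.Th_eq_zero (hsq z) a3 a4, hTh z hzb, mul_eq_zero, or_iff_right h.hs.ne']
  · rw [sub_neg_eq_add, ← sub_eq_add_neg]; exact hneg z hzb hp

end

section
variable {A B : ℝ}
open MeasureTheory

lemma Par.Lf_off (h : Par A B) {f : ℂ → ℂ} (hf : ContDiff ℝ 1 f) (hc : HasCompactSupport f)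
    (hs : ∀ z ∈ tsupport f, z ∉ Gam A B) : Lf A B f = 0 := by
  unfold Lf
  rw [dbar_mul_zero hf hc fun z hz => h.Hh_analytic (hs z hz), mul_zero]

structure Arc (A B : ℝ) (γ G : ℝ → ℂ) : Prop where
  smooth : ContDiff ℝ 1 γ
  inj : InjOn γ (Icc 0 1)
  reg : ∀ t ∈ Icc (0:ℝ) 1, deriv γ t ≠ 0
  mem : ∀ t ∈ Icc (0:ℝ) 1, γ t ∈ Gam A B
  qne : ∀ t ∈ Ioo (0:ℝ) 1, Qf A B (γ t) ≠ 0
  q0 : Qf A B (γ 0) = 0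
  q1 : Qf A B (γ 1) = 0
  cont : ContinuousOn G (Icc 0 1)
  sq : ∀ t ∈ Icc (0:ℝ) 1, G t ^ 2 = Qf A B (γ t)

lemma Arc.gne {γ G : ℝ → ℂ} (a : Arc A B γ G) {t : ℝ} (ht : t ∈ Ioo (0:ℝ) 1) : G t ≠ 0 := by
  intro h0
  have := a.sq t (Ioo_subset_Icc_self ht)
  rw [h0] at this
  exact a.qne t ht (by rw [← this]; ring)

lemma Arc.real (h : Par A B) {γ G : ℝ → ℂ} (a : Arc A B γ G) {t : ℝ} (ht : t ∈ Ioo (0:ℝ) 1) :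
    (G t / (γ t ^ 2 - 1) * deriv γ t).re = 0 := by
  have hmem : Icc (0:ℝ) 1 ∈ 𝓝 t := Icc_mem_nhds ht.1 ht.2
  have hz := h.ne_of_Gam (a.mem t (Ioo_subset_Icc_self ht))
  have h1 := h.Th_along (a.smooth.differentiable one_ne_zero t).hasDerivAt (a.cont.continuousAt hmem)
    (by filter_upwards [hmem] with s hs using a.sq s hs) hz.1 hz.2
  have h2 : (fun s => Th A B (γ s - mm A B + G s)) =ᶠ[𝓝 t] fun _ => 0 := by
    filter_upwards [hmem] with s hs
    have hz' := h.ne_of_Gam (a.mem s hs)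
    exact (h.Th_eq_zero (a.sq s hs) hz'.1 hz'.2).2 (a.mem s hs)
  have h3 := (h1.congr_of_eventuallyEq h2.symm).unique (hasDerivAt_const t (0:ℝ))
  have : ((A:ℂ)+B+2) = ((A+B+2 : ℝ) : ℂ) := by push_cast; ring
  rw [this, re_ofReal_mul, mul_eq_zero, or_iff_right h.hs.ne'] at h3
  exact h3

/-- arclength-type density (imaginary part) -/
def dens (γ G : ℝ → ℂ) (t : ℝ) : ℝ := (G t / (γ t ^ 2 - 1) * deriv γ t).im

lemma Arc.dens_eq (h : Par A B) {γ G : ℝ → ℂ} (a : Arc A B γ G) {t : ℝ} (ht : t ∈ Ioo (0:ℝ) 1) :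
    G t / (γ t ^ 2 - 1) * deriv γ t = dens γ G t * I := by
  apply Complex.ext
  · simp [a.real h ht]
  · simp [dens]

lemma Par.sq_sub_ne (h : Par A B) {z : ℂ} (hz : z ∈ Gam A B) : z^2 - 1 ≠ 0 := by
  obtain ⟨h1, h2⟩ := h.ne_of_Gam hz
  have := one_sub_sq_ne h1 h2
  intro h; apply this; linear_combination -h

lemma Arc.dens_ne (h : Par A B) {γ G : ℝ → ℂ} (a : Arc A B γ G) {t : ℝ} (ht : t ∈ Ioo (0:ℝ) 1) : dens γ G t ≠ 0 := by
  intro h0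
  have := a.dens_eq h ht
  rw [h0] at this
  simp only [ofReal_zero, zero_mul] at this
  exact mul_ne_zero (div_ne_zero (a.gne ht) (h.sq_sub_ne (a.mem t (Ioo_subset_Icc_self ht)))) (a.reg t (Ioo_subset_Icc_self ht)) this

lemma Arc.dens_cont (h : Par A B) {γ G : ℝ → ℂ} (a : Arc A B γ G) :
    ContinuousOn (fun t => G t / (γ t ^ 2 - 1) * deriv γ t) (Icc 0 1) := by
  have c1 := a.smooth.continuous
  have c2 : Continuous (deriv γ) := a.smooth.continuous_deriv le_rfl
  exact (a.cont.div (by fun_prop) fun t ht => h.sq_sub_ne (a.mem t ht)).mul c2.continuousOn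

/-- the measure on one arc -/
def Mu (A B : ℝ) (γ G : ℝ → ℂ) (f : ℂ → ℂ) : ℂ :=
  ∫ t in (0:ℝ)..1, f (γ t) * ((((A:ℂ) + B + 2) / (2 * Real.pi * Complex.I)) * (G t / ((γ t) ^ 2 - 1)) * deriv γ t)

/-- data of an arc in a chart -/
lemma Arc.inchart (h : Par A B) {γ G : ℝ → ℂ} (a : Arc A B γ G) {t0 : ℝ} (ht0 : t0 ∈ Ioo (0:ℝ) 1)
    {e : OpenPartialHomeomorph ℂ ℂ} {Gc : ℂ → ℂ} (hs : γ t0 ∈ e.source) (hsq : ∀ z, Gc z ^2 = Qf A B z)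
    (he : ∀ z ∈ e.source, AnalyticAt ℂ Gc z ∧ HasDerivAt e (Gc z / (z^2-1)) z ∧ ((e z).re = 0 ↔ z ∈ Gam A B)) (hG : Gc (γ t0) = G t0) :
    ∃ η > 0, Icc (t0-η) (t0+η) ⊆ Ioo 0 1 ∧ ∀ t ∈ Icc (t0-η) (t0+η), γ t ∈ e.source ∧
      e (γ t) = (e (γ t)).im * I ∧ HasDerivAt (fun t => (e (γ t)).im) (dens γ G t) t := by
  have cγ := a.smooth.continuous
  have hmem : Icc (0:ℝ) 1 ∈ 𝓝 t0 := Icc_mem_nhds ht0.1 ht0.2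
  have c1 : ContinuousAt (fun t => Gc (γ t) + G t) t0 :=
    (ContinuousAt.comp (f := γ) (x := t0) (he _ hs).1.continuousAt cγ.continuousAt).add (a.cont.continuousAt hmem)
  have ev : ∀ᶠ t in 𝓝 t0, t ∈ Ioo (0:ℝ) 1 ∧ γ t ∈ e.source ∧ Gc (γ t) = G t := by
    filter_upwards [Ioo_mem_nhds ht0.1 ht0.2, cγ.continuousAt.preimage_mem_nhds (e.open_source.mem_nhds hs),
      c1.eventually_ne (show Gc (γ t0) + G t0 ≠ 0 by
        rw [hG]; intro h0; exact a.gne ht0 (by linear_combination h0/2))] with t m1 m2 m3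
    refine ⟨m1, m2, ?_⟩
    have : (Gc (γ t) - G t) * (Gc (γ t) + G t) = 0 := by
      linear_combination hsq (γ t) - a.sq t (Ioo_subset_Icc_self m1)
    rcases mul_eq_zero.1 this with h1 | h1
    · exact sub_eq_zero.1 h1
    · exact absurd h1 m3
  obtain ⟨η, η0, hη⟩ := Metric.eventually_nhds_iff_ball.1 ev
  refine ⟨η/2, half_pos η0, fun t ht => (hη t ?_).1, fun t ht => ?_⟩
  · rw [Metric.mem_ball, Real.dist_eq, abs_lt]; constructor <;> linarith [ht.1, ht.2]
  obtain ⟨m1, m2, m3⟩ := hη t (by rw [Metric.mem_ball, Real.dist_eq, abs_lt]; constructor <;> linarith [ht.1, ht.2])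
  refine ⟨m2, ?_, ?_⟩
  · apply Complex.ext
    · simp [((he _ m2).2.2).2 (a.mem t (Ioo_subset_Icc_self m1))]
    · simp
  · have d1 := (he _ m2).2.1.comp_of_eq t (a.smooth.differentiable one_ne_zero t).hasDerivAt rfl
    have d2 : HasDerivAt (fun t => (e (γ t)).im) (Gc (γ t) / (γ t^2-1) * deriv γ t).im t := imCLM.hasFDerivAt.comp_hasDerivAt t d1
    rw [m3] at d2
    exact d2

lemma Arc.locl (h : Par A B) {γL γC γR : ℝ → ℂ} (hr : ArcParam A B γL γC γR) {γ G : ℝ → ℂ} (a : Arc A B γ G) (hpos : ∀ t ∈ Ioo (0:ℝ) 1, 0 < dens γ G t)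
    {t0 : ℝ} (ht0 : t0 ∈ Ioo (0:ℝ) 1) (hloc : ∀ᶠ z in 𝓝 (γ t0), z ∈ Gam A B → z ∈ γ '' Icc 0 1) :
    ∃ U ∈ 𝓝 (γ t0), ∀ f : ℂ → ℂ, ContDiff ℝ 1 f → HasCompactSupport f → tsupport f ⊆ U → Lf A B f = Mu A B γ G f := by
  have ht0' := Ioo_subset_Icc_self ht0
  obtain ⟨e, Gc, hs, he0, hG0, hsq, he⟩ := h.chart (a.mem t0 ht0') (a.sq t0 ht0') (a.gne ht0)
  obtain ⟨η, η0, hη, hch⟩ := a.inchart h ht0 hs hsq (fun z hz => ⟨(he z hz).1, (he z hz).2.2.2.2.1, (he z hz).2.2.2.2.2.1⟩) hG0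
  have cγ := a.smooth.continuous
  set far := γ '' (Icc 0 1 \ Ioo (t0-η) (t0+η)) with hfar
  have cfar : IsCompact far := (isCompact_Icc.diff isOpen_Ioo).image cγ
  have nfar : γ t0 ∉ far := by
    rintro ⟨t, ⟨ht, hn⟩, e⟩
    have := a.inj ht ht0' e
    subst this
    exact hn ⟨by linarith, by linarith⟩
  refine ⟨e.source ∩ {z | z ∈ Gam A B → z ∈ γ '' Icc 0 1} ∩ farᶜ,
    inter_mem (inter_mem (e.open_source.mem_nhds hs) hloc) (cfar.isClosed.isOpen_compl.mem_nhds nfar), ?_⟩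
  intro f hf hc hU
  have hUs : tsupport f ⊆ e.source := fun z hz => (hU hz).1.1
  have ne1 : ∀ z ∈ e.source, z^2-1 ≠ 0 := fun z hz => by
    have := one_sub_sq_ne (he z hz).2.2.1 (he z hz).2.2.2.1
    intro h; apply this; linear_combination -h
  obtain ⟨F, F1, F2, Fc, F3⟩ := chart_int e (d := fun z => Gc z / (z^2-1)) (fun z hz => (he z hz).2.2.2.2.1)
    (fun z hz => div_ne_zero (he z hz).2.1 (ne1 z hz)) hf hc hUs ((A:ℂ)+B+2) 0
  -- compute Lf
  have hL : ∫ z, dbar f z * Hh A B z = -((A:ℂ)+B+2)/2 * ∫ v : ℝ, F (v * I) := by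
    have hlam : ∀ z ∈ tsupport f, AnalyticAt ℂ (fun z => lam A B z (-Gc z)) z := fun z hz =>
      lam_analytic (he z (hUs hz)).1.neg (he z (hUs hz)).2.2.1 (he z (hUs hz)).2.2.2.1
    have z1 := dbar_mul_zero hf hc hlam
    have i1 : Integrable (fun z => dbar f z * lam A B z (-Gc z)) := by
      obtain ⟨m1, m2⟩ := mul_test hf hlam
      have : (fun z => dbar f z * lam A B z (-Gc z)) = dbar (fun z => f z * lam A B z (-Gc z)) := by
        ext z; exact (m2 z).symm
      rw [this]
      exact (dbar_cont m1).integrable_of_hasCompactSupport (dbar_supp hc.mul_right)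
    have hae : ∀ᵐ z ∂(volume : Measure ℂ), z ∉ Gam A B := by
      rw [ae_iff]; simpa using h.Gam_null hr
    have i2 := h.Lf_int hr (dbar_cont hf) (dbar_supp hc)
    have eq : ∫ z, (dbar f z * Hh A B z - dbar f z * lam A B z (-Gc z)) = ∫ z, dbar f z * ((if 0 < (e z).re then ((A:ℂ)+B+2) else 0) * (Gc z / (z^2-1))) := by
      refine integral_congr_ae ?_
      filter_upwards [hae] with z hz
      by_cases hzs : z ∈ tsupport f
      · obtain ⟨-, -, n1, n2, -, b1, b2, b3⟩ := he z (hUs hzs)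
        rw [h.Hh_eq hz n1 n2, ← mul_sub]
        congr 1
        rcases lt_trichotomy ((e z).re) 0 with hl | hl | hl
        · rw [b3 hl, if_neg (by linarith)]; ring
        · exact absurd (b1.1 hl) hz
        · rw [b2 hl, if_pos hl, Par.lam_sub]
      · rw [dbar_zero hzs]; ring
    rw [integral_sub i2 i1, z1, sub_zero, F3] at eq
    rw [eq]; ring
  have hMu : Mu A B γ G f = ((A:ℂ)+B+2)/(2*Real.pi) * ∫ v : ℝ, F (v * I) := by
    unfold Mu
    have hab : t0 - η ≤ t0 + η := by linarith
    have hpi : (Real.pi:ℂ) ≠ 0 := by exact_mod_cast Real.pi_ne_zero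
    have s1 : ∀ t ∈ Icc (0:ℝ) 1, t ∉ Ioo (t0-η) (t0+η) → f (γ t) = 0 := by
      intro t ht hn
      by_contra hne
      exact (hU (subset_tsupport _ hne)).2 ⟨t, ⟨ht, hn⟩, rfl⟩
    have hsub : Ioc (t0-η) (t0+η) ⊆ Ioc 0 1 := fun t ht => Ioo_subset_Ioc_self (hη (Ioc_subset_Icc_self ht))
    have stepA : (∫ t in (0:ℝ)..1, f (γ t) * ((((A:ℂ) + B + 2) / (2 * Real.pi * Complex.I)) * (G t / ((γ t) ^ 2 - 1)) * deriv γ t))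
        = ∫ t in (t0-η)..(t0+η), f (γ t) * ((((A:ℂ) + B + 2) / (2 * Real.pi * Complex.I)) * (G t / ((γ t) ^ 2 - 1)) * deriv γ t) := by
      rw [intervalIntegral.integral_of_le zero_le_one, intervalIntegral.integral_of_le hab]
      refine (setIntegral_eq_of_subset_of_forall_sdiff_eq_zero measurableSet_Ioc hsub fun t ht => ?_)
      rw [s1 t (Ioc_subset_Icc_self ht.1) (fun hn => ht.2 (Ioo_subset_Ioc_self hn)), zero_mul]
    have stepB : (∫ t in (t0-η)..(t0+η), f (γ t) * ((((A:ℂ) + B + 2) / (2 * Real.pi * Complex.I)) * (G t / ((γ t) ^ 2 - 1)) * deriv γ t))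
        = ((A:ℂ)+B+2)/(2*Real.pi) * ∫ t in (t0-η)..(t0+η), dens γ G t • ((fun v : ℝ => F (v * I)) ∘ fun t => (e (γ t)).im) t := by
      rw [← intervalIntegral.integral_const_mul]
      refine intervalIntegral.integral_congr fun t ht => ?_
      rw [uIcc_of_le hab] at ht
      obtain ⟨m1, m2, m3⟩ := hch t ht
      simp only [Function.comp]
      rw [← m2, F1 _ m1, mul_assoc (((A:ℂ) + B + 2) / (2 * Real.pi * Complex.I)), a.dens_eq h (hη ht), real_smul]
      have := I_ne_zero
      field_simp
    have dcont : ContinuousOn (dens γ G) (uIcc (t0-η) (t0+η)) := by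
      rw [uIcc_of_le hab]
      exact (continuous_im.comp_continuousOn (a.dens_cont h)).mono fun t ht => Ioo_subset_Icc_self (hη ht)
    have stepC := intervalIntegral.integral_comp_smul_deriv (a := t0-η) (b := t0+η) (f := fun t => (e (γ t)).im) (f' := dens γ G)
      (g := fun v : ℝ => F (v * I)) (fun t ht => (hch t (by rwa [uIcc_of_le hab] at ht)).2.2) dcont (by fun_prop)
    rw [stepA, stepB, stepC]
    congr 1
    refine intervalIntegral.integral_eq_integral_of_support_subset fun v hv => ?_
    have hv' : (v:ℂ) * I ∈ e '' tsupport f := by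
      by_contra hn; exact hv (F2 _ hn)
    obtain ⟨z, hz, ez⟩ := hv'
    have zG : z ∈ Gam A B := (he z (hUs hz)).2.2.2.2.2.1.1 (by rw [ez]; simp)
    obtain ⟨t, ht, rfl⟩ := (hU hz).1.2 zG
    have htη : t ∈ Ioo (t0-η) (t0+η) := by
      by_contra hn; exact (hU hz).2 ⟨t, ⟨ht, hn⟩, rfl⟩
    have vt : v = (e (γ t)).im := by rw [ez]; simp
    have mono : StrictMonoOn (fun t => (e (γ t)).im) (Icc (t0-η) (t0+η)) := by
      refine strictMonoOn_of_deriv_pos (convex_Icc _ _) (fun t ht => (hch t ht).2.2.continuousAt.continuousWithinAt) ?_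
      intro t ht
      rw [interior_Icc] at ht
      have ht' := Ioo_subset_Icc_self ht
      rw [(hch t ht').2.2.deriv]
      exact hpos t (hη ht')
    rw [vt]
    exact ⟨mono (left_mem_Icc.2 hab) (Ioo_subset_Icc_self htη) htη.1, (mono (Ioo_subset_Icc_self htη) (right_mem_Icc.2 hab) htη.2).le⟩
  unfold Lf
  rw [hL, hMu]; ring

end

section
variable {A B : ℝ}
open MeasureTheory

structure Crv (A B : ℝ) (γ : ℝ → ℂ) : Prop where
  smooth : ContDiff ℝ 1 γ
  inj : InjOn γ (Icc 0 1)
  reg : ∀ t ∈ Icc (0:ℝ) 1, deriv γ t ≠ 0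
  mem : ∀ t ∈ Icc (0:ℝ) 1, γ t ∈ Gam A B
  qne : ∀ t ∈ Ioo (0:ℝ) 1, Qf A B (γ t) ≠ 0
  q0 : Qf A B (γ 0) = 0
  q1 : Qf A B (γ 1) = 0

/-- near an interior point, the set is contained in the arc -/
lemma Crv.cover (h : Par A B) {γ : ℝ → ℂ} (a : Crv A B γ) {t0 : ℝ} (ht0 : t0 ∈ Ioo (0:ℝ) 1) :
    ∀ᶠ z in 𝓝 (γ t0), z ∈ Gam A B → z ∈ γ '' Icc 0 1 := by
  have ht0' := Ioo_subset_Icc_self ht0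
  have hne : dg A B (γ t0) ≠ 0 := by
    intro h0; have := dg_sq A B (γ t0); rw [h0] at this
    exact a.qne t0 ht0 (by rw [← this]; ring)
  obtain ⟨e, Gc, hs, he0, hG0, hsq, he⟩ := h.chart (a.mem t0 ht0') (dg_sq A B (γ t0)) hne
  have cγ := a.smooth.continuous
  have ev : ∀ᶠ t in 𝓝 t0, t ∈ Ioo (0:ℝ) 1 ∧ γ t ∈ e.source := by
    filter_upwards [Ioo_mem_nhds ht0.1 ht0.2, cγ.continuousAt.preimage_mem_nhds (e.open_source.mem_nhds hs)] with t m1 m2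
      using ⟨m1, m2⟩
  have d1 : ∀ t, γ t ∈ e.source → HasDerivAt (fun t => e (γ t)) (Gc (γ t) / (γ t^2-1) * deriv γ t) t := fun t ht =>
    (he _ ht).2.2.2.2.1.comp_of_eq t (a.smooth.differentiable one_ne_zero t).hasDerivAt rfl
  have dim : ∀ t, γ t ∈ e.source → HasDerivAt (fun t => (e (γ t)).im) (Gc (γ t) / (γ t^2-1) * deriv γ t).im t := fun t ht =>
    imCLM.hasFDerivAt.comp_hasDerivAt t (d1 t ht)
  have dre : HasDerivAt (fun t => (e (γ t)).re) (Gc (γ t0) / (γ t0^2-1) * deriv γ t0).re t0 :=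
    reCLM.hasFDerivAt.comp_hasDerivAt t0 (d1 t0 hs)
  have re0 : (fun t => (e (γ t)).re) =ᶠ[𝓝 t0] fun _ => 0 := by
    filter_upwards [ev] with t ht
    exact (he _ ht.2).2.2.2.2.2.1.2 (a.mem t (Ioo_subset_Icc_self ht.1))
  have hre := (dre.congr_of_eventuallyEq re0.symm).unique (hasDerivAt_const t0 (0:ℝ))
  have hdne : Gc (γ t0) / (γ t0^2-1) * deriv γ t0 ≠ 0 :=
    mul_ne_zero (div_ne_zero (he _ hs).2.1 (h.sq_sub_ne (a.mem t0 ht0'))) (a.reg t0 ht0')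
  have him : (Gc (γ t0) / (γ t0^2-1) * deriv γ t0).im ≠ 0 := fun h0 => hdne (Complex.ext hre h0)
  have c2 : Continuous (deriv γ) := a.smooth.continuous_deriv le_rfl
  have cG : ContinuousAt (fun t => Gc (γ t)) t0 := ContinuousAt.comp (f := γ) (x := t0) (he _ hs).1.continuousAt cγ.continuousAt
  have cd : ContinuousAt (fun t => (Gc (γ t) / (γ t^2-1) * deriv γ t).im) t0 :=
    continuous_im.continuousAt.comp ((cG.div (by fun_prop) (h.sq_sub_ne (a.mem t0 ht0'))).mul c2.continuousAt)
  have st := hasStrictDerivAt_of_hasDerivAt_of_continuousAt (ev.mono fun t ht => dim t ht.2) cd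
  have mp := st.map_nhds_eq him
  simp only [he0, zero_im] at mp
  have im1 : (fun t => (e (γ t)).im) '' {t | t ∈ Ioo (0:ℝ) 1 ∧ γ t ∈ e.source} ∈ 𝓝 (0:ℝ) := by
    rw [← mp]; exact image_mem_map ev
  have ce : ContinuousAt e (γ t0) := e.continuousAt hs
  have cim : Tendsto (fun z => (e z).im) (𝓝 (γ t0)) (𝓝 0) := by
    have := (continuous_im.continuousAt.comp ce : ContinuousAt (fun z => (e z).im) (γ t0))
    have t : Tendsto (fun z => (e z).im) (𝓝 (γ t0)) (𝓝 (e (γ t0)).im) := this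
    rwa [he0, zero_im] at t
  filter_upwards [e.open_source.mem_nhds hs, cim im1] with z hz hz2 hzG
  obtain ⟨t, ⟨ht1, ht2⟩, ht3⟩ := hz2
  refine ⟨t, Ioo_subset_Icc_self ht1, e.injOn ht2 hz (Complex.ext ?_ ht3)⟩
  rw [(he _ hz).2.2.2.2.2.1.2 hzG, (he _ ht2).2.2.2.2.2.1.2 (a.mem t (Ioo_subset_Icc_self ht1))]

lemma Crv.disj (h : Par A B) {γ γb : ℝ → ℂ} (a : Crv A B γ) (b : Crv A B γb) {t1 : ℝ} (ht1 : t1 ∈ Ioo (0:ℝ) 1)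
    (hn : γ t1 ∉ γb '' Icc 0 1) : ∀ t ∈ Ioo (0:ℝ) 1, γ t ∉ γb '' Icc 0 1 := by
  have cγ := a.smooth.continuous
  have cl : IsClosed (γb '' Icc 0 1) := (isCompact_Icc.image b.smooth.continuous).isClosed
  have key : Ioo (0:ℝ) 1 ⊆ {t | γ t ∉ γb '' Icc 0 1} := by
    refine isPreconnected_Ioo.subset_of_closure_inter_subset (cl.isOpen_compl.preimage cγ) ⟨t1, ht1, hn⟩ ?_
    rintro t ⟨hc, ht⟩ hmem
    obtain ⟨s, hs, es⟩ := hmem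
    have hs' : s ∈ Ioo (0:ℝ) 1 := by
      have q := a.qne t ht
      rw [← es] at q
      refine ⟨lt_of_le_of_ne hs.1 ?_, lt_of_le_of_ne hs.2 ?_⟩
      · rintro rfl; exact q b.q0
      · rintro rfl; exact q b.q1
    have cov := b.cover h hs'
    rw [es] at cov
    have ev : ∀ᶠ x in 𝓝 t, γ x ∈ γb '' Icc 0 1 := by
      filter_upwards [cγ.continuousAt.eventually cov, Ioo_mem_nhds ht.1 ht.2] with x h1 h2
      exact h1 (a.mem x (Ioo_subset_Icc_self h2))
    obtain ⟨x, h1, h2⟩ := (mem_closure_iff_nhds.1 hc) _ ev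
    exact h2 h1
  exact fun t ht => key ht

/-- a continuous path between conjugate points crosses the real line -/
lemma exists_cross (h : Par A B) {γ : ℝ → ℂ} (hγ : Continuous γ)
    (he : (γ 0 = zetaP A B ∧ γ 1 = zetaM A B) ∨ (γ 0 = zetaM A B ∧ γ 1 = zetaP A B)) :
    ∃ t ∈ Ioo (0:ℝ) 1, (γ t).im = 0 := by
  have k := h.kk_pos
  have ip : (zetaP A B).im = kk A B := by rw [h.zetaP_eq]; simp
  have iM : (zetaM A B).im = -kk A B := by rw [h.zetaM_eq]; simp
  have c : ContinuousOn (fun t => (γ t).im) (Icc 0 1) := (continuous_im.comp hγ).continuousOn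
  rcases he with ⟨e0, e1⟩ | ⟨e0, e1⟩
  · have := intermediate_value_Ioo' zero_le_one c
    simp only [e0, e1, ip, iM] at this
    obtain ⟨t, ht, e⟩ := this (show (0:ℝ) ∈ Ioo _ _ from ⟨by linarith, k⟩)
    exact ⟨t, ht, e⟩
  · have := intermediate_value_Ioo zero_le_one c
    simp only [e0, e1, ip, iM] at this
    obtain ⟨t, ht, e⟩ := this (show (0:ℝ) ∈ Ioo _ _ from ⟨by linarith, k⟩)
    exact ⟨t, ht, e⟩

lemma Par.crvs (h : Par A B) {γL γC γR : ℝ → ℂ} (hr : ArcParam A B γL γC γR) : Crv A B γL ∧ Crv A B γC ∧ Crv A B γR := by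
  obtain ⟨⟨m1, m2, m3⟩, q1, q2, q3⟩ := h.arc_facts hr
  have qP : Qf A B (zetaP A B) = 0 := by rw [← h.Q_eq]; ring
  have qM : Qf A B (zetaM A B) = 0 := by rw [← h.Q_eq]; ring
  exact ⟨⟨hr.smoothL, hr.injL, hr.regL, m1, q1, by rw [hr.endL0, qP], by rw [hr.endL1, qM]⟩,
    ⟨hr.smoothC, hr.injC, hr.regC, m2, q2, by rw [hr.endC0, qP], by rw [hr.endC1, qM]⟩,
    ⟨hr.smoothR, hr.injR, hr.regR, m3, q3, by rw [hr.endR0, qM], by rw [hr.endR1, qP]⟩⟩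

lemma Par.disjs (h : Par A B) {γL γC γR : ℝ → ℂ} (hr : ArcParam A B γL γC γR) :
    (∀ t ∈ Ioo (0:ℝ) 1, γL t ∉ γC '' Icc 0 1 ∧ γL t ∉ γR '' Icc 0 1) ∧
    (∀ t ∈ Ioo (0:ℝ) 1, γC t ∉ γL '' Icc 0 1 ∧ γC t ∉ γR '' Icc 0 1) ∧
    (∀ t ∈ Ioo (0:ℝ) 1, γR t ∉ γL '' Icc 0 1 ∧ γR t ∉ γC '' Icc 0 1) := by
  obtain ⟨cL, cC, cR⟩ := h.crvs hr
  obtain ⟨l, hl, il⟩ := exists_cross h hr.smoothL.continuous (Or.inl ⟨hr.endL0, hr.endL1⟩)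
  obtain ⟨c, hc, ic⟩ := exists_cross h hr.smoothC.continuous (Or.inl ⟨hr.endC0, hr.endC1⟩)
  obtain ⟨r, hrr, ir⟩ := exists_cross h hr.smoothR.continuous (Or.inr ⟨hr.endR0, hr.endR1⟩)
  have xl := hr.crossL l (Ioo_subset_Icc_self hl) il
  have xc := hr.crossC c (Ioo_subset_Icc_self hc) ic
  have xr := hr.crossR r (Ioo_subset_Icc_self hrr) ir
  refine ⟨fun t ht => ⟨cL.disj h cC hl ?_ t ht, cL.disj h cR hl ?_ t ht⟩,
    fun t ht => ⟨cC.disj h cL hc ?_ t ht, cC.disj h cR hc ?_ t ht⟩,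
    fun t ht => ⟨cR.disj h cL hrr ?_ t ht, cR.disj h cC hrr ?_ t ht⟩⟩
  · rintro ⟨s, hs, e⟩; have := hr.crossC s hs (by rw [e, il]); rw [e] at this; linarith [this.1]
  · rintro ⟨s, hs, e⟩; have := hr.crossR s hs (by rw [e, il]); rw [e] at this; linarith
  · rintro ⟨s, hs, e⟩; have := hr.crossL s hs (by rw [e, ic]); rw [e] at this; linarith [xc.1]
  · rintro ⟨s, hs, e⟩; have := hr.crossR s hs (by rw [e, ic]); rw [e] at this; linarith [xc.2]
  · rintro ⟨s, hs, e⟩; have := hr.crossL s hs (by rw [e, ir]); rw [e] at this; linarith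
  · rintro ⟨s, hs, e⟩; have := hr.crossC s hs (by rw [e, ir]); rw [e] at this; linarith [this.2]

end

section
variable {A B : ℝ}
open MeasureTheory

lemma qr_sqP (x : ℝ) : ((qr A B x : ℝ) : ℂ)^2 = Qf A B x := by
  unfold Qf; exact_mod_cast qr_sq x

lemma Par.qr_cont (h : Par A B) : Continuous (qr A B) :=
  continuous_iff_continuousAt.2 fun x => (h.qr_deriv x).continuousAt

/-- at most one real point of Γ on an interval avoiding ±1 -/
lemma Par.real_unique (h : Par A B) {s : Set ℝ} (hs : Convex ℝ s) (h1 : (1:ℝ) ∉ s) (h2 : (-1:ℝ) ∉ s)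
    {x y : ℝ} (hx : x ∈ s) (hy : y ∈ s) (gx : (x:ℂ) ∈ Gam A B) (gy : (y:ℂ) ∈ Gam A B) : x = y := by
  by_contra hne
  wlog hxy : x < y generalizing x y
  · exact this hy hx gy gx (Ne.symm hne) (lt_of_le_of_ne (not_lt.1 hxy) (Ne.symm hne))
  have n1 : ∀ t ∈ s, (t:ℂ) ≠ 1 ∧ (t:ℂ) ≠ -1 := by
    intro t ht
    constructor
    · intro e; apply h1; have : t = 1 := by exact_mod_cast e
      rwa [this] at ht
    · intro e; apply h2; have : t = -1 := by exact_mod_cast e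
      rwa [this] at ht
  have hd : ∀ t ∈ s, HasDerivAt (fun t : ℝ => Th A B ((t:ℂ) - mm A B + (qr A B t : ℝ))) ((A+B+2) * (qr A B t / (t^2-1))) t := by
    intro t ht
    have hγ : HasDerivAt (fun x : ℝ => (x:ℂ)) 1 t := by simpa using (hasDerivAt_id t).ofReal_comp
    have c : Continuous fun t : ℝ => ((qr A B t : ℝ) : ℂ) := continuous_ofReal.comp h.qr_cont
    have d := h.Th_along hγ c.continuousAt (Eventually.of_forall fun s => qr_sqP s) (n1 t ht).1 (n1 t ht).2
    refine d.congr_deriv ?_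
    rw [mul_one, show ((A:ℂ)+B+2) * (((qr A B t : ℝ):ℂ) / ((t:ℂ)^2-1)) = (((A+B+2) * (qr A B t / (t^2-1)) : ℝ) : ℂ) by push_cast; ring, ofReal_re]
  have e0 : ∀ t ∈ s, (t:ℂ) ∈ Gam A B → Th A B ((t:ℂ) - mm A B + (qr A B t : ℝ)) = 0 := fun t ht hg =>
    (h.Th_eq_zero (qr_sqP t) (n1 t ht).1 (n1 t ht).2).2 hg
  have hsub : Icc x y ⊆ s := hs.ordConnected.out hx hy
  obtain ⟨c, hc, hc0⟩ := exists_hasDerivAt_eq_zero (f' := fun t => (A+B+2) * (qr A B t / (t^2-1))) hxy (fun t ht => (hd t (hsub ht)).continuousAt.continuousWithinAt)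
    ((e0 x hx gx).trans (e0 y hy gy).symm) (fun t ht => hd t (hsub (Ioo_subset_Icc_self ht)))
  have hcs := hsub (Ioo_subset_Icc_self hc)
  have q := h.qr_pos c
  have hne : c^2 - 1 ≠ 0 := by
    intro e
    have : (c-1)*(c+1) = 0 := by linear_combination e
    rcases mul_eq_zero.1 this with e | e
    · exact h1 (by rwa [show c = 1 by linarith] at hcs)
    · exact h2 (by rwa [show c = -1 by linarith] at hcs)
  exact mul_ne_zero h.hs.ne' (div_ne_zero q.ne' hne) hc0

/-- derivative sign at a unique crossing from above -/
lemma cross_deriv {φ : ℝ → ℝ} {d t0 : ℝ} (hc : Continuous φ) (hd : HasDerivAt φ d t0) (h0 : 0 < φ 0) (ht0 : t0 ∈ Ioo (0:ℝ) 1)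
    (hz : φ t0 = 0) (hu : ∀ t ∈ Icc (0:ℝ) 1, φ t = 0 → t = t0) : d ≤ 0 := by
  have hpos : ∀ t ∈ Ioo (0:ℝ) t0, 0 < φ t := by
    intro t ht
    by_contra hn
    obtain ⟨s, hs, es⟩ := intermediate_value_Icc' ht.1.le hc.continuousOn (show (0:ℝ) ∈ Icc (φ t) (φ 0) from ⟨not_lt.1 hn, h0.le⟩)
    have := hu s ⟨hs.1, by linarith [hs.2, ht.2, ht0.2]⟩ es
    linarith [hs.2, ht.2]
  have hs := (hasDerivAt_iff_tendsto_slope.1 hd).mono_left (nhdsWithin_mono t0 (show Iio t0 ⊆ {t0}ᶜ from fun t ht => ne_of_lt ht))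
  refine le_of_tendsto hs ?_
  filter_upwards [Ioo_mem_nhdsLT ht0.1] with t ht
  rw [slope_def_field, hz, sub_zero]
  exact (div_neg_of_pos_of_neg (hpos t ht) (by linarith [ht.2])).le

lemma Arc.pos_of (h : Par A B) {γ G : ℝ → ℂ} (a : Arc A B γ G) {t0 : ℝ} (ht0 : t0 ∈ Ioo (0:ℝ) 1) (hp : 0 < dens γ G t0) :
    ∀ t ∈ Ioo (0:ℝ) 1, 0 < dens γ G t := by
  intro t ht
  by_contra hn
  have c : ContinuousOn (dens γ G) (Ioo 0 1) := (continuous_im.comp_continuousOn (a.dens_cont h)).mono Ioo_subset_Icc_self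
  obtain ⟨s, hs, es⟩ := isPreconnected_Ioo.intermediate_value ht ht0 c (show (0:ℝ) ∈ Icc _ _ from ⟨not_lt.1 hn, hp.le⟩)
  exact a.dens_ne h hs es

lemma Arc.dens_real {γ G : ℝ → ℂ} {t0 x g : ℝ} (hx : γ t0 = x) (hg : G t0 = g) :
    dens γ G t0 = g / (x^2-1) * (deriv γ t0).im := by
  unfold dens
  rw [hx, hg, show ((g:ℂ) / ((x:ℂ)^2-1)) = ((g/(x^2-1) : ℝ) : ℂ) by push_cast; ring, im_ofReal_mul]

lemma Crv.arc {γ F : ℝ → ℂ} (c : Crv A B γ) (hF : ∀ t ∈ Ioo (0:ℝ) 1, F t ^ 2 = Qf A B (γ t)) (hc : ContinuousOn F (Ioo 0 1)) :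
    Arc A B γ ((Ioo (0:ℝ) 1).indicator F) := by
  have hsq : ∀ t ∈ Icc (0:ℝ) 1, (Ioo (0:ℝ) 1).indicator F t ^ 2 = Qf A B (γ t) := by
    intro t ht
    by_cases hi : t ∈ Ioo (0:ℝ) 1
    · rw [indicator_of_mem hi, hF t hi]
    · rw [indicator_of_notMem hi]
      have : t = 0 ∨ t = 1 := by
        by_contra hn; push Not at hn
        exact hi ⟨lt_of_le_of_ne ht.1 (Ne.symm hn.1), lt_of_le_of_ne ht.2 hn.2⟩
      rcases this with rfl | rfl
      · rw [c.q0]; ring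
      · rw [c.q1]; ring
  refine ⟨c.smooth, c.inj, c.reg, c.mem, c.qne, c.q0, c.q1, ?_, hsq⟩
  intro t ht
  by_cases hi : t ∈ Ioo (0:ℝ) 1
  · have : ContinuousAt F t := hc.continuousAt (Ioo_mem_nhds hi.1 hi.2)
    refine (this.congr ?_).continuousWithinAt
    filter_upwards [Ioo_mem_nhds hi.1 hi.2] with s hs
    rw [indicator_of_mem hs]
  · have g0 : (Ioo (0:ℝ) 1).indicator F t = 0 := indicator_of_notMem hi _
    have q0 : Qf A B (γ t) = 0 := by rw [← hsq t ht, g0]; ring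
    unfold ContinuousWithinAt
    rw [g0, tendsto_zero_iff_norm_tendsto_zero]
    have c1 : Continuous fun s => Real.sqrt ‖Qf A B (γ s)‖ := Real.continuous_sqrt.comp (Qf_diff.continuous.comp c.smooth.continuous).norm
    have c2 : Tendsto (fun s => Real.sqrt ‖Qf A B (γ s)‖) (𝓝[Icc 0 1] t) (𝓝 0) := by
      have := c1.continuousAt (x := t)
      have t2 : Tendsto (fun s => Real.sqrt ‖Qf A B (γ s)‖) (𝓝 t) (𝓝 (Real.sqrt ‖Qf A B (γ t)‖)) := this
      rw [q0, norm_zero, Real.sqrt_zero] at t2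
      exact t2.mono_left nhdsWithin_le_nhds
    refine c2.congr' ?_
    filter_upwards [self_mem_nhdsWithin] with s hs
    rw [← hsq s hs, norm_pow, Real.sqrt_sq (norm_nonneg _)]

lemma Mu_indicator {γ F : ℝ → ℂ} {f : ℂ → ℂ} : Mu A B γ ((Ioo (0:ℝ) 1).indicator F) f = Mu A B γ F f := by
  unfold Mu
  rw [intervalIntegral.integral_of_le zero_le_one, intervalIntegral.integral_of_le zero_le_one,
    integral_Ioc_eq_integral_Ioo, integral_Ioc_eq_integral_Ioo]
  refine setIntegral_congr_fun measurableSet_Ioo fun t ht => ?_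
  simp only [indicator_of_mem ht]

/-- `R` on the real line to the right of the cut -/
lemma R_right (h : Par A B) {R : ℂ → ℂ} {x0 : ℝ} (hc : ∀ x : ℝ, x0 < x → ContinuousAt R x)
    (hs : ∀ x : ℝ, x0 < x → R x ^ 2 = Qf A B x) (hl : Tendsto (fun z => R z / z) (cobounded ℂ) (𝓝 1)) :
    ∀ x : ℝ, x0 < x → R x = qr A B x := by
  have pm : ∀ x : ℝ, x0 < x → R x = qr A B x ∨ R x = -(qr A B x : ℝ) := by
    intro x hx
    have := hs x hx
    rw [← qr_sqP] at this
    exact sq_eq_sq_iff_eq_or_eq_neg.1 this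
  intro x hx
  rcases pm x hx with e | e
  · exact e
  exfalso
  have t1 := hl.comp (RCLike.tendsto_ofReal_atTop_cobounded ℂ)
  have t2 := (continuous_re.tendsto _).comp t1
  have ev := t2.eventually (lt_mem_nhds (show (0:ℝ) < (1:ℂ).re by simp))
  obtain ⟨y, hy1, hy2⟩ := (ev.and (eventually_gt_atTop (max x 0))).exists
  have hxy : x < y := lt_of_le_of_lt (le_max_left _ _) hy2
  have hy0 : 0 < y := lt_of_le_of_lt (le_max_right _ _) hy2
  have c : ContinuousOn (fun t : ℝ => (R t).re) (Icc x y) := fun t ht =>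
    (continuous_re.continuousAt.comp (ContinuousAt.comp (f := fun t : ℝ => (t:ℂ)) (hc t (lt_of_lt_of_le hx ht.1)) continuous_ofReal.continuousAt)).continuousWithinAt
  have hyp : 0 < (R y).re := by
    have : 0 < (R (y:ℂ) / (y:ℂ)).re := hy1
    rw [div_ofReal_re] at this
    exact (div_pos_iff_of_pos_right hy0).1 this
  have hxn : (R x).re < 0 := by rw [e, ← ofReal_neg, ofReal_re]; linarith [h.qr_pos x]
  obtain ⟨s, hs1, hs2⟩ := intermediate_value_Icc hxy.le c (show (0:ℝ) ∈ Icc _ _ from ⟨hxn.le, hyp.le⟩)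
  have q := h.qr_pos s
  rcases pm s (lt_of_lt_of_le hx hs1.1) with e | e
  · simp only [e, ofReal_re] at hs2; linarith
  · simp only [e, ← ofReal_neg, ofReal_re] at hs2; linarith

lemma R_left (h : Par A B) {R : ℂ → ℂ} {x0 : ℝ} (hc : ∀ x : ℝ, x < x0 → ContinuousAt R x)
    (hs : ∀ x : ℝ, x < x0 → R x ^ 2 = Qf A B x) (hl : Tendsto (fun z => R z / z) (cobounded ℂ) (𝓝 1)) :
    ∀ x : ℝ, x < x0 → R x = -(qr A B x : ℝ) := by
  have key := R_right (A := B) (B := A) h.symm (R := fun z => - R (-z)) (x0 := -x0)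
    (fun x hx => by
      have : ContinuousAt R (-(x:ℂ)) := by have := hc (-x) (by linarith); rwa [ofReal_neg] at this
      exact (ContinuousAt.comp (f := fun z : ℂ => -z) this continuous_neg.continuousAt).neg)
    (fun x hx => by
      have := hs (-x) (by linarith)
      rw [ofReal_neg] at this
      rw [neg_sq, this, ← Qf_symm, neg_neg])
    (by
      have : Tendsto (fun z : ℂ => -z) (cobounded ℂ) (cobounded ℂ) := tendsto_neg_cobounded
      refine (hl.comp this).congr fun z => ?_
      simp [div_neg, neg_div])
  intro x hx
  have := key (-x) (by linarith)
  simp only [ofReal_neg, neg_neg] at this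
  have e : qr B A (-x) = qr A B x := by unfold qr; rw [mm_symm, kk_symm]; congr 1; ring
  rw [e] at this
  rw [← this, neg_neg]

end

section
variable {A B : ℝ}
open MeasureTheory

lemma Arc.crv {γ G : ℝ → ℂ} (a : Arc A B γ G) : Crv A B γ := ⟨a.smooth, a.inj, a.reg, a.mem, a.qne, a.q0, a.q1⟩

lemma Crv.uniq (h : Par A B) {γ : ℝ → ℂ} (c : Crv A B γ) {s : Set ℝ} (hs : Convex ℝ s) (h1 : (1:ℝ) ∉ s) (h2 : (-1:ℝ) ∉ s)
    (hcr : ∀ t ∈ Icc (0:ℝ) 1, (γ t).im = 0 → (γ t).re ∈ s) {t0 : ℝ} (ht0 : t0 ∈ Icc (0:ℝ) 1) (h0 : (γ t0).im = 0) :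
    ∀ t ∈ Icc (0:ℝ) 1, (γ t).im = 0 → t = t0 := by
  intro t ht hi
  have e : ∀ t, (γ t).im = 0 → γ t = ((γ t).re : ℂ) := fun t ht => Complex.ext (by simp) (by simp [ht])
  have := h.real_unique hs h1 h2 (hcr t ht hi) (hcr t0 ht0 h0) (by rw [← e t hi]; exact c.mem t ht) (by rw [← e t0 h0]; exact c.mem t0 ht0)
  refine c.inj ht ht0 ?_
  rw [e t hi, e t0 h0, this]

set_option maxHeartbeats 1000000 in
lemma Par.arcs (h : Par A B) {γL γC γR : ℝ → ℂ} (hr : ArcParam A B γL γC γR) {R : ℂ → ℂ} (hR : IsSqrtBranch A B γC R)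
    {Rp : ℝ → ℂ} (hRp : IsPlusBoundary A B γC R Rp) :
    (Arc A B γL ((Ioo (0:ℝ) 1).indicator fun t => R (γL t)) ∧ ∀ t ∈ Ioo (0:ℝ) 1, 0 < dens γL ((Ioo (0:ℝ) 1).indicator fun t => R (γL t)) t) ∧
    (Arc A B γC Rp ∧ ∀ t ∈ Ioo (0:ℝ) 1, 0 < dens γC Rp t) ∧
    (Arc A B γR ((Ioo (0:ℝ) 1).indicator fun t => R (γR t)) ∧ ∀ t ∈ Ioo (0:ℝ) 1, 0 < dens γR ((Ioo (0:ℝ) 1).indicator fun t => R (γR t)) t) := by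
  obtain ⟨cL, cC, cR⟩ := h.crvs hr
  obtain ⟨dL, -, dR⟩ := h.disjs hr
  have cl : IsClosed (γC '' Icc 0 1) := (isCompact_Icc.image cC.smooth.continuous).isClosed
  have Rc : ∀ z, z ∉ γC '' Icc 0 1 → ContinuousAt R z := fun z hz =>
    (hR.1.differentiableAt (cl.isOpen_compl.mem_nhds hz)).continuousAt
  have Rs : ∀ z, z ∉ γC '' Icc 0 1 → R z ^ 2 = Qf A B z := fun z hz => by rw [hR.2.1 z hz, h.Q_eq]
  have aL : Arc A B γL ((Ioo (0:ℝ) 1).indicator fun t => R (γL t)) := cL.arc (fun t ht => Rs _ (dL t ht).1)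
    fun t ht => (ContinuousAt.comp (f := γL) (Rc _ (dL t ht).1) cL.smooth.continuous.continuousAt).continuousWithinAt
  have aR : Arc A B γR ((Ioo (0:ℝ) 1).indicator fun t => R (γR t)) := cR.arc (fun t ht => Rs _ (dR t ht).2)
    fun t ht => (ContinuousAt.comp (f := γR) (Rc _ (dR t ht).2) cR.smooth.continuous.continuousAt).continuousWithinAt
  have aC : Arc A B γC Rp := ⟨cC.smooth, cC.inj, cC.reg, cC.mem, cC.qne, cC.q0, cC.q1, hRp.1,
    fun t ht => by rw [hRp.2.1 t ht, h.Q_eq]⟩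
  obtain ⟨l, hl, il⟩ := exists_cross h hr.smoothL.continuous (Or.inl ⟨hr.endL0, hr.endL1⟩)
  obtain ⟨c, hc, ic⟩ := exists_cross h hr.smoothC.continuous (Or.inl ⟨hr.endC0, hr.endC1⟩)
  obtain ⟨r, hrr, ir⟩ := exists_cross h hr.smoothR.continuous (Or.inr ⟨hr.endR0, hr.endR1⟩)
  have e : ∀ z : ℂ, z.im = 0 → z = (z.re : ℂ) := fun t ht => Complex.ext (by simp) (by simp [ht])
  have uL := cL.uniq h (convex_Iio (-1:ℝ)) (by simp) (by simp) (fun t ht hi => hr.crossL t ht hi) (Ioo_subset_Icc_self hl) il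
  have uC := cC.uniq h (convex_Ioo (-1:ℝ) 1) (by simp) (by simp) (fun t ht hi => hr.crossC t ht hi) (Ioo_subset_Icc_self hc) ic
  have uR := cR.uniq h (convex_Ioi (1:ℝ)) (by simp) (by simp) (fun t ht hi => hr.crossR t ht hi) (Ioo_subset_Icc_self hrr) ir
  have k := h.kk_pos
  have ip : (zetaP A B).im = kk A B := by rw [h.zetaP_eq]; simp
  have iM : (zetaM A B).im = -kk A B := by rw [h.zetaM_eq]; simp
  have dim : ∀ γ : ℝ → ℂ, ContDiff ℝ 1 γ → ∀ t, HasDerivAt (fun t => (γ t).im) (deriv γ t).im t := fun γ hγ t =>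
    imCLM.hasFDerivAt.comp_hasDerivAt t (hγ.differentiable one_ne_zero t).hasDerivAt
  have sL : (deriv γL l).im ≤ 0 := cross_deriv (continuous_im.comp cL.smooth.continuous) (dim γL cL.smooth l) (by simp [hr.endL0, ip, k]) hl il uL
  have sC : (deriv γC c).im ≤ 0 := cross_deriv (continuous_im.comp cC.smooth.continuous) (dim γC cC.smooth c) (by simp [hr.endC0, ip, k]) hc ic uC
  have sR : -(deriv γR r).im ≤ 0 := cross_deriv (φ := fun t => -(γR t).im) (continuous_im.comp cR.smooth.continuous).neg (dim γR cR.smooth r).neg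
    (by simp [hr.endR0, iM, k]) hrr (by simp [ir]) (fun t ht hi => uR t ht (by simpa using hi))
  set x0 := (γC c).re with hx0
  have ex0 := e _ ic
  have xc := hr.crossC c (Ioo_subset_Icc_self hc) ic
  have xl := hr.crossL l (Ioo_subset_Icc_self hl) il
  have xr := hr.crossR r (Ioo_subset_Icc_self hrr) ir
  have off : ∀ x : ℝ, x ≠ x0 → (x:ℂ) ∉ γC '' Icc 0 1 := by
    rintro x hx ⟨t, ht, et⟩
    have := uC t ht (by rw [et]; simp)
    rw [this] at et
    apply hx; rw [hx0, et]; simp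
  have right := R_right h (x0 := x0) (fun x hx => Rc _ (off x hx.ne')) (fun x hx => Rs _ (off x hx.ne')) hR.2.2
  have left := R_left h (x0 := x0) (fun x hx => Rc _ (off x hx.ne)) (fun x hx => Rs _ (off x hx.ne)) hR.2.2
  refine ⟨⟨aL, aL.pos_of h hl ?_⟩, ⟨aC, aC.pos_of h hc ?_⟩, ⟨aR, aR.pos_of h hrr ?_⟩⟩
  · have q := h.qr_pos (γL l).re
    have g : (Ioo (0:ℝ) 1).indicator (fun t => R (γL t)) l = ((-qr A B (γL l).re : ℝ) : ℂ) := by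
      rw [indicator_of_mem hl, ofReal_neg, ← left _ (by linarith [xc.1]), ← e _ il]
    have d := Arc.dens_real (e _ il) g
    have hne := aL.dens_ne h hl
    refine lt_of_le_of_ne ?_ (Ne.symm hne)
    rw [d]
    refine mul_nonneg_of_nonpos_of_nonpos (div_nonpos_of_nonpos_of_nonneg (by linarith) ?_) sL
    nlinarith
  · have q := h.qr_pos x0
    have sq := aC.sq c (Ioo_subset_Icc_self hc)
    have hne := aC.dens_ne h hc
    have hx1 : x0^2 - 1 < 0 := by nlinarith [xc.1, xc.2]
    have greal : ∃ g : ℝ, Rp c = g ∧ g ≠ 0 := by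
      rw [ex0, ← qr_sqP] at sq
      rcases sq_eq_sq_iff_eq_or_eq_neg.1 sq with e | e
      · exact ⟨_, e, q.ne'⟩
      · exact ⟨-qr A B x0, by rw [e]; simp [hx0], by simpa using q.ne'⟩
    obtain ⟨g, hg, g0⟩ := greal
    have d := Arc.dens_real ex0 hg
    have cne : (deriv γC c).im ≠ 0 := by
      intro h0; rw [h0, mul_zero] at d; exact hne d
    have cneg : (deriv γC c).im < 0 := lt_of_le_of_ne sC cne
    have cre : (deriv γC c).re = 0 := by
      have := aC.real h hc
      rw [hg, ex0, show ((g:ℂ) / ((x0:ℂ)^2-1)) = ((g/(x0^2-1) : ℝ) : ℂ) by push_cast; ring, re_ofReal_mul] at this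
      exact (mul_eq_zero.1 this).resolve_left (div_ne_zero g0 hx1.ne)
    have t1 := hRp.2.2 c hc
    have t2 : Tendsto (fun ε : ℝ => R (γC c + (ε : ℂ) * (Complex.I * deriv γC c))) (𝓝[>] 0) (𝓝 (qr A B x0 : ℝ)) := by
      have c1 : Continuous fun ε : ℝ => ((qr A B (x0 - ε * (deriv γC c).im) : ℝ) : ℂ) :=
        continuous_ofReal.comp (h.qr_cont.comp (by fun_prop))
      have c2 : Tendsto (fun ε : ℝ => ((qr A B (x0 - ε * (deriv γC c).im) : ℝ) : ℂ)) (𝓝 0) (𝓝 ((qr A B (x0 - 0 * (deriv γC c).im) : ℝ) : ℂ)) := c1.tendsto 0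
      rw [zero_mul, sub_zero] at c2
      refine (c2.mono_left (nhdsWithin_le_nhds (s := Ioi 0))).congr' ?_
      filter_upwards [self_mem_nhdsWithin] with ε hε
      have hε0 : 0 < ε := hε
      rw [← right _ (by nlinarith)]
      congr 1
      apply Complex.ext
      · simp [hx0, sub_eq_add_neg]
      · simp [ic, cre]
    have gq : Rp c = qr A B x0 := tendsto_nhds_unique t1 t2
    have d := Arc.dens_real ex0 gq
    rw [d]
    exact mul_pos_of_neg_of_neg (div_neg_of_pos_of_neg q hx1) cneg
  · have q := h.qr_pos (γR r).re
    have g : (Ioo (0:ℝ) 1).indicator (fun t => R (γR t)) r = ((qr A B (γR r).re : ℝ) : ℂ) := by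
      rw [indicator_of_mem hrr, ← right _ (by linarith [xc.2]), ← e _ ir]
    have d := Arc.dens_real (e _ ir) g
    have hne := aR.dens_ne h hrr
    refine lt_of_le_of_ne ?_ (Ne.symm hne)
    rw [d]
    refine mul_nonneg (div_nonneg q.le ?_) (by linarith)
    nlinarith

end

section
variable {A B : ℝ}
open MeasureTheory

lemma Arc.mu_int (h : Par A B) {γ G : ℝ → ℂ} (a : Arc A B γ G) {f : ℂ → ℂ} (hf : Continuous f) :
    IntervalIntegrable (fun t => f (γ t) * ((((A:ℂ) + B + 2) / (2 * Real.pi * Complex.I)) * (G t / ((γ t) ^ 2 - 1)) * deriv γ t)) volume 0 1 := by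
  refine ContinuousOn.intervalIntegrable ?_
  rw [uIcc_of_le zero_le_one]
  refine (hf.comp a.smooth.continuous).continuousOn.mul ?_
  refine ((a.dens_cont h).const_smul (((A:ℂ) + B + 2) / (2 * Real.pi * Complex.I))).congr fun t ht => ?_
  exact mul_assoc _ _ _

lemma Arc.mu_add (h : Par A B) {γ G : ℝ → ℂ} (a : Arc A B γ G) {f g : ℂ → ℂ} (hf : Continuous f) (hg : Continuous g) :
    Mu A B γ G (fun z => f z + g z) = Mu A B γ G f + Mu A B γ G g := by
  unfold Mu
  rw [← intervalIntegral.integral_add (a.mu_int h hf) (a.mu_int h hg)]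
  congr 1; ext t; ring

lemma mu_off {γ G : ℝ → ℂ} {f : ℂ → ℂ} (hs : ∀ t ∈ Icc (0:ℝ) 1, γ t ∉ tsupport f) : Mu A B γ G f = 0 := by
  unfold Mu
  rw [intervalIntegral.integral_congr (g := fun _ => 0) fun t ht => ?_]
  · simp
  · rw [uIcc_of_le zero_le_one] at ht
    simp only [image_eq_zero_of_notMem_tsupport (hs t ht), zero_mul]

lemma dbar_add {f g : ℂ → ℂ} {z : ℂ} (hf : DifferentiableAt ℝ f z) (hg : DifferentiableAt ℝ g z) :
    dbar (fun z => f z + g z) z = dbar f z + dbar g z := by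
  unfold dbar
  rw [fderiv_fun_add hf hg]
  simp only [add_apply]; ring

lemma Par.Lf_add (h : Par A B) {γL γC γR : ℝ → ℂ} (hr : ArcParam A B γL γC γR) {f g : ℂ → ℂ} (hf : ContDiff ℝ 1 f) (hg : ContDiff ℝ 1 g)
    (cf : HasCompactSupport f) (cg : HasCompactSupport g) : Lf A B (fun z => f z + g z) = Lf A B f + Lf A B g := by
  unfold Lf
  rw [← mul_add, ← integral_add (h.Lf_int hr (dbar_cont hf) (dbar_supp cf)) (h.Lf_int hr (dbar_cont hg) (dbar_supp cg))]
  congr 2; ext z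
  rw [dbar_add (hf.differentiable one_ne_zero z) (hg.differentiable one_ne_zero z)]; ring

/-- bundled data -/
structure Dat (A B : ℝ) (γL γC γR HL HC HR : ℝ → ℂ) : Prop where
  par : Par A B
  arc : ArcParam A B γL γC γR
  L : Arc A B γL HL
  C : Arc A B γC HC
  R : Arc A B γR HR
  pL : ∀ t ∈ Ioo (0:ℝ) 1, 0 < dens γL HL t
  pC : ∀ t ∈ Ioo (0:ℝ) 1, 0 < dens γC HC t
  pR : ∀ t ∈ Ioo (0:ℝ) 1, 0 < dens γR HR t

/-- defect functional -/
def DD (A B : ℝ) (γL γC γR HL HC HR : ℝ → ℂ) (f : ℂ → ℂ) : ℂ :=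
  Lf A B f - (Mu A B γL HL f + Mu A B γC HC f + Mu A B γR HR f)

variable {γL γC γR HL HC HR : ℝ → ℂ}

lemma Dat.add (d : Dat A B γL γC γR HL HC HR) {f g : ℂ → ℂ} (hf : ContDiff ℝ 1 f) (hg : ContDiff ℝ 1 g)
    (cf : HasCompactSupport f) (cg : HasCompactSupport g) :
    DD A B γL γC γR HL HC HR (fun z => f z + g z) = DD A B γL γC γR HL HC HR f + DD A B γL γC γR HL HC HR g := by
  unfold DD
  rw [d.par.Lf_add d.arc hf hg cf cg, d.L.mu_add d.par hf.continuous hg.continuous, d.C.mu_add d.par hf.continuous hg.continuous,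
    d.R.mu_add d.par hf.continuous hg.continuous]; ring

lemma Crv.ioo {γ : ℝ → ℂ} (c : Crv A B γ) {t : ℝ} (ht : t ∈ Icc (0:ℝ) 1) (hq : Qf A B (γ t) ≠ 0) : t ∈ Ioo (0:ℝ) 1 := by
  refine ⟨lt_of_le_of_ne ht.1 ?_, lt_of_le_of_ne ht.2 ?_⟩
  · rintro rfl; exact hq c.q0
  · rintro rfl; exact hq c.q1

lemma Crv.off_nhds {γ : ℝ → ℂ} (c : Crv A B γ) {z : ℂ} (hz : z ∉ γ '' Icc 0 1) : (γ '' Icc 0 1)ᶜ ∈ 𝓝 z :=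
  (isCompact_Icc.image c.smooth.continuous).isClosed.isOpen_compl.mem_nhds hz

lemma Dat.point (d : Dat A B γL γC γR HL HC HR) {z : ℂ} (hz : Qf A B z ≠ 0) :
    ∃ U ∈ 𝓝 z, ∀ f : ℂ → ℂ, ContDiff ℝ 1 f → HasCompactSupport f → tsupport f ⊆ U → DD A B γL γC γR HL HC HR f = 0 := by
  have h := d.par
  by_cases hG : z ∈ Gam A B
  · have hu := d.arc.union
    rw [h.Gamma_eq] at hu
    rw [← hu] at hG
    obtain ⟨dL, dC, dR⟩ := h.disjs d.arc
    have off : ∀ {γ G : ℝ → ℂ} {f : ℂ → ℂ} {V : Set ℂ}, tsupport f ⊆ V → V ⊆ (γ '' Icc 0 1)ᶜ → Mu A B γ G f = 0 :=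
      fun h1 h2 => mu_off fun t ht hm => h2 (h1 hm) ⟨t, ht, rfl⟩
    rcases hG with (⟨t, ht, rfl⟩ | ⟨t, ht, rfl⟩) | ⟨t, ht, rfl⟩
    · have ht' := d.L.crv.ioo ht hz
      obtain ⟨U, hU, H⟩ := Arc.locl h d.arc d.L d.pL ht' (d.L.crv.cover h ht')
      refine ⟨U ∩ ((γC '' Icc 0 1)ᶜ ∩ (γR '' Icc 0 1)ᶜ), inter_mem hU (inter_mem (d.C.crv.off_nhds (dL t ht').1) (d.R.crv.off_nhds (dL t ht').2)), ?_⟩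
      intro f hf hc hs
      unfold DD
      rw [H f hf hc (fun z hz => (hs hz).1), off hs (fun z hz => hz.2.1), off hs (fun z hz => hz.2.2)]; ring
    · have ht' := d.C.crv.ioo ht hz
      obtain ⟨U, hU, H⟩ := Arc.locl h d.arc d.C d.pC ht' (d.C.crv.cover h ht')
      refine ⟨U ∩ ((γL '' Icc 0 1)ᶜ ∩ (γR '' Icc 0 1)ᶜ), inter_mem hU (inter_mem (d.L.crv.off_nhds (dC t ht').1) (d.R.crv.off_nhds (dC t ht').2)), ?_⟩
      intro f hf hc hs
      unfold DD
      rw [H f hf hc (fun z hz => (hs hz).1), off (γ := γL) hs (fun z hz => hz.2.1), off (γ := γR) hs (fun z hz => hz.2.2)]; ring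
    · have ht' := d.R.crv.ioo ht hz
      obtain ⟨U, hU, H⟩ := Arc.locl h d.arc d.R d.pR ht' (d.R.crv.cover h ht')
      refine ⟨U ∩ ((γL '' Icc 0 1)ᶜ ∩ (γC '' Icc 0 1)ᶜ), inter_mem hU (inter_mem (d.L.crv.off_nhds (dR t ht').1) (d.C.crv.off_nhds (dR t ht').2)), ?_⟩
      intro f hf hc hs
      unfold DD
      rw [H f hf hc (fun z hz => (hs hz).1), off (γ := γL) hs (fun z hz => hz.2.1), off (γ := γC) hs (fun z hz => hz.2.2)]; ring
  · refine ⟨(Gam A B)ᶜ, h.Gam_closed.isOpen_compl.mem_nhds hG, fun f hf hc hs => ?_⟩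
    unfold DD
    rw [h.Lf_off hf hc fun z hz => hs hz, mu_off fun t ht hm => hs hm (d.L.mem t ht), mu_off fun t ht hm => hs hm (d.C.mem t ht),
      mu_off fun t ht hm => hs hm (d.R.mem t ht)]; ring

open scoped Manifold ContDiff in
lemma Dat.away (d : Dat A B γL γC γR HL HC HR) {f : ℂ → ℂ} (hf : ContDiff ℝ 1 f) (hc : HasCompactSupport f)
    (hs : ∀ z ∈ tsupport f, Qf A B z ≠ 0) : DD A B γL γC γR HL HC HR f = 0 := by
  have hp : ∀ z : tsupport f, ∃ U : Set ℂ, IsOpen U ∧ (z:ℂ) ∈ U ∧ ∀ f : ℂ → ℂ, ContDiff ℝ 1 f → HasCompactSupport f → tsupport f ⊆ U → DD A B γL γC γR HL HC HR f = 0 := by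
    intro z
    obtain ⟨U, hU, H⟩ := d.point (hs z z.2)
    obtain ⟨V, hV, oV, zV⟩ := mem_nhds_iff.1 hU
    exact ⟨V, oV, zV, fun f hf hc hs => H f hf hc (hs.trans hV)⟩
  choose U oU mU HU using hp
  obtain ⟨T, hT⟩ := hc.isCompact.elim_finite_subcover U oU fun z hz => mem_iUnion.2 ⟨⟨z, hz⟩, mU ⟨z, hz⟩⟩
  obtain ⟨ρ, hρ⟩ := SmoothPartitionOfUnity.exists_isSubordinate 𝓘(ℝ, ℂ) (isClosed_tsupport f) (fun i : T => U i) (fun i => oU i)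
    (fun z hz => by obtain ⟨i, hi, hz⟩ := mem_iUnion₂.1 (hT hz); exact mem_iUnion.2 ⟨⟨i, hi⟩, hz⟩)
  have smooth : ∀ i, ContDiff ℝ 1 fun z => f z * ((ρ i z : ℝ) : ℂ) := fun i =>
    hf.mul (ofRealCLM.contDiff.comp ((contMDiff_iff_contDiff.1 (ρ i).contMDiff).of_le (by simp)))
  have cs : ∀ i, HasCompactSupport fun z => f z * ((ρ i z : ℝ) : ℂ) := fun i => hc.mul_right
  have z0 : ∀ i, DD A B γL γC γR HL HC HR (fun z => f z * ((ρ i z : ℝ) : ℂ)) = 0 := by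
    intro i
    refine HU i _ (smooth i) (cs i) (Subset.trans (closure_mono ?_) (hρ i))
    intro z hz h0
    exact hz (by simp [h0])
  have sum : ∀ S : Finset T, ContDiff ℝ 1 (fun z => ∑ i ∈ S, f z * ((ρ i z : ℝ) : ℂ)) ∧ HasCompactSupport (fun z => ∑ i ∈ S, f z * ((ρ i z : ℝ) : ℂ)) ∧
      DD A B γL γC γR HL HC HR (fun z => ∑ i ∈ S, f z * ((ρ i z : ℝ) : ℂ)) = 0 := by
    classical
    intro S
    induction S using Finset.induction_on with
    | empty =>
      refine ⟨by simpa using contDiff_const, by simpa using HasCompactSupport.intro (isCompact_empty (X := ℂ)) (fun _ _ => rfl), ?_⟩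
      simp [DD, Lf, Mu, dbar]
    | insert i S hi ih =>
      obtain ⟨i1, i2, i3⟩ := ih
      have e : (fun z => ∑ i ∈ insert i S, f z * ((ρ i z : ℝ) : ℂ)) = fun z => f z * ((ρ i z : ℝ) : ℂ) + ∑ i ∈ S, f z * ((ρ i z : ℝ) : ℂ) := by
        ext z; rw [Finset.sum_insert hi]
      rw [e]
      exact ⟨(smooth i).add i1, (cs i).add i2, by rw [d.add (smooth i) i1 (cs i) i2, z0, i3, add_zero]⟩
  have e : f = fun z => ∑ i : T, f z * ((ρ i z : ℝ) : ℂ) := by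
    ext z
    rw [← Finset.mul_sum]
    by_cases hz : z ∈ tsupport f
    · have := ρ.sum_eq_one hz
      rw [finsum_eq_sum_of_fintype] at this
      rw [← ofReal_sum, this, ofReal_one, mul_one]
    · rw [image_eq_zero_of_notMem_tsupport hz, zero_mul]
  rw [e]
  exact (sum Finset.univ).2.2

end

section
variable {A B : ℝ}
open MeasureTheory

def chi0 : ContDiffBump (0:ℂ) := ⟨1, 2, one_pos, one_lt_two⟩

/-- cut-off at scale `1/a` around `w` -/
def cut (w : ℂ) (a : ℝ) (z : ℂ) : ℂ := ((chi0 ((a:ℂ) * (z - w)) : ℝ) : ℂ)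

lemma cut_smooth (w : ℂ) (a : ℝ) : ContDiff ℝ 1 (cut w a) := by
  have : ContDiff ℝ 1 fun z : ℂ => (a:ℂ) * (z - w) := contDiff_const.mul (contDiff_id.sub contDiff_const)
  exact ofRealCLM.contDiff.comp (chi0.contDiff.comp this)

lemma cut_norm (w : ℂ) (a : ℝ) (z : ℂ) : ‖cut w a z‖ ≤ 1 := by
  unfold cut
  rw [norm_real, Real.norm_of_nonneg chi0.nonneg]
  exact chi0.le_one

lemma cut_one {w : ℂ} {a : ℝ} {z : ℂ} (h : |a| * ‖z - w‖ ≤ 1) : cut w a z = 1 := by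
  unfold cut
  rw [chi0.one_of_mem_closedBall, ofReal_one]
  rw [mem_closedBall_zero_iff, norm_mul, norm_real]
  exact h

lemma cut_zero {w : ℂ} {a : ℝ} {z : ℂ} (h : 2 ≤ |a| * ‖z - w‖) : cut w a z = 0 := by
  unfold cut
  rw [chi0.zero_of_le_dist, ofReal_zero]
  rw [dist_zero_right, norm_mul, norm_real]
  exact h

lemma cut_fderiv : ∃ C : ℝ, 0 ≤ C ∧ ∀ w a z, ‖fderiv ℝ (cut w a) z‖ ≤ C * |a| := by
  have hs : ContDiff ℝ 1 fun z : ℂ => ((chi0 z : ℝ) : ℂ) := ofRealCLM.contDiff.comp chi0.contDiff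
  have hcs : HasCompactSupport fun z : ℂ => ((chi0 z : ℝ) : ℂ) := chi0.hasCompactSupport.comp_left ofReal_zero
  obtain ⟨C, hC⟩ := (hs.continuous_fderiv one_ne_zero).bounded_above_of_compact_support (hcs.fderiv ℝ)
  refine ⟨C, (norm_nonneg _).trans (hC 0), fun w a z => ?_⟩
  have d1 : HasFDerivAt (fun z : ℂ => (a:ℂ) * (z - w)) (a • ContinuousLinearMap.id ℝ ℂ) z := by
    have := ((hasFDerivAt_id (𝕜 := ℝ) z).sub_const w).const_smul a
    refine this.congr_of_eventuallyEq (Eventually.of_forall fun z => ?_)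
    simp
  have d2 := ((hs.differentiable one_ne_zero ((a:ℂ) * (z - w))).hasFDerivAt).comp z d1
  have e : fderiv ℝ (cut w a) z = _ := d2.fderiv
  rw [e]
  refine (ContinuousLinearMap.opNorm_comp_le _ _).trans ?_
  refine mul_le_mul (hC _) ?_ (norm_nonneg _) ((norm_nonneg _).trans (hC 0))
  rw [norm_smul, Real.norm_eq_abs]
  exact mul_le_of_le_one_right (abs_nonneg _) ContinuousLinearMap.norm_id_le

lemma dbar_le (f : ℂ → ℂ) (z : ℂ) : ‖dbar f z‖ ≤ ‖fderiv ℝ f z‖ := by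
  unfold dbar
  have h1 := (fderiv ℝ f z).le_opNorm 1
  have h2 := (fderiv ℝ f z).le_opNorm I
  rw [norm_one, mul_one] at h1
  rw [norm_I, mul_one] at h2
  rw [norm_div, Complex.norm_ofNat]
  have h3 := norm_add_le (fderiv ℝ f z 1) (I * fderiv ℝ f z I)
  rw [norm_mul, norm_I, one_mul] at h3
  linarith

lemma Par.Lf_cut (h : Par A B) {γL γC γR : ℝ → ℂ} (hr : ArcParam A B γL γC γR) {f : ℂ → ℂ} (hf : ContDiff ℝ 1 f) (hc : HasCompactSupport f) (w : ℂ) :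
    Tendsto (fun k : ℕ => Lf A B fun z => f z * cut w (k+1) z) atTop (𝓝 0) := by
  obtain ⟨C, C0, hC⟩ := cut_fderiv
  obtain ⟨M1, hM1⟩ := hf.continuous.bounded_above_of_compact_support hc
  obtain ⟨M2, hM2⟩ := (hf.continuous_fderiv one_ne_zero).bounded_above_of_compact_support (hc.fderiv ℝ)
  obtain ⟨M, M0, hM⟩ := h.Hh_bdd (isCompact_closedBall w 2)
  have p1 : 0 ≤ M1 := (norm_nonneg _).trans (hM1 0)
  have p2 : 0 ≤ M2 := (norm_nonneg _).trans (hM2 0)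
  have hae : ∀ᵐ z ∂(volume : Measure ℂ), z ∉ Gam A B := by
    rw [ae_iff]; simpa using h.Gam_null hr
  have bound : ∀ k : ℕ, ‖Lf A B fun z => f z * cut w (k+1) z‖ ≤ (1/Real.pi) * (((M1*C+M2)*M) * (4*Real.pi)) * (1/((k:ℝ)+1)) := by
    intro k
    have k0 : (0:ℝ) < (k:ℝ)+1 := by positivity
    have k1 : (1:ℝ) ≤ (k:ℝ)+1 := by have : (0:ℝ) ≤ k := Nat.cast_nonneg k
                                    linarith
    have gs : ContDiff ℝ 1 fun z => f z * cut w (k+1) z := hf.mul (cut_smooth _ _)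
    set g := fun z => f z * cut w (k+1) z with hg
    set Bl := Metric.closedBall w (2/((k:ℝ)+1)) with hBl
    have sub : Bl ⊆ Metric.closedBall w 2 := Metric.closedBall_subset_closedBall (div_le_self (by norm_num) k1)
    have supp : ∀ z, z ∉ Bl → z ∉ tsupport g := by
      intro z hz hzs
      refine hz (closure_minimal (fun y hy => ?_) Metric.isClosed_closedBall hzs)
      by_contra hn
      apply hy
      rw [Metric.mem_closedBall, dist_eq, not_le, div_lt_iff₀ k0] at hn
      simp only [hg]
      rw [cut_zero (by rw [abs_of_pos k0]; linarith), mul_zero]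
    have b : ∀ z, ‖dbar g z‖ ≤ (M1*C+M2)*((k:ℝ)+1) := by
      intro z
      refine (dbar_le g z).trans ?_
      rw [hg, fderiv_fun_mul (hf.differentiable one_ne_zero z) ((cut_smooth _ _).differentiable one_ne_zero z)]
      refine (norm_add_le _ _).trans ?_
      rw [norm_smul, norm_smul]
      have a1 : ‖f z‖ * ‖fderiv ℝ (cut w (k+1)) z‖ ≤ M1 * (C * |(k:ℝ)+1|) := mul_le_mul (hM1 z) (hC _ _ _) (norm_nonneg _) p1
      have a2 : ‖cut w (k+1) z‖ * ‖fderiv ℝ f z‖ ≤ 1 * M2 := mul_le_mul (cut_norm _ _ _) (hM2 z) (norm_nonneg _) zero_le_one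
      rw [abs_of_pos k0] at a1
      nlinarith
    have I1 : ∫ z, dbar g z * Hh A B z = ∫ z in Bl, dbar g z * Hh A B z := by
      refine (setIntegral_eq_integral_of_forall_compl_eq_zero fun z hz => ?_).symm
      rw [dbar_zero (supp z hz), zero_mul]
    have I2 : ‖∫ z in Bl, dbar g z * Hh A B z‖ ≤ ((M1*C+M2)*((k:ℝ)+1)*M) * volume.real Bl := by
      refine norm_setIntegral_le_of_norm_le_const_ae (measure_closedBall_lt_top) ?_
      filter_upwards [ae_restrict_of_ae hae, ae_restrict_mem Metric.isClosed_closedBall.measurableSet] with z hz hzB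
      rw [norm_mul]
      exact mul_le_mul (b z) (hM z (sub hzB) hz) (norm_nonneg _) (by positivity)
    have vol : volume.real Bl = (2/((k:ℝ)+1))^2 * Real.pi := by
      rw [Measure.real, hBl, Complex.volume_closedBall]
      have : (0:ℝ) ≤ 2/((k:ℝ)+1) := by positivity
      simp [ENNReal.toReal_ofReal this]
    unfold Lf
    rw [norm_mul, I1]
    have : ‖-(1/(Real.pi:ℂ))‖ = 1/Real.pi := by
      rw [norm_neg, norm_div, norm_one, norm_real, Real.norm_of_nonneg Real.pi_pos.le]
    rw [this, mul_assoc]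
    refine mul_le_mul_of_nonneg_left (I2.trans (le_of_eq ?_)) (by positivity)
    rw [vol]; field_simp; ring
  refine squeeze_zero_norm bound ?_
  have := (tendsto_one_div_add_atTop_nhds_zero_nat (𝕜 := ℝ)).const_mul ((1/Real.pi) * (((M1*C+M2)*M) * (4*Real.pi)))
  rwa [mul_zero] at this

lemma Arc.mu_cut (h : Par A B) {γ G : ℝ → ℂ} (a : Arc A B γ G) {f : ℂ → ℂ} (hf : Continuous f) (w : ℂ) :
    Tendsto (fun k : ℕ => Mu A B γ G fun z => f z * cut w (k+1) z) atTop (𝓝 0) := by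
  unfold Mu
  have key := intervalIntegral.tendsto_integral_filter_of_dominated_convergence (μ := volume) (a := 0) (b := 1) (l := atTop)
    (F := fun (k : ℕ) t => f (γ t) * cut w (k+1) (γ t) * ((((A:ℂ) + B + 2) / (2 * Real.pi * Complex.I)) * (G t / ((γ t) ^ 2 - 1)) * deriv γ t))
    (f := fun _ => (0:ℂ)) (fun t => ‖f (γ t) * ((((A:ℂ) + B + 2) / (2 * Real.pi * Complex.I)) * (G t / ((γ t) ^ 2 - 1)) * deriv γ t)‖)
    (Eventually.of_forall fun k => (a.mu_int h (hf.mul (cut_smooth w (k+1)).continuous)).def'.aestronglyMeasurable)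
    (Eventually.of_forall fun k => Eventually.of_forall fun t _ => by
      rw [norm_mul, norm_mul, norm_mul (f (γ t))]
      have := cut_norm w (k+1) (γ t)
      refine mul_le_mul_of_nonneg_right ?_ (norm_nonneg _)
      exact mul_le_of_le_one_right (norm_nonneg _) this)
    (a.mu_int h hf).norm ?_
  · simpa using key
  have hn : volume {t : ℝ | t ∈ Icc (0:ℝ) 1 ∧ γ t = w} = 0 := by
    apply Set.Subsingleton.measure_zero
    rintro s ⟨hs, e1⟩ t ⟨ht, e2⟩
    exact a.inj hs ht (e1.trans e2.symm)
  have : ∀ᵐ t : ℝ, ¬ (t ∈ Icc (0:ℝ) 1 ∧ γ t = w) := by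
    rw [ae_iff]; simpa only [not_not] using hn
  filter_upwards [this] with t ht hti
  rw [uIoc_of_le zero_le_one] at hti
  have hne : γ t ≠ w := fun e => ht ⟨Ioc_subset_Icc_self hti, e⟩
  have pos : 0 < ‖γ t - w‖ := norm_pos_iff.2 (sub_ne_zero.2 hne)
  refine tendsto_const_nhds.congr' ?_
  obtain ⟨N, hN⟩ := exists_nat_gt (2/‖γ t - w‖)
  filter_upwards [eventually_ge_atTop N] with k hk
  rw [cut_zero, mul_zero, zero_mul]
  have hk' : (N:ℝ) ≤ k := by exact_mod_cast hk
  rw [abs_of_pos (by positivity)]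
  rw [div_lt_iff₀ pos] at hN
  nlinarith

variable {γL γC γR HL HC HR : ℝ → ℂ}

lemma Dat.step (d : Dat A B γL γC γR HL HC HR) (w : ℂ) {f : ℂ → ℂ} (hf : ContDiff ℝ 1 f) (hc : HasCompactSupport f)
    (H : ∀ g : ℂ → ℂ, ContDiff ℝ 1 g → HasCompactSupport g → tsupport g ⊆ tsupport f → w ∉ tsupport g → DD A B γL γC γR HL HC HR g = 0) :
    DD A B γL γC γR HL HC HR f = 0 := by
  have t : Tendsto (fun k : ℕ => DD A B γL γC γR HL HC HR fun z => f z * cut w (k+1) z) atTop (𝓝 0) := by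
    unfold DD
    have := (d.par.Lf_cut d.arc hf hc w).sub (((d.L.mu_cut d.par hf.continuous w).add (d.C.mu_cut d.par hf.continuous w)).add (d.R.mu_cut d.par hf.continuous w))
    simpa using this
  have e : ∀ k : ℕ, DD A B γL γC γR HL HC HR f = DD A B γL γC γR HL HC HR fun z => f z * cut w (k+1) z := by
    intro k
    have k0 : (0:ℝ) < (k:ℝ)+1 := by positivity
    have s1 : ContDiff ℝ 1 fun z => f z * (1 - cut w (k+1) z) := hf.mul (contDiff_const.sub (cut_smooth _ _))
    have s2 : ContDiff ℝ 1 fun z => f z * cut w (k+1) z := hf.mul (cut_smooth _ _)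
    have c1 : HasCompactSupport fun z => f z * (1 - cut w (k+1) z) := hc.mul_right
    have c2 : HasCompactSupport fun z => f z * cut w (k+1) z := hc.mul_right
    have z1 := H _ s1 c1 (closure_mono fun z hz h0 => hz (by simp [h0])) (by
      rw [notMem_tsupport_iff_eventuallyEq]
      filter_upwards [Metric.closedBall_mem_nhds w (show 0 < 1/((k:ℝ)+1) by positivity)] with z hz
      rw [Metric.mem_closedBall, dist_eq, le_div_iff₀ k0] at hz
      rw [cut_one (by rw [abs_of_pos k0]; linarith)]
      simp)
    have := d.add s1 s2 c1 c2
    rw [z1, zero_add] at this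
    rw [← this]
    congr 1; ext z; ring
  exact tendsto_nhds_unique tendsto_const_nhds (t.congr fun k => (e k).symm)

lemma Dat.zero (d : Dat A B γL γC γR HL HC HR) {f : ℂ → ℂ} (hf : ContDiff ℝ 1 f) (hc : HasCompactSupport f) :
    Lf A B f = Mu A B γL HL f + Mu A B γC HC f + Mu A B γR HR f := by
  have : DD A B γL γC γR HL HC HR f = 0 := by
    refine d.step (zetaP A B) hf hc fun g hg cg _ hP => ?_
    refine d.step (zetaM A B) hg cg fun g2 hg2 cg2 hs hM => ?_
    refine d.away hg2 cg2 fun z hz hq => ?_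
    rw [← d.par.Q_eq, mul_eq_zero, sub_eq_zero, sub_eq_zero] at hq
    rcases hq with rfl | rfl
    · exact hP (hs hz)
    · exact hM hz
  unfold DD at this
  exact sub_eq_zero.1 this

end

section
variable {A B : ℝ}
open MeasureTheory

lemma Par.Hh_inf (h : Par A B) {γL γC γR : ℝ → ℂ} (hr : ArcParam A B γL γC γR) :
    Tendsto (fun z => z * Hh A B z) (cobounded ℂ) (𝓝 1) := by
  have e1 := (tendsto_inv₀_cobounded' (α := ℂ)).eventually h.VV_inf'
  have e2 : ∀ᶠ z in cobounded ℂ, z ∉ Gam A B := (h.Gam_compact hr).isBounded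
  have c : Tendsto (fun w : ℂ => ((A+B) + (A-B)*w - (A+B+2) * ((1 - mm A B * w)^2 + (kk A B)^2 * w^2)^(1/2:ℂ)) / (2*(w^2-1))) (𝓝 0) (𝓝 1) := by
    have : ContinuousAt (fun w : ℂ => ((A+B) + (A-B)*w - (A+B+2) * ((1 - mm A B * w)^2 + (kk A B)^2 * w^2)^(1/2:ℂ)) / (2*(w^2-1))) 0 := by
      refine ContinuousAt.div (ContinuousAt.sub (by fun_prop) (continuousAt_const.mul ?_)) (by fun_prop) (by norm_num)
      exact ContinuousAt.cpow (by fun_prop) (by fun_prop) (by simp)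
    have t := this.tendsto
    have v : ((A+B) + (A-B)*(0:ℂ) - (A+B+2) * ((1 - mm A B * 0)^2 + (kk A B)^2 * 0^2)^(1/2:ℂ)) / (2*(0^2-1)) = 1 := by
      norm_num
    rwa [v] at t
  refine (c.comp tendsto_inv₀_cobounded).congr' ?_
  filter_upwards [e1, e2, eventually_ne_cobounded 0, eventually_ne_cobounded 1, eventually_ne_cobounded (-1)] with z a1 a2 z0 z1 z2
  have a3 := a1.2
  rw [inv_inv] at a3
  rw [h.Hh_eq a2 z1 z2, a3]
  have q : 1 - z^2 ≠ 0 := by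
    intro e
    have : (z-1)*(z+1) = 0 := by linear_combination -e
    rcases mul_eq_zero.1 this with e | e
    · exact z1 (sub_eq_zero.1 e)
    · exact z2 (eq_neg_of_add_eq_zero_left e)
  have q' : z⁻¹^2-1 ≠ 0 := by
    intro e; apply q; field_simp at e; linear_combination e
  simp only [Function.comp]
  unfold lam
  generalize ((1 - mm A B * z⁻¹)^2 + (kk A B)^2 * z⁻¹^2)^(1/2:ℂ) = s
  rw [show z⁻¹^2-1 = (1-z^2)/z^2 by field_simp]
  field_simp
  ring

lemma cut_supp (w : ℂ) {a : ℝ} (ha : 0 < a) : HasCompactSupport (cut w a) := by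
  refine HasCompactSupport.intro (isCompact_closedBall w (2/a)) fun z hz => cut_zero ?_
  rw [Metric.mem_closedBall, dist_eq, not_le, div_lt_iff₀ ha] at hz
  rw [abs_of_pos ha]; linarith

set_option maxHeartbeats 1000000 in
lemma Par.Lf_one (h : Par A B) {γL γC γR : ℝ → ℂ} (hr : ArcParam A B γL γC γR) :
    Tendsto (fun a : ℝ => Lf A B (cut 0 a)) (𝓝[>] 0) (𝓝 1) := by
  obtain ⟨C, C0, hC⟩ := cut_fderiv
  rw [Metric.tendsto_nhds]
  intro ε hε
  set δ := ε / (4*C+1) with hδ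
  have δ0 : 0 < δ := by positivity
  have e1 := Metric.tendsto_nhds.1 (h.Hh_inf hr) δ δ0
  obtain ⟨r, -, hr0⟩ := (hasBasis_cobounded_norm.eventually_iff).1 e1
  have hsmall : ∀ᶠ a : ℝ in 𝓝[>] 0, a < 1/(max r 1) := nhdsWithin_le_nhds (eventually_lt_nhds (by positivity))
  filter_upwards [hsmall, self_mem_nhdsWithin] with a h1 a0
  have a0 : 0 < a := a0
  have ra : r ≤ 1/a := by
    rw [lt_div_iff₀ (by positivity)] at h1
    rw [le_div_iff₀ a0]
    nlinarith [le_max_left r 1]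
  have sm := cut_smooth 0 a
  have cs := cut_supp 0 a0
  have pm := pompeiu sm cs 0
  rw [cut_one (by simp)] at pm
  have i1 := h.Lf_int hr (dbar_cont sm) (dbar_supp cs)
  have i2 := cc_inv_int (dbar_cont sm) (dbar_supp cs) 0
  have pi0 : (Real.pi:ℂ) ≠ 0 := by exact_mod_cast Real.pi_pos.ne'
  have ed : Lf A B (cut 0 a) - 1 = -(1/(Real.pi:ℂ)) * ∫ z, dbar (cut 0 a) z * (Hh A B z - 1/z) := by
    have : ∫ z, dbar (cut 0 a) z * (Hh A B z - 1/z) = (∫ z, dbar (cut 0 a) z * Hh A B z) - ∫ z, dbar (cut 0 a) z / (z-0) := by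
      rw [← integral_sub i1 (by simpa only [mul_one_div] using i2)]
      congr 1; ext z; rw [sub_zero]; ring
    rw [this, pm]
    unfold Lf
    field_simp
    ring
  have b : ∀ z, ‖dbar (cut 0 a) z * (Hh A B z - 1/z)‖ ≤ C*a*(δ*a) := by
    intro z
    rw [norm_mul]
    by_cases hz : a * ‖z‖ < 1
    · have : fderiv ℝ (cut 0 a) z = 0 := by
        have e : cut 0 a =ᶠ[𝓝 z] fun _ => 1 := by
          have o : IsOpen {z : ℂ | a * ‖z‖ < 1} := isOpen_lt (by fun_prop) (by fun_prop)
          filter_upwards [o.mem_nhds hz] with y hy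
          exact cut_one (by rw [abs_of_pos a0, sub_zero]; exact le_of_lt hy)
        rw [e.fderiv_eq]; simp
      have : dbar (cut 0 a) z = 0 := by simp [dbar, this]
      rw [this, norm_zero, zero_mul]; positivity
    · push Not at hz
      have nz : 0 < ‖z‖ := by by_contra hn; nlinarith
      have hz1 : 1/a ≤ ‖z‖ := by rw [div_le_iff₀ a0]; linarith
      have z0 := norm_pos_iff.1 nz
      have := hr0 (show z ∈ {z : ℂ | r ≤ ‖z‖} from ra.trans hz1)
      rw [dist_eq] at this
      refine mul_le_mul ((dbar_le _ z).trans ?_) ?_ (norm_nonneg _) (by positivity)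
      · have := hC 0 a z
        rwa [abs_of_pos a0] at this
      · rw [show Hh A B z - 1/z = (z * Hh A B z - 1)/z by field_simp, norm_div, div_le_iff₀ nz]
        nlinarith
  have I1 : ∫ z, dbar (cut 0 a) z * (Hh A B z - 1/z) = ∫ z in Metric.closedBall 0 (2/a), dbar (cut 0 a) z * (Hh A B z - 1/z) := by
    refine (setIntegral_eq_integral_of_forall_compl_eq_zero fun z hz => ?_).symm
    rw [dbar_zero, zero_mul]
    intro hzs
    refine hz (closure_minimal (fun y hy => ?_) Metric.isClosed_closedBall hzs)
    by_contra hn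
    apply hy
    rw [Metric.mem_closedBall, dist_eq, not_le, div_lt_iff₀ a0] at hn
    exact cut_zero (by rw [abs_of_pos a0]; linarith)
  have I2 : ‖∫ z in Metric.closedBall (0:ℂ) (2/a), dbar (cut 0 a) z * (Hh A B z - 1/z)‖ ≤ C*a*(δ*a) * volume.real (Metric.closedBall (0:ℂ) (2/a)) :=
    norm_setIntegral_le_of_norm_le_const measure_closedBall_lt_top fun z _ => b z
  have vol : volume.real (Metric.closedBall (0:ℂ) (2/a)) = (2/a)^2 * Real.pi := by
    rw [Measure.real, Complex.volume_closedBall]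
    have : (0:ℝ) ≤ 2/a := by positivity
    simp [ENNReal.toReal_ofReal this]
  rw [dist_eq, ed, norm_mul, I1]
  have : ‖-(1/(Real.pi:ℂ))‖ = 1/Real.pi := by
    rw [norm_neg, norm_div, norm_one, norm_real, Real.norm_of_nonneg Real.pi_pos.le]
  rw [this]
  have f1 : 1/Real.pi * (C*a*(δ*a) * ((2/a)^2 * Real.pi)) = 4*C*δ := by
    have := Real.pi_pos
    field_simp; ring
  rw [vol] at I2
  have f2 : 4*C*δ < ε := by
    have : (4*C+1)*δ = ε := by rw [hδ]; field_simp
    linarith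
  exact (mul_le_mul_of_nonneg_left I2 (by positivity)).trans_lt (f1 ▸ f2)

lemma mu_congr {γ G : ℝ → ℂ} {f g : ℂ → ℂ} (hs : ∀ t ∈ Icc (0:ℝ) 1, f (γ t) = g (γ t)) : Mu A B γ G f = Mu A B γ G g := by
  unfold Mu
  refine intervalIntegral.integral_congr fun t ht => ?_
  rw [uIcc_of_le zero_le_one] at ht
  simp only [hs t ht]

variable {γL γC γR HL HC HR : ℝ → ℂ}

/-- the total integral -/
def MM (A B : ℝ) (γL γC γR HL HC HR : ℝ → ℂ) (f : ℂ → ℂ) : ℂ :=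
  Mu A B γL HL f + Mu A B γC HC f + Mu A B γR HR f

lemma Dat.congr (d : Dat A B γL γC γR HL HC HR) {f g : ℂ → ℂ} (hs : ∀ z ∈ Gam A B, f z = g z) :
    MM A B γL γC γR HL HC HR f = MM A B γL γC γR HL HC HR g := by
  unfold MM
  rw [mu_congr fun t ht => hs _ (d.L.mem t ht), mu_congr fun t ht => hs _ (d.C.mem t ht), mu_congr fun t ht => hs _ (d.R.mem t ht)]

lemma Dat.mass (d : Dat A B γL γC γR HL HC HR) :
    ∃ a : ℝ, 0 < a ∧ (∀ z ∈ Gam A B, cut 0 a z = 1) ∧ Lf A B (cut 0 a) = 1 := by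
  obtain ⟨r, hr⟩ := (d.par.Gam_compact d.arc).isBounded.subset_closedBall 0
  have hsmall : ∀ᶠ a : ℝ in 𝓝[>] 0, a < 1/(max r 1) := nhdsWithin_le_nhds (eventually_lt_nhds (by positivity))
  have one : ∀ᶠ a : ℝ in 𝓝[>] 0, 0 < a ∧ ∀ z ∈ Gam A B, cut 0 a z = 1 := by
    filter_upwards [hsmall, self_mem_nhdsWithin] with a h1 a0
    have a0 : 0 < a := a0
    refine ⟨a0, fun z hz => cut_one ?_⟩
    have h2 := hr hz
    rw [mem_closedBall_iff_norm] at h2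
    rw [lt_div_iff₀ (by positivity)] at h1
    rw [abs_of_pos a0]
    nlinarith [le_max_left r 1]
  have t := d.par.Lf_one d.arc
  have t2 : Tendsto (fun a : ℝ => Lf A B (cut 0 a)) (𝓝[>] 0) (𝓝 (MM A B γL γC γR HL HC HR fun _ => 1)) := by
    refine tendsto_const_nhds.congr' ?_
    filter_upwards [one] with a ha
    rw [d.zero (cut_smooth 0 a) (cut_supp 0 ha.1)]
    exact d.congr fun z hz => (ha.2 z hz).symm
  have m := tendsto_nhds_unique t t2
  obtain ⟨a, ha⟩ := one.exists
  refine ⟨a, ha.1, ha.2, ?_⟩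
  rw [m, d.zero (cut_smooth 0 a) (cut_supp 0 ha.1)]
  exact d.congr ha.2
end

section
variable {A B : ℝ}
open MeasureTheory
variable {γL γC γR HL HC HR : ℝ → ℂ}

lemma Arc.mu_le (h : Par A B) {γ G : ℝ → ℂ} (a : Arc A B γ G) : ∃ D : ℝ, 0 ≤ D ∧ ∀ (f g : ℂ → ℂ) (δ : ℝ), Continuous f → Continuous g →
    (∀ z, ‖f z - g z‖ ≤ δ) → ‖Mu A B γ G f - Mu A B γ G g‖ ≤ δ * D := by
  refine ⟨∫ t in (0:ℝ)..1, ‖(1:ℂ) * ((((A:ℂ) + B + 2) / (2 * Real.pi * Complex.I)) * (G t / ((γ t) ^ 2 - 1)) * deriv γ t)‖,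
    intervalIntegral.integral_nonneg zero_le_one fun t _ => norm_nonneg _, fun f g δ hf hg hd => ?_⟩
  have i1 := a.mu_int h (f := fun _ => 1) continuous_const
  unfold Mu
  rw [← intervalIntegral.integral_sub (a.mu_int h hf) (a.mu_int h hg), ← intervalIntegral.integral_const_mul]
  refine intervalIntegral.norm_integral_le_of_norm_le zero_le_one (Eventually.of_forall fun t _ => ?_) (i1.norm.const_mul δ)
  rw [← sub_mul, norm_mul, one_mul]
  exact mul_le_mul_of_nonneg_right (hd _) (norm_nonneg _)

lemma msum_le (m : Multiset ℂ) (u : ℂ → ℂ) (v : ℂ → ℝ) (h : ∀ z, ‖u z‖ ≤ v z) : ‖(m.map u).sum‖ ≤ (m.map v).sum := by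
  induction m using Multiset.induction_on with
  | empty => simp
  | cons a s ih =>
    simp only [Multiset.map_cons, Multiset.sum_cons]
    exact (norm_add_le _ _).trans (add_le_add (h a) ih)

lemma msum_lin (m : Multiset ℂ) (χ : ℂ → ℂ) (δ M : ℝ) :
    (m.map fun z => δ + M * (1 - (χ z).re)).sum = (δ + M) * m.card - M * ((m.map χ).sum).re := by
  induction m using Multiset.induction_on with
  | empty => simp
  | cons a s ih =>
    simp only [Multiset.map_cons, Multiset.sum_cons, Multiset.card_cons, ih, add_re]
    push_cast; ring

lemma JSeq.card {p : ℕ → ℂ[X]} {α β : ℕ → ℝ} (S : JSeq A B p α β) : ∀ᶠ n in atTop, (p n).roots.card = n := by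
  filter_upwards [ExpAsymp.ev_ne two_pos S.lead] with n hn
  rw [IsAlgClosed.card_roots_eq_natDegree]
  exact le_antisymm (S.deg n) (le_natDegree_of_ne_zero hn)

lemma Dat.weak (d : Dat A B γL γC γR HL HC HR) {p : ℕ → ℂ[X]} {α β : ℕ → ℝ} (S : JSeq A B p α β)
    {f : ℂ → ℂ} (hf : Continuous f) {M : ℝ} (hM : ∀ z, ‖f z‖ ≤ M) :
    Tendsto (fun n : ℕ => ((p n).roots.map f).sum / (n:ℂ)) atTop (𝓝 (MM A B γL γC γR HL HC HR f)) := by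
  obtain ⟨a, a0, ha, hm⟩ := d.mass
  obtain ⟨D1, p1, q1⟩ := d.L.mu_le d.par
  obtain ⟨D2, p2, q2⟩ := d.C.mu_le d.par
  obtain ⟨D3, p3, q3⟩ := d.R.mu_le d.par
  have M0 : 0 ≤ M := (norm_nonneg _).trans (hM 0)
  rw [Metric.tendsto_nhds]
  intro ε hε
  set δ := ε / (D1+D2+D3+4) with hδ
  have δ0 : 0 < δ := by positivity
  obtain ⟨g, gs, hg, -⟩ := hf.exists_contDiff_approx 1 (ε := fun _ => δ) continuous_const fun _ => δ0
  have gs : ContDiff ℝ 1 g := gs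
  have fg : ∀ z, ‖f z - g z‖ ≤ δ := fun z => by rw [← dist_eq, dist_comm]; exact (hg z).le
  have gcs : ContDiff ℝ 1 fun z => g z * cut 0 a z := gs.mul (cut_smooth 0 a)
  have gcc : HasCompactSupport fun z => g z * cut 0 a z := (cut_supp 0 a0).mul_left
  have t1 := S.limC1 d.par d.arc gcs gcc
  have t2 := S.limC1 d.par d.arc (cut_smooth 0 a) (cut_supp 0 a0)
  rw [hm] at t2
  have e0 : Lf A B (fun z => g z * cut 0 a z) = MM A B γL γC γR HL HC HR g := by
    rw [d.zero gcs gcc]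
    exact d.congr fun z hz => by rw [ha z hz, mul_one]
  rw [e0] at t1
  have b1 := Metric.tendsto_nhds.1 t1 δ δ0
  have b2 := Metric.tendsto_nhds.1 t2 (δ/(M+1)) (by positivity)
  filter_upwards [b1, b2, S.card, eventually_gt_atTop 0] with n b1 b2 hn n0
  have n0' : (0:ℝ) < n := by exact_mod_cast n0
  have nc : (n:ℂ) ≠ 0 := by exact_mod_cast n0.ne'
  set m := (p n).roots with hm'
  have c1 : ‖(m.map f).sum / (n:ℂ) - (m.map fun z => g z * cut 0 a z).sum / (n:ℂ)‖ ≤ 2*δ := by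
    rw [← sub_div, ← Multiset.sum_map_sub, norm_div, norm_natCast, div_le_iff₀ n0']
    refine (msum_le m _ (fun z => δ + M * (1 - (cut 0 a z).re)) fun z => ?_).trans ?_
    · have x0 : 0 ≤ (cut 0 a z).re := by unfold cut; rw [ofReal_re]; exact chi0.nonneg
      have x1 : (cut 0 a z).re ≤ 1 := by unfold cut; rw [ofReal_re]; exact chi0.le_one
      have x2 : cut 0 a z = ((cut 0 a z).re : ℂ) := by unfold cut; rw [ofReal_re]
      generalize (cut 0 a z).re = x at x0 x1 x2
      rw [x2, show f z - g z * (x:ℂ) = (f z - g z) * (x:ℂ) + f z * ((1 - x : ℝ):ℂ) by push_cast; ring]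
      refine (norm_add_le _ _).trans ?_
      rw [norm_mul, norm_mul, norm_real, norm_real, Real.norm_of_nonneg x0, Real.norm_of_nonneg (by linarith)]
      have := mul_le_mul_of_nonneg_right (hM z) (show 0 ≤ 1 - x by linarith)
      have := mul_le_mul (fg z) x1 x0 δ0.le
      linarith
    · rw [msum_lin, hn]
      have y1 : 1 - ((m.map (cut 0 a)).sum / (n:ℂ)).re ≤ δ/(M+1) := by
        rw [dist_comm, dist_eq] at b2
        exact (re_le_norm (1 - _)).trans b2.le
      rw [div_natCast_re, sub_le_iff_le_add] at y1
      generalize ((m.map (cut 0 a)).sum).re = s at y1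
      have y2 : M * (δ/(M+1)) ≤ δ := by
        rw [mul_div_assoc', div_le_iff₀ (by positivity)]; nlinarith
      have y3 : M * n - M * s ≤ M * (δ/(M+1)) * n := by
        have : (n:ℝ) - s ≤ (δ/(M+1)) * n := by
          have := mul_le_mul_of_nonneg_right y1 n0'.le
          rw [add_mul, div_mul_cancel₀ _ n0'.ne'] at this
          linarith
        nlinarith
      nlinarith
  have c2 : ‖MM A B γL γC γR HL HC HR f - MM A B γL γC γR HL HC HR g‖ ≤ δ * (D1+D2+D3) := by
    have u1 := q1 f g δ hf gs.continuous fg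
    have u2 := q2 f g δ hf gs.continuous fg
    have u3 := q3 f g δ hf gs.continuous fg
    unfold MM
    rw [show ∀ a b c a' b' c' : ℂ, (a+b+c) - (a'+b'+c') = (a-a')+(b-b')+(c-c') by intros; ring]
    refine (norm_add₃_le).trans ?_
    linarith
  rw [← dist_eq] at c1 c2
  rw [dist_comm] at c2
  have k := dist_triangle4 ((m.map f).sum / (n:ℂ)) _ _ (MM A B γL γC γR HL HC HR f) |>.trans (add_le_add_three c1 b1.le c2)
  refine k.trans_lt ?_
  have : (D1+D2+D3+4)*δ = ε := by rw [hδ]; field_simp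
  linarith
end

/-- Theorem, case (a): if `dist(α_n,ℤ)^{1/n} → e^{−r_α}`,
`dist(β_n,ℤ)^{1/n} → e^{−r_β}`, `dist(α_n+β_n,ℤ)^{1/n} → e^{−r_{α+β}}` with
`r_α = r_β = r_{α+β}`, then the zeros of `P_n^{(α_n,β_n)}` accumulate on `Γ` and the
normalized zero counting measures converge weak* to `μ`. -/
theorem zeros_weak_convergence_case_a
    (A B : ℝ) (hA : -1 < A) (hA0 : A < 0) (hB : -1 < B) (hB0 : B < 0)
    (hAB : -2 < A + B) (hAB1 : A + B < -1)
    (γL γC γR : ℝ → ℂ) (harcs : ArcParam A B γL γC γR)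
    (R : ℂ → ℂ) (hR : IsSqrtBranch A B γC R)
    (Rp : ℝ → ℂ) (hRp : IsPlusBoundary A B γC R Rp)
    (α β : ℕ → ℝ)
    (hα : Tendsto (fun n : ℕ => α n / n) atTop (nhds A))
    (hβ : Tendsto (fun n : ℕ => β n / n) atTop (nhds B))
    (rα rβ rαβ : ℝ) (hrα0 : 0 ≤ rα) (hrβ0 : 0 ≤ rβ) (hrαβ0 : 0 ≤ rαβ)
    (hdα : Tendsto (fun n : ℕ => distInt (α n) ^ ((n : ℝ)⁻¹)) atTop (nhds (Real.exp (-rα))))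
    (hdβ : Tendsto (fun n : ℕ => distInt (β n) ^ ((n : ℝ)⁻¹)) atTop (nhds (Real.exp (-rβ))))
    (hdαβ : Tendsto (fun n : ℕ => distInt (α n + β n) ^ ((n : ℝ)⁻¹)) atTop
      (nhds (Real.exp (-rαβ))))
    (hcase : rα = rβ ∧ rβ = rαβ) :
    -- the zeros accumulate on Γ
    (∀ K : Set ℂ, IsCompact K → K ∩ GammaSet A B = ∅ →
      ∀ᶠ n : ℕ in atTop, ∀ z ∈ K, Polynomial.eval z (jacobiPoly n (α n) (β n)) ≠ 0) ∧
    -- weak* convergence of the normalized zero counting measures to μ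
    (∀ f : ℂ → ℂ, Continuous f → (∃ M : ℝ, ∀ z : ℂ, ‖f z‖ ≤ M) →
      Tendsto (fun n : ℕ =>
          (((jacobiPoly n (α n) (β n)).roots.map f).sum) / (n : ℂ))
        atTop
        (nhds (
          (∫ t in (0:ℝ)..1, f (γL t) * ((((A:ℂ) + B + 2) / (2 * Real.pi * Complex.I)) *
              (R (γL t) / ((γL t) ^ 2 - 1)) * deriv γL t)) +
          (∫ t in (0:ℝ)..1, f (γC t) * ((((A:ℂ) + B + 2) / (2 * Real.pi * Complex.I)) *
              (Rp t / ((γC t) ^ 2 - 1)) * deriv γC t)) +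
          (∫ t in (0:ℝ)..1, f (γR t) * ((((A:ℂ) + B + 2) / (2 * Real.pi * Complex.I)) *
              (R (γR t) / ((γR t) ^ 2 - 1)) * deriv γR t))))) := by
  obtain ⟨rfl, rfl⟩ := hcase
  have h : Par A B := ⟨hA, hA0, hB, hB0, by linarith, by linarith⟩
  have S := h.seq hα hβ hdα hdβ hdαβ
  have hc : ∀ n : ℕ, ((Real.exp (-(lgk A B rα * n)) : ℝ) : ℂ) ≠ 0 := fun n =>
    ofReal_ne_zero.2 (Real.exp_pos _).ne'
  refine ⟨fun K hK hKG => ?_, fun f hf hM => ?_⟩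
  · rw [h.Gamma_eq] at hKG
    filter_upwards [S.accum h harcs hK hKG] with n hn z hz e
    apply hn z hz
    unfold pN
    rw [eval_mul, e, mul_zero]
  · obtain ⟨M, hM⟩ := hM
    obtain ⟨⟨L, pL⟩, ⟨Cc, pC⟩, ⟨Rr, pR⟩⟩ := h.arcs harcs hR hRp
    have d : Dat A B γL γC γR _ _ _ := ⟨h, harcs, L, Cc, Rr, pL, pC, pR⟩
    have w := d.weak S hf hM
    unfold MM at w
    rw [Mu_indicator, Mu_indicator] at w
    unfold Mu at w
    refine w.congr fun n => ?_
    unfold pN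
    rw [roots_C_mul _ (hc n)]

end
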